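/- Let n ≥ 5 and let u be a nonnegative C⁴ solution of Δ²u = u^p in the punctured ball B₁\{0} ⊂ ℝⁿ, with n/(n-4) < p < (n+4)/(n-4). Then either the singularity at x = 0 is removable (i.e., u extends to a C⁴ solution of Δ²u = u^p in the entire ball B₁), or u is a distribution solution in the entire ball B₁ (i.e., u ∈ L^p_loc(B₁) and ∫_{B₁} u Δ²φ = ∫_{B₁} u^p φ for all φ ∈ C_c^∞(B₁)) and lim_{|x|→0} |x|^{4/(p-1)} u(x) = C_{p,n}, where C_{p,n} = K₀(p,n)^{1/(p-1)} > 0. -/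

import Mathlib

open MeasureTheory Metric Filter

/-- The Euclidean Laplacian `Δu` of `u : ℝⁿ → ℝ`, computed as the trace of the second
derivative: `Δu(x) = ∑ i, ∂²u/∂xᵢ²(x)`. -/
noncomputable def lap {n : ℕ} (u : EuclideanSpace ℝ (Fin n) → ℝ) :
    EuclideanSpace ℝ (Fin n) → ℝ :=
  fun x => ∑ i : Fin n,
    iteratedFDeriv ℝ 2 u x ![EuclideanSpace.single i 1, EuclideanSpace.single i 1]

/-- The biharmonic operator `Δ²u = Δ(Δu)`. -/
noncomputable def bilap {n : ℕ} (u : EuclideanSpace ℝ (Fin n) → ℝ) :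
    EuclideanSpace ℝ (Fin n) → ℝ :=
  lap (lap u)

/-- The constant `K₀(p,n)`. -/
noncomputable def K0 (n : ℕ) (p : ℝ) : ℝ :=
  8 / (p - 1) ^ 4 *
    (((n : ℝ) - 2) * ((n : ℝ) - 4) * (p - 1) ^ 3
      + 2 * ((n : ℝ) ^ 2 - 10 * (n : ℝ) + 20) * (p - 1) ^ 2
      - 16 * ((n : ℝ) - 4) * (p - 1) + 32)



theorem lap_apply {n : ℕ} (f : EuclideanSpace ℝ (Fin n) → ℝ) (x : EuclideanSpace ℝ (Fin n)) :
    lap f x = ∑ i : Fin n, fderiv ℝ (fderiv ℝ f) x (EuclideanSpace.single i 1)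
      (EuclideanSpace.single i 1) := by
  simp [lap, iteratedFDeriv_two_apply]

theorem lap_congr {n : ℕ} {f g : EuclideanSpace ℝ (Fin n) → ℝ} {x : EuclideanSpace ℝ (Fin n)}
    (h : f =ᶠ[nhds x] g) : lap f x = lap g x := by
  simp only [lap, (h.iteratedFDeriv ℝ 2).self_of_nhds]

theorem lap_eventuallyEq {n : ℕ} {f g : EuclideanSpace ℝ (Fin n) → ℝ}
    {x : EuclideanSpace ℝ (Fin n)} (h : f =ᶠ[nhds x] g) : lap f =ᶠ[nhds x] lap g :=
  h.eventuallyEq_nhds.mono fun _ hy => lap_congr hy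

theorem bilap_congr {n : ℕ} {f g : EuclideanSpace ℝ (Fin n) → ℝ} {x : EuclideanSpace ℝ (Fin n)}
    (h : f =ᶠ[nhds x] g) : bilap f x = bilap g x :=
  lap_congr (lap_eventuallyEq h)

theorem contDiffOn_lap {n : ℕ} {f : EuclideanSpace ℝ (Fin n) → ℝ}
    {s : Set (EuclideanSpace ℝ (Fin n))} (hs : IsOpen s) {k m : WithTop ℕ∞} (hk : k + 2 ≤ m)
    (hf : ContDiffOn ℝ m f s) : ContDiffOn ℝ k (lap f) s := by
  have h2 : ContDiffOn ℝ (k + 1 + 1) f s := hf.of_le (by rwa [add_assoc, one_add_one_eq_two])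
  have h1 : ContDiffOn ℝ k (fderiv ℝ (fderiv ℝ f)) s :=
    (h2.fderiv_of_isOpen hs le_rfl).fderiv_of_isOpen hs le_rfl
  have : lap f = fun x => ∑ i : Fin n, fderiv ℝ (fderiv ℝ f) x (EuclideanSpace.single i 1)
      (EuclideanSpace.single i 1) := funext fun x => lap_apply f x
  rw [this]
  exact ContDiffOn.sum fun i _ => (h1.clm_apply contDiffOn_const).clm_apply contDiffOn_const

theorem contDiff_lap {n : ℕ} {f : EuclideanSpace ℝ (Fin n) → ℝ} {k m : WithTop ℕ∞}
    (hk : k + 2 ≤ m) (hf : ContDiff ℝ m f) : ContDiff ℝ k (lap f) :=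
  contDiffOn_univ.1 (contDiffOn_lap isOpen_univ hk hf.contDiffOn)

theorem tsupport_lap_subset {n : ℕ} (f : EuclideanSpace ℝ (Fin n) → ℝ) :
    tsupport (lap f) ⊆ tsupport f := by
  intro x hx
  by_contra h
  have h0 : f =ᶠ[nhds x] fun _ => (0 : ℝ) := notMem_tsupport_iff_eventuallyEq.1 h
  have h1 : lap f =ᶠ[nhds x] lap fun _ => (0 : ℝ) := lap_eventuallyEq h0
  have h2 : lap (fun _ : EuclideanSpace ℝ (Fin n) => (0 : ℝ)) = 0 := by
    ext y; simp [lap_apply]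
  rw [h2] at h1
  exact (notMem_tsupport_iff_eventuallyEq.2 h1) hx

theorem continuous_mul_of_tsupport {n : ℕ} {f g : EuclideanSpace ℝ (Fin n) → ℝ}
    {s : Set (EuclideanSpace ℝ (Fin n))} (hs : IsOpen s) (hf : ContinuousOn f s)
    (hg : Continuous g) (h : tsupport g ⊆ s) : Continuous fun x => f x * g x := by
  refine continuous_of_tsupport fun x hx => ?_
  have hx' : x ∈ s := h (tsupport_mul_subset_right hx)
  exact (hf.continuousAt (hs.mem_nhds hx')).mul hg.continuousAt

theorem integrable_mul_of_tsupport {n : ℕ} {f g : EuclideanSpace ℝ (Fin n) → ℝ}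
    {s : Set (EuclideanSpace ℝ (Fin n))} (hs : IsOpen s) (hf : ContinuousOn f s)
    (hg : Continuous g) (hc : HasCompactSupport g) (h : tsupport g ⊆ s) :
    Integrable (fun x => f x * g x) :=
  (continuous_mul_of_tsupport hs hf hg h).integrable_of_hasCompactSupport hc.mul_left

theorem integral_mul_lap {n : ℕ} {f g : EuclideanSpace ℝ (Fin n) → ℝ}
    {s : Set (EuclideanSpace ℝ (Fin n))} (hs : IsOpen s) (hf : ContDiffOn ℝ 2 f s)
    (hg : ContDiff ℝ 2 g) (hc : HasCompactSupport g) (h : tsupport g ⊆ s) :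
    ∫ x, f x * lap g x = ∫ x, lap f x * g x := by
  have hf1 : ContDiffOn ℝ 1 (fderiv ℝ f) s := hf.fderiv_of_isOpen hs le_rfl
  have hf2 : ContDiffOn ℝ 0 (fderiv ℝ (fderiv ℝ f)) s := hf1.fderiv_of_isOpen hs le_rfl
  have hg1 : ContDiff ℝ 1 (fderiv ℝ g) := hg.fderiv_right le_rfl
  have hg2 : ContDiff ℝ 0 (fderiv ℝ (fderiv ℝ g)) := hg1.fderiv_right le_rfl
  have key : ∀ v : EuclideanSpace ℝ (Fin n),
      ∫ x, f x * fderiv ℝ (fderiv ℝ g) x v v = ∫ x, fderiv ℝ (fderiv ℝ f) x v v * g x := by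
    intro v
    have cg1 : ContDiff ℝ 1 fun x => fderiv ℝ g x v := hg1.clm_apply contDiff_const
    have cf1 : ContDiffOn ℝ 1 (fun x => fderiv ℝ f x v) s := hf1.clm_apply contDiffOn_const
    have dg1 : ∀ x, fderiv ℝ (fun x => fderiv ℝ g x v) x v = fderiv ℝ (fderiv ℝ g) x v v := by
      intro x
      rw [fderiv_clm_apply (hg1.differentiable (by norm_num) x) (by fun_prop)]
      simp
    have df1 : ∀ x ∈ s, fderiv ℝ (fun x => fderiv ℝ f x v) x v = fderiv ℝ (fderiv ℝ f) x v v := by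
      intro x hx
      rw [fderiv_clm_apply ((hf1.differentiableOn (by norm_num) x hx).differentiableAt
        (hs.mem_nhds hx)) (by fun_prop)]
      simp
    have cg2 : Continuous fun x => fderiv ℝ (fun x => fderiv ℝ g x v) x v := by
      simp only [dg1]
      exact (hg2.continuous.clm_apply continuous_const).clm_apply continuous_const
    have sg1 : tsupport (fun x => fderiv ℝ g x v) ⊆ tsupport g := by
      exact tsupport_fderiv_apply_subset ℝ v
    have sg2 : tsupport (fun x => fderiv ℝ (fun x => fderiv ℝ g x v) x v) ⊆ tsupport g :=
      (tsupport_fderiv_apply_subset ℝ v).trans sg1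
    have hc1 : HasCompactSupport fun x => fderiv ℝ g x v := hc.mono' ((subset_tsupport _).trans sg1)
    have hc2 : HasCompactSupport fun x => fderiv ℝ (fun x => fderiv ℝ g x v) x v :=
      hc.mono' ((subset_tsupport _).trans sg2)
    have cf2 : ContinuousOn (fun x => fderiv ℝ (fun x => fderiv ℝ f x v) x v) s := by
      refine ContinuousOn.congr ?_ df1
      exact (hf2.continuousOn.clm_apply continuousOn_const).clm_apply continuousOn_const
    have e1 := integral_mul_fderiv_eq_neg_fderiv_mul_of_integrable (μ := volume) (v := v) (f := f)
      (g := fun x => fderiv ℝ g x v)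
      (integrable_mul_of_tsupport hs cf1.continuousOn cg1.continuous hc1 (sg1.trans h))
      (integrable_mul_of_tsupport hs hf.continuousOn cg2 hc2 (sg2.trans h))
      (integrable_mul_of_tsupport hs hf.continuousOn cg1.continuous hc1 (sg1.trans h))
      (fun x hx => (hf.differentiableOn (by norm_num) x (h (sg1 hx))).differentiableAt
        (hs.mem_nhds (h (sg1 hx))))
      (fun x _ => cg1.differentiable (by norm_num) x)
    have e2 := integral_mul_fderiv_eq_neg_fderiv_mul_of_integrable (μ := volume) (v := v)
      (f := fun x => fderiv ℝ f x v) (g := g)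
      (integrable_mul_of_tsupport hs cf2 hg.continuous hc h)
      (integrable_mul_of_tsupport hs cf1.continuousOn cg1.continuous hc1 (sg1.trans h))
      (integrable_mul_of_tsupport hs cf1.continuousOn hg.continuous hc h)
      (fun x hx => (cf1.differentiableOn (by norm_num) x (h hx)).differentiableAt
        (hs.mem_nhds (h hx)))
      (fun x _ => hg.differentiable (by norm_num) x)
    simp only [dg1] at e1
    rw [e1, e2, neg_neg]
    refine integral_congr_ae (Filter.Eventually.of_forall fun x => ?_)
    by_cases hx : x ∈ tsupport g
    · simp only [df1 x (h hx)]
    · simp [image_eq_zero_of_notMem_tsupport hx]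
  have cg : ∀ v : EuclideanSpace ℝ (Fin n), Continuous fun x => fderiv ℝ (fderiv ℝ g) x v v :=
    fun v => (hg2.continuous.clm_apply continuous_const).clm_apply continuous_const
  have sg : ∀ v : EuclideanSpace ℝ (Fin n),
      tsupport (fun x => fderiv ℝ (fderiv ℝ g) x v v) ⊆ tsupport g := by
    intro v
    refine (closure_mono ?_ : _ ⊆ tsupport (fderiv ℝ (fderiv ℝ g))).trans
      ((tsupport_fderiv_subset ℝ).trans (tsupport_fderiv_subset ℝ))
    intro x hx h0
    exact hx (by simp [h0])
  have cf : ∀ v : EuclideanSpace ℝ (Fin n),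
      ContinuousOn (fun x => fderiv ℝ (fderiv ℝ f) x v v) s := fun v =>
    (hf2.continuousOn.clm_apply continuousOn_const).clm_apply continuousOn_const
  simp only [lap_apply, Finset.mul_sum, Finset.sum_mul]
  rw [integral_finsetSum, integral_finsetSum]
  · exact Finset.sum_congr rfl fun i _ => key _
  · intro i _
    exact integrable_mul_of_tsupport hs (cf _) hg.continuous hc h
  · intro i _
    exact integrable_mul_of_tsupport hs hf.continuousOn (cg _)
      (hc.mono' ((subset_tsupport _).trans (sg _))) ((sg _).trans h)

theorem integral_mul_bilap {n : ℕ} {f g : EuclideanSpace ℝ (Fin n) → ℝ}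
    {s : Set (EuclideanSpace ℝ (Fin n))} (hs : IsOpen s) (hf : ContDiffOn ℝ 4 f s)
    (hg : ContDiff ℝ 4 g) (hc : HasCompactSupport g) (h : tsupport g ⊆ s) :
    ∫ x, f x * bilap g x = ∫ x, bilap f x * g x := by
  have e : (2 : WithTop ℕ∞) + 2 ≤ 4 := by norm_num
  have e' : (2 : WithTop ℕ∞) ≤ 4 := by norm_num
  have h1 := integral_mul_lap hs (hf.of_le e') (contDiff_lap e hg)
    (hc.mono' ((subset_tsupport _).trans (tsupport_lap_subset g)))
    ((tsupport_lap_subset g).trans h)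
  have h2 := integral_mul_lap hs (contDiffOn_lap hs e hf) (hg.of_le e') hc h
  exact h1.trans h2


abbrev Eu (n : ℕ) := EuclideanSpace ℝ (Fin n)

theorem lap_comp_normSq {n : ℕ} {F F1 F2 : ℝ → ℝ} (h1 : ∀ q, 0 < q → HasDerivAt F (F1 q) q)
    (h2 : ∀ q, 0 < q → HasDerivAt F1 (F2 q) q) {x : Eu n} (hx : x ≠ 0) :
    lap (fun y : Eu n => F (‖y‖ ^ 2)) x = 4 * ‖x‖ ^ 2 * F2 (‖x‖ ^ 2) + 2 * n * F1 (‖x‖ ^ 2) := by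
  have hd : ∀ y : Eu n, y ≠ 0 → HasFDerivAt (fun y : Eu n => F (‖y‖ ^ 2))
      (F1 (‖y‖ ^ 2) • (2 • innerSL ℝ y)) y := by
    intro y hy
    have h0 : HasFDerivAt (fun y : Eu n => ‖y‖ ^ 2) (2 • innerSL ℝ y) y :=
      (hasStrictFDerivAt_norm_sq y).hasFDerivAt
    exact HasDerivAt.comp_hasFDerivAt (h₂ := F) y (h1 (‖y‖ ^ 2) (by positivity)) h0
  have hev : fderiv ℝ (fun y : Eu n => F (‖y‖ ^ 2)) =ᶠ[nhds x]
      fun y => F1 (‖y‖ ^ 2) • (2 • innerSL ℝ y) := by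
    filter_upwards [isOpen_ne.mem_nhds hx] with y hy
    exact (hd y hy).fderiv
  have hd2 : HasFDerivAt (fun y : Eu n => F1 (‖y‖ ^ 2) • (2 • innerSL ℝ y))
      (F1 (‖x‖ ^ 2) • (2 • (innerSL ℝ : Eu n →L[ℝ] Eu n →L[ℝ] ℝ)) +
        (F2 (‖x‖ ^ 2) • (2 • innerSL ℝ x)).smulRight (2 • innerSL ℝ x)) x := by
    have h0 : HasFDerivAt (fun y : Eu n => ‖y‖ ^ 2) (2 • innerSL ℝ x) x :=
      (hasStrictFDerivAt_norm_sq x).hasFDerivAt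
    have ha : HasFDerivAt (fun y : Eu n => F1 (‖y‖ ^ 2)) (F2 (‖x‖ ^ 2) • (2 • innerSL ℝ x)) x :=
      HasDerivAt.comp_hasFDerivAt (h₂ := F1) x (h2 (‖x‖ ^ 2) (by positivity)) h0
    have hb : HasFDerivAt (fun y : Eu n => 2 • innerSL ℝ y)
        (2 • (innerSL ℝ : Eu n →L[ℝ] Eu n →L[ℝ] ℝ)) x :=
      (2 • (innerSL ℝ : Eu n →L[ℝ] Eu n →L[ℝ] ℝ)).hasFDerivAt
    exact ha.smul hb
  rw [lap_apply, hev.fderiv_eq, hd2.fderiv]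
  have hs : ∑ i : Fin n, (x i) ^ 2 = ‖x‖ ^ 2 := by
    rw [EuclideanSpace.norm_sq_eq]; simp
  have hi : ∀ i : Fin n, innerSL ℝ (EuclideanSpace.single i (1 : ℝ))
      (EuclideanSpace.single i (1 : ℝ)) = (1 : ℝ) := fun i => by
    rw [innerSL_apply_apply]; simp
  simp [EuclideanSpace.inner_single_right, Finset.sum_add_distrib, hi]
  rw [← hs, Finset.mul_sum, Finset.sum_mul, add_comm]
  congr 1
  · exact Finset.sum_congr rfl fun i _ => by ring
  · ring

/-- The function `‖x‖^β g(log ‖x‖)`, extended by `0` at the origin. -/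
noncomputable def radLog {n : ℕ} (β : ℝ) (g : ℝ → ℝ) (x : Eu n) : ℝ :=
  open Classical in if x = 0 then 0 else ‖x‖ ^ β * g (Real.log ‖x‖)

/-- The action of `r² Δ` on `r^β g(log r)`. -/
noncomputable def lapLog (n : ℕ) (β : ℝ) (g : ℝ → ℝ) (t : ℝ) : ℝ :=
  deriv (deriv g) t + (2 * β + n - 2) * deriv g t + β * (β + n - 2) * g t

theorem radLog_of_ne {n : ℕ} (β : ℝ) (g : ℝ → ℝ) {x : Eu n} (hx : x ≠ 0) :
    radLog β g x = ‖x‖ ^ β * g (Real.log ‖x‖) := by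
  simp [radLog, hx]

@[simp] theorem radLog_zero {n : ℕ} (β : ℝ) (g : ℝ → ℝ) : radLog β g (0 : Eu n) = 0 := by
  simp [radLog]

theorem contDiffOn_radLog {n : ℕ} (β : ℝ) {g : ℝ → ℝ} {m : WithTop ℕ∞} (hg : ContDiff ℝ m g) :
    ContDiffOn ℝ m (radLog β g : Eu n → ℝ) {0}ᶜ := by
  have : ContDiffOn ℝ m (fun x : Eu n => ‖x‖ ^ β * g (Real.log ‖x‖)) {0}ᶜ := by
    have hn : ContDiffOn ℝ m (fun x : Eu n => ‖x‖) {0}ᶜ := fun x hx =>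
      (contDiffAt_norm ℝ hx).contDiffWithinAt
    have h0 : ∀ x ∈ ({0}ᶜ : Set (Eu n)), ‖x‖ ≠ 0 := fun x hx => norm_ne_zero_iff.2 hx
    exact (hn.rpow_const_of_ne h0).mul (hg.comp_contDiffOn (hn.log h0))
  exact this.congr fun x hx => radLog_of_ne β g hx

theorem radLog_eventuallyEq_zero {n : ℕ} (β : ℝ) {g : ℝ → ℝ} {T : ℝ} (h : ∀ t < T, g t = 0) :
    (radLog β g : Eu n → ℝ) =ᶠ[nhds 0] fun _ => (0 : ℝ) := by
  filter_upwards [ball_mem_nhds (0 : Eu n) (Real.exp_pos T)] with x hx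
  by_cases hx0 : x = 0
  · simp [hx0]
  · rw [radLog_of_ne β g hx0, h, mul_zero]
    rw [Real.log_lt_iff_lt_exp (norm_pos_iff.2 hx0)]
    simpa using hx

theorem contDiff_radLog {n : ℕ} (β : ℝ) {g : ℝ → ℝ} {m : WithTop ℕ∞} (hg : ContDiff ℝ m g)
    {T : ℝ} (h : ∀ t < T, g t = 0) : ContDiff ℝ m (radLog β g : Eu n → ℝ) := by
  rw [contDiff_iff_contDiffAt]
  intro x
  by_cases hx : x = 0
  · subst hx
    exact contDiffAt_const.congr_of_eventuallyEq (radLog_eventuallyEq_zero β h)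
  · exact (contDiffOn_radLog β hg).contDiffAt (isOpen_compl_singleton.mem_nhds hx)

theorem lap_radLog {n : ℕ} (β : ℝ) {g : ℝ → ℝ} (hg : ContDiff ℝ 2 g) {x : Eu n} (hx : x ≠ 0) :
    lap (radLog β g) x = radLog (β - 2) (lapLog n β g) x := by
  have hev : (radLog β g : Eu n → ℝ) =ᶠ[nhds x]
      fun y : Eu n => (fun q => q ^ (β / 2) * g (Real.log q / 2)) (‖y‖ ^ 2) := by
    filter_upwards [isOpen_ne.mem_nhds hx] with y hy
    rw [radLog_of_ne β g hy]
    have h0 := norm_pos_iff.2 hy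
    rw [← Real.rpow_natCast, ← Real.rpow_mul h0.le, Real.log_rpow h0]
    congr 2 <;> push_cast <;> ring
  have g1 : ContDiff ℝ 1 (deriv g) := by
    have : ContDiff ℝ (1 + 1) g := hg
    exact (contDiff_succ_iff_deriv.1 this).2.2
  have hg0 : ∀ t, HasDerivAt g (deriv g t) t := fun t =>
    (hg.differentiable (by norm_num) t).hasDerivAt
  have hg1 : ∀ t, HasDerivAt (deriv g) (deriv (deriv g) t) t := fun t =>
    (g1.differentiable (by norm_num) t).hasDerivAt
  have hl : ∀ q : ℝ, 0 < q → HasDerivAt (fun q => Real.log q / 2) (q⁻¹ / 2) q := fun q hq =>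
    (Real.hasDerivAt_log hq.ne').div_const 2
  have hp : ∀ (b q : ℝ), 0 < q → HasDerivAt (fun q : ℝ => q ^ b) (b * q ^ (b - 1)) q :=
    fun b q hq => Real.hasDerivAt_rpow_const (Or.inl hq.ne')
  have H1 : ∀ q : ℝ, 0 < q → HasDerivAt (fun q => q ^ (β / 2) * g (Real.log q / 2))
      (q ^ (β / 2 - 1) * ((β * g (Real.log q / 2) + deriv g (Real.log q / 2)) / 2)) q := by
    intro q hq
    have := (hp (β / 2) q hq).mul ((hg0 _).comp q (hl q hq))
    refine this.congr_deriv ?_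
    have e : q ^ (β / 2) * q⁻¹ = q ^ (β / 2 - 1) := by
      rw [Real.rpow_sub_one hq.ne', div_eq_mul_inv (q ^ (β / 2))]
    simp only [Function.comp]
    rw [← e]; ring
  have H2 : ∀ q : ℝ, 0 < q → HasDerivAt
      (fun q => q ^ (β / 2 - 1) * ((β * g (Real.log q / 2) + deriv g (Real.log q / 2)) / 2))
      (q ^ (β / 2 - 2) * ((β / 2 - 1) * ((β * g (Real.log q / 2) + deriv g (Real.log q / 2)) / 2)
        + (β * deriv g (Real.log q / 2) + deriv (deriv g) (Real.log q / 2)) / 4)) q := by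
    intro q hq
    have := (hp (β / 2 - 1) q hq).mul (((((hg0 _).comp q (hl q hq)).const_mul β).add
      ((hg1 _).comp q (hl q hq))).div_const 2)
    refine this.congr_deriv ?_
    have e : q ^ (β / 2 - 1) * q⁻¹ = q ^ (β / 2 - 2) := by
      rw [← div_eq_mul_inv, ← Real.rpow_sub_one hq.ne']; ring_nf
    have e' : β / 2 - 1 - 1 = β / 2 - 2 := by ring
    simp only [Function.comp, e']
    rw [← e]
    simp only [Function.comp, Pi.add_apply]
    ring
  rw [lap_congr hev, lap_comp_normSq H1 H2 hx, radLog_of_ne _ _ hx]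
  have h0 := norm_pos_iff.2 hx
  have e1 : (‖x‖ ^ 2) ^ (β / 2 - 1) = ‖x‖ ^ (β - 2) := by
    rw [← Real.rpow_natCast, ← Real.rpow_mul h0.le]; push_cast; ring_nf
  have e2 : ‖x‖ ^ 2 * (‖x‖ ^ 2) ^ (β / 2 - 2) = ‖x‖ ^ (β - 2) := by
    rw [← e1, mul_comm, ← Real.rpow_add_one (by positivity)]; ring_nf
  have e3 : Real.log (‖x‖ ^ 2) / 2 = Real.log ‖x‖ := by
    rw [Real.log_pow]; push_cast; ring
  rw [e3, e1, ← e2]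
  unfold lapLog
  ring

theorem contDiff_lapLog {n : ℕ} (β : ℝ) {g : ℝ → ℝ} {k m : WithTop ℕ∞} (hk : k + 2 ≤ m)
    (hg : ContDiff ℝ m g) : ContDiff ℝ k (lapLog n β g) := by
  have h2 : ContDiff ℝ (k + 1 + 1) g := hg.of_le (by rwa [add_assoc, one_add_one_eq_two])
  have h1 : ContDiff ℝ (k + 1) (deriv g) := (contDiff_succ_iff_deriv.1 h2).2.2
  have h0 : ContDiff ℝ k (deriv (deriv g)) := (contDiff_succ_iff_deriv.1 h1).2.2
  unfold lapLog
  have e1 : k ≤ k + 1 := le_self_add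
  have e2 : k ≤ k + 1 + 1 := e1.trans le_self_add
  exact (h0.add (contDiff_const.mul (h1.of_le e1))).add (contDiff_const.mul (h2.of_le e2))

theorem bilap_radLog {n : ℕ} (β : ℝ) {g : ℝ → ℝ} (hg : ContDiff ℝ 4 g) {x : Eu n} (hx : x ≠ 0) :
    bilap (radLog β g) x = radLog (β - 4) (lapLog n (β - 2) (lapLog n β g)) x := by
  have h1 : lap (radLog β g : Eu n → ℝ) =ᶠ[nhds x] radLog (β - 2) (lapLog n β g) := by
    filter_upwards [isOpen_ne.mem_nhds hx] with y hy
    exact lap_radLog β (hg.of_le (by norm_num)) hy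
  unfold bilap
  rw [lap_congr h1, lap_radLog _ (contDiff_lapLog (m := 4) β (by norm_num) hg) hx]
  ring_nf

theorem lap_zero {n : ℕ} : lap (fun _ : Eu n => (0 : ℝ)) = fun _ => 0 := by
  ext y; simp [lap_apply]

theorem bilap_radLog' {n : ℕ} (β : ℝ) {g : ℝ → ℝ} (hg : ContDiff ℝ 4 g) {T : ℝ}
    (h : ∀ t < T, g t = 0) :
    bilap (radLog β g : Eu n → ℝ) = radLog (β - 4) (lapLog n (β - 2) (lapLog n β g)) := by
  ext x
  by_cases hx : x = 0
  · subst hx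
    rw [bilap_congr (radLog_eventuallyEq_zero β h)]
    simp [bilap, lap_zero]
  · exact bilap_radLog β hg hx


/-- The standing assumptions, in terms of `a = 4 / (p - 1)`. -/
structure Sol (n : ℕ) (p a : ℝ) (u : Eu n → ℝ) : Prop where
  hn : 5 ≤ n
  hp : 1 < p
  hap : a * (p - 1) = 4
  ha1 : ((n : ℝ) - 4) / 2 < a
  ha2 : a < (n : ℝ) - 4
  reg : ContDiffOn ℝ 4 u (ball 0 1 \ {0})
  pos : ∀ x ∈ ball (0 : Eu n) 1 \ {0}, 0 ≤ u x
  eq : ∀ x ∈ ball (0 : Eu n) 1 \ {0}, bilap u x = u x ^ p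

theorem four_le_top : (4 : WithTop ℕ∞) ≤ ((⊤ : ℕ∞) : WithTop ℕ∞) := by
  change ((4 : ℕ∞) : WithTop ℕ∞) ≤ ((⊤ : ℕ∞) : WithTop ℕ∞)
  exact WithTop.coe_le_coe.2 le_top

theorem isOpen_punctured (n : ℕ) : IsOpen (ball (0 : Eu n) 1 \ {0}) :=
  isOpen_ball.sdiff isClosed_singleton

theorem tsupport_radLog_subset {n : ℕ} (β : ℝ) {g : ℝ → ℝ} {T₁ T₂ : ℝ}
    (h1 : ∀ t < T₁, g t = 0) (h2 : ∀ t, T₂ < t → g t = 0) :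
    tsupport (radLog β g : Eu n → ℝ) ⊆ {x | Real.exp T₁ ≤ ‖x‖ ∧ ‖x‖ ≤ Real.exp T₂} := by
  apply closure_minimal
  · intro x hx
    by_cases hx0 : x = 0
    · simp [hx0] at hx
    rw [Function.mem_support, radLog_of_ne β g hx0] at hx
    have h0 := norm_pos_iff.2 hx0
    have hg := right_ne_zero_of_mul hx
    constructor
    · by_contra! h
      exact hg (h1 _ ((Real.log_lt_iff_lt_exp h0).2 h))
    · by_contra! h
      exact hg (h2 _ ((Real.lt_log_iff_exp_lt h0).2 h))
  · exact (isClosed_le continuous_const continuous_norm).inter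
      (isClosed_le continuous_norm continuous_const)

theorem hasCompactSupport_radLog {n : ℕ} (β : ℝ) {g : ℝ → ℝ} {T₁ T₂ : ℝ}
    (h1 : ∀ t < T₁, g t = 0) (h2 : ∀ t, T₂ < t → g t = 0) :
    HasCompactSupport (radLog β g : Eu n → ℝ) := by
  refine (isCompact_closedBall (0 : Eu n) (Real.exp T₂)).of_isClosed_subset
    (isClosed_tsupport _) fun x hx => ?_
  simpa using (tsupport_radLog_subset β h1 h2 hx).2

theorem lapLog_comp_sub (n : ℕ) (β : ℝ) (g : ℝ → ℝ) (s : ℝ) :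
    lapLog n β (fun t => g (t - s)) = fun t => lapLog n β g (t - s) := by
  have h : ∀ f : ℝ → ℝ, deriv (fun t => f (t - s)) = fun t => deriv f (t - s) := fun f => by
    ext t; exact deriv_comp_sub_const ..
  ext t
  simp only [lapLog, h]

theorem exists_lapLog_pow_mul (n : ℕ) (β : ℝ) {k s : ℝ → ℝ} (hk : ContDiff ℝ (⊤ : ℕ∞) k)
    (hs : ContDiff ℝ (⊤ : ℕ∞) s) (j : ℕ) : ∃ s' : ℝ → ℝ, ContDiff ℝ (⊤ : ℕ∞) s' ∧
      lapLog n β (fun t => k t ^ (j + 2) * s t) = fun t => k t ^ j * s' t := by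
  have hd : ∀ {f : ℝ → ℝ}, ContDiff ℝ (⊤ : ℕ∞) f → ContDiff ℝ (⊤ : ℕ∞) (deriv f) := fun hf =>
    (contDiff_infty_iff_deriv.1 hf).2
  have hD : ∀ {f : ℝ → ℝ}, ContDiff ℝ (⊤ : ℕ∞) f → ∀ t, HasDerivAt f (deriv f t) t :=
    fun hf t => (hf.differentiable (by simp) t).hasDerivAt
  have key : ∀ (i : ℕ) {r : ℝ → ℝ}, ContDiff ℝ (⊤ : ℕ∞) r → 
      deriv (fun t => k t ^ (i + 1) * r t) =
        fun t => k t ^ i * ((i + 1) * deriv k t * r t + k t * deriv r t) := by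
    intro i r hr
    ext t
    have := ((hD hk t).pow (i + 1)).mul (hD hr t)
    refine (this.deriv).trans ?_
    rw [Pi.pow_apply]
    push_cast
    ring
  obtain ⟨w, hw⟩ : ∃ w : ℝ → ℝ,
      w = fun t => (((j + 1 : ℕ) : ℝ) + 1) * deriv k t * s t + k t * deriv s t := ⟨_, rfl⟩
  have k' := hd hk
  have s1 := hd hs
  have c1 : ContDiff ℝ (⊤ : ℕ∞) w := by
    rw [hw]; fun_prop
  have c2 := hd c1
  have e1 : deriv (fun t => k t ^ (j + 2) * s t) = fun t => k t ^ (j + 1) * w t := by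
    rw [key (j + 1) hs, hw]
  have e2 := key j c1
  refine ⟨fun t => ((j + 1) * deriv k t * w t + k t * deriv w t) +
    (2 * β + n - 2) * (k t * w t) + β * (β + n - 2) * (k t ^ 2 * s t), by fun_prop, ?_⟩
  ext t
  simp only [lapLog]
  rw [e1, e2]
  ring

theorem weak_test {n : ℕ} {p a : ℝ} {u : Eu n → ℝ} (h : Sol n p a u) {φ : Eu n → ℝ}
    (hφ : ContDiff ℝ 4 φ) (hc : HasCompactSupport φ) (hs : tsupport φ ⊆ ball 0 1 \ {0}) :
    ∫ x, u x * bilap φ x = ∫ x, u x ^ p * φ x := by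
  rw [integral_mul_bilap (isOpen_punctured n) h.reg hφ hc hs]
  congr 1
  ext x
  by_cases hx : x ∈ tsupport φ
  · rw [h.eq x (hs hx)]
  · rw [image_eq_zero_of_notMem_tsupport hx, mul_zero, mul_zero]

theorem young_half {p : ℝ} (hp : 1 < p) (C : ℝ) : ∃ C' : ℝ, 0 ≤ C' ∧ ∀ y : ℝ, 0 ≤ y →
    C * y ≤ y ^ p / 2 + C' := by
  refine ⟨|C| * (2 * |C|) ^ (1 / (p - 1)), by positivity, fun y hy => ?_⟩
  have hC : C * y ≤ |C| * y := mul_le_mul_of_nonneg_right (le_abs_self C) hy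
  refine hC.trans ?_
  have h0 : 0 ≤ |C| := abs_nonneg C
  rcases le_total y ((2 * |C|) ^ (1 / (p - 1))) with h | h
  · have := mul_le_mul_of_nonneg_left h h0
    have : 0 ≤ y ^ p := by positivity
    linarith
  · have h1 : 2 * |C| ≤ y ^ (p - 1) := by
      have := Real.rpow_le_rpow (by positivity) h (by linarith : 0 ≤ p - 1)
      rwa [← Real.rpow_mul (by positivity), one_div, inv_mul_cancel₀ (by linarith),
        Real.rpow_one] at this
    rcases hy.eq_or_lt with rfl | hy0
    · simp; positivity
    have h2 : y ^ p = y ^ (p - 1) * y := by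
      rw [← Real.rpow_add_one hy0.ne']; ring_nf
    rw [h2]
    have := mul_le_mul_of_nonneg_right h1 hy
    have : 0 ≤ |C| * (2 * |C|) ^ (1 / (p - 1)) := by positivity
    linarith

/-- The logarithmic ring `e^(s-1) ≤ |x| ≤ e^(s+1)`. -/
def ring (n : ℕ) (s : ℝ) : Set (Eu n) := {x | Real.exp (s - 1) ≤ ‖x‖ ∧ ‖x‖ ≤ Real.exp (s + 1)}

theorem isCompact_ring (n : ℕ) (s : ℝ) : IsCompact (ring n s) :=
  (isCompact_closedBall (0 : Eu n) (Real.exp (s + 1))).of_isClosed_subset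
    ((isClosed_le continuous_const continuous_norm).inter
      (isClosed_le continuous_norm continuous_const)) fun x hx => by simpa using hx.2

theorem volume_closedBall_exp (n : ℕ) (s : ℝ) : volume.real (closedBall (0 : Eu n) (Real.exp s)) =
    Real.exp (s * n) * volume.real (ball (0 : Eu n) 1) := by
  rw [Measure.addHaar_real_closedBall _ _ (Real.exp_pos s).le]
  simp [mul_comm s, Real.exp_nat_mul]

theorem Sol.contOn {n : ℕ} {p a : ℝ} {u : Eu n → ℝ} (h : Sol n p a u) :
    ContinuousOn u (ball 0 1 \ {0}) := h.reg.continuousOn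

theorem Sol.contOn_rpow {n : ℕ} {p a : ℝ} {u : Eu n → ℝ} (h : Sol n p a u) :
    ContinuousOn (fun x => u x ^ p) (ball 0 1 \ {0}) :=
  h.contOn.rpow_const fun _ _ => Or.inr (by linarith [h.hp])

theorem ring_subset (n : ℕ) {s : ℝ} (hs : s < -1) : ring n s ⊆ ball 0 1 \ {0} := by
  intro x hx
  refine ⟨?_, ?_⟩
  · rw [mem_ball_zero_iff]
    exact hx.2.trans_lt (by rw [Real.exp_lt_one_iff]; linarith)
  · rintro rfl
    have := hx.1
    rw [norm_zero] at this
    exact absurd this (Real.exp_pos _).not_ge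

theorem ring_rpow_le {n : ℕ} {p a : ℝ} {u : Eu n → ℝ} (h : Sol n p a u) :
    ∃ C : ℝ, 0 ≤ C ∧ ∀ s < -2, ∫ x in ring n s, u x ^ p ≤ C * Real.exp (s * (n - a - 4)) := by
  obtain ⟨m, hm⟩ := exists_nat_ge (4 / (p - 1))
  have hp := h.hp
  let b : ContDiffBump (0 : ℝ) := ⟨1, 2, one_pos, one_lt_two⟩
  have hb : ContDiff ℝ (⊤ : ℕ∞) b := b.contDiff
  obtain ⟨S1, hS1, e1⟩ := exists_lapLog_pow_mul n 0 hb (contDiff_const (c := (1 : ℝ))) (m + 3)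
  obtain ⟨S, hS, e2⟩ := exists_lapLog_pow_mul n (0 - 2) hb hS1 (m + 1)
  obtain ⟨B, hB⟩ := (isCompact_Icc (a := (-2 : ℝ)) (b := 2)).exists_bound_of_continuousOn
    hS.continuous.continuousOn
  obtain ⟨C', hC'0, hC'⟩ := young_half hp (B * Real.exp 8)
  refine ⟨2 * (C' * (Real.exp (2 * n) * volume.real (ball (0 : Eu n) 1))), by positivity,
    fun s hs => ?_⟩
  have hb0 : ∀ t, b t ≠ 0 → |t| < 2 := fun t ht => by
    have : t ∈ Function.support b := ht
    rw [b.support_eq] at this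
    simpa using this
  let g : ℝ → ℝ := fun t => b (t - s) ^ (m + 3 + 2) * 1
  have hg : ContDiff ℝ (⊤ : ℕ∞) g := by
    have : ContDiff ℝ (⊤ : ℕ∞) fun t => b (t - s) := hb.comp (contDiff_id.sub contDiff_const)
    fun_prop
  have hg1 : ∀ t < s - 2, g t = 0 := fun t ht => by
    have : b (t - s) = 0 := by
      by_contra h'
      have := abs_lt.1 (hb0 _ h')
      linarith
    simp [g, this]
  have hg2 : ∀ t, s + 2 < t → g t = 0 := fun t ht => by
    have : b (t - s) = 0 := by
      by_contra h'
      have := abs_lt.1 (hb0 _ h')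
      linarith
    simp [g, this]
  have hφ : ContDiff ℝ 4 (radLog 0 g : Eu n → ℝ) := contDiff_radLog 0 (hg.of_le four_le_top) hg1
  have hc := hasCompactSupport_radLog (n := n) 0 hg1 hg2
  have hsup : tsupport (radLog 0 g : Eu n → ℝ) ⊆ ball 0 1 \ {0} := by
    refine (tsupport_radLog_subset 0 hg1 hg2).trans fun x hx => ⟨?_, ?_⟩
    · rw [mem_ball_zero_iff]
      exact hx.2.trans_lt (by rw [Real.exp_lt_one_iff]; linarith)
    · rintro rfl
      have := hx.1
      rw [norm_zero] at this
      exact absurd this (Real.exp_pos _).not_ge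
  have hbi : ∀ x : Eu n, x ≠ 0 → bilap (radLog 0 g : Eu n → ℝ) x =
      ‖x‖ ^ (-4 : ℝ) * (b (Real.log ‖x‖ - s) ^ (m + 1) * S (Real.log ‖x‖ - s)) := by
    intro x hx
    rw [bilap_radLog 0 (hg.of_le four_le_top) hx, radLog_of_ne _ _ hx]
    have f1 : lapLog n 0 g = fun t => b (t - s) ^ (m + 3) * S1 (t - s) := by
      refine (lapLog_comp_sub n 0 (fun t => b t ^ (m + 3 + 2) * 1) s).trans ?_
      rw [e1]
    have f2 : lapLog n (0 - 2) (lapLog n 0 g) = fun t => b (t - s) ^ (m + 1) * S (t - s) := by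
      rw [f1]
      refine (lapLog_comp_sub n (0 - 2) (fun t => b t ^ (m + 1 + 2) * S1 t) s).trans ?_
      rw [e2]
    rw [f2]
    norm_num
  have hφ0 : ∀ x, 0 ≤ (radLog 0 g : Eu n → ℝ) x := fun x => by
    by_cases hx : x = 0
    · simp [hx]
    · rw [radLog_of_ne _ _ hx]
      have := b.nonneg (x := Real.log ‖x‖ - s)
      positivity
  have i1 := integrable_mul_of_tsupport (isOpen_punctured n) h.contOn_rpow hφ.continuous hc hsup
  have hV : Integrable ((closedBall (0 : Eu n) (Real.exp (s + 2))).indicator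
      fun _ => Real.exp (-s * (a + 4)) * C') :=
    (integrable_indicator_iff measurableSet_closedBall).2
      (integrableOn_const (by exact (isCompact_closedBall _ _).measure_lt_top.ne))
  have hpt : ∀ x, u x * bilap (radLog 0 g : Eu n → ℝ) x ≤ u x ^ p * (radLog 0 g : Eu n → ℝ) x / 2 +
      (closedBall (0 : Eu n) (Real.exp (s + 2))).indicator
      (fun _ => Real.exp (-s * (a + 4)) * C') x := by
    intro x
    have hind : 0 ≤ (closedBall (0 : Eu n) (Real.exp (s + 2))).indicator
      (fun _ => Real.exp (-s * (a + 4)) * C') x := Set.indicator_nonneg (fun _ _ => by positivity) x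
    by_cases hx : x ∈ tsupport (radLog 0 g : Eu n → ℝ)
    · have hx1 := hsup hx
      have hx0 : x ≠ 0 := hx1.2
      have hr := norm_pos_iff.2 hx0
      have hu := h.pos x hx1
      have hxm := tsupport_radLog_subset 0 hg1 hg2 hx
      rw [Set.indicator_of_mem (by simpa using hxm.2), hbi x hx0, radLog_of_ne _ _ hx0]
      have hl1 : |Real.log ‖x‖ - s| ≤ 2 := by
        rw [abs_le]
        constructor
        · have := (Real.le_log_iff_exp_le hr).2 hxm.1; linarith
        · have := (Real.log_le_iff_le_exp hr).2 hxm.2; linarith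
      have hS' : |S (Real.log ‖x‖ - s)| ≤ B := hB _ (abs_le.1 hl1)
      have hB0 : 0 ≤ B := (abs_nonneg _).trans hS'
      obtain ⟨κ, hκ⟩ : ∃ κ, κ = b (Real.log ‖x‖ - s) := ⟨_, rfl⟩
      have hκ0 : 0 ≤ κ := hκ ▸ b.nonneg
      have hκ1 : κ ≤ 1 := hκ ▸ b.le_one
      simp only [g, Real.rpow_zero, one_mul, mul_one, ← hκ]
      have hn4 : ‖x‖ ^ (-4 : ℝ) ≤ Real.exp 8 * Real.exp (-(4 * s)) := by
        rw [← Real.exp_add, Real.rpow_def_of_pos hr, Real.exp_le_exp]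
        have := (abs_le.1 hl1).1
        linarith
      have step1 : u x * (‖x‖ ^ (-4 : ℝ) * (κ ^ (m + 1) * S (Real.log ‖x‖ - s))) ≤
          u x * ((Real.exp 8 * Real.exp (-(4 * s))) * (κ ^ (m + 1) * B)) := by
        apply mul_le_mul_of_nonneg_left _ hu
        have q1 : κ ^ (m + 1) * S (Real.log ‖x‖ - s) ≤ κ ^ (m + 1) * B :=
          mul_le_mul_of_nonneg_left ((le_abs_self _).trans hS') (by positivity)
        exact (mul_le_mul_of_nonneg_left q1 (by positivity)).trans
          (mul_le_mul_of_nonneg_right hn4 (by positivity))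
      refine step1.trans ?_
      have hy := hC' (Real.exp (s * a) * u x * κ ^ (m + 1)) (by positivity)
      have hE : Real.exp (-s * (a + 4)) * Real.exp (s * a) = Real.exp (-(4 * s)) := by
        rw [← Real.exp_add]; ring_nf
      have hE2 : Real.exp (-s * (a + 4)) * Real.exp (s * a) ^ p = 1 := by
        rw [← Real.exp_mul, ← Real.exp_add, Real.exp_eq_one_iff]
        linear_combination (-s) * (-h.hap)
      have hκp : (κ ^ (m + 1)) ^ p ≤ κ ^ (m + 3 + 2) := by
        rw [← Real.rpow_natCast, ← Real.rpow_mul hκ0, ← Real.rpow_natCast]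
        have h5 : ((m + 3 + 2 : ℕ) : ℝ) ≤ ((m + 1 : ℕ) : ℝ) * p := by
          push_cast
          have : 4 ≤ m * (p - 1) := by rwa [div_le_iff₀ (by linarith)] at hm
          nlinarith
        rcases hκ0.eq_or_lt with h0 | h0
        · rw [← h0, Real.zero_rpow, Real.zero_rpow]
          · positivity
          · positivity
        · exact Real.rpow_le_rpow_of_exponent_ge h0 hκ1 h5
      have hyp : (Real.exp (s * a) * u x * κ ^ (m + 1)) ^ p ≤
          Real.exp (s * a) ^ p * u x ^ p * κ ^ (m + 3 + 2) := by
        rw [Real.mul_rpow (by positivity) (by positivity), Real.mul_rpow (by positivity) hu]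
        exact mul_le_mul_of_nonneg_left hκp (by positivity)
      calc u x * ((Real.exp 8 * Real.exp (-(4 * s))) * (κ ^ (m + 1) * B))
          = Real.exp (-s * (a + 4)) *
            (B * Real.exp 8 * (Real.exp (s * a) * u x * κ ^ (m + 1))) := by
            rw [← hE]; ring
        _ ≤ Real.exp (-s * (a + 4)) *
            (Real.exp (s * a) ^ p * u x ^ p * κ ^ (m + 3 + 2) / 2 + C') := by
            apply mul_le_mul_of_nonneg_left _ (by positivity)
            linarith
        _ = (Real.exp (-s * (a + 4)) * Real.exp (s * a) ^ p) * (u x ^ p * κ ^ (m + 3 + 2) / 2) +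
            Real.exp (-s * (a + 4)) * C' := by ring
        _ = _ := by rw [hE2, one_mul]
    · have hx' : x ∉ tsupport (bilap (radLog 0 g : Eu n → ℝ)) := fun h' =>
        hx (tsupport_lap_subset _ (tsupport_lap_subset _ h'))
      rw [image_eq_zero_of_notMem_tsupport hx', image_eq_zero_of_notMem_tsupport hx]
      simpa using hind
  have i2 : Integrable fun x => u x * bilap (radLog 0 g : Eu n → ℝ) x :=
    integrable_mul_of_tsupport (isOpen_punctured n) h.contOn
      ((contDiff_lap (k := 0) (m := 2) (by norm_num)
        (contDiff_lap (k := 2) (m := 4) (by norm_num) hφ)).continuous)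
      (hc.mono' ((subset_tsupport _).trans ((tsupport_lap_subset _).trans (tsupport_lap_subset _))))
      (((tsupport_lap_subset _).trans (tsupport_lap_subset _)).trans hsup)
  have hI := integral_mono i2 ((i1.div_const 2).add hV) hpt
  rw [weak_test h hφ hc hsup] at hI
  have hadd : ∫ x, ((u x ^ p * (radLog 0 g : Eu n → ℝ) x / 2 +
      (closedBall (0 : Eu n) (Real.exp (s + 2))).indicator
      (fun _ => Real.exp (-s * (a + 4)) * C') x)) = (∫ x, u x ^ p * (radLog 0 g : Eu n → ℝ) x) / 2 +
      Real.exp ((s + 2) * n) * volume.real (ball (0 : Eu n) 1) * (Real.exp (-s * (a + 4)) * C') := by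
    rw [integral_add (i1.div_const 2) hV, integral_div, integral_indicator measurableSet_closedBall,
      setIntegral_const, volume_closedBall_exp, smul_eq_mul]
  have hI' := hI.trans_eq hadd
  have hring : ∫ x in ring n s, u x ^ p ≤ ∫ x, u x ^ p * (radLog 0 g : Eu n → ℝ) x := by
    rw [← integral_indicator (isCompact_ring n s).measurableSet]
    refine integral_mono ((integrable_indicator_iff (isCompact_ring n s).measurableSet).2
      ((h.contOn_rpow.mono (ring_subset n (by linarith))).integrableOn_compact
        (isCompact_ring n s))) i1 fun x => ?_
    by_cases hx : x ∈ ring n s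
    · have hx1 := ring_subset n (by linarith) hx
      have hr := norm_pos_iff.2 (show x ≠ 0 from hx1.2)
      rw [Set.indicator_of_mem hx, radLog_of_ne _ _ hx1.2]
      have : b (Real.log ‖x‖ - s) = 1 := by
        apply b.one_of_mem_closedBall
        rw [mem_closedBall_zero_iff, Real.norm_eq_abs, abs_le]
        constructor
        · have := (Real.le_log_iff_exp_le hr).2 hx.1
          simp only [b]; linarith
        · have := (Real.log_le_iff_le_exp hr).2 hx.2
          simp only [b]; linarith
      simp [g, this]
    · rw [Set.indicator_of_notMem hx]
      by_cases hx' : x ∈ tsupport (radLog 0 g : Eu n → ℝ)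
      · have := h.pos x (hsup hx')
        exact mul_nonneg (by positivity) (hφ0 x)
      · rw [image_eq_zero_of_notMem_tsupport hx', mul_zero]
  have hexp : Real.exp ((s + 2) * n) * Real.exp (-s * (a + 4)) =
      Real.exp (2 * n) * Real.exp (s * (n - a - 4)) := by
    rw [← Real.exp_add, ← Real.exp_add]; ring_nf
  calc _ ≤ _ := hring
    _ ≤ 2 * (Real.exp ((s + 2) * n) * volume.real (ball (0 : Eu n) 1) *
        (Real.exp (-s * (a + 4)) * C')) := by linarith
    _ = 2 * ((Real.exp ((s + 2) * n) * Real.exp (-s * (a + 4))) *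
        volume.real (ball (0 : Eu n) 1) * C') := by ring
    _ = _ := by rw [hexp]; ring


theorem integrableOn_of_ring {n : ℕ} {f : Eu n → ℝ} (hf : ContinuousOn f (ball 0 1 \ {0}))
    (hf0 : ∀ x ∈ ball (0 : Eu n) 1 \ {0}, 0 ≤ f x) {C γ : ℝ} (hγ : 0 < γ)
    (hn : 0 < n)
    (hC : ∀ s < -2, ∫ x in ring n s, f x ≤ C * Real.exp (s * γ)) {r : ℝ} (hr : r < 1) :
    IntegrableOn f (closedBall 0 r) := by
  have : Nonempty (Fin n) := ⟨⟨0, hn⟩⟩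
  have hk : ∀ k : ℕ, (-3 - k : ℝ) < -2 := fun k => by
    have : (0 : ℝ) ≤ k := k.cast_nonneg
    linarith
  have hS : IntegrableOn f (⋃ k : ℕ, ring n (-3 - k)) := by
    refine integrableOn_iUnion_of_summable_integral_norm (fun k =>
      (hf.mono (ring_subset n (by linarith [hk k]))).integrableOn_compact (isCompact_ring n _)) ?_
    refine Summable.of_nonneg_of_le (fun k => integral_nonneg fun x => norm_nonneg _) (fun k => ?_)
      ((summable_geometric_of_lt_one (Real.exp_pos (-γ)).le
        (Real.exp_lt_one_iff.2 (by linarith))).mul_left (C * Real.exp (-3 * γ)))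
    have e : ∫ x in ring n (-3 - k), ‖f x‖ = ∫ x in ring n (-3 - k), f x :=
      setIntegral_congr_fun (isCompact_ring n _).measurableSet fun x hx =>
        Real.norm_of_nonneg (hf0 x (ring_subset n (by linarith [hk k]) hx))
    rw [e, mul_assoc, ← Real.exp_nat_mul, ← Real.exp_add]
    refine (hC _ (hk k)).trans_eq ?_
    ring_nf
  have h1 : IntegrableOn f ({x | Real.exp (-2) ≤ ‖x‖ ∧ ‖x‖ ≤ r}) := by
    refine (hf.mono fun x hx => ?_).integrableOn_compact
      ((isCompact_closedBall (0 : Eu n) r).of_isClosed_subset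
      ((isClosed_le continuous_const continuous_norm).inter
      (isClosed_le continuous_norm continuous_const)) fun x hx => by simpa using hx.2)
    refine ⟨by simpa using hx.2.trans_lt hr, ?_⟩
    rintro rfl
    have := hx.1
    rw [norm_zero] at this
    exact absurd this (Real.exp_pos _).not_ge
  have h0 : IntegrableOn f {0} := integrableOn_singleton (hx := isCompact_singleton.measure_lt_top)
  refine ((h0.union hS).union h1).mono_set fun x hx => ?_
  by_cases hx0 : x = 0
  · exact Or.inl (Or.inl hx0)
  have hp := norm_pos_iff.2 hx0
  rcases le_or_gt (Real.exp (-2)) ‖x‖ with h | h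
  · exact Or.inr ⟨h, by simpa using hx⟩
  · refine Or.inl (Or.inr (Set.mem_iUnion.2 ⟨⌊-Real.log ‖x‖ - 2⌋₊, ?_⟩))
    have hl : Real.log ‖x‖ < -2 := (Real.log_lt_iff_lt_exp hp).2 h
    have f1 := Nat.floor_le (show 0 ≤ -Real.log ‖x‖ - 2 by linarith)
    have f2 := Nat.lt_floor_add_one (-Real.log ‖x‖ - 2)
    constructor
    · rw [← Real.le_log_iff_exp_le hp]; linarith
    · rw [← Real.log_le_iff_le_exp hp]; linarith

theorem Sol.integrableOn_rpow {n : ℕ} {p a : ℝ} {u : Eu n → ℝ} (h : Sol n p a u) {r : ℝ}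
    (hr : r < 1) : IntegrableOn (fun x => u x ^ p) (closedBall 0 r) := by
  obtain ⟨C, -, hC⟩ := ring_rpow_le h
  have e : 0 < (n : ℝ) - a - 4 := by linarith [h.ha2]
  exact integrableOn_of_ring h.contOn_rpow (fun x hx => Real.rpow_nonneg (h.pos x hx) _) e
    (by linarith [h.hn]) hC hr

theorem ring_mul_le {n : ℕ} {p a : ℝ} {u : Eu n → ℝ} (h : Sol n p a u) :
    ∃ C : ℝ, ∀ s < -2, ∫ x in ring n s, u x * ‖x‖ ^ (-4 : ℝ) ≤ C * Real.exp (s * (n - a - 4)) := by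
  obtain ⟨C, hC0, hC⟩ := ring_rpow_le h
  have hp := h.hp
  refine ⟨Real.exp 4 * (C + Real.exp n * volume.real (ball (0 : Eu n) 1)), fun s hs => ?_⟩
  have hpt : ∀ x ∈ ring n s, u x * ‖x‖ ^ (-4 : ℝ) ≤
      Real.exp 4 * (u x ^ p + Real.exp (-s * (a + 4))) := by
    intro x hx
    have hx1 := ring_subset n (by linarith) hx
    have hu := h.pos x hx1
    have hr := norm_pos_iff.2 (show x ≠ 0 from hx1.2)
    have h4 : ‖x‖ ^ (-4 : ℝ) ≤ Real.exp 4 * Real.exp (-(4 * s)) := by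
      rw [← Real.exp_add, Real.rpow_def_of_pos hr, Real.exp_le_exp]
      have := (Real.le_log_iff_exp_le hr).2 hx.1
      linarith
    have key : Real.exp (-(4 * s)) * u x ≤ u x ^ p + Real.exp (-s * (a + 4)) := by
      rcases hu.eq_or_lt with h0 | h0
      · rw [← h0]; have := Real.rpow_nonneg (le_refl (0 : ℝ)) p
        have := Real.exp_pos (-s * (a + 4))
        simp only [mul_zero]; linarith
      rcases le_total (Real.exp (-s * a)) (u x) with h1 | h1
      · have h2 : Real.exp (-(4 * s)) ≤ u x ^ (p - 1) := by
          have := Real.rpow_le_rpow (by positivity) h1 (by linarith : 0 ≤ p - 1)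
          rw [← Real.exp_mul] at this
          refine (le_of_eq ?_).trans this
          congr 1
          linear_combination s * h.hap
        have h3 : u x ^ p = u x ^ (p - 1) * u x := by
          rw [← Real.rpow_add_one h0.ne']; ring_nf
        have := mul_le_mul_of_nonneg_right h2 hu
        have := Real.exp_pos (-s * (a + 4))
        linarith
      · have h2 : Real.exp (-s * (a + 4)) = Real.exp (-(4 * s)) * Real.exp (-s * a) := by
          rw [← Real.exp_add]; ring_nf
        have := mul_le_mul_of_nonneg_left h1 (Real.exp_pos (-(4 * s))).le
        have := Real.rpow_nonneg hu p
        linarith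
    calc u x * ‖x‖ ^ (-4 : ℝ) ≤ u x * (Real.exp 4 * Real.exp (-(4 * s))) :=
          mul_le_mul_of_nonneg_left h4 hu
      _ = Real.exp 4 * (Real.exp (-(4 * s)) * u x) := by ring
      _ ≤ _ := mul_le_mul_of_nonneg_left key (Real.exp_pos 4).le
  have hK := isCompact_ring n s
  have hsub := ring_subset n (s := s) (by linarith)
  have c1 : ContinuousOn (fun x => u x * ‖x‖ ^ (-4 : ℝ)) (ring n s) :=
    (h.contOn.mono hsub).mul (continuous_norm.continuousOn.rpow_const fun x hx =>
      Or.inl (norm_ne_zero_iff.2 (hsub hx).2))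
  have i2 : IntegrableOn (fun x => u x ^ p) (ring n s) :=
    (h.contOn_rpow.mono hsub).integrableOn_compact hK
  have i3 : IntegrableOn (fun _ : Eu n => Real.exp (-s * (a + 4))) (ring n s) :=
    integrableOn_const hK.measure_lt_top.ne
  have hI := setIntegral_mono_on (c1.integrableOn_compact hK)
    ((i2.add i3).const_mul (Real.exp 4)) hK.measurableSet hpt
  refine hI.trans ?_
  simp only [Pi.add_apply]
  rw [integral_const_mul, integral_add i2 i3, setIntegral_const, smul_eq_mul, mul_assoc]
  refine mul_le_mul_of_nonneg_left ?_ (Real.exp_pos 4).le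
  have hv : volume.real (ring n s) ≤ Real.exp ((s + 1) * n) * volume.real (ball (0 : Eu n) 1) := by
    rw [← volume_closedBall_exp]
    exact measureReal_mono (fun x hx => by simpa using hx.2)
      (isCompact_closedBall _ _).measure_lt_top.ne
  have e : Real.exp ((s + 1) * n) * Real.exp (-s * (a + 4)) =
      Real.exp n * Real.exp (s * (n - a - 4)) := by
    rw [← Real.exp_add, ← Real.exp_add]; ring_nf
  have := mul_le_mul_of_nonneg_right hv (Real.exp_pos (-s * (a + 4))).le
  have e' : Real.exp ((s + 1) * n) * volume.real (ball (0 : Eu n) 1) * Real.exp (-s * (a + 4)) =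
     volume.real (ball (0 : Eu n) 1) * (Real.exp n * Real.exp (s * (n - a - 4))) := by
    rw [← e]; ring
  rw [e'] at this
  have := hC s hs
  linarith

theorem Sol.integrableOn_mul {n : ℕ} {p a : ℝ} {u : Eu n → ℝ} (h : Sol n p a u) {r : ℝ}
    (hr : r < 1) : IntegrableOn (fun x => u x * ‖x‖ ^ (-4 : ℝ)) (closedBall 0 r) := by
  obtain ⟨C, hC⟩ := ring_mul_le h
  have e : 0 < (n : ℝ) - a - 4 := by linarith [h.ha2]
  exact integrableOn_of_ring (h.contOn.mul (continuous_norm.continuousOn.rpow_const fun x hx =>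
    Or.inl (norm_ne_zero_iff.2 hx.2))) (fun x hx => mul_nonneg (h.pos x hx) (by positivity)) e
    (by linarith [h.hn]) hC hr

theorem norm_bilap_le {n : ℕ} {f : Eu n → ℝ} (hf : ContDiff ℝ 4 f) (x : Eu n) :
    |bilap f x| ≤ (n : ℝ) ^ 2 * ‖iteratedFDeriv ℝ 4 f x‖ := by
  have key : ∀ (g : Eu n → ℝ) (x : Eu n), |lap g x| ≤ n * ‖iteratedFDeriv ℝ 2 g x‖ := by
    intro g x
    refine (Finset.abs_sum_le_sum_abs _ _).trans ?_
    have : ∀ i ∈ (Finset.univ : Finset (Fin n)), |iteratedFDeriv ℝ 2 g x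
        ![EuclideanSpace.single i 1, EuclideanSpace.single i 1]| ≤ ‖iteratedFDeriv ℝ 2 g x‖ := by
      intro i _
      refine ((iteratedFDeriv ℝ 2 g x).le_opNorm _).trans ?_
      simp [Fin.prod_univ_two]
    refine (Finset.sum_le_sum this).trans ?_
    simp
  have h1 : ContDiff ℝ 3 (fderiv ℝ f) := hf.fderiv_right (by norm_num)
  have h2 : ContDiff ℝ 2 (fderiv ℝ (fderiv ℝ f)) := h1.fderiv_right (by norm_num)
  let e : Fin n → Eu n := fun i => EuclideanSpace.single i 1
  have he : ∀ i, ‖e i‖ = 1 := fun i => by simp [e]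
  have hlap : lap f = fun x => ∑ i : Fin n, (fun y => (fun z => fderiv ℝ (fderiv ℝ f) z (e i)) y
      (e i)) x := by
    ext y; rw [lap_apply]
  have h3 : ∀ i, ContDiff ℝ 2 fun z => fderiv ℝ (fderiv ℝ f) z (e i) := fun i =>
    h2.clm_apply contDiff_const
  have h3' : ∀ i, ContDiff ℝ 2 fun z => fderiv ℝ (fderiv ℝ f) z (e i) (e i) := fun i =>
    (h3 i).clm_apply contDiff_const
  have h4 : ‖iteratedFDeriv ℝ 2 (lap f) x‖ ≤ n * ‖iteratedFDeriv ℝ 4 f x‖ := by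
    rw [hlap, iteratedFDeriv_fun_sum_apply fun i _ => (h3' i).contDiffAt]
    refine (norm_sum_le _ _).trans ?_
    have : ∀ i ∈ (Finset.univ : Finset (Fin n)), ‖iteratedFDeriv ℝ 2
        (fun z => fderiv ℝ (fderiv ℝ f) z (e i) (e i)) x‖ ≤ ‖iteratedFDeriv ℝ 4 f x‖ := by
      intro i _
      refine (norm_iteratedFDeriv_clm_apply_const (N := 2) (h3 i).contDiffAt le_rfl).trans ?_
      rw [he, one_mul]
      refine (norm_iteratedFDeriv_clm_apply_const (N := 2) h2.contDiffAt le_rfl).trans ?_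
      rw [he, one_mul, norm_iteratedFDeriv_fderiv, norm_iteratedFDeriv_fderiv]
    refine (Finset.sum_le_sum this).trans ?_
    simp
  calc |bilap f x| ≤ n * ‖iteratedFDeriv ℝ 2 (lap f) x‖ := key _ x
    _ ≤ n * (n * ‖iteratedFDeriv ℝ 4 f x‖) := mul_le_mul_of_nonneg_left h4 (by positivity)
    _ = _ := by ring


theorem continuous_bilap {n : ℕ} {f : Eu n → ℝ} (hf : ContDiff ℝ 4 f) : Continuous (bilap f) :=
  (contDiff_lap (k := 0) (m := 2) (by norm_num)
    (contDiff_lap (k := 2) (m := 4) (by norm_num) hf)).continuous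

theorem tsupport_bilap_subset {n : ℕ} (f : Eu n → ℝ) : tsupport (bilap f) ⊆ tsupport f :=
  (tsupport_lap_subset _).trans (tsupport_lap_subset _)

theorem exists_closedBall_of_compact {n : ℕ} {K : Set (Eu n)} (hK : IsCompact K)
    (h : K ⊆ ball 0 1) : ∃ r : ℝ, 0 < r ∧ r < 1 ∧ K ⊆ closedBall 0 r := by
  rcases K.eq_empty_or_nonempty with rfl | hne
  · exact ⟨1 / 2, by norm_num, by norm_num, Set.empty_subset _⟩
  obtain ⟨x, hx, hmax⟩ := hK.exists_isMaxOn hne continuous_norm.continuousOn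
  have h1 : ‖x‖ < 1 := by simpa using h hx
  refine ⟨(1 + ‖x‖) / 2, by positivity, by linarith, fun y hy => ?_⟩
  have := hmax hy
  simp only [Set.mem_ofPred_eq] at this
  rw [mem_closedBall_zero_iff]
  linarith

theorem integrable_mul_of_integrableOn {n : ℕ} {f g : Eu n → ℝ}
    (hf : ∀ r < 1, IntegrableOn f (closedBall 0 r)) (hg : Continuous g)
    (hc : HasCompactSupport g) (h : tsupport g ⊆ ball 0 1) : Integrable fun x => f x * g x := by
  obtain ⟨r, -, hr, hK⟩ := exists_closedBall_of_compact hc h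
  have h1 := ((hf r hr).mono_set hK).mul_continuousOn hg.continuousOn hc
  rwa [integrableOn_iff_integrable_of_support_subset] at h1
  exact (Function.support_mul_subset_right _ _).trans (subset_tsupport _)

theorem Sol.integrableOn_u {n : ℕ} {p a : ℝ} {u : Eu n → ℝ} (h : Sol n p a u) {r : ℝ}
    (hr : r < 1) : IntegrableOn u (closedBall 0 r) := by
  have : Nonempty (Fin n) := ⟨⟨0, by linarith [h.hn]⟩⟩
  have h1 := (h.integrableOn_mul hr).mul_continuousOn
    (g' := fun x : Eu n => ‖x‖ ^ 4) (by fun_prop) (isCompact_closedBall 0 r)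
  refine h1.congr_fun_ae ((ae_restrict_of_ae (Measure.ae_ne volume (0 : Eu n))).mono fun x hx => ?_)
  have hx' := norm_pos_iff.2 hx
  simp only
  rw [mul_assoc, ← Real.rpow_natCast, ← Real.rpow_add hx']
  norm_num

theorem exists_radial_cutoff (n : ℕ) : ∃ (Θ : Eu n → ℝ) (B : ℝ), ContDiff ℝ (⊤ : ℕ∞) Θ ∧
    (∀ x, 0 ≤ Θ x ∧ Θ x ≤ 1) ∧ (∀ x, ‖x‖ < 1 → Θ x = 0) ∧ (∀ x, 3 < ‖x‖ → Θ x = 1) ∧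
    ∀ i ≤ 4, ∀ y, ‖y‖ ^ i * ‖iteratedFDeriv ℝ i Θ y‖ ≤ B := by
  let θ := fun t => Real.smoothTransition t
  have hθ : ContDiff ℝ (⊤ : ℕ∞) θ := Real.smoothTransition.contDiff
  have hθ0 : ∀ t < 0, θ t = 0 := fun t ht => Real.smoothTransition.zero_of_nonpos ht.le
  have hΘ : ContDiff ℝ (⊤ : ℕ∞) (radLog 0 θ : Eu n → ℝ) := contDiff_radLog 0 hθ hθ0
  have h1 : ∀ x : Eu n, 3 < ‖x‖ → radLog 0 θ x = 1 := fun x hx => by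
    have hx0 : x ≠ 0 := norm_pos_iff.1 (by linarith)
    rw [radLog_of_ne _ _ hx0, Real.rpow_zero, one_mul]
    apply Real.smoothTransition.one_of_one_le
    rw [Real.le_log_iff_exp_le (by linarith)]
    linarith [Real.exp_one_lt_three]
  have hb : ∀ i, i ≤ 4 → ∃ B, ∀ y : Eu n,
      ‖y‖ ^ i * ‖iteratedFDeriv ℝ i (radLog 0 θ : Eu n → ℝ) y‖ ≤ B := by
    intro i hi
    have hcont : Continuous fun y : Eu n =>
        ‖y‖ ^ i * ‖iteratedFDeriv ℝ i (radLog 0 θ : Eu n → ℝ) y‖ :=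
      (continuous_norm.pow i).mul (hΘ.continuous_iteratedFDeriv (by exact_mod_cast le_top)).norm
    obtain ⟨B, hB⟩ := (isCompact_closedBall (0 : Eu n) 3).exists_bound_of_continuousOn
      hcont.continuousOn
    refine ⟨max B 1, fun y => ?_⟩
    rcases le_or_gt ‖y‖ 3 with hy | hy
    · exact ((le_abs_self _).trans (hB y (by simpa using hy))).trans (le_max_left _ _)
    · have hev : (radLog 0 θ : Eu n → ℝ) =ᶠ[nhds y] fun _ => (1 : ℝ) := by
        filter_upwards [(isOpen_lt continuous_const continuous_norm).mem_nhds hy] with z hz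
        exact h1 z hz
      rw [(hev.iteratedFDeriv ℝ i).self_of_nhds]
      rcases Nat.eq_zero_or_pos i with rfl | h0
      · simp
      · rw [iteratedFDeriv_const_of_ne h0.ne']
        simp
  choose! B hB using hb
  refine ⟨radLog 0 θ, ∑ i ∈ Finset.range 5, |B i|, hΘ, fun x => ?_, fun x hx => ?_, h1,
    fun i hi y => ?_⟩
  · by_cases hx : x = 0
    · simp [hx]
    · rw [radLog_of_ne _ _ hx, Real.rpow_zero, one_mul]
      exact ⟨Real.smoothTransition.nonneg _, Real.smoothTransition.le_one _⟩
  · by_cases hx0 : x = 0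
    · simp [hx0]
    · rw [radLog_of_ne _ _ hx0, hθ0, mul_zero]
      exact Real.log_neg (norm_pos_iff.2 hx0) hx
  · exact ((hB i hi y).trans (le_abs_self _)).trans
      (Finset.single_le_sum (f := fun i => |B i|) (fun _ _ => abs_nonneg _)
        (Finset.mem_range.2 (by lia)))

theorem norm_iteratedFDeriv_comp_smul_le {n : ℕ} {Θ : Eu n → ℝ} {B : ℝ}
    (hΘ : ContDiff ℝ (⊤ : ℕ∞) Θ) {i : ℕ}
    (hB : ∀ y, ‖y‖ ^ i * ‖iteratedFDeriv ℝ i Θ y‖ ≤ B) {c : ℝ} (hc : 0 < c) (x : Eu n) :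
    ‖x‖ ^ i * ‖iteratedFDeriv ℝ i (fun y => Θ (c • y)) x‖ ≤ B := by
  let L : Eu n →L[ℝ] Eu n := c • ContinuousLinearMap.id ℝ (Eu n)
  have hL : ‖L‖ ≤ c := ContinuousLinearMap.opNorm_le_bound _ hc.le fun y => by
    simp [L, norm_smul, abs_of_pos hc]
  have e : (fun y => Θ (c • y)) = Θ ∘ L := by ext y; simp [L]
  rw [e, L.iteratedFDeriv_comp_right hΘ x (by exact_mod_cast le_top)]
  have h1 := (iteratedFDeriv ℝ i Θ (L x)).norm_compContinuousLinearMap_le fun _ => L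
  have h2 : ∏ _j : Fin i, ‖L‖ ≤ c ^ i := by
    simpa using pow_le_pow_left₀ (norm_nonneg L) hL i
  have h3 := hB (L x)
  have h4 : ‖L x‖ = c * ‖x‖ := by simp [L, norm_smul, abs_of_pos hc]
  rw [h4, mul_pow] at h3
  refine le_trans ?_ h3
  calc _ ≤ ‖x‖ ^ i * (‖iteratedFDeriv ℝ i Θ (L x)‖ * c ^ i) :=
        mul_le_mul_of_nonneg_left (h1.trans (mul_le_mul_of_nonneg_left h2 (norm_nonneg _)))
          (by positivity)
    _ = _ := by ring

theorem bilap_mul_cutoff_le {n : ℕ} {φ Θ : Eu n → ℝ} {A B : ℝ} (hφ : ContDiff ℝ 4 φ)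
    (hΘ : ContDiff ℝ (⊤ : ℕ∞) Θ) (hA0 : 0 ≤ A)
    (hA : ∀ i ≤ 4, ∀ y, ‖iteratedFDeriv ℝ i φ y‖ ≤ A)
    (hB : ∀ i ≤ 4, ∀ y, ‖y‖ ^ i * ‖iteratedFDeriv ℝ i Θ y‖ ≤ B) {c : ℝ} (hc : 0 < c) {x : Eu n}
    (hx1 : ‖x‖ ≤ 1) :
    ‖x‖ ^ 4 * |bilap (fun y => φ y * Θ (c • y)) x| ≤ (n : ℝ) ^ 2 * (16 * (A * B)) := by
  have hΘc : ContDiff ℝ 4 fun y => Θ (c • y) :=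
    (hΘ.of_le four_le_top).comp (contDiff_const_smul c)
  have h1 := norm_iteratedFDeriv_mul_le hφ hΘc x (n := 4) le_rfl
  have h2 : ∀ i ∈ Finset.range 5, ‖x‖ ^ 4 * (((4 : ℕ).choose i : ℝ) * ‖iteratedFDeriv ℝ i φ x‖ *
      ‖iteratedFDeriv ℝ (4 - i) (fun y => Θ (c • y)) x‖) ≤ ((4 : ℕ).choose i : ℝ) * (A * B) := by
    intro i hi
    have hi4 : i ≤ 4 := by have := Finset.mem_range.1 hi; lia
    have b1 := norm_iteratedFDeriv_comp_smul_le hΘ (hB (4 - i) (by lia)) hc x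
    have b2 := hA i hi4 x
    have b3 : ‖x‖ ^ 4 = ‖x‖ ^ i * ‖x‖ ^ (4 - i) := by rw [← pow_add]; congr 1; lia
    have b4 : ‖x‖ ^ i ≤ 1 := pow_le_one₀ (norm_nonneg _) hx1
    calc _ = ((4 : ℕ).choose i : ℝ) * ((‖x‖ ^ i * ‖iteratedFDeriv ℝ i φ x‖) *
        (‖x‖ ^ (4 - i) * ‖iteratedFDeriv ℝ (4 - i) (fun y => Θ (c • y)) x‖)) := by rw [b3]; ring
      _ ≤ ((4 : ℕ).choose i : ℝ) * ((1 * A) * B) := by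
        refine mul_le_mul_of_nonneg_left ?_ (by positivity)
        refine mul_le_mul (mul_le_mul b4 b2 (norm_nonneg _) zero_le_one) b1 (by positivity)
          (by positivity)
      _ = _ := by ring
  have h3 : ‖x‖ ^ 4 * ‖iteratedFDeriv ℝ 4 (fun y => φ y * Θ (c • y)) x‖ ≤ 16 * (A * B) := by
    refine (mul_le_mul_of_nonneg_left h1 (by positivity)).trans ?_
    rw [Finset.mul_sum]
    refine (Finset.sum_le_sum h2).trans (le_of_eq ?_)
    simp only [Finset.sum_range_succ, Finset.sum_range_zero]
    norm_num [Nat.choose]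
    ring
  calc _ ≤ ‖x‖ ^ 4 * ((n : ℝ) ^ 2 * ‖iteratedFDeriv ℝ 4 (fun y => φ y * Θ (c • y)) x‖) :=
        mul_le_mul_of_nonneg_left (norm_bilap_le (hφ.mul hΘc) x) (by positivity)
    _ = (n : ℝ) ^ 2 * (‖x‖ ^ 4 * ‖iteratedFDeriv ℝ 4 (fun y => φ y * Θ (c • y)) x‖) := by ring
    _ ≤ _ := mul_le_mul_of_nonneg_left h3 (by positivity)

theorem exists_iteratedFDeriv_bound {n : ℕ} {φ : Eu n → ℝ} (hφ : ContDiff ℝ 4 φ)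
    (hc : HasCompactSupport φ) :
    ∃ A, 0 ≤ A ∧ ∀ i ≤ 4, ∀ y, ‖iteratedFDeriv ℝ i φ y‖ ≤ A := by
  have : ∀ i, i ≤ 4 → ∃ A, ∀ y, ‖iteratedFDeriv ℝ i φ y‖ ≤ A := fun i hi =>
    (hc.iteratedFDeriv i).exists_bound_of_continuous
      (hφ.continuous_iteratedFDeriv (by exact_mod_cast hi))
  choose! A hA using this
  exact ⟨∑ i ∈ Finset.range 5, |A i|, by positivity, fun i hi y =>
    ((hA i hi y).trans (le_abs_self _)).trans
      (Finset.single_le_sum (f := fun i => |A i|) (fun _ _ => abs_nonneg _)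
        (Finset.mem_range.2 (by lia)))⟩

/-- The equation holds in the sense of distributions in the whole ball. -/
theorem Sol.weak {n : ℕ} {p a : ℝ} {u : Eu n → ℝ} (h : Sol n p a u) {φ : Eu n → ℝ}
    (hφ : ContDiff ℝ 4 φ) (hc : HasCompactSupport φ) (hs : tsupport φ ⊆ ball 0 1) :
    ∫ x, u x * bilap φ x = ∫ x, u x ^ p * φ x := by
  have : Nonempty (Fin n) := ⟨⟨0, by linarith [h.hn]⟩⟩
  obtain ⟨Θ, B, hΘ, hΘ01, hΘ0, hΘ1, hB⟩ := exists_radial_cutoff n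
  obtain ⟨A, hA0, hA⟩ := exists_iteratedFDeriv_bound hφ hc
  obtain ⟨r, hr0, hr, hK⟩ := exists_closedBall_of_compact hc hs
  have hck : ∀ k : ℕ, (0 : ℝ) < k + 1 := fun k => by positivity
  have htest : ∀ k : ℕ, ∫ x, u x * bilap (fun y => φ y * Θ (((k : ℝ) + 1) • y)) x =
      ∫ x, u x ^ p * (φ x * Θ (((k : ℝ) + 1) • x)) := by
    intro k
    refine weak_test h (hφ.mul ((hΘ.of_le four_le_top).comp (contDiff_const_smul _)))
      hc.mul_right fun x hx => ⟨hs (tsupport_mul_subset_left hx), ?_⟩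
    rintro rfl
    refine (notMem_tsupport_iff_eventuallyEq.2 ?_) hx
    filter_upwards [ball_mem_nhds (0 : Eu n) (inv_pos.2 (hck k))] with y hy
    rw [hΘ0, mul_zero, Pi.zero_apply]
    rw [norm_smul, Real.norm_of_nonneg (hck k).le]
    rw [mem_ball_zero_iff] at hy
    calc _ < ((k : ℝ) + 1) * ((k : ℝ) + 1)⁻¹ := mul_lt_mul_of_pos_left hy (hck k)
      _ = 1 := mul_inv_cancel₀ (hck k).ne'
  have hev : ∀ x : Eu n, x ≠ 0 → ∀ᶠ k : ℕ in atTop, (fun y => φ y * Θ (((k : ℝ) + 1) • y))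
      =ᶠ[nhds x] φ := by
    intro x hx
    have hx' := norm_pos_iff.2 hx
    obtain ⟨N, hN⟩ := exists_nat_gt (6 / ‖x‖)
    filter_upwards [eventually_ge_atTop N] with k hk
    filter_upwards [(isOpen_lt (continuous_const (y := ‖x‖ / 2)) continuous_norm).mem_nhds
      (show ‖x‖ / 2 < ‖x‖ by linarith)] with y hy
    rw [hΘ1, mul_one]
    rw [norm_smul, Real.norm_of_nonneg (hck k).le]
    have hy' : ‖x‖ / 2 < ‖y‖ := hy
    have : (6 / ‖x‖) < k + 1 := hN.trans_le (by have : (N : ℝ) ≤ k := by exact_mod_cast hk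
                                                linarith)
    rw [div_lt_iff₀ hx'] at this
    nlinarith [hck k]
  have c1 := ContDiff.continuous hφ
  have hΘc : ∀ k : ℕ, ContDiff ℝ 4 fun y : Eu n => Θ (((k : ℝ) + 1) • y) := fun k =>
    (hΘ.of_le four_le_top).comp (contDiff_const_smul _)
  have L1 : Tendsto (fun k : ℕ => ∫ x, u x ^ p * (φ x * Θ (((k : ℝ) + 1) • x))) atTop
      (nhds (∫ x, u x ^ p * φ x)) := by
    have hprod := integrable_mul_of_integrableOn (fun r hr => h.integrableOn_rpow hr) c1 hc hs
    refine tendsto_integral_of_dominated_convergence (fun x => ‖u x ^ p * φ x‖) (fun k => ?_)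
      hprod.norm (fun k => ?_) ?_
    · exact (integrable_mul_of_integrableOn (fun r hr => h.integrableOn_rpow hr)
        (c1.mul (hΘc k).continuous) hc.mul_right
        ((tsupport_mul_subset_left).trans hs)).aestronglyMeasurable
    · refine Eventually.of_forall fun x => ?_
      rw [← mul_assoc, norm_mul]
      refine mul_le_of_le_one_right (norm_nonneg _) ?_
      rw [Real.norm_of_nonneg (hΘ01 _).1]
      exact (hΘ01 _).2
    · filter_upwards [Measure.ae_ne volume (0 : Eu n)] with x hx
      refine tendsto_const_nhds.congr' ?_
      filter_upwards [hev x hx] with k hk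
      have hk' : φ x * Θ (((k : ℝ) + 1) • x) = φ x := hk.self_of_nhds
      rw [hk']
  have L2 : Tendsto (fun k : ℕ => ∫ x, u x * bilap (fun y => φ y * Θ (((k : ℝ) + 1) • y)) x) atTop
      (nhds (∫ x, u x * bilap φ x)) := by
    have hG : Integrable fun x => ((n : ℝ) ^ 2 * (16 * (A * B))) * (closedBall (0 : Eu n) r).indicator
        (fun x => u x * ‖x‖ ^ (-4 : ℝ)) x :=
      ((integrable_indicator_iff measurableSet_closedBall).2 (h.integrableOn_mul hr)).const_mul _
    refine tendsto_integral_of_dominated_convergence _ (fun k => ?_) hG (fun k => ?_) ?_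
    · exact (integrable_mul_of_integrableOn (fun r hr => h.integrableOn_u hr)
        (continuous_bilap (hφ.mul (hΘc k)))
        (hc.mul_right.mono' ((subset_tsupport _).trans (tsupport_bilap_subset _)))
        ((tsupport_bilap_subset _).trans
          ((tsupport_mul_subset_left).trans hs))).aestronglyMeasurable
    · filter_upwards [Measure.ae_ne volume (0 : Eu n)] with x hx
      by_cases hxr : x ∈ closedBall (0 : Eu n) r
      · rw [Set.indicator_of_mem hxr]
        have hx' := norm_pos_iff.2 hx
        have hxr' : ‖x‖ ≤ r := by simpa using hxr
        have hu := h.pos x ⟨by simpa using hxr'.trans_lt hr, hx⟩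
        have := bilap_mul_cutoff_le hφ hΘ hA0 hA hB (hck k) (hxr'.trans hr.le)
        rw [norm_mul, Real.norm_of_nonneg hu, Real.norm_eq_abs]
        have e : ‖x‖ ^ (-4 : ℝ) = (‖x‖ ^ 4)⁻¹ := by
          rw [Real.rpow_neg hx'.le]; norm_cast
        rw [e]
        have := mul_le_mul_of_nonneg_left this (mul_nonneg hu (inv_nonneg.2 (pow_nonneg hx'.le 4)))
        have h4 : (‖x‖ ^ 4)⁻¹ * ‖x‖ ^ 4 = 1 := inv_mul_cancel₀ (by positivity)
        calc _ = u x * ((‖x‖ ^ 4)⁻¹ * ‖x‖ ^ 4) *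
              |bilap (fun y => φ y * Θ (((k : ℝ) + 1) • y)) x| := by rw [h4, mul_one]
          _ = u x * (‖x‖ ^ 4)⁻¹ * (‖x‖ ^ 4 *
              |bilap (fun y => φ y * Θ (((k : ℝ) + 1) • y)) x|) := by ring
          _ ≤ _ := this
          _ = _ := by ring
      · rw [Set.indicator_of_notMem hxr, mul_zero]
        have : x ∉ tsupport (bilap (fun y => φ y * Θ (((k : ℝ) + 1) • y))) := fun hx' =>
          hxr (hK (tsupport_mul_subset_left (tsupport_bilap_subset _ hx')))
        rw [image_eq_zero_of_notMem_tsupport this]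
        simp
    · filter_upwards [Measure.ae_ne volume (0 : Eu n)] with x hx
      refine tendsto_const_nhds.congr' ?_
      filter_upwards [hev x hx] with k hk
      rw [bilap_congr hk]
  exact tendsto_nhds_unique L2 (L1.congr fun k => (htest k).symm)


theorem lapLog_congr {n : ℕ} (β : ℝ) {f g : ℝ → ℝ} {t : ℝ} (h : f =ᶠ[nhds t] g) :
    lapLog n β f =ᶠ[nhds t] lapLog n β g := by
  filter_upwards [h, h.deriv, h.deriv.deriv] with s h0 h1 h2
  simp [lapLog, h0, h1, h2]

theorem lapLog_const (n : ℕ) (β c : ℝ) :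
    lapLog n β (fun _ => c) = fun _ => β * (β + n - 2) * c := by
  ext t; simp [lapLog]

theorem lapLog_sub (n : ℕ) (β : ℝ) {f g : ℝ → ℝ} (hf : ContDiff ℝ 2 f) (hg : ContDiff ℝ 2 g) :
    lapLog n β (fun t => f t - g t) = fun t => lapLog n β f t - lapLog n β g t := by
  have hf1 := hf.differentiable (by norm_num)
  have hg1 := hg.differentiable (by norm_num)
  have hd : ∀ {f : ℝ → ℝ}, ContDiff ℝ 2 f → Differentiable ℝ (deriv f) := fun {f} hf =>
    (contDiff_succ_iff_deriv (n := 1).1 (by simpa [one_add_one_eq_two] using hf)).2.2.differentiable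
      (by norm_num)
  have e : deriv (fun t => f t - g t) = fun t => deriv f t - deriv g t := by
    ext t; exact deriv_fun_sub (hf1 t) (hg1 t)
  ext t
  simp only [lapLog, e]
  rw [deriv_fun_sub (hd hf t) (hd hg t)]
  ring

/-- Logarithmic polar coordinates. -/
theorem integral_radLog_neg (n : ℕ) (hn : n ≠ 0) (g : ℝ → ℝ) :
    ∫ x : Eu n, radLog (-(n : ℝ)) g x =
      n * (volume : Measure (Eu n)).real (ball 0 1) * ∫ t, g t := by
  have : Nonempty (Fin n) := ⟨⟨0, Nat.pos_of_ne_zero hn⟩⟩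
  have e : ∀ x : Eu n, radLog (-(n : ℝ)) g x =
      (fun y : ℝ => y ^ (-(n : ℝ)) * g (Real.log y)) ‖x‖ := fun x => by
    by_cases hx : x = 0
    · subst hx
      simp [Real.zero_rpow (neg_ne_zero.2 (Nat.cast_ne_zero.2 hn))]
    · rw [radLog_of_ne _ _ hx]
  rw [integral_congr_ae (Eventually.of_forall e), integral_fun_norm_addHaar volume
      (fun y : ℝ => y ^ (-(n : ℝ)) * g (Real.log y)), finrank_euclideanSpace_fin]
  have h1 : ∫ y in Set.Ioi (0 : ℝ), y ^ (n - 1) • ((fun y : ℝ => y ^ (-(n : ℝ)) * g (Real.log y)) y)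
      = ∫ t, g t := by
    have h := integral_image_eq_integral_abs_deriv_smul (s := Set.univ) (f := Real.exp)
      (f' := Real.exp) MeasurableSet.univ (fun t _ => (Real.hasDerivAt_exp t).hasDerivWithinAt)
      (Real.exp_injective.injOn)
      (fun y => y ^ (n - 1) • ((fun y : ℝ => y ^ (-(n : ℝ)) * g (Real.log y)) y))
    rw [Set.image_univ, Real.range_exp] at h
    rw [h, setIntegral_univ]
    refine integral_congr_ae (Eventually.of_forall fun t => ?_)
    simp only [smul_eq_mul, Real.log_exp, Real.abs_exp]
    have : Real.exp t * (Real.exp t ^ (n - 1) * Real.exp t ^ (-(n : ℝ))) = 1 := by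
      rw [← mul_assoc, ← pow_succ', Nat.sub_add_cancel (Nat.pos_of_ne_zero hn),
        ← Real.rpow_natCast, ← Real.rpow_add (Real.exp_pos t)]
      simp
    calc _ = (Real.exp t * (Real.exp t ^ (n - 1) * Real.exp t ^ (-(n : ℝ)))) * g t := by ring
      _ = _ := by rw [this, one_mul]
  rw [h1]
  simp [mul_assoc]

/-- The radial biharmonic operator applied to a smooth step, in logarithmic variable. -/
noncomputable def ellCut (n : ℕ) : ℝ → ℝ :=
  lapLog n (2 - n) (lapLog n (4 - n) Real.smoothTransition)

theorem contDiff_step {m : WithTop ℕ∞} (hm : m ≤ (⊤ : ℕ∞)) : ContDiff ℝ m Real.smoothTransition :=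
  Real.smoothTransition.contDiff.of_le hm

theorem contDiff_lapLog_step (n : ℕ) (β : ℝ) :
    ContDiff ℝ (⊤ : ℕ∞) (lapLog n β Real.smoothTransition) :=
  contDiff_lapLog (m := (⊤ : ℕ∞)) β (le_refl _) (contDiff_step le_rfl)

theorem contDiff_ellCut (n : ℕ) : ContDiff ℝ (⊤ : ℕ∞) (ellCut n) :=
  contDiff_lapLog (m := (⊤ : ℕ∞)) _ (le_refl _) (contDiff_lapLog_step n _)

theorem step_eventuallyEq_zero {t : ℝ} (ht : t < 0) :
    Real.smoothTransition =ᶠ[nhds t] fun _ => (0 : ℝ) := by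
  filter_upwards [Iio_mem_nhds ht] with s hs
  exact Real.smoothTransition.zero_of_nonpos (le_of_lt hs)

theorem step_eventuallyEq_one {t : ℝ} (ht : 1 < t) :
    Real.smoothTransition =ᶠ[nhds t] fun _ => (1 : ℝ) := by
  filter_upwards [Ioi_mem_nhds ht] with s hs
  exact Real.smoothTransition.one_of_one_le (le_of_lt hs)

theorem ellCut_of_neg (n : ℕ) {t : ℝ} (ht : t < 0) : ellCut n t = 0 := by
  have h := (lapLog_congr (n := n) (2 - n) (lapLog_congr (n := n) (4 - n)
    (step_eventuallyEq_zero ht))).self_of_nhds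
  rw [ellCut, h, lapLog_const, lapLog_const]
  simp

theorem ellCut_of_one_lt (n : ℕ) {t : ℝ} (ht : 1 < t) : ellCut n t = 0 := by
  have h := (lapLog_congr (n := n) (2 - n) (lapLog_congr (n := n) (4 - n)
    (step_eventuallyEq_one ht))).self_of_nhds
  rw [ellCut, h, lapLog_const, lapLog_const]
  ring

theorem hasCompactSupport_ellCut (n : ℕ) : HasCompactSupport (ellCut n) := by
  refine HasCompactSupport.intro (isCompact_Icc (a := (0 : ℝ)) (b := 1)) fun t ht => ?_
  by_contra h
  refine ht ⟨?_, ?_⟩ <;> by_contra h'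
  · exact h (ellCut_of_neg n (not_le.1 h'))
  · exact h (ellCut_of_one_lt n (not_le.1 h'))

theorem integral_ellCut (n : ℕ) : ∫ t, ellCut n t = 2 * ((n : ℝ) - 2) * (n - 4) := by
  set G := lapLog n (4 - n) Real.smoothTransition with hG
  have hGs : ContDiff ℝ (⊤ : ℕ∞) G := contDiff_lapLog_step n _
  have hG1 : ContDiff ℝ (⊤ : ℕ∞) (deriv G) := (contDiff_infty_iff_deriv.1 hGs).2
  have hd : ∀ t, HasDerivAt (fun t => deriv G t + (2 - n) * G t) (ellCut n t) t := by
    intro t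
    have a := ((hG1.differentiable (by simp)) t).hasDerivAt
    have b := ((hGs.differentiable (by simp)) t).hasDerivAt
    convert! a.add (b.const_mul (2 - (n : ℝ))) using 1
    simp only [ellCut, lapLog, hG]
    ring
  have h := integral_of_hasDerivAt_of_tendsto (m := (0 : ℝ)) (n := (2 - (n : ℝ)) * (2 * (4 - n))) hd
    ((contDiff_ellCut n).continuous.integrable_of_hasCompactSupport (hasCompactSupport_ellCut n))
    (tendsto_const_nhds.congr' ?_) (tendsto_const_nhds.congr' ?_)
  · rw [h]; ring
  · filter_upwards [eventually_lt_atBot (0 : ℝ)] with t ht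
    have e := lapLog_congr (n := n) (4 - n) (step_eventuallyEq_zero ht)
    rw [hG, e.deriv.self_of_nhds, e.self_of_nhds, lapLog_const]
    simp
  · filter_upwards [eventually_gt_atTop (1 : ℝ)] with t ht
    have e := lapLog_congr (n := n) (4 - n) (step_eventuallyEq_one ht)
    rw [hG, e.deriv.self_of_nhds, e.self_of_nhds, lapLog_const, deriv_const]
    ring

/-- Truncations of the fundamental solution. -/
noncomputable def kern (n : ℕ) (s : ℝ) : Eu n → ℝ :=
  radLog (4 - n) fun t => Real.smoothTransition (t + s) - Real.smoothTransition (t + 2)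

noncomputable def kerInf (n : ℕ) : Eu n → ℝ :=
  radLog (4 - n) fun t => 1 - Real.smoothTransition (t + 2)

noncomputable def bump (n : ℕ) (s : ℝ) : Eu n → ℝ :=
  radLog (-(n : ℝ)) fun t => ellCut n (t + s)

theorem contDiff_step_shift {m : WithTop ℕ∞} (hm : m ≤ (⊤ : ℕ∞)) (s : ℝ) :
    ContDiff ℝ m fun t => Real.smoothTransition (t + s) :=
  (contDiff_step hm).comp (contDiff_id.add contDiff_const)

theorem ker_cut_zero {s : ℝ} (hs : 2 ≤ s) : ∀ t < -s,
    Real.smoothTransition (t + s) - Real.smoothTransition (t + 2) = 0 := fun t ht => by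
  rw [Real.smoothTransition.zero_of_nonpos (by linarith),
    Real.smoothTransition.zero_of_nonpos (by linarith), sub_zero]

theorem ker_cut_zero' {s : ℝ} (hs : 2 ≤ s) : ∀ t, -1 < t →
    Real.smoothTransition (t + s) - Real.smoothTransition (t + 2) = 0 := fun t ht => by
  rw [Real.smoothTransition.one_of_one_le (by linarith),
    Real.smoothTransition.one_of_one_le (by linarith), sub_self]

theorem contDiff_ker (n : ℕ) {s : ℝ} (hs : 2 ≤ s) : ContDiff ℝ (⊤ : ℕ∞) (kern n s) :=
  contDiff_radLog _ ((contDiff_step_shift le_rfl s).sub (contDiff_step_shift le_rfl 2))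
    (ker_cut_zero hs)

theorem contDiff_bump (n : ℕ) (s : ℝ) : ContDiff ℝ (⊤ : ℕ∞) (bump n s) :=
  contDiff_radLog _ ((contDiff_ellCut n).comp (contDiff_id.add contDiff_const)) (T := -s)
    fun t ht => ellCut_of_neg n (by simpa using by linarith)

theorem hasCompactSupport_ker (n : ℕ) {s : ℝ} (hs : 2 ≤ s) : HasCompactSupport (kern n s) :=
  hasCompactSupport_radLog _ (ker_cut_zero hs) (ker_cut_zero' hs)

theorem tsupport_ker_subset (n : ℕ) {s : ℝ} (hs : 2 ≤ s) :
    tsupport (kern n s) ⊆ closedBall 0 (Real.exp (-1)) := fun x hx => by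
  simpa using (tsupport_radLog_subset _ (ker_cut_zero hs) (ker_cut_zero' hs) hx).2

theorem tsupport_bump_subset (n : ℕ) (s : ℝ) :
    tsupport (bump n s) ⊆ closedBall 0 (Real.exp (1 - s)) := fun x hx => by
  simpa using (tsupport_radLog_subset (T₁ := -s) (T₂ := 1 - s) _
    (fun t ht => ellCut_of_neg n (by linarith)) (fun t ht => ellCut_of_one_lt n (by linarith)) hx).2

theorem hasCompactSupport_bump (n : ℕ) (s : ℝ) : HasCompactSupport (bump n s) :=
  (isCompact_closedBall (0 : Eu n) _).of_isClosed_subset (isClosed_tsupport _)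
    (tsupport_bump_subset n s)

theorem bilap_ker (n : ℕ) {s : ℝ} (hs : 2 ≤ s) (x : Eu n) :
    bilap (kern n s) x = bump n s x - bump n 2 x := by
  have h4 : ((4 : WithTop ℕ∞)) ≤ ((⊤ : ℕ∞) : WithTop ℕ∞) := four_le_top
  have h2 : ((2 : WithTop ℕ∞)) ≤ ((⊤ : ℕ∞) : WithTop ℕ∞) :=
    le_trans (by norm_num) four_le_top
  rw [kern, bilap_radLog' _ ((contDiff_step_shift h4 s).sub (contDiff_step_shift h4 2))
    (ker_cut_zero hs), lapLog_sub _ _ (contDiff_step_shift h2 s) (contDiff_step_shift h2 2),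
    lapLog_sub]
  · have e : ∀ s : ℝ, lapLog n (4 - n - 2) (lapLog n (4 - n) fun t =>
        Real.smoothTransition (t + s)) = fun t => ellCut n (t + s) := fun s => by
      have a := lapLog_comp_sub n (4 - n) Real.smoothTransition (-s)
      simp only [sub_neg_eq_add] at a
      have b := lapLog_comp_sub n (2 - n) (lapLog n (4 - n) Real.smoothTransition) (-s)
      simp only [sub_neg_eq_add] at b
      rw [a, show (4 : ℝ) - n - 2 = 2 - n by ring, b]
      rfl
    rw [e, e]
    by_cases hx : x = 0
    · subst hx; simp [bump]
    · rw [bump, bump, radLog_of_ne _ _ hx, radLog_of_ne _ _ hx, radLog_of_ne _ _ hx,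
        show (4 : ℝ) - n - 4 = -n by ring]
      ring
  · exact (contDiff_lapLog (m := (⊤ : ℕ∞)) _ (le_refl _) (contDiff_step_shift le_rfl s)).of_le h2
  · exact (contDiff_lapLog (m := (⊤ : ℕ∞)) _ (le_refl _) (contDiff_step_shift le_rfl 2)).of_le h2

/-- The inverse of the normalising constant of the fundamental solution. -/
noncomputable def cN (n : ℕ) : ℝ :=
  n * (volume : Measure (Eu n)).real (ball 0 1) * (2 * ((n : ℝ) - 2) * (n - 4))

theorem cN_pos {n : ℕ} (hn : 5 ≤ n) : 0 < cN n := by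
  have h5 : (5 : ℝ) ≤ n := by exact_mod_cast hn
  have : 0 < (volume : Measure (Eu n)).real (ball 0 1) :=
    ENNReal.toReal_pos (measure_ball_pos _ _ one_pos).ne' measure_ball_lt_top.ne
  have h1 : (0 : ℝ) < n - 2 := by linarith
  have h2 : (0 : ℝ) < n - 4 := by linarith
  have h3 : (0 : ℝ) < n := by linarith
  unfold cN
  positivity

theorem integral_bump {n : ℕ} (hn : n ≠ 0) (s : ℝ) : ∫ x, bump n s x = cN n := by
  rw [bump, integral_radLog_neg n hn, integral_add_right_eq_self (ellCut n), integral_ellCut, cN]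

theorem lap_comp_const_sub {n : ℕ} (f : Eu n → ℝ) (x : Eu n) :
    lap (fun y => f (x - y)) = fun y => lap f (x - y) := by
  ext y
  have e : ∀ {F : Type} [NormedAddCommGroup F] [NormedSpace ℝ F] (g : Eu n → F),
      fderiv ℝ (fun y => g (x - y)) = fun y => -fderiv ℝ g (x - y) := fun g => by
    ext1 y
    have h1 : (fun y => g (x - y)) = fun y => (fun z => g (z + x)) (-y) := by
      ext1 y; congr 1; abel
    have h2 := (ContinuousLinearEquiv.neg ℝ (M := Eu n)).comp_right_fderiv
      (f := fun z => g (z + x)) (x := y)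
    have h3 : (fun y => (fun z => g (z + x)) (-y)) =
      (fun z => g (z + x)) ∘ (ContinuousLinearEquiv.neg ℝ (M := Eu n)) := rfl
    rw [h1, h3, h2, fderiv_comp_add_right]
    ext v
    simp [neg_add_eq_sub]
  simp only [lap_apply]
  rw [e f]
  refine Finset.sum_congr rfl fun i _ => ?_
  have := congrFun (e (fderiv ℝ f)) y
  rw [fderiv_fun_neg, this]
  simp

theorem bilap_comp_const_sub {n : ℕ} (f : Eu n → ℝ) (x : Eu n) :
    bilap (fun y => f (x - y)) = fun y => bilap f (x - y) := by
  simp [bilap, lap_comp_const_sub]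


theorem locallyIntegrable_norm_rpow {n : ℕ} (hn : 1 ≤ n) {b : ℝ} (hb : -(n : ℝ) < b) :
    LocallyIntegrable (fun x : Eu n => ‖x‖ ^ b) := by
  have : Nonempty (Fin n) := ⟨⟨0, hn⟩⟩
  refine locallyIntegrable_of_norm_le_rpow (C := 1) (α := -b) (by simpa using hn)
    (by simpa using by linarith) (Eventually.of_forall fun x => ?_)
    (measurable_norm.pow_const b).aestronglyMeasurable
  rw [neg_neg, one_mul, Real.norm_of_nonneg (by positivity)]

theorem integrableOn_norm_sub_rpow {n : ℕ} (hn : 1 ≤ n) {b : ℝ} (hb : -(n : ℝ) < b)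
    (x z : Eu n) (r : ℝ) : IntegrableOn (fun y : Eu n => ‖x - y‖ ^ b) (closedBall z r) := by
  have h := ((locallyIntegrable_norm_rpow hn hb).integrableOn_isCompact
    (isCompact_closedBall (x - z) r))
  have e := (Measure.measurePreserving_sub_left (volume : Measure (Eu n)) x).integrableOn_comp_preimage
    (Homeomorph.subLeft x).measurableEmbedding (f := fun y : Eu n => ‖y‖ ^ b)
    (s := closedBall (x - z) r)
  refine (e.2 h).mono_set fun y hy => ?_
  simp only [Set.mem_preimage, mem_closedBall, dist_eq_norm] at hy ⊢
  rwa [sub_sub_sub_cancel_left, norm_sub_rev]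

/-- The (unnormalised) fundamental solution. -/
noncomputable def gam (n : ℕ) (x : Eu n) : ℝ := ‖x‖ ^ (4 - n : ℝ)

theorem gam_nonneg {n : ℕ} (x : Eu n) : 0 ≤ gam n x := by unfold gam; positivity

theorem measurable_gam (n : ℕ) : Measurable (gam n) := measurable_norm.pow_const _

theorem gam_neg {n : ℕ} (x : Eu n) : gam n (-x) = gam n x := by simp [gam]

theorem gam_anti {n : ℕ} (hn : 5 ≤ n) {x : Eu n} {δ : ℝ} (hδ : 0 < δ) (h : δ ≤ ‖x‖) :
    gam n x ≤ δ ^ (4 - n : ℝ) := by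
  have h5 : (5 : ℝ) ≤ n := by exact_mod_cast hn
  exact Real.rpow_le_rpow_of_nonpos hδ h (by linarith)

theorem integrableOn_gam {n : ℕ} (hn : 5 ≤ n) (x z : Eu n) (r : ℝ) :
    IntegrableOn (fun y : Eu n => gam n (x - y)) (closedBall z r) :=
  integrableOn_norm_sub_rpow (by omega) (by linarith) x z r

theorem integrable_gam_mul {n : ℕ} (hn : 5 ≤ n) {f : Eu n → ℝ} (hf : Integrable f) (x : Eu n)
    {δ C : ℝ} (hδ : 0 < δ) (hC : ∀ y ∈ closedBall x δ, |f y| ≤ C) :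
    Integrable fun y => gam n (x - y) * f y := by
  have hm : Measurable fun y => gam n (x - y) := (measurable_gam n).comp (measurable_const_sub x)
  have hb : Integrable fun y => C * (closedBall x δ).indicator (fun y => gam n (x - y)) y
      + δ ^ (4 - n : ℝ) * |f y| :=
    (((integrable_indicator_iff measurableSet_closedBall).2
      (integrableOn_gam hn x x δ)).const_mul C).add (hf.abs.const_mul _)
  refine hb.mono' (hm.aestronglyMeasurable.mul hf.aestronglyMeasurable)
    (Eventually.of_forall fun y => ?_)
  rw [norm_mul, Real.norm_of_nonneg (gam_nonneg _), Real.norm_eq_abs]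
  by_cases hy : y ∈ closedBall x δ
  · rw [Set.indicator_of_mem hy]
    have := mul_le_mul_of_nonneg_left (hC y hy) (gam_nonneg (x - y))
    have h2 : 0 ≤ δ ^ (4 - n : ℝ) * |f y| := by positivity
    linarith
  · rw [Set.indicator_of_notMem hy, mul_zero, zero_add]
    refine mul_le_mul_of_nonneg_right (gam_anti hn hδ ?_) (abs_nonneg _)
    rw [mem_closedBall, dist_eq_norm, norm_sub_rev] at hy
    linarith

theorem kerInf_nonneg (n : ℕ) (x : Eu n) : 0 ≤ kerInf n x := by
  unfold kerInf
  by_cases hx : x = 0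
  · simp [hx]
  · rw [radLog_of_ne _ _ hx]
    exact mul_nonneg (by positivity) (by linarith [Real.smoothTransition.le_one (Real.log ‖x‖ + 2)])

theorem kerInf_le_gam (n : ℕ) (x : Eu n) : kerInf n x ≤ gam n x := by
  unfold kerInf
  by_cases hx : x = 0
  · simpa [hx] using gam_nonneg _
  · rw [radLog_of_ne _ _ hx]
    exact mul_le_of_le_one_right (by positivity)
      (by linarith [Real.smoothTransition.nonneg (Real.log ‖x‖ + 2)])

theorem kern_nonneg (n : ℕ) {s : ℝ} (hs : 2 ≤ s) (x : Eu n) : 0 ≤ kern n s x := by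
  unfold kern
  by_cases hx : x = 0
  · simp [hx]
  · rw [radLog_of_ne _ _ hx]
    exact mul_nonneg (by positivity)
      (sub_nonneg.2 (Real.smoothTransition.monotone (by linarith)))

theorem kern_le_kerInf (n : ℕ) (s : ℝ) (x : Eu n) : kern n s x ≤ kerInf n x := by
  unfold kern kerInf
  by_cases hx : x = 0
  · simp [hx]
  · rw [radLog_of_ne _ _ hx, radLog_of_ne _ _ hx]
    refine mul_le_mul_of_nonneg_left ?_ (by positivity)
    linarith [Real.smoothTransition.le_one (Real.log ‖x‖ + s)]

theorem kern_eventually_eq (n : ℕ) (x : Eu n) : ∀ᶠ k : ℕ in atTop, kern n k x = kerInf n x := by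
  have h : Tendsto (fun k : ℕ => Real.log ‖x‖ + k) atTop atTop :=
    tendsto_atTop_add_const_left _ _ tendsto_natCast_atTop_atTop
  filter_upwards [h.eventually_ge_atTop 1] with k hk
  unfold kern kerInf
  by_cases hx : x = 0
  · simp [hx]
  · rw [radLog_of_ne _ _ hx, radLog_of_ne _ _ hx, Real.smoothTransition.one_of_one_le hk]

theorem kerInf_eq_zero (n : ℕ) {x : Eu n} (hx : Real.exp (-1) < ‖x‖) : kerInf n x = 0 := by
  have h0 : x ≠ 0 := norm_pos_iff.1 ((Real.exp_pos _).trans hx)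
  have := (Real.lt_log_iff_exp_lt (norm_pos_iff.2 h0)).2 hx
  rw [kerInf, radLog_of_ne _ _ h0, Real.smoothTransition.one_of_one_le (by linarith)]
  simp

theorem kerInf_eq_gam {n : ℕ} (hn : n ≠ 4) {x : Eu n} (hx : ‖x‖ ≤ Real.exp (-2)) :
    kerInf n x = gam n x := by
  have h4 : (4 : ℝ) - n ≠ 0 := sub_ne_zero.2 (by exact_mod_cast hn.symm)
  by_cases h0 : x = 0
  · simp [h0, kerInf, gam, Real.zero_rpow h4]
  have := (Real.log_le_iff_le_exp (norm_pos_iff.2 h0)).2 hx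
  rw [kerInf, radLog_of_ne _ _ h0, Real.smoothTransition.zero_of_nonpos (by linarith), gam]
  simp

theorem measurable_radLog {n : ℕ} (β : ℝ) {g : ℝ → ℝ} (hg : Measurable g) :
    Measurable (radLog β g : Eu n → ℝ) := by
  unfold radLog
  exact Measurable.ite (measurableSet_singleton 0) measurable_const
    ((measurable_norm.pow_const β).mul (hg.comp (Real.measurable_log.comp measurable_norm)))

theorem measurable_kerInf (n : ℕ) : Measurable (kerInf n) :=
  measurable_radLog _ (measurable_const.sub (contDiff_step_shift (m := 0) (by simp) 2).continuous.measurable)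

theorem integrable_abs_bump (n : ℕ) (s : ℝ) : Integrable (bump n s) :=
  (contDiff_bump n s).continuous.integrable_of_hasCompactSupport (hasCompactSupport_bump n s)

theorem integral_abs_bump {n : ℕ} (hn : n ≠ 0) (s : ℝ) : ∫ x, |bump n s x| =
    n * (volume : Measure (Eu n)).real (ball 0 1) * ∫ t, |ellCut n t| := by
  rw [← integral_add_right_eq_self (fun t => |ellCut n t|) s, ← integral_radLog_neg n hn]
  congr 1
  ext x
  unfold bump
  by_cases hx : x = 0
  · simp [hx]
  · rw [radLog_of_ne _ _ hx, radLog_of_ne _ _ hx, abs_mul, abs_of_nonneg (by positivity)]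

theorem tsupport_comp_const_sub_subset {n : ℕ} {f : Eu n → ℝ} {r : ℝ}
    (h : tsupport f ⊆ closedBall 0 r) (x : Eu n) :
    tsupport (fun y => f (x - y)) ⊆ closedBall x r := by
  have : tsupport (fun y => f (x - y)) ⊆ (fun y => x - y) ⁻¹' tsupport f :=
    tsupport_comp_subset_preimage f (by fun_prop)
  intro y hy
  have := h (this hy)
  rw [mem_closedBall, dist_eq_norm, norm_sub_rev]
  simpa using this

theorem tendsto_integral_bump {n : ℕ} (hn : n ≠ 0) {u : Eu n → ℝ} {x : Eu n} (hx : ‖x‖ < 1)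
    (hu : ∀ r < 1, IntegrableOn u (closedBall 0 r)) (hc : ContinuousAt u x) :
    Tendsto (fun k : ℕ => ∫ y, u y * bump n k (x - y)) atTop (nhds (cN n * u x)) := by
  set A := n * (volume : Measure (Eu n)).real (ball 0 1) * ∫ t, |ellCut n t| with hA
  have hA0 : 0 ≤ A := by
    have : 0 ≤ ∫ t, |ellCut n t| := integral_nonneg fun _ => abs_nonneg _
    positivity
  have hE : Tendsto (fun k : ℕ => Real.exp (1 - k)) atTop (nhds 0) :=
    Real.tendsto_exp_atBot.comp (tendsto_atBot_add_const_left _ 1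
      (tendsto_neg_atTop_atBot.comp tendsto_natCast_atTop_atTop))
  rw [Metric.tendsto_nhds]
  intro ε hε
  obtain ⟨δ, hδ, hd⟩ := Metric.continuousAt_iff.1 hc (ε / (A + 1)) (by positivity)
  filter_upwards [hE.eventually_lt_const hδ, hE.eventually_lt_const (sub_pos.2 hx)] with k hk hk1
  have ts := tsupport_comp_const_sub_subset (tsupport_bump_subset n k) x
  have hcs : HasCompactSupport fun y => bump n k (x - y) :=
    (isCompact_closedBall x _).of_isClosed_subset (isClosed_tsupport _) ts
  have hcont : Continuous fun y => bump n k (x - y) :=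
    (contDiff_bump n k).continuous.comp (continuous_const.sub continuous_id)
  have i1 : Integrable fun y => u y * bump n k (x - y) := by
    refine integrable_mul_of_integrableOn hu hcont hcs (ts.trans fun y hy => ?_)
    rw [mem_closedBall, dist_eq_norm] at hy
    rw [mem_ball_zero_iff]
    have := norm_sub_norm_le y x
    linarith
  have i2 : Integrable fun y => bump n k (x - y) := (integrable_abs_bump n k).comp_sub_left x
  have e : cN n * u x = ∫ y, u x * bump n k (x - y) := by
    rw [integral_const_mul, integral_sub_left_eq_self (bump n k) volume x, integral_bump hn, mul_comm]
  rw [Real.dist_eq, e, ← integral_sub i1 (i2.const_mul _), ← Real.norm_eq_abs]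
  have hb : ‖∫ y, (u y * bump n k (x - y) - u x * bump n k (x - y))‖ ≤
      ∫ y, ε / (A + 1) * |bump n k (x - y)| := by
    refine norm_integral_le_of_norm_le (i2.abs.const_mul _) (Eventually.of_forall fun y => ?_)
    rw [← sub_mul, norm_mul, Real.norm_eq_abs, Real.norm_eq_abs]
    by_cases hy : y ∈ closedBall x (Real.exp (1 - k))
    · exact mul_le_mul_of_nonneg_right (hd (lt_of_le_of_lt hy hk)).le (abs_nonneg _)
    · have : bump n k (x - y) = 0 :=
        image_eq_zero_of_notMem_tsupport (f := fun y => bump n k (x - y)) fun h => hy (ts h)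
      simp [this]
  refine hb.trans_lt ?_
  rw [integral_const_mul, integral_sub_left_eq_self (fun z => |bump n k z|) volume x,
    integral_abs_bump hn, ← hA, div_mul_eq_mul_div, div_lt_iff₀ (by positivity)]
  nlinarith

theorem Sol.rep {n : ℕ} {p a : ℝ} {u : Eu n → ℝ} (h : Sol n p a u) {x : Eu n} (hx0 : x ≠ 0)
    (hx : ‖x‖ < 1 / 2) : (Integrable fun y => kerInf n (x - y) * u y ^ p) ∧
      cN n * u x = (∫ y, kerInf n (x - y) * u y ^ p) + ∫ y, u y * bump n 2 (x - y) := by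
  have hn0 : n ≠ 0 := by have := h.hn; omega
  have e1 : Real.exp (-1) < 3 / 8 := Real.exp_neg_one_lt_d9.trans (by norm_num)
  have hxm : x ∈ ball (0 : Eu n) 1 \ {0} := ⟨by simpa using by linarith, hx0⟩
  have hnear : ∀ y, y ∈ closedBall x (Real.exp (-1)) → y ∈ closedBall (0 : Eu n) (7 / 8) := by
    intro y hy
    rw [mem_closedBall, dist_eq_norm] at hy
    rw [mem_closedBall_zero_iff]
    have := norm_sub_norm_le y x
    linarith
  have hsub : closedBall (0 : Eu n) (7 / 8) ⊆ ball 0 1 :=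
    closedBall_subset_ball (by norm_num)
  set F := (closedBall (0 : Eu n) (7 / 8)).indicator fun y => u y ^ p with hF
  have hFi : Integrable F := (integrable_indicator_iff measurableSet_closedBall).2
    (h.integrableOn_rpow (by norm_num))
  have hcx : ContinuousAt (fun y => u y ^ p) x :=
    h.contOn_rpow.continuousAt ((isOpen_punctured n).mem_nhds hxm)
  obtain ⟨δ, hδ, hd⟩ := Metric.continuousAt_iff.1 hcx 1 one_pos
  have hprod : Integrable fun y => gam n (x - y) * F y := by
    refine integrable_gam_mul h.hn hFi x (δ := δ / 2) (C := |u x ^ p| + 1) (by positivity)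
      fun y hy => ?_
    rw [hF]
    by_cases hy7 : y ∈ closedBall (0 : Eu n) (7 / 8)
    · rw [Set.indicator_of_mem hy7]
      have := hd (lt_of_le_of_lt (mem_closedBall.1 hy) (half_lt_self hδ))
      rw [Real.dist_eq] at this
      have h2 := abs_sub_abs_le_abs_sub (u y ^ p) (u x ^ p)
      linarith
    · rw [Set.indicator_of_notMem hy7, abs_zero]; positivity
  have hkF : ∀ y, kerInf n (x - y) * u y ^ p = kerInf n (x - y) * F y := fun y => by
    by_cases hy7 : y ∈ closedBall (0 : Eu n) (7 / 8)
    · rw [hF, Set.indicator_of_mem hy7]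
    · have : kerInf n (x - y) = 0 := by
        refine kerInf_eq_zero n ?_
        by_contra hc
        exact hy7 (hnear y (by rw [mem_closedBall, dist_eq_norm, norm_sub_rev]; linarith))
      simp [this]
  have hI : Integrable fun y => kerInf n (x - y) * u y ^ p := by
    simp_rw [hkF]
    refine hprod.mono (((measurable_kerInf n).comp
      (measurable_const_sub x)).aestronglyMeasurable.mul hFi.aestronglyMeasurable)
      (Eventually.of_forall fun y => ?_)
    rw [norm_mul, norm_mul, Real.norm_of_nonneg (kerInf_nonneg n _),
      Real.norm_of_nonneg (gam_nonneg _)]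
    exact mul_le_mul_of_nonneg_right (kerInf_le_gam n _) (norm_nonneg _)
  refine ⟨hI, ?_⟩
  have hts : ∀ k : ℕ, 2 ≤ k → tsupport (fun y => kern n k (x - y)) ⊆ closedBall x (Real.exp (-1)) :=
    fun k hk => tsupport_comp_const_sub_subset (tsupport_ker_subset n (by exact_mod_cast hk)) x
  have hcs : ∀ k : ℕ, 2 ≤ k → HasCompactSupport fun y => kern n k (x - y) := fun k hk =>
    (isCompact_closedBall x _).of_isClosed_subset (isClosed_tsupport _) (hts k hk)
  have L1 : Tendsto (fun k : ℕ => ∫ y, kern n k (x - y) * u y ^ p) atTop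
      (nhds (∫ y, kerInf n (x - y) * u y ^ p)) := by
    refine tendsto_integral_filter_of_dominated_convergence _ ?_ ?_ hI.norm ?_
    · filter_upwards [eventually_ge_atTop 2] with k hk
      have hk2 : (2 : ℝ) ≤ k := by exact_mod_cast hk
      simp_rw [mul_comm (kern n _ _)]
      exact (integrable_mul_of_integrableOn (fun r hr => h.integrableOn_rpow hr)
        ((contDiff_ker n hk2).continuous.comp (continuous_const.sub continuous_id)) (hcs k hk)
        ((hts k hk).trans fun y hy => hsub (hnear y hy))).aestronglyMeasurable
    · filter_upwards [eventually_ge_atTop 2] with k hk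
      have hk2 : (2 : ℝ) ≤ k := by exact_mod_cast hk
      refine Eventually.of_forall fun y => ?_
      rw [norm_mul, norm_mul, Real.norm_of_nonneg (kerInf_nonneg n _),
        Real.norm_of_nonneg (kern_nonneg n hk2 _)]
      exact mul_le_mul_of_nonneg_right (kern_le_kerInf n k _) (norm_nonneg _)
    · refine Eventually.of_forall fun y => tendsto_const_nhds.congr' ?_
      filter_upwards [kern_eventually_eq n (x - y)] with k hk
      rw [hk]
  have L2 := tendsto_integral_bump hn0 (by linarith : ‖x‖ < 1)
    (fun r hr => h.integrableOn_u hr) (h.contOn.continuousAt ((isOpen_punctured n).mem_nhds hxm))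
  have hw : ∀ k : ℕ, 2 ≤ k → ∫ y, u y * bump n k (x - y) =
      (∫ y, kern n k (x - y) * u y ^ p) + ∫ y, u y * bump n 2 (x - y) := by
    intro k hk
    have hk2 : (2 : ℝ) ≤ k := by exact_mod_cast hk
    have hw := h.weak (φ := fun y => kern n k (x - y))
      (((contDiff_ker n hk2).of_le four_le_top).comp (contDiff_const.sub contDiff_id)) (hcs k hk)
      ((hts k hk).trans fun y hy => hsub (hnear y hy))
    have hb : ∀ s : ℝ, 2 ≤ s → Integrable fun y => u y * bump n s (x - y) := fun s hs => by
      have hts := tsupport_comp_const_sub_subset (tsupport_bump_subset n s) x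
      refine integrable_mul_of_integrableOn (fun r hr => h.integrableOn_u hr)
        ((contDiff_bump n s).continuous.comp (continuous_const.sub continuous_id))
        ((isCompact_closedBall x _).of_isClosed_subset (isClosed_tsupport _) hts)
        (hts.trans fun y hy => hsub (hnear y (closedBall_subset_closedBall ?_ hy)))
      exact Real.exp_le_exp.2 (by linarith)
    rw [bilap_comp_const_sub] at hw
    simp only [bilap_ker n hk2, mul_sub] at hw
    rw [integral_sub (hb k hk2) (hb 2 le_rfl)] at hw
    simp_rw [mul_comm (kern n _ _)]
    linarith
  refine tendsto_nhds_unique L2 ((L1.add_const _).congr' ?_)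
  filter_upwards [eventually_ge_atTop 2] with k hk
  rw [hw k hk]


theorem exists_small_volume {n : ℕ} (hn : 5 ≤ n) {ε : ℝ} (hε : 0 < ε) :
    ∃ η : ℝ, 0 < η ∧ ∀ T : Set (Eu n), MeasurableSet T → volume T ≤ ENNReal.ofReal η →
      ∀ y, IntegrableOn (fun z => gam n (y - z)) T ∧ ∫ z in T, gam n (y - z) ≤ ε := by
  set g : Eu n → ℝ := (closedBall (0 : Eu n) 1).indicator (gam n) with hg
  have hgi : Integrable g := by
    have := integrableOn_gam hn (0 : Eu n) 0 1
    simp only [zero_sub, gam_neg] at this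
    exact (integrable_indicator_iff measurableSet_closedBall).2 this
  have h0 := hgi.tendsto_setIntegral_nhds_zero (ι := Set (Eu n))
    (l := comap (fun s => volume s) (nhds 0)) (s := id) tendsto_comap
  obtain ⟨t, ht, hts⟩ := mem_comap.1 (h0.eventually_le_const (half_pos hε))
  obtain ⟨η, hη, hηt⟩ := ENNReal.nhds_zero_basis.mem_iff.1 ht
  obtain ⟨η', hη'0, hη'⟩ : ∃ η' : ℝ, 0 < η' ∧ ENNReal.ofReal η' < η := by
    obtain ⟨b, hb0, hb⟩ := ENNReal.lt_iff_exists_real_btwn.1 hη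
    exact ⟨b, by simpa using hb.1, hb.2⟩
  refine ⟨min η' (ε / 2), lt_min hη'0 (half_pos hε), fun T hT hvol y => ?_⟩
  have hfin : volume T < ⊤ := hvol.trans_lt ENNReal.ofReal_lt_top
  have hle : ∀ z, gam n (y - z) ≤ g (y - z) + 1 := fun z => by
    by_cases hz : y - z ∈ closedBall (0 : Eu n) 1
    · rw [hg, Set.indicator_of_mem hz]; linarith
    · rw [hg, Set.indicator_of_notMem hz, zero_add]
      refine (gam_anti hn one_pos ?_).trans (by simp)
      simp only [mem_closedBall, dist_zero_right, not_le] at hz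
      exact hz.le
  have i1 : IntegrableOn (fun z => g (y - z)) T := (hgi.comp_sub_left y).integrableOn
  have i2 : IntegrableOn (fun _ : Eu n => (1 : ℝ)) T := integrableOn_const hfin.ne
  have i3 : IntegrableOn (fun z => gam n (y - z)) T := by
    refine (i1.add i2).mono' ((measurable_gam n).comp (measurable_const_sub y)).aestronglyMeasurable
      (Eventually.of_forall fun z => ?_)
    rw [Real.norm_of_nonneg (gam_nonneg _)]
    exact hle z
  refine ⟨i3, ?_⟩
  have e1 : ∫ z in T, gam n (y - z) ≤ (∫ z in T, g (y - z)) + ∫ z in T, (1 : ℝ) := by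
    rw [← integral_add i1 i2]
    exact integral_mono i3 (i1.add i2) hle
  have hmp := Measure.measurePreserving_sub_left (volume : Measure (Eu n)) y
  have hemb := (Homeomorph.subLeft y).measurableEmbedding
  have e2 : ∫ z in T, g (y - z) ≤ ε / 2 := by
    have hpre : (fun z => y - z) ⁻¹' ((fun z => y - z) ⁻¹' T) = T := by
      ext z; simp
    have := hmp.setIntegral_preimage_emb hemb g ((fun z => y - z) ⁻¹' T)
    rw [hpre] at this
    rw [this]
    have hv : volume ((fun z => y - z) ⁻¹' T) = volume T :=
      hmp.measure_preimage hT.nullMeasurableSet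
    refine hts (show volume ((fun z => y - z) ⁻¹' T) ∈ t from hηt ?_)
    rw [hv]
    exact lt_of_le_of_lt (hvol.trans (ENNReal.ofReal_le_ofReal (min_le_left _ _))) hη'
  have e3 : ∫ z in T, (1 : ℝ) ≤ ε / 2 := by
    rw [setIntegral_const, smul_eq_mul, mul_one]
    exact (ENNReal.toReal_le_of_le_ofReal (by positivity) hvol).trans (min_le_right _ _)
  linarith

open EuclideanGeometry in
theorem image_inversion_compl_closedBall {n : ℕ} {R : ℝ} (hR : 0 < R) :
    inversion (0 : Eu n) R '' (closedBall 0 R)ᶜ = ball 0 R \ {0} := by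
  have key : ∀ x : Eu n, x ≠ 0 → ‖inversion (0 : Eu n) R x‖ = R ^ 2 / ‖x‖ := fun x hx => by
    have := dist_inversion_center (0 : Eu n) x R
    simpa using this
  ext y
  constructor
  · rintro ⟨x, hx, rfl⟩
    simp only [Set.mem_compl_iff, mem_closedBall, dist_zero_right, not_le] at hx
    have hx0 : x ≠ 0 := norm_pos_iff.1 (hR.trans hx)
    have hk := key x hx0
    refine ⟨?_, ?_⟩
    · rw [mem_ball_zero_iff, hk, div_lt_iff₀ (hR.trans hx)]
      nlinarith
    · rw [Set.mem_singleton_iff, ← norm_eq_zero, hk]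
      have := hR.trans hx
      positivity
  · rintro ⟨hy, hy0⟩
    rw [mem_ball_zero_iff] at hy
    rw [Set.mem_singleton_iff] at hy0
    refine ⟨inversion 0 R y, ?_, inversion_inversion _ hR.ne' _⟩
    have := norm_pos_iff.2 hy0
    simp only [Set.mem_compl_iff, mem_closedBall, dist_zero_right, not_le]
    rw [key y hy0, lt_div_iff₀ this]
    nlinarith

open EuclideanGeometry in
theorem abs_det_inversion_deriv {n : ℕ} {R : ℝ} {x : Eu n} :
    |((R / dist x 0) ^ 2 • ((ℝ ∙ (x - 0))ᗮ.reflection : Eu n →L[ℝ] Eu n)).det| =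
      (R / ‖x‖) ^ (2 * n) := by
  have h1 : |((ℝ ∙ (x - 0))ᗮ.reflection : Eu n →L[ℝ] Eu n).det| = 1 := by
    have := Submodule.det_reflection (K := (ℝ ∙ (x - 0))ᗮ)
    rw [ContinuousLinearMap.det]
    erw [this]
    simp
  rw [ContinuousLinearMap.det, ContinuousLinearMap.toLinearMap_smul, LinearMap.det_smul, abs_mul]
  rw [ContinuousLinearMap.det] at h1
  rw [h1, mul_one, finrank_euclideanSpace_fin, dist_zero_right, ← pow_mul, abs_of_nonneg]
  rw [pow_mul]; positivity

open EuclideanGeometry in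
theorem inversion_change {n : ℕ} (hn : n ≠ 0) {R : ℝ} (hR : 0 < R) {F : Eu n → ℝ}
    (hF : Integrable F) : IntegrableOn (fun w => (R / ‖w‖) ^ (2 * n) * F (inversion 0 R w))
        (closedBall 0 R)ᶜ ∧
      ∫ z, F z = (∫ w in (closedBall 0 R)ᶜ, F w) +
        ∫ w in (closedBall 0 R)ᶜ, (R / ‖w‖) ^ (2 * n) * F (inversion 0 R w) := by
  have : Nonempty (Fin n) := ⟨⟨0, Nat.pos_of_ne_zero hn⟩⟩
  have hm : MeasurableSet (closedBall (0 : Eu n) R)ᶜ := measurableSet_closedBall.compl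
  have h0 : ∀ x ∈ (closedBall (0 : Eu n) R)ᶜ, x ≠ 0 := fun x hx => by
    rintro rfl
    exact hx (mem_closedBall_self hR.le)
  have hd : ∀ x ∈ (closedBall (0 : Eu n) R)ᶜ, HasFDerivWithinAt (inversion 0 R)
      ((R / dist x 0) ^ 2 • ((ℝ ∙ (x - 0))ᗮ.reflection : Eu n →L[ℝ] Eu n))
      (closedBall 0 R)ᶜ x := fun x hx => (hasFDerivAt_inversion (h0 x hx)).hasFDerivWithinAt
  have hinj : Set.InjOn (inversion (0 : Eu n) R) (closedBall 0 R)ᶜ :=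
    (inversion_injective 0 hR.ne').injOn
  have e1 := integral_image_eq_integral_abs_det_fderiv_smul volume hm hd hinj F
  have e2 := integrableOn_image_iff_integrableOn_abs_det_fderiv_smul volume hm hd hinj F
  rw [image_inversion_compl_closedBall hR] at e1 e2
  have e3 := e2.1 hF.integrableOn
  have c1 : ∀ x ∈ (closedBall (0 : Eu n) R)ᶜ,
      |((R / dist x 0) ^ 2 • ((ℝ ∙ (x - 0))ᗮ.reflection : Eu n →L[ℝ] Eu n)).det| •
        F (inversion 0 R x) = (R / ‖x‖) ^ (2 * n) * F (inversion 0 R x) := fun x hx => by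
    rw [abs_det_inversion_deriv, smul_eq_mul]
  refine ⟨(integrableOn_congr_fun c1 hm).1 e3, ?_⟩
  rw [← setIntegral_congr_fun hm c1, ← e1]
  have hae : (ball (0 : Eu n) R \ {0} : Set (Eu n)) =ᵐ[volume] closedBall 0 R :=
    (sdiff_null_ae_eq_self (measure_singleton _)).trans
      (ae_eq_of_subset_of_measure_ge ball_subset_closedBall
        (Measure.addHaar_closedBall_eq_addHaar_ball volume _ _).le
        measurableSet_ball.nullMeasurableSet measure_closedBall_lt_top.ne)
  rw [setIntegral_congr_set hae, add_comm]
  exact (integral_add_compl measurableSet_closedBall hF).symm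


/-- The right-hand side `u ^ p`, cut off to a fixed punctured ball. -/
noncomputable def src {n : ℕ} (p : ℝ) (u : Eu n → ℝ) : Eu n → ℝ :=
  (closedBall (0 : Eu n) (2 / 25) \ {0}).indicator fun y => u y ^ p

theorem Sol.src_nonneg {n : ℕ} {p a : ℝ} {u : Eu n → ℝ} (h : Sol n p a u) (x : Eu n) :
    0 ≤ src p u x :=
  Set.indicator_nonneg (fun y hy => Real.rpow_nonneg
    (h.pos y ⟨closedBall_subset_ball (by norm_num) hy.1, hy.2⟩) _) x

theorem Sol.integrable_src {n : ℕ} {p a : ℝ} {u : Eu n → ℝ} (h : Sol n p a u) :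
    Integrable (src p u) :=
  (integrable_indicator_iff (measurableSet_closedBall.diff (measurableSet_singleton _))).2
    ((h.integrableOn_rpow (r := 2 / 25) (by norm_num)).mono_set Set.sdiff_subset)

theorem src_eq {n : ℕ} {p : ℝ} {u : Eu n → ℝ} {x : Eu n} (h0 : x ≠ 0) (hx : ‖x‖ ≤ 2 / 25) :
    src p u x = u x ^ p :=
  Set.indicator_of_mem (s := closedBall (0 : Eu n) (2 / 25) \ {0})
    ⟨by simpa using hx, h0⟩ _

theorem Sol.rep' {n : ℕ} {p a : ℝ} {u : Eu n → ℝ} (h : Sol n p a u) : ∃ M, ∀ x : Eu n, x ≠ 0 →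
    ‖x‖ < 1 / 25 → (Integrable fun y => gam n (x - y) * src p u y) ∧
      |cN n * u x - ∫ y, gam n (x - y) * src p u y| ≤ M := by
  have : Nonempty (Fin n) := ⟨⟨0, by linarith [h.hn]⟩⟩
  have e1 : Real.exp (-1) < 3 / 8 := Real.exp_neg_one_lt_d9.trans (by norm_num)
  have e2 : 3 / 25 ≤ Real.exp (-2) := by
    have h1 := Real.exp_one_lt_d9
    rw [Real.exp_neg, show (2 : ℝ) = 1 + 1 by norm_num, Real.exp_add, le_inv_comm₀ (by norm_num)
      (by positivity)]
    nlinarith [Real.exp_pos 1]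
  obtain ⟨B, hB⟩ := (contDiff_bump n 2).continuous.bounded_above_of_compact_support
    (hasCompactSupport_bump n 2)
  have hB0 : 0 ≤ B := (norm_nonneg _).trans (hB 0)
  have hne : ∀ᵐ y : Eu n, y ≠ 0 := Measure.ae_ne volume 0
  set G := (closedBall (0 : Eu n) (7 / 8)).indicator fun y => |u y ^ p| with hG
  set G1 := (closedBall (0 : Eu n) (7 / 8)).indicator fun y => |u y| with hG1
  have hGi : Integrable G := (integrable_indicator_iff measurableSet_closedBall).2
    (h.integrableOn_rpow (by norm_num)).abs
  have hGi1 : Integrable G1 := (integrable_indicator_iff measurableSet_closedBall).2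
    (h.integrableOn_u (by norm_num)).abs
  have hsrcG : ∀ y, |src p u y| ≤ G y := fun y => by
    by_cases hy : y ∈ closedBall (0 : Eu n) (2 / 25) \ {0}
    · rw [src, hG, Set.indicator_of_mem hy, Set.indicator_of_mem
        (closedBall_subset_closedBall (by norm_num) hy.1)]
    · rw [src, Set.indicator_of_notMem hy, abs_zero]
      exact Set.indicator_nonneg (fun _ _ => abs_nonneg _) _
  refine ⟨(1 / 25) ^ (4 - n : ℝ) * (∫ y, G y) + B * ∫ y, G1 y, fun x hx0 hx => ?_⟩
  obtain ⟨hI, hrep⟩ := h.rep hx0 (by linarith)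
  have hnear : ∀ y : Eu n, ‖x - y‖ ≤ Real.exp (-1) → y ∈ closedBall (0 : Eu n) (7 / 8) := by
    intro y hy
    rw [mem_closedBall_zero_iff]
    have := norm_sub_norm_le y x
    rw [norm_sub_rev] at hy
    linarith
  have hxy : ∀ y : Eu n, ‖y‖ ≤ 2 / 25 → kerInf n (x - y) = gam n (x - y) := fun y hy => by
    refine kerInf_eq_gam (by have := h.hn; omega) ?_
    have := norm_sub_le x y
    linarith
  have hIs : Integrable fun y => gam n (x - y) * src p u y := by
    have := hI.indicator (s := closedBall (0 : Eu n) (2 / 25) \ {0})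
      (measurableSet_closedBall.diff (measurableSet_singleton _))
    refine this.congr (Eventually.of_forall fun y => ?_)
    by_cases hy : y ∈ closedBall (0 : Eu n) (2 / 25) \ {0}
    · simp only [src, Set.indicator_of_mem hy]
      rw [hxy y (by simpa using hy.1)]
    · simp only [src, Set.indicator_of_notMem hy, mul_zero]
  refine ⟨hIs, ?_⟩
  have hd : cN n * u x - ∫ y, gam n (x - y) * src p u y =
      (∫ y, (kerInf n (x - y) * u y ^ p - gam n (x - y) * src p u y)) +
        ∫ y, u y * bump n 2 (x - y) := by
    rw [integral_sub hI hIs, hrep]; ring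
  rw [hd]
  have b1 : |∫ y, (kerInf n (x - y) * u y ^ p - gam n (x - y) * src p u y)| ≤
      (1 / 25) ^ (4 - n : ℝ) * (∫ y, G y) := by
    rw [← integral_const_mul, ← Real.norm_eq_abs]
    refine norm_integral_le_of_norm_le (hGi.const_mul _) ?_
    filter_upwards [hne] with y hy0
    have hg0 : 0 ≤ G y := Set.indicator_nonneg (fun _ _ => abs_nonneg _) _
    by_cases hy : ‖y‖ ≤ 2 / 25
    · rw [hxy y hy, src_eq hy0 hy, sub_self, norm_zero]
      positivity
    · have : src p u y = 0 := Set.indicator_of_notMem (fun hc => hy (by simpa using hc.1)) _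
      rw [this, mul_zero, sub_zero, norm_mul, Real.norm_of_nonneg (kerInf_nonneg n _)]
      by_cases hk : Real.exp (-1) < ‖x - y‖
      · rw [kerInf_eq_zero n hk, zero_mul]; positivity
      · rw [hG, Set.indicator_of_mem (hnear y (not_lt.1 hk)), Real.norm_eq_abs]
        refine mul_le_mul_of_nonneg_right ((kerInf_le_gam n _).trans (gam_anti h.hn (by norm_num)
          ?_)) (abs_nonneg _)
        have := norm_sub_norm_le y x
        rw [norm_sub_rev] at this
        linarith
  have b2 : |∫ y, u y * bump n 2 (x - y)| ≤ B * ∫ y, G1 y := by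
    rw [← integral_const_mul, ← Real.norm_eq_abs]
    refine norm_integral_le_of_norm_le (hGi1.const_mul _) (Eventually.of_forall fun y => ?_)
    by_cases hk : ‖x - y‖ ≤ Real.exp (-1)
    · rw [hG1, Set.indicator_of_mem (hnear y hk), norm_mul, mul_comm, Real.norm_eq_abs (u y)]
      exact mul_le_mul_of_nonneg_right (hB _) (abs_nonneg _)
    · have : bump n 2 (x - y) = 0 := by
        by_contra hc
        have := tsupport_bump_subset n 2 (subset_tsupport _ hc)
        rw [mem_closedBall_zero_iff] at this
        norm_num at this
        exact hk this
      rw [this, mul_zero, norm_zero]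
      exact mul_nonneg hB0 (Set.indicator_nonneg (fun _ _ => abs_nonneg _) _)
  exact (abs_add_le _ _).trans (add_le_add b1 b2)


theorem reflected_dist_sq {n : ℕ} {R : ℝ} (hR : 0 < R) {w : Eu n} (hw : w ≠ 0) (y : Eu n) :
    (‖y - (R / ‖w‖) ^ 2 • w‖ * ‖w‖ / R) ^ 2 =
      ‖y - w‖ ^ 2 + (‖y‖ ^ 2 - R ^ 2) * (‖w‖ ^ 2 - R ^ 2) / R ^ 2 := by
  have hw' := norm_pos_iff.2 hw
  rw [div_pow, mul_pow, norm_sub_sq_real, norm_sub_sq_real, inner_smul_right, norm_smul,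
    Real.norm_of_nonneg (by positivity)]
  field_simp
  ring

theorem reflected_dist_comm {n : ℕ} {R : ℝ} (hR : 0 < R) {y w : Eu n} (hy : y ≠ 0) (hw : w ≠ 0) :
    ‖(R / ‖y‖) ^ 2 • y - w‖ * ‖y‖ / R = ‖y - (R / ‖w‖) ^ 2 • w‖ * ‖w‖ / R := by
  rw [← pow_left_inj₀ (by positivity) (by positivity) two_ne_zero, reflected_dist_sq hR hw,
    norm_sub_rev, reflected_dist_sq hR hy, norm_sub_rev]
  ring

open EuclideanGeometry in
theorem inversion_zero_eq {n : ℕ} (R : ℝ) (x : Eu n) :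
    inversion (0 : Eu n) R x = (R / ‖x‖) ^ 2 • x := by
  simp [inversion]

open EuclideanGeometry in
theorem norm_inv_sub_inv {n : ℕ} (R : ℝ) {y w : Eu n} (hy : y ≠ 0) (hw : w ≠ 0) :
    ‖(R / ‖y‖) ^ 2 • y - (R / ‖w‖) ^ 2 • w‖ = R ^ 2 / (‖y‖ * ‖w‖) * ‖y - w‖ := by
  rw [← inversion_zero_eq, ← inversion_zero_eq, ← dist_eq_norm, dist_inversion_inversion hy hw,
    dist_zero_right, dist_zero_right, dist_eq_norm]

theorem norm_reflected {n : ℕ} {R : ℝ} {y : Eu n} (hy : y ≠ 0) :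
    ‖(R / ‖y‖) ^ 2 • y‖ = R ^ 2 / ‖y‖ := by
  have := norm_pos_iff.2 hy
  rw [norm_smul, Real.norm_of_nonneg (by positivity)]
  field_simp

/-- The Kelvin transform of order four with respect to the sphere of radius `R`. -/
noncomputable def kelvin (n : ℕ) (R : ℝ) (U : Eu n → ℝ) (y : Eu n) : ℝ :=
  (R / ‖y‖) ^ ((n : ℝ) - 4) * U ((R / ‖y‖) ^ 2 • y)

/-- The kernel `gam` reflected in the sphere of radius `R`. -/
noncomputable def gamR (n : ℕ) (R : ℝ) (y w : Eu n) : ℝ :=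
  (‖y - (R / ‖w‖) ^ 2 • w‖ * ‖w‖ / R) ^ (4 - n : ℝ)

theorem gamR_nonneg {n : ℕ} {R : ℝ} (hR : 0 < R) (y w : Eu n) : 0 ≤ gamR n R y w := by
  unfold gamR; positivity

theorem reflected_dist_pos_sq {n : ℕ} {R : ℝ} (hR : 0 < R) {y w : Eu n} (hy : R < ‖y‖)
    (hw : R < ‖w‖) : 0 < (‖y‖ ^ 2 - R ^ 2) * (‖w‖ ^ 2 - R ^ 2) / R ^ 2 := by
  have h1 : 0 < ‖y‖ ^ 2 - R ^ 2 := by nlinarith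
  have h2 : 0 < ‖w‖ ^ 2 - R ^ 2 := by nlinarith
  positivity

theorem gamR_le_gam {n : ℕ} (hn : 5 ≤ n) {R : ℝ} (hR : 0 < R) {y w : Eu n} (hy : R < ‖y‖)
    (hw : R < ‖w‖) (hyw : w ≠ y) : gamR n R y w ≤ gam n (y - w) := by
  have h5 : (5 : ℝ) ≤ n := by exact_mod_cast hn
  have hw0 : w ≠ 0 := norm_pos_iff.1 (hR.trans hw)
  refine Real.rpow_le_rpow_of_nonpos (norm_pos_iff.2 (sub_ne_zero.2 hyw.symm)) ?_ (by linarith)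
  rw [← pow_le_pow_iff_left₀ (norm_nonneg _) (by positivity) two_ne_zero, reflected_dist_sq hR hw0]
  linarith [reflected_dist_pos_sq hR hy hw]

/-- Entire solutions of the integral equation `U = κ |x|^(4-n) * U^p + c₀`, with a possible
singularity at `q`. -/
structure IEq (n : ℕ) (p κ c0 : ℝ) (q : Eu n) (U : Eu n → ℝ) : Prop where
  hn : 5 ≤ n
  hp : 1 < p
  hp2 : p * ((n : ℝ) - 4) < n + 4
  hκ : 0 < κ
  hc0 : 0 ≤ c0
  pos : ∀ x, 0 ≤ U x
  cont : ContinuousOn U {q}ᶜ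
  int : ∀ x ≠ q, Integrable fun z => gam n (x - z) * U z ^ p
  eq : ∀ x ≠ q, U x = κ * (∫ z, gam n (x - z) * U z ^ p) + c0

/-- The right-hand side for the Kelvin transform. -/
noncomputable def kelSrc (n : ℕ) (p R : ℝ) (U : Eu n → ℝ) (w : Eu n) : ℝ :=
  (R / ‖w‖) ^ ((n : ℝ) + 4) * U ((R / ‖w‖) ^ 2 • w) ^ p

theorem IEq.kelvin_sub {n : ℕ} {p κ c0 : ℝ} {q : Eu n} {U : Eu n → ℝ} (h : IEq n p κ c0 q U)
    {R : ℝ} (hR : 0 < R) (hRq : R < ‖q‖) {y : Eu n} (hy : R < ‖y‖) (hyq : y ≠ q) :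
    IntegrableOn (fun w => (gam n (y - w) - gamR n R y w) * (U w ^ p - kelSrc n p R U w))
        (closedBall 0 R)ᶜ ∧
      U y - kelvin n R U y = c0 * (1 - (R / ‖y‖) ^ ((n : ℝ) - 4)) +
        κ * ∫ w in (closedBall 0 R)ᶜ,
          (gam n (y - w) - gamR n R y w) * (U w ^ p - kelSrc n p R U w) := by
  have hn0 : n ≠ 0 := by have := h.hn; omega
  have hm : MeasurableSet (closedBall (0 : Eu n) R)ᶜ := measurableSet_closedBall.compl
  have hy0 : 0 < ‖y‖ := hR.trans hy
  have hy0' : y ≠ 0 := norm_pos_iff.1 hy0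
  have hIy : (R / ‖y‖) ^ 2 • y ≠ q := by
    intro hc
    rw [← hc, norm_reflected hy0', lt_div_iff₀ hy0] at hRq
    nlinarith
  have hw0 : ∀ w ∈ (closedBall (0 : Eu n) R)ᶜ, R < ‖w‖ := fun w hw => by simpa using hw
  obtain ⟨a1, a2⟩ := inversion_change hn0 hR (h.int y hyq)
  obtain ⟨b1, b2⟩ := inversion_change hn0 hR (h.int _ hIy)
  have hs := (h.int y hyq).integrableOn (s := (closedBall (0 : Eu n) R)ᶜ)
  have hs' := (h.int _ hIy).integrableOn (s := (closedBall (0 : Eu n) R)ᶜ)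
  have e1 : ∀ w ∈ (closedBall (0 : Eu n) R)ᶜ, (R / ‖w‖) ^ (2 * n) *
      (gam n (y - (R / ‖w‖) ^ 2 • w) * U ((R / ‖w‖) ^ 2 • w) ^ p) =
      gamR n R y w * kelSrc n p R U w := by
    intro w hw
    have hw' := hR.trans (hw0 w hw)
    have hr : 0 < R / ‖w‖ := by positivity
    have : gamR n R y w = gam n (y - (R / ‖w‖) ^ 2 • w) * (R / ‖w‖) ^ ((n : ℝ) - 4) := by
      unfold gamR gam
      rw [mul_div_assoc, Real.mul_rpow (by positivity) (by positivity), ← inv_div R,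
        Real.inv_rpow hr.le, ← Real.rpow_neg hr.le]
      congr 2; ring
    rw [this, kelSrc, ← Real.rpow_natCast]
    have e : (R / ‖w‖) ^ ((2 * n : ℕ) : ℝ) =
        (R / ‖w‖) ^ ((n : ℝ) - 4) * (R / ‖w‖) ^ ((n : ℝ) + 4) := by
      rw [← Real.rpow_add hr]; push_cast; ring_nf
    rw [e]; ring
  have e2 : ∀ w ∈ (closedBall (0 : Eu n) R)ᶜ, (R / ‖y‖) ^ ((n : ℝ) - 4) *
      (gam n ((R / ‖y‖) ^ 2 • y - w) * U w ^ p) = gamR n R y w * U w ^ p := by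
    intro w hw
    have hw' := hR.trans (hw0 w hw)
    have hr : 0 < R / ‖y‖ := by positivity
    unfold gamR gam
    rw [← reflected_dist_comm hR hy0' (norm_pos_iff.1 hw'), mul_div_assoc,
      Real.mul_rpow (by positivity) (by positivity), ← inv_div R, Real.inv_rpow hr.le,
      ← Real.rpow_neg hr.le]
    ring_nf
  have e3 : ∀ w ∈ (closedBall (0 : Eu n) R)ᶜ, (R / ‖y‖) ^ ((n : ℝ) - 4) * ((R / ‖w‖) ^ (2 * n) *
      (gam n ((R / ‖y‖) ^ 2 • y - (R / ‖w‖) ^ 2 • w) * U ((R / ‖w‖) ^ 2 • w) ^ p)) =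
      gam n (y - w) * kelSrc n p R U w := by
    intro w hw
    have hw' := hR.trans (hw0 w hw)
    have hr : 0 < R / ‖y‖ := by positivity
    have hr2 : 0 < R / ‖w‖ := by positivity
    have e : (R / ‖w‖) ^ ((2 * n : ℕ) : ℝ) =
        (R / ‖w‖) ^ ((n : ℝ) - 4) * (R / ‖w‖) ^ ((n : ℝ) + 4) := by
      rw [← Real.rpow_add hr2]; push_cast; ring_nf
    have e' : ‖(R / ‖y‖) ^ 2 • y - (R / ‖w‖) ^ 2 • w‖ = (R / ‖y‖) * (R / ‖w‖) * ‖y - w‖ := by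
      rw [norm_inv_sub_inv R hy0' (norm_pos_iff.1 hw')]
      field_simp
    unfold gam kelSrc
    rw [e', ← Real.rpow_natCast, e, Real.mul_rpow (by positivity) (by positivity),
      Real.mul_rpow hr.le hr2.le]
    have k1 : ∀ r : ℝ, 0 < r → r ^ ((n : ℝ) - 4) * r ^ (4 - n : ℝ) = 1 := fun r hr => by
      rw [← Real.rpow_add hr]; simp
    have k1a := k1 _ hr
    have k1b := k1 _ hr2
    linear_combination (‖y - w‖ ^ (4 - n : ℝ) * ((R / ‖w‖) ^ ((n : ℝ) + 4) *
      U ((R / ‖w‖) ^ 2 • w) ^ p)) * (k1a * ((R / ‖w‖) ^ ((n : ℝ) - 4) *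
      (R / ‖w‖) ^ (4 - n : ℝ)) + k1b)
  simp only [inversion_zero_eq] at a1 a2 b1 b2
  have i2 := a1.congr_fun e1 hm
  have i3 := IntegrableOn.congr_fun (hs'.const_mul ((R / ‖y‖) ^ ((n : ℝ) - 4))) e2 hm
  have i4 := IntegrableOn.congr_fun (b1.const_mul ((R / ‖y‖) ^ ((n : ℝ) - 4))) e3 hm
  have hexp : ∀ w, (gam n (y - w) - gamR n R y w) * (U w ^ p - kelSrc n p R U w) =
      (gam n (y - w) * U w ^ p + gamR n R y w * kelSrc n p R U w) -
      (gamR n R y w * U w ^ p + gam n (y - w) * kelSrc n p R U w) := fun w => by ring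
  simp only [hexp]
  have j1 : IntegrableOn (fun w => gam n (y - w) * U w ^ p + gamR n R y w * kelSrc n p R U w)
    (closedBall 0 R)ᶜ := hs.add i2
  have j2 : IntegrableOn (fun w => gamR n R y w * U w ^ p + gam n (y - w) * kelSrc n p R U w)
    (closedBall 0 R)ᶜ := i3.add i4
  refine ⟨j1.sub j2, ?_⟩
  rw [integral_sub j1 j2, integral_add hs i2, integral_add i3 i4,
    ← setIntegral_congr_fun hm e1, ← setIntegral_congr_fun hm e2, ← setIntegral_congr_fun hm e3,
    integral_const_mul, integral_const_mul, kelvin, h.eq y hyq, h.eq _ hIy, a2, b2]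
  ring


theorem rpow_sub_rpow_le {p s t M : ℝ} (hp : 1 < p) (hs : 0 ≤ s) (hst : s ≤ t) (htM : t ≤ M) :
    t ^ p - s ^ p ≤ p * M ^ (p - 1) * (t - s) := by
  rcases (hs.trans hst).eq_or_lt with h0 | ht
  · have : s = 0 := le_antisymm (h0 ▸ hst) hs
    rw [← h0, this]; simp
  have h1 := one_add_mul_self_le_rpow_one_add (s := (s - t) / t) (p := p)
    (by rw [le_div_iff₀ ht]; linarith) hp.le
  rw [show 1 + (s - t) / t = s / t by field_simp; ring, Real.div_rpow hs ht.le,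
    le_div_iff₀ (by positivity)] at h1
  have e : t ^ p = t ^ (p - 1) * t := by
    rw [← Real.rpow_add_one ht.ne']; ring_nf
  have h2 : t ^ (p - 1) ≤ M ^ (p - 1) := Real.rpow_le_rpow ht.le htM (by linarith)
  have h3 : (1 + p * ((s - t) / t)) * t ^ p = t ^ p + p * t ^ (p - 1) * (s - t) := by
    rw [e]; field_simp
  rw [h3] at h1
  have h4 : p * t ^ (p - 1) * (t - s) ≤ p * M ^ (p - 1) * (t - s) := by
    have := sub_nonneg.2 hst
    gcongr
  linarith

section
variable {n : ℕ} {p κ c0 : ℝ} {q : Eu n} {U : Eu n → ℝ}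

theorem IEq.kelvin_nonneg (h : IEq n p κ c0 q U) {R : ℝ} (hR : 0 < R) (w : Eu n) :
    0 ≤ kelvin n R U w :=
  mul_nonneg (by positivity) (h.pos _)

theorem IEq.kelSrc_eq (h : IEq n p κ c0 q U) {R : ℝ} (hR : 0 < R) {w : Eu n} (hw : R < ‖w‖) :
    kelSrc n p R U w = (R / ‖w‖) ^ ((n : ℝ) + 4 - p * (n - 4)) * kelvin n R U w ^ p := by
  have hr : 0 < R / ‖w‖ := div_pos hR (hR.trans hw)
  rw [kelSrc, kelvin, Real.mul_rpow (by positivity) (h.pos _), ← Real.rpow_mul hr.le, ← mul_assoc,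
    ← Real.rpow_add hr]
  ring_nf

theorem IEq.kelSrc_le (h : IEq n p κ c0 q U) {R : ℝ} (hR : 0 < R) {w : Eu n} (hw : R < ‖w‖) :
    kelSrc n p R U w ≤ kelvin n R U w ^ p := by
  have hw0 := hR.trans hw
  rw [h.kelSrc_eq hR hw]
  refine mul_le_of_le_one_left (Real.rpow_nonneg (h.kelvin_nonneg hR w) _) ?_
  exact Real.rpow_le_one (by positivity) ((div_le_one hw0).2 hw.le) (by linarith [h.hp2])

theorem norm_reflected_le {R : ℝ} (hR : 0 < R) {w : Eu n} (hw : R ≤ ‖w‖) :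
    ‖(R / ‖w‖) ^ 2 • w‖ ≤ R := by
  have hw0 := hR.trans_le hw
  rw [norm_reflected (norm_pos_iff.1 hw0), div_le_iff₀ hw0]
  nlinarith

theorem IEq.kelvin_le (h : IEq n p κ c0 q U) {R M : ℝ} (hR : 0 < R)
    (hM : ∀ z ∈ closedBall (0 : Eu n) R, U z ≤ M) {w : Eu n} (hw : R < ‖w‖) :
    kelvin n R U w ≤ M := by
  have h5 : (5 : ℝ) ≤ n := by exact_mod_cast h.hn
  have hw0 := hR.trans hw
  refine (mul_le_of_le_one_left (h.pos _) ?_).trans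
    (hM _ (mem_closedBall_zero_iff.2 (norm_reflected_le hR hw.le)))
  exact Real.rpow_le_one (by positivity) ((div_le_one hw0).2 hw.le) (by linarith)

theorem IEq.narrow (h : IEq n p κ c0 q U) {R R2 M ε : ℝ} (hR : 0 < R) (hRq : R < ‖q‖)
    {T : Set (Eu n)} (hTm : MeasurableSet T) (hT : ∀ z : Eu n, R < ‖z‖ → ‖z‖ < R2 → z ∈ T)
    (hM : ∀ z ∈ closedBall (0 : Eu n) R, U z ≤ M)
    (hfar : ∀ y : Eu n, R2 ≤ ‖y‖ → R < ‖y‖ → y ≠ q → kelvin n R U y ≤ U y)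
    (hsm : ∀ y, IntegrableOn (fun z => gam n (y - z)) T ∧ ∫ z in T, gam n (y - z) ≤ ε)
    (hε : κ * (p * M ^ (p - 1)) * ε ≤ 1 / 2) {y : Eu n} (hy : R < ‖y‖) (hyq : y ≠ q) :
    kelvin n R U y ≤ U y := by
  have h5 : (5 : ℝ) ≤ n := by exact_mod_cast h.hn
  have : Nonempty (Fin n) := ⟨⟨0, by linarith [h.hn]⟩⟩
  have hM0 : 0 ≤ M := (h.pos 0).trans (hM 0 (mem_closedBall_self hR.le))
  have hp0 : 0 < p := by linarith [h.hp]
  have hκ := h.hκ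
  have step : ∀ b : ℝ, 0 ≤ b → (∀ z : Eu n, R < ‖z‖ → z ≠ q → kelvin n R U z - U z ≤ b) →
      ∀ z : Eu n, R < ‖z‖ → z ≠ q → kelvin n R U z - U z ≤ b / 2 := by
    intro b hb hz y hy hyq
    obtain ⟨hi, he⟩ := h.kelvin_sub hR hRq hy hyq
    set D := p * M ^ (p - 1) * b with hD
    have hD0 : 0 ≤ D := by positivity
    have hTi := (integrable_indicator_iff hTm).2 (hsm y).1
    have key : -(D * ε) ≤ ∫ w in (closedBall 0 R)ᶜ,
        (gam n (y - w) - gamR n R y w) * (U w ^ p - kelSrc n p R U w) := by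
      have k1 : ∫ w in (closedBall 0 R)ᶜ, -(D * T.indicator (fun z => gam n (y - z)) w) ≤
          ∫ w in (closedBall 0 R)ᶜ,
            (gam n (y - w) - gamR n R y w) * (U w ^ p - kelSrc n p R U w) := by
        refine setIntegral_mono_on_ae (hTi.const_mul D).neg.integrableOn hi
          measurableSet_closedBall.compl ?_
        filter_upwards [Measure.ae_ne volume y, Measure.ae_ne volume q] with w hwy hwq hw
        have hw : R < ‖w‖ := by simpa using hw
        have hg := gamR_le_gam h.hn hR hy hw hwy
        have hg0 := gamR_nonneg (n := n) hR y w
        have hind : 0 ≤ T.indicator (fun z => gam n (y - z)) w :=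
          Set.indicator_nonneg (fun z _ => gam_nonneg _) w
        rcases le_total (kelSrc n p R U w) (U w ^ p) with hle | hle
        · exact (neg_nonpos.2 (mul_nonneg hD0 hind)).trans
            (mul_nonneg (by linarith) (by linarith))
        have hk := h.kelSrc_le hR hw
        have hkU : U w ≤ kelvin n R U w := by
          by_contra hc
          have := Real.rpow_lt_rpow (h.kelvin_nonneg hR w) (not_le.1 hc) hp0
          linarith
        have hd : kelSrc n p R U w - U w ^ p ≤ D := by
          refine (sub_le_sub_right hk _).trans ((rpow_sub_rpow_le h.hp (h.pos w) hkU
            (h.kelvin_le hR hM hw)).trans ?_)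
          exact mul_le_mul_of_nonneg_left (hz w hw hwq) (by positivity)
        by_cases hwT : w ∈ T
        · rw [Set.indicator_of_mem hwT]
          have := mul_le_mul (show gam n (y - w) - gamR n R y w ≤ gam n (y - w) by linarith) hd
            (by linarith) (gam_nonneg _)
          linarith
        · rw [Set.indicator_of_notMem hwT]
          have hR2 : R2 ≤ ‖w‖ := by
            by_contra hc
            exact hwT (hT w hw (not_le.1 hc))
          have := Real.rpow_le_rpow (h.kelvin_nonneg hR w) (hfar w hR2 hw hwq) hp0.le
          have : U w ^ p - kelSrc n p R U w = 0 := by linarith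
          rw [this]; simp
      refine le_trans ?_ k1
      rw [integral_neg, integral_const_mul, neg_le_neg_iff]
      refine mul_le_mul_of_nonneg_left (le_trans ?_ (hsm y).2) hD0
      rw [← integral_indicator hTm]
      exact setIntegral_le_integral hTi (Eventually.of_forall fun z =>
        Set.indicator_nonneg (fun z _ => gam_nonneg _) z)
    have c1 : 0 ≤ c0 * (1 - (R / ‖y‖) ^ ((n : ℝ) - 4)) := by
      have hy0 := hR.trans hy
      refine mul_nonneg h.hc0 (sub_nonneg.2 (Real.rpow_le_one (by positivity)
        ((div_le_one hy0).2 hy.le) (by linarith)))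
    have c2 := mul_le_mul_of_nonneg_left key hκ.le
    have c3 := mul_le_mul_of_nonneg_right hε hb
    rw [hD] at c2
    nlinarith
  have iter : ∀ k : ℕ, ∀ z : Eu n, R < ‖z‖ → z ≠ q → kelvin n R U z - U z ≤ M * (1 / 2) ^ k := by
    intro k
    induction k with
    | zero =>
      intro z hz _
      have := h.kelvin_le hR hM hz
      have := h.pos z
      linarith
    | succ k ih =>
      intro z hz hzq
      refine (step _ (by positivity) ih z hz hzq).trans_eq ?_
      ring
  have hlim : Tendsto (fun k : ℕ => M * (1 / 2 : ℝ) ^ k) atTop (nhds (M * 0)) :=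
    (tendsto_pow_atTop_nhds_zero_of_lt_one (by norm_num) (by norm_num)).const_mul M
  have := ge_of_tendsto' hlim fun k => iter k y hy hyq
  linarith

end


theorem exists_thin_shell {n : ℕ} {R : ℝ} (hR : 0 ≤ R) {η : ℝ} (hη : 0 < η) :
    ∃ R2, R < R2 ∧ volume (ball (0 : Eu n) R2 \ closedBall 0 R) ≤ ENNReal.ofReal η := by
  have hc : Tendsto (fun r : ℝ => (r ^ n - R ^ n) * (volume : Measure (Eu n)).real (ball 0 1))
      (nhdsWithin R (Set.Ioi R)) (nhds ((R ^ n - R ^ n) *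
        (volume : Measure (Eu n)).real (ball 0 1))) :=
    ((((continuous_pow n).tendsto R).sub_const _).mul_const _).mono_left nhdsWithin_le_nhds
  rw [sub_self, zero_mul] at hc
  obtain ⟨r, hr, hrR⟩ := ((hc.eventually_lt_const hη).and self_mem_nhdsWithin).exists
  have hrR : R < r := hrR
  refine ⟨r, hrR, ?_⟩
  have hr0 : 0 ≤ r := hR.trans hrR.le
  have hfin := (measure_ball_lt_top (μ := (volume : Measure (Eu n))) (x := 0) (r := 1)).ne
  have v : ∀ s : ℝ, 0 ≤ s → volume (closedBall (0 : Eu n) s) = ENNReal.ofReal (s ^ n *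
      (volume : Measure (Eu n)).real (ball 0 1)) := fun s hs => by
    rw [Measure.addHaar_closedBall _ _ hs, ENNReal.ofReal_mul (by positivity),
      ofReal_measureReal hfin, finrank_euclideanSpace_fin]
  calc volume (ball (0 : Eu n) r \ closedBall 0 R)
      ≤ volume (closedBall (0 : Eu n) r \ closedBall 0 R) :=
        measure_mono (Set.sdiff_subset_sdiff_left ball_subset_closedBall)
    _ = volume (closedBall (0 : Eu n) r) - volume (closedBall (0 : Eu n) R) :=
        measure_sdiff (closedBall_subset_closedBall hrR.le)
          measurableSet_closedBall.nullMeasurableSet measure_closedBall_lt_top.ne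
    _ ≤ ENNReal.ofReal η := by
        rw [v r hr0, v R hR, ← ENNReal.ofReal_sub _ (by positivity), ← sub_mul]
        exact ENNReal.ofReal_le_ofReal hr.le

section
variable {n : ℕ} {p κ c0 : ℝ} {q : Eu n} {U : Eu n → ℝ}

theorem IEq.lower (h : IEq n p κ c0 q U) {x0 : Eu n} (hx0 : x0 ≠ q) (hU : U x0 ≠ 0) :
    ∃ c L : ℝ, 0 < c ∧ 0 < L ∧ ∀ y, y ≠ q → c * (‖y‖ + L) ^ (4 - n : ℝ) ≤ U y := by
  have h5 : (5 : ℝ) ≤ n := by exact_mod_cast h.hn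
  have : Nonempty (Fin n) := ⟨⟨0, by linarith [h.hn]⟩⟩
  have hp0 : 0 < p := by linarith [h.hp]
  have hκ := h.hκ
  have hU0 : 0 < U x0 := (h.pos x0).lt_of_ne' hU
  have hcx : ContinuousAt U x0 := h.cont.continuousAt (isOpen_compl_singleton.mem_nhds hx0)
  obtain ⟨δ, hδ, hd⟩ := Metric.eventually_nhds_iff_ball.1
    (hcx.eventually (lt_mem_nhds (half_lt_self hU0)))
  set m := U x0 / 2 with hm
  have hm0 : 0 < m := by positivity
  have hv : 0 < (volume : Measure (Eu n)).real (ball x0 δ) :=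
    ENNReal.toReal_pos (measure_ball_pos _ _ hδ).ne' measure_ball_lt_top.ne
  refine ⟨κ * ((volume : Measure (Eu n)).real (ball x0 δ) * m ^ p), ‖x0‖ + δ, by positivity,
    by positivity, fun y hy => ?_⟩
  have k : ∫ z in ball x0 δ, (‖y‖ + (‖x0‖ + δ)) ^ (4 - n : ℝ) * m ^ p ≤
      ∫ z in ball x0 δ, gam n (y - z) * U z ^ p := by
    refine setIntegral_mono_on_ae (integrableOn_const measure_ball_lt_top.ne) (h.int y hy).integrableOn measurableSet_ball ?_
    filter_upwards [Measure.ae_ne volume y] with z hzy hz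
    have h1 : 0 < ‖y - z‖ := norm_pos_iff.2 (sub_ne_zero.2 hzy.symm)
    have h2 : ‖y - z‖ ≤ ‖y‖ + (‖x0‖ + δ) := by
      have a1 := norm_sub_le y z
      have a2 := norm_sub_norm_le z x0
      have a3 : ‖z - x0‖ < δ := by rwa [← dist_eq_norm]
      linarith
    exact mul_le_mul (Real.rpow_le_rpow_of_nonpos h1 h2 (by linarith))
      (Real.rpow_le_rpow hm0.le (hd z hz).le hp0.le) (by positivity) (gam_nonneg _)
  have k2 := setIntegral_le_integral (s := ball x0 δ) (h.int y hy)
    (Eventually.of_forall fun z => mul_nonneg (gam_nonneg _) (Real.rpow_nonneg (h.pos z) _))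
  rw [setIntegral_const, smul_eq_mul] at k
  have k3 := mul_le_mul_of_nonneg_left (k.trans k2) hκ.le
  rw [h.eq y hy]
  have := h.hc0
  linarith

theorem rpow_add_le {n : ℕ} (hn : 5 ≤ n) {r L t : ℝ} (hr : 0 < r) (hL : 0 ≤ L) (ht : r ≤ t) :
    (1 + L / r) ^ (4 - n : ℝ) * t ^ (4 - n : ℝ) ≤ (t + L) ^ (4 - n : ℝ) := by
  have h5 : (5 : ℝ) ≤ n := by exact_mod_cast hn
  have ht0 := hr.trans_le ht
  rw [← Real.mul_rpow (by positivity) ht0.le]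
  refine Real.rpow_le_rpow_of_nonpos (by positivity) ?_ (by linarith)
  have : L / r * r ≤ L / r * t := mul_le_mul_of_nonneg_left ht (by positivity)
  rw [div_mul_cancel₀ _ hr.ne'] at this
  linarith

theorem kelvin_eq {n : ℕ} {R : ℝ} (hR : 0 < R) (U : Eu n → ℝ) {y : Eu n} (hy : y ≠ 0) :
    kelvin n R U y = ‖y‖ ^ (4 - n : ℝ) * (R ^ ((n : ℝ) - 4) * U (R ^ 2 • ((‖y‖ ^ 2)⁻¹ • y))) := by
  have h0 := norm_pos_iff.2 hy
  rw [kelvin, Real.div_rpow hR.le h0.le, div_pow, smul_smul, div_eq_mul_inv,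
    ← Real.rpow_neg h0.le, neg_sub, div_eq_mul_inv]
  ring

theorem IEq.exists_bound (h : IEq n p κ c0 q U) {R : ℝ} (hR : R < ‖q‖) :
    ∃ M, 0 ≤ M ∧ ∀ z ∈ closedBall (0 : Eu n) R, U z ≤ M := by
  obtain ⟨M, hM⟩ := (isCompact_closedBall (0 : Eu n) R).bddAbove_image
    (h.cont.mono fun z hz hc => by
      rw [Set.mem_singleton_iff.1 hc, mem_closedBall_zero_iff] at hz; linarith)
  exact ⟨max M 0, le_max_right _ _, fun z hz => (hM ⟨z, hz, rfl⟩).trans (le_max_left _ _)⟩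

theorem IEq.exists_eps (h : IEq n p κ c0 q U) {M : ℝ} (hM : 0 ≤ M) :
    ∃ ε : ℝ, 0 < ε ∧ κ * (p * M ^ (p - 1)) * ε ≤ 1 / 2 := by
  have hp0 : 0 < p := by linarith [h.hp]
  have hκ := h.hκ
  have : 0 ≤ κ * (p * M ^ (p - 1)) := by positivity
  refine ⟨1 / (2 * (κ * (p * M ^ (p - 1)) + 1)), by positivity, ?_⟩
  rw [mul_one_div, div_le_div_iff₀ (by positivity) (by norm_num)]
  linarith

/-- The radii of spheres centred at the origin for which the moving sphere inequality holds. -/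
def goodRadii (n : ℕ) (q : Eu n) (U : Eu n → ℝ) : Set ℝ :=
  {R | ∀ y : Eu n, R < ‖y‖ → y ≠ q → kelvin n R U y ≤ U y}

theorem IEq.exists_goodRadius (h : IEq n p κ c0 q U) (hq : q ≠ 0) {x0 : Eu n} (hx0 : x0 ≠ q)
    (hU : U x0 ≠ 0) : ∃ R, 0 < R ∧ R < ‖q‖ ∧ R ∈ goodRadii n q U := by
  have h5 : (5 : ℝ) ≤ n := by exact_mod_cast h.hn
  have hq0 := norm_pos_iff.2 hq
  obtain ⟨M, hM0, hM⟩ := h.exists_bound (half_lt_self hq0)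
  obtain ⟨ε, hε, hε'⟩ := h.exists_eps hM0
  obtain ⟨η, hη, hsm⟩ := exists_small_volume h.hn hε
  obtain ⟨r1, hr1, hv⟩ := exists_thin_shell (n := n) le_rfl hη
  obtain ⟨c, L, hc, hL, hlow⟩ := h.lower hx0 hU
  set c1 := c * (1 + L / r1) ^ (4 - n : ℝ) with hc1
  have hc10 : 0 < c1 := by positivity
  have ht : Tendsto (fun t : ℝ => t ^ ((n : ℝ) - 4) * M) (nhdsWithin 0 (Set.Ioi 0))
      (nhds (0 ^ ((n : ℝ) - 4) * M)) :=
    ((Real.continuousAt_rpow_const _ _ (Or.inr (by linarith))).tendsto.mono_left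
      nhdsWithin_le_nhds).mul_const M
  rw [Real.zero_rpow (by linarith), zero_mul] at ht
  obtain ⟨R, ⟨hR1, hR2⟩, hR0⟩ := ((ht.eventually_lt_const hc10).and ((eventually_lt_nhds
    (half_pos hq0)).filter_mono nhdsWithin_le_nhds)).and self_mem_nhdsWithin |>.exists
  have hR0 : 0 < R := hR0
  refine ⟨R, hR0, by linarith, fun y hy hyq => ?_⟩
  have hMR : ∀ z ∈ closedBall (0 : Eu n) R, U z ≤ M := fun z hz =>
    hM z (closedBall_subset_closedBall hR2.le hz)
  refine h.narrow hR0 (by linarith) (R2 := r1) (T := ball 0 r1 \ closedBall 0 0)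
    (measurableSet_ball.diff measurableSet_closedBall) (fun z hz hz2 => ⟨by simpa using hz2,
      by simpa using norm_pos_iff.1 (hR0.trans hz)⟩) hMR ?_
    (hsm _ (measurableSet_ball.diff measurableSet_closedBall) hv) hε' hy hyq
  intro y hy1 hy hyq
  have hy0 := hR0.trans hy
  rw [kelvin_eq hR0 U (norm_pos_iff.1 hy0)]
  have e1 := hM _ (closedBall_subset_closedBall hR2.le (mem_closedBall_zero_iff.2
    (norm_reflected_le hR0 hy.le)))
  rw [div_pow, div_eq_mul_inv, ← smul_smul] at e1
  have e2 := mul_le_mul_of_nonneg_left (rpow_add_le h.hn hr1 hL.le hy1) hc.le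
  calc _ ≤ ‖y‖ ^ (4 - n : ℝ) * (R ^ ((n : ℝ) - 4) * M) := by gcongr
    _ ≤ ‖y‖ ^ (4 - n : ℝ) * c1 := by gcongr
    _ ≤ c * (‖y‖ + L) ^ (4 - n : ℝ) := by rw [hc1]; linarith
    _ ≤ U y := hlow y hyq

theorem gam_sub_gamR_lower (hn : 5 ≤ n) {R R2 D : ℝ} (hR : 0 < R) (hR2 : R < R2) (hD : 0 ≤ D) :
    ∃ c, 0 < c ∧ ∀ y w : Eu n, R2 ≤ ‖y‖ → 2 * R ≤ ‖w‖ → ‖w‖ ≤ D → w ≠ y →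
      c * ‖y‖ ^ (4 - n : ℝ) ≤ gam n (y - w) - gamR n R y w := by
  have h5 : (5 : ℝ) ≤ n := by exact_mod_cast hn
  have hR20 := hR.trans hR2
  set C := 1 + D / R2 with hC
  have hC0 : 0 < C := by positivity
  have hq1 : R ^ 2 / R2 ^ 2 < 1 := by
    rw [div_lt_one (by positivity)]; nlinarith
  set s := 3 * (1 - R ^ 2 / R2 ^ 2) / C ^ 2 with hs
  have hs0 : 0 < s := by
    have : 0 < 1 - R ^ 2 / R2 ^ 2 := by linarith
    positivity
  set θ := √(1 + s) with hθ
  have hθ1 : 1 < θ := by rw [hθ, Real.lt_sqrt (by norm_num)]; linarith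
  have hθ2 : θ ^ 2 = 1 + s := Real.sq_sqrt (by linarith)
  have hθn : θ ^ (4 - n : ℝ) < 1 := Real.rpow_lt_one_of_one_lt_of_neg hθ1 (by linarith)
  refine ⟨C ^ (4 - n : ℝ) * (1 - θ ^ (4 - n : ℝ)), by
    have : 0 < 1 - θ ^ (4 - n : ℝ) := by linarith
    positivity, fun y w hy hw hwD hwy => ?_⟩
  have hw0 : w ≠ 0 := norm_pos_iff.1 (by linarith)
  have hy0 : 0 < ‖y‖ := by linarith
  have hA : 0 < ‖y - w‖ := norm_pos_iff.2 (sub_ne_zero.2 hwy.symm)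
  have hAC : ‖y - w‖ ≤ C * ‖y‖ := by
    have h1 := norm_sub_le y w
    have h2 : D / R2 * R2 ≤ D / R2 * ‖y‖ := mul_le_mul_of_nonneg_left hy (by positivity)
    rw [div_mul_cancel₀ _ hR20.ne'] at h2
    rw [hC]; linarith
  have hB : θ * ‖y - w‖ ≤ ‖y - (R / ‖w‖) ^ 2 • w‖ * ‖w‖ / R := by
    rw [← pow_le_pow_iff_left₀ (by positivity) (by positivity) two_ne_zero,
      reflected_dist_sq hR hw0, mul_pow, hθ2]
    have a1 : 3 ≤ (‖w‖ ^ 2 - R ^ 2) / R ^ 2 := by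
      rw [le_div_iff₀ (by positivity)]; nlinarith
    have a2 : (1 - R ^ 2 / R2 ^ 2) * ‖y‖ ^ 2 ≤ ‖y‖ ^ 2 - R ^ 2 := by
      have : R ^ 2 / R2 ^ 2 * R2 ^ 2 ≤ R ^ 2 / R2 ^ 2 * ‖y‖ ^ 2 := by gcongr
      rw [div_mul_cancel₀ _ (by positivity)] at this
      linarith
    have a3 : s * ‖y - w‖ ^ 2 ≤ 3 * ((1 - R ^ 2 / R2 ^ 2) * ‖y‖ ^ 2) := by
      have : s * ‖y - w‖ ^ 2 ≤ s * (C * ‖y‖) ^ 2 := by gcongr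
      refine this.trans_eq ?_
      rw [hs]; field_simp
    have a4 : 0 ≤ (1 - R ^ 2 / R2 ^ 2) * ‖y‖ ^ 2 :=
      mul_nonneg (by linarith) (by positivity)
    have a5 := mul_le_mul a2 a1 (by norm_num) (a4.trans a2)
    rw [mul_div_assoc]
    linarith
  have hg : gamR n R y w ≤ θ ^ (4 - n : ℝ) * gam n (y - w) := by
    unfold gamR gam
    rw [← Real.mul_rpow (by positivity) hA.le]
    exact Real.rpow_le_rpow_of_nonpos (by positivity) hB (by linarith)
  have hg2 : C ^ (4 - n : ℝ) * ‖y‖ ^ (4 - n : ℝ) ≤ gam n (y - w) := by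
    rw [← Real.mul_rpow hC0.le hy0.le]
    exact Real.rpow_le_rpow_of_nonpos hA hAC (by linarith)
  have := mul_le_mul_of_nonneg_right hg2 (sub_nonneg.2 hθn.le)
  linarith

theorem IEq.gap (h : IEq n p κ c0 q U) {x0 : Eu n} (hx0 : x0 ≠ q) (hU : U x0 ≠ 0) {R R2 : ℝ}
    (hR : 0 < R) (hRq : R < ‖q‖) (hR2 : R < R2) (hG : R ∈ goodRadii n q U) :
    ∃ c, 0 < c ∧ ∀ y, R2 ≤ ‖y‖ → y ≠ q →
      c * ‖y‖ ^ (4 - n : ℝ) ≤ U y - kelvin n R U y := by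
  have h5 : (5 : ℝ) ≤ n := by exact_mod_cast h.hn
  have : Nonempty (Fin n) := ⟨⟨0, by linarith [h.hn]⟩⟩
  have hp0 : 0 < p := by linarith [h.hp]
  have hκ := h.hκ
  have hq0 := hR.trans hRq
  obtain ⟨c, L, hc, hL, hlow⟩ := h.lower hx0 hU
  obtain ⟨c', hc', hk⟩ := gam_sub_gamR_lower h.hn hR hR2 (D := 4 * ‖q‖) (by positivity)
  set σ := (n : ℝ) + 4 - p * (n - 4) with hσ
  have hσ0 : 0 < σ := by linarith [h.hp2]
  set K := ball ((3 : ℝ) • q) ‖q‖ with hK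
  set m := (1 - (1 / 2 : ℝ) ^ σ) *
    ((R / (4 * ‖q‖)) ^ ((n : ℝ) - 4) * (c * (R + L) ^ (4 - n : ℝ))) ^ p with hm
  have hhalf : (1 / 2 : ℝ) ^ σ < 1 := Real.rpow_lt_one (by norm_num) (by norm_num) hσ0
  have hm0 : 0 < m := by
    have : 0 < 1 - (1 / 2 : ℝ) ^ σ := by linarith
    positivity
  have hKw : ∀ w ∈ K, 2 * ‖q‖ ≤ ‖w‖ ∧ ‖w‖ ≤ 4 * ‖q‖ := fun w hw => by
    rw [hK, mem_ball, dist_eq_norm] at hw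
    have a1 := norm_sub_norm_le w ((3 : ℝ) • q)
    have a2 := norm_sub_norm_le ((3 : ℝ) • q) w
    rw [norm_sub_rev] at a2
    rw [norm_smul, Real.norm_of_nonneg (by norm_num)] at a1 a2
    constructor <;> linarith
  have hsrc : ∀ w ∈ K, m ≤ U w ^ p - kelSrc n p R U w := fun w hw => by
    obtain ⟨w1, w2⟩ := hKw w hw
    have hwR : R < ‖w‖ := by linarith
    have hw0 := hR.trans hwR
    have hwq : w ≠ q := fun hc => by rw [hc] at w1; linarith
    have b1 := Real.rpow_le_rpow (h.kelvin_nonneg hR w) (hG w hwR hwq) hp0.le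
    have b2 := h.kelSrc_eq hR hwR
    have b3 : (R / ‖w‖) ^ σ ≤ (1 / 2 : ℝ) ^ σ := by
      refine Real.rpow_le_rpow (by positivity) ?_ hσ0.le
      rw [div_le_div_iff₀ hw0 (by norm_num)]; linarith
    have b4 : (R / (4 * ‖q‖)) ^ ((n : ℝ) - 4) * (c * (R + L) ^ (4 - n : ℝ)) ≤
        kelvin n R U w := by
      unfold kelvin
      have hI := norm_reflected_le hR hwR.le
      refine mul_le_mul (Real.rpow_le_rpow (by positivity) (by gcongr) (by linarith)) ?_
        (by positivity) (by positivity)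
      refine le_trans ?_ (hlow _ fun hcc => by rw [hcc] at hI; linarith)
      exact mul_le_mul_of_nonneg_left (Real.rpow_le_rpow_of_nonpos (by positivity)
        (by linarith) (by linarith)) hc.le
    have b5 := Real.rpow_le_rpow (by positivity) b4 hp0.le
    have b6 : 0 ≤ kelvin n R U w ^ p := Real.rpow_nonneg (h.kelvin_nonneg hR w) _
    rw [← hσ] at b2
    calc m ≤ (1 - (1 / 2 : ℝ) ^ σ) * kelvin n R U w ^ p :=
          mul_le_mul_of_nonneg_left b5 (by linarith)
      _ ≤ U w ^ p - kelSrc n p R U w := by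
          rw [b2]
          have := mul_le_mul_of_nonneg_right b3 b6
          linarith
  have hv : 0 < (volume : Measure (Eu n)).real K :=
    ENNReal.toReal_pos (measure_ball_pos _ _ hq0).ne' measure_ball_lt_top.ne
  refine ⟨κ * ((volume : Measure (Eu n)).real K * (c' * m)), by positivity, fun y hy hyq => ?_⟩
  have hyR : R < ‖y‖ := by linarith
  obtain ⟨hi, he⟩ := h.kelvin_sub hR hRq hyR hyq
  have hKs : K ⊆ (closedBall 0 R)ᶜ := fun w hw => by
    simpa using (by linarith [(hKw w hw).1] : R < ‖w‖)
  have k1 : ∫ w in K, c' * ‖y‖ ^ (4 - n : ℝ) * m ≤ ∫ w in K,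
      (gam n (y - w) - gamR n R y w) * (U w ^ p - kelSrc n p R U w) := by
    refine setIntegral_mono_on_ae (integrableOn_const measure_ball_lt_top.ne) (hi.mono_set hKs) measurableSet_ball ?_
    filter_upwards [Measure.ae_ne volume y] with w hwy hw
    have a1 := hk y w hy (by linarith [(hKw w hw).1]) (hKw w hw).2 hwy
    exact mul_le_mul a1 (hsrc w hw) hm0.le (le_trans (by positivity) a1)
  have k2 : ∫ w in K, (gam n (y - w) - gamR n R y w) * (U w ^ p - kelSrc n p R U w) ≤
      ∫ w in (closedBall 0 R)ᶜ,
        (gam n (y - w) - gamR n R y w) * (U w ^ p - kelSrc n p R U w) := by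
    refine setIntegral_mono_set hi ?_ (LE.le.eventuallyLE hKs)
    rw [EventuallyLE, ae_restrict_iff' measurableSet_closedBall.compl]
    filter_upwards [Measure.ae_ne volume y, Measure.ae_ne volume q] with w hwy hwq hw
    have hw : R < ‖w‖ := by simpa using hw
    refine mul_nonneg (sub_nonneg.2 (gamR_le_gam h.hn hR hyR hw hwy)) (sub_nonneg.2 ?_)
    exact (h.kelSrc_le hR hw).trans
      (Real.rpow_le_rpow (h.kelvin_nonneg hR w) (hG w hw hwq) hp0.le)
  rw [setIntegral_const, smul_eq_mul] at k1
  have c1 : 0 ≤ c0 * (1 - (R / ‖y‖) ^ ((n : ℝ) - 4)) := by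
    have hy0 := hR.trans hyR
    refine mul_nonneg h.hc0 (sub_nonneg.2 (Real.rpow_le_one (by positivity)
      ((div_le_one hy0).2 hyR.le) (by linarith)))
  have := mul_le_mul_of_nonneg_left (k1.trans k2) hκ.le
  rw [he]
  linarith

end


section
variable {n : ℕ} {p κ c0 : ℝ} {q : Eu n} {U : Eu n → ℝ}

theorem IEq.goodRadii_mem_nhds (h : IEq n p κ c0 q U) {x0 : Eu n} (hx0 : x0 ≠ q) (hU : U x0 ≠ 0)
    {R : ℝ} (hR : 0 < R) (hRq : R < ‖q‖) (hG : R ∈ goodRadii n q U) :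
    goodRadii n q U ∈ nhdsWithin R (Set.Ioi R) := by
  have h5 : (5 : ℝ) ≤ n := by exact_mod_cast h.hn
  set R1 := (R + ‖q‖) / 2 with hR1
  obtain ⟨M, hM0, hM⟩ := h.exists_bound (R := R1) (by linarith)
  obtain ⟨ε, hε, hε'⟩ := h.exists_eps hM0
  obtain ⟨η, hη, hsm⟩ := exists_small_volume h.hn hε
  obtain ⟨R2, hR2, hv⟩ := exists_thin_shell (n := n) hR.le hη
  obtain ⟨c, hc, hgap⟩ := h.gap hx0 hU hR hRq hR2 hG
  have hR20 := hR.trans hR2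
  have hcont : ∀ w ∈ closedBall (0 : Eu n) (1 / R2), ∀ᶠ z : ℝ × Eu n in nhds (R, w),
      z.1 ^ ((n : ℝ) - 4) * U (z.1 ^ 2 • z.2) < R ^ ((n : ℝ) - 4) * U (R ^ 2 • z.2) + c := by
    intro w hw
    have hq1 : R ^ 2 • w ≠ q := by
      intro hcc
      rw [mem_closedBall_zero_iff] at hw
      rw [← hcc, norm_smul, Real.norm_of_nonneg (by positivity)] at hRq
      have : R ^ 2 * ‖w‖ ≤ R ^ 2 * (1 / R2) := by gcongr
      have : R ^ 2 * (1 / R2) ≤ R := by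
        rw [mul_one_div, div_le_iff₀ hR20]; nlinarith
      linarith
    have hUc : ContinuousAt U (R ^ 2 • w) :=
      h.cont.continuousAt (isOpen_compl_singleton.mem_nhds hq1)
    have f1 : ContinuousAt (fun z : ℝ × Eu n => z.1 ^ ((n : ℝ) - 4) * U (z.1 ^ 2 • z.2)) (R, w) :=
      (continuousAt_fst.rpow_const (Or.inl hR.ne')).mul (ContinuousAt.comp
        (f := fun z : ℝ × Eu n => z.1 ^ 2 • z.2) hUc (by fun_prop))
    have f2 : ContinuousAt (fun z : ℝ × Eu n => R ^ ((n : ℝ) - 4) * U (R ^ 2 • z.2) + c) (R, w) :=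
      (continuousAt_const.mul (ContinuousAt.comp
        (f := fun z : ℝ × Eu n => R ^ 2 • z.2) hUc (by fun_prop))).add continuousAt_const
    exact f1.eventually_lt f2 (by simpa using hc)
  have hunif := (isCompact_closedBall (0 : Eu n) (1 / R2)).eventually_forall_of_forall_eventually
    (P := fun t w => t ^ ((n : ℝ) - 4) * U (t ^ 2 • w) < R ^ ((n : ℝ) - 4) * U (R ^ 2 • w) + c)
    hcont
  filter_upwards [hunif.filter_mono nhdsWithin_le_nhds, self_mem_nhdsWithin,
    (eventually_lt_nhds (show R < R1 by rw [hR1]; linarith)).filter_mono nhdsWithin_le_nhds]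
    with t ht htR htR1 y hy hyq
  have htR : R < t := htR
  have ht0 := hR.trans htR
  have htq : t < ‖q‖ := by linarith
  refine h.narrow ht0 htq (R2 := R2) (T := ball 0 R2 \ closedBall 0 R)
    (measurableSet_ball.diff measurableSet_closedBall) (fun z hz hz2 => ⟨by simpa using hz2,
      by simpa using htR.trans hz⟩)
    (fun z hz => hM z (closedBall_subset_closedBall htR1.le hz)) ?_
    (hsm _ (measurableSet_ball.diff measurableSet_closedBall) hv) hε' hy hyq
  intro y hy1 hy hyq
  have hy0 : 0 < ‖y‖ := ht0.trans hy
  have hy0' := norm_pos_iff.1 hy0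
  have hw : (‖y‖ ^ 2)⁻¹ • y ∈ closedBall (0 : Eu n) (1 / R2) := by
    rw [mem_closedBall_zero_iff, norm_smul, Real.norm_of_nonneg (by positivity)]
    have : (‖y‖ ^ 2)⁻¹ * ‖y‖ = 1 / ‖y‖ := by field_simp
    rw [this]
    exact one_div_le_one_div_of_le hR20 hy1
  have h1 := ht _ hw
  have h2 := hgap y hy1 hyq
  have h3 : 0 < ‖y‖ ^ (4 - n : ℝ) := by positivity
  have h4 := mul_lt_mul_of_pos_left h1 h3
  rw [kelvin_eq hR U hy0'] at h2
  rw [kelvin_eq ht0 U hy0']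
  linarith

theorem IEq.tendsto_kelvin (h : IEq n p κ c0 q U) {R : ℝ} (hR : 0 < R) {y : Eu n} (hy : y ≠ 0)
    (hq : (R / ‖y‖) ^ 2 • y ≠ q) : ContinuousAt (fun t => kelvin n t U y) R := by
  have hy0 := norm_pos_iff.2 hy
  have hUc : ContinuousAt U ((R / ‖y‖) ^ 2 • y) :=
    h.cont.continuousAt (isOpen_compl_singleton.mem_nhds hq)
  unfold kelvin
  refine ContinuousAt.mul ?_ (ContinuousAt.comp (f := fun t : ℝ => (t / ‖y‖) ^ 2 • y) hUc
    (by fun_prop))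
  exact ContinuousAt.rpow_const (by fun_prop) (Or.inl (by positivity))

theorem IEq.kelvin_le_self (h : IEq n p κ c0 q U) (hq : q ≠ 0) {x0 : Eu n} (hx0 : x0 ≠ q)
    (hU : U x0 ≠ 0) {y : Eu n} (hy : ‖q‖ < ‖y‖) : kelvin n ‖q‖ U y ≤ U y := by
  have hq0 := norm_pos_iff.2 hq
  obtain ⟨a, ha0, haq, haG⟩ := h.exists_goodRadius hq hx0 hU
  have hinner : ∀ R y, 0 < R → R ≤ ‖q‖ → R < ‖y‖ → (R / ‖y‖) ^ 2 • y ≠ q := by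
    intro R y hR hRq hy hc
    have hy0 := hR.trans hy
    rw [← hc, norm_reflected (norm_pos_iff.1 hy0), le_div_iff₀ hy0] at hRq
    nlinarith
  have hall : ∀ b, a ≤ b → b < ‖q‖ → b ∈ goodRadii n q U := by
    intro b hab hb
    refine IsClosed.Icc_subset_of_forall_mem_nhdsWithin (a := a) (b := b) ?_ haG ?_ ⟨hab, le_rfl⟩
    · refine IsSeqClosed.isClosed fun x R hx hxR => ⟨fun y hy hyq => ?_,
        isClosed_Icc.mem_of_tendsto hxR (Eventually.of_forall fun k => (hx k).2)⟩
      have hRm : R ∈ Set.Icc a b :=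
        isClosed_Icc.mem_of_tendsto hxR (Eventually.of_forall fun k => (hx k).2)
      have hR0 : 0 < R := ha0.trans_le hRm.1
      have hc := h.tendsto_kelvin hR0 (norm_pos_iff.1 (hR0.trans hy))
        (hinner R y hR0 (hRm.2.trans hb.le) hy)
      refine le_of_tendsto (hc.tendsto.comp hxR) ?_
      filter_upwards [hxR.eventually_lt_const hy] with k hk
      exact (hx k).1 y hk hyq
    · rintro R ⟨hRG, hRa, hRb⟩
      exact h.goodRadii_mem_nhds hx0 hU (ha0.trans_le hRa) (hRb.trans hb) hRG
  have hc := h.tendsto_kelvin hq0 (norm_pos_iff.1 (hq0.trans hy)) (hinner _ y hq0 le_rfl hy)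
  refine le_of_tendsto (hc.tendsto.mono_left nhdsWithin_le_nhds : Tendsto _
    (nhdsWithin ‖q‖ (Set.Iio ‖q‖)) _) ?_
  filter_upwards [self_mem_nhdsWithin, (eventually_gt_nhds haq).filter_mono nhdsWithin_le_nhds]
    with R hR haR
  exact hall R haR.le hR y (lt_trans hR hy) fun hc => by rw [hc] at hy; exact lt_irrefl _ hy

theorem IEq.translate (h : IEq n p κ c0 q U) (c : Eu n) :
    IEq n p κ c0 (q - c) fun x => U (x + c) := by
  have hne : ∀ x, x ≠ q - c → x + c ≠ q := fun x hx hc => hx (by rw [← hc]; abel)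
  have e : ∀ x z : Eu n, gam n (x - z) * U (z + c) ^ p =
      (fun z => gam n (x + c - z) * U z ^ p) (z + c) := fun x z => by
    simp
  refine ⟨h.hn, h.hp, h.hp2, h.hκ, h.hc0, fun x => h.pos _, ?_, fun x hx => ?_, fun x hx => ?_⟩
  · exact h.cont.comp (by fun_prop) fun x hx => hne x hx
  · simp_rw [e]
    exact (h.int _ (hne x hx)).comp_add_right c
  · rw [h.eq _ (hne x hx)]
    simp_rw [e]
    rw [integral_add_right_eq_self (fun z => gam n (x + c - z) * U z ^ p) c]

theorem IEq.reflection_le (h : IEq n p κ c0 0 U) {x0 : Eu n} (hx0 : x0 ≠ 0) (hU : U x0 ≠ 0)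
    {y y' : Eu n} (hyy : ‖y‖ = ‖y'‖) (hne : y ≠ y') : U y' ≤ U y := by
  have hy'0 : y' ≠ 0 := by
    rintro rfl
    rw [norm_zero, norm_eq_zero] at hyy
    exact hne hyy
  set e := y - y' with he
  have he0 : e ≠ 0 := sub_ne_zero.2 hne
  have hye : 2 * inner ℝ y e = ‖e‖ ^ 2 := by
    rw [he, norm_sub_sq_real, inner_sub_right, real_inner_self_eq_norm_sq, ← hyy]; ring
  have hen := norm_pos_iff.2 he0
  have hsq : ∀ s : ℝ, ‖s • y + e‖ ^ 2 = s ^ 2 * ‖y‖ ^ 2 + s * ‖e‖ ^ 2 + ‖e‖ ^ 2 := fun s => by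
    rw [norm_add_sq_real, norm_smul, mul_pow, inner_smul_left, Real.norm_eq_abs, sq_abs]
    simp only [conj_trivial]
    linear_combination s * hye
  have main : ∀ s : ℝ, 0 < s → (‖e‖ / ‖s • y + e‖) ^ ((n : ℝ) - 4) *
      U (y - ((s * ‖y‖ ^ 2 + ‖e‖ ^ 2) / ‖s • y + e‖ ^ 2) • (s • y + e)) ≤ U y := by
    intro s hs
    set T := 1 / s with hT
    have hT0 : 0 < T := by positivity
    have h' := h.translate (-(T • e))
    rw [zero_sub, neg_neg] at h'
    have hq : T • e ≠ 0 := smul_ne_zero hT0.ne' he0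
    have hse : y + T • e = T • (s • y + e) := by
      rw [smul_add, smul_smul, hT, one_div, inv_mul_cancel₀ hs.ne', one_smul]
    have hn1 : ‖y + T • e‖ = T * ‖s • y + e‖ := by
      rw [hse, norm_smul, Real.norm_of_nonneg hT0.le]
    have hn2 : ‖T • e‖ = T * ‖e‖ := by rw [norm_smul, Real.norm_of_nonneg hT0.le]
    have hlt : ‖e‖ < ‖s • y + e‖ := by
      rw [← pow_lt_pow_iff_left₀ (by positivity) (by positivity) two_ne_zero, hsq]
      have : 0 < s * ‖e‖ ^ 2 := by positivity
      have : 0 ≤ s ^ 2 * ‖y‖ ^ 2 := by positivity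
      linarith
    have k := h'.kelvin_le_self hq (x0 := x0 + T • e) (by simpa using hx0) (by simpa using hU)
      (y := y + T • e) (by rw [hn1, hn2]; gcongr)
    rw [kelvin, hn1, hn2, mul_div_mul_left _ _ hT0.ne'] at k
    have hN : 0 < ‖s • y + e‖ := hen.trans hlt
    have e1 : (‖e‖ / ‖s • y + e‖) ^ 2 • (y + T • e) + -(T • e) =
        y - ((s * ‖y‖ ^ 2 + ‖e‖ ^ 2) / ‖s • y + e‖ ^ 2) • (s • y + e) := by
      have e2 : (‖e‖ / ‖s • y + e‖) ^ 2 = 1 - s * ((s * ‖y‖ ^ 2 + ‖e‖ ^ 2) / ‖s • y + e‖ ^ 2) := by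
        have := hsq s
        field_simp
        linarith
      rw [e2, sub_smul, one_smul, hse, smul_smul]
      have : s * ((s * ‖y‖ ^ 2 + ‖e‖ ^ 2) / ‖s • y + e‖ ^ 2) * T =
        (s * ‖y‖ ^ 2 + ‖e‖ ^ 2) / ‖s • y + e‖ ^ 2 := by rw [hT]; field_simp
      rw [this, ← hse]; abel
    rw [e1, add_neg_cancel_right] at k
    exact k
  have hc0 : ContinuousAt (fun s : ℝ => (s * ‖y‖ ^ 2 + ‖e‖ ^ 2) / ‖s • y + e‖ ^ 2) 0 :=
    ContinuousAt.div (by fun_prop) (by fun_prop) (by simpa using he0)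
  have hz : y - ((0 * ‖y‖ ^ 2 + ‖e‖ ^ 2) / ‖(0 : ℝ) • y + e‖ ^ 2) • ((0 : ℝ) • y + e) = y' := by
    simp [he0]
    rw [he]; abel
  have hlim : Tendsto (fun s : ℝ => (‖e‖ / ‖s • y + e‖) ^ ((n : ℝ) - 4) *
      U (y - ((s * ‖y‖ ^ 2 + ‖e‖ ^ 2) / ‖s • y + e‖ ^ 2) • (s • y + e))) (nhds 0)
      (nhds ((‖e‖ / ‖(0 : ℝ) • y + e‖) ^ ((n : ℝ) - 4) * U y')) := by
    refine Tendsto.mul ?_ ?_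
    · refine ContinuousAt.tendsto (ContinuousAt.rpow_const (ContinuousAt.div (by fun_prop)
        (by fun_prop) (by simpa using he0)) (Or.inl ?_))
      simpa using he0
    · have hUc : Tendsto U (nhds y') (nhds (U y')) :=
        h.cont.continuousAt (isOpen_compl_singleton.mem_nhds hy'0)
      have hcc : ContinuousAt (fun s : ℝ =>
          y - ((s * ‖y‖ ^ 2 + ‖e‖ ^ 2) / ‖s • y + e‖ ^ 2) • (s • y + e)) 0 :=
        continuousAt_const.sub (hc0.smul (by fun_prop))
      have hct := hcc.tendsto
      simp only [hz] at hct
      exact hUc.comp hct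
  rw [zero_smul, zero_add, div_self hen.ne', Real.one_rpow, one_mul] at hlim
  refine le_of_tendsto (x := nhdsWithin (0 : ℝ) (Set.Ioi 0))
    (hlim.mono_left nhdsWithin_le_nhds) ?_
  filter_upwards [self_mem_nhdsWithin] with s hs using main s hs

/-- Solutions of the integral equation are radially symmetric about the singular point. -/
theorem IEq.radial (h : IEq n p κ c0 q U) {y y' : Eu n} (hyy : ‖y - q‖ = ‖y' - q‖) :
    U y = U y' := by
  by_cases hne : y = y'
  · rw [hne]
  have hy : y ≠ q := fun hc => hne (by
    rw [hc, sub_self, norm_zero, eq_comm, norm_eq_zero, sub_eq_zero] at hyy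
    rw [hc, hyy])
  have hy' : y' ≠ q := fun hc => hne (by
    rw [hc, sub_self, norm_zero, norm_eq_zero, sub_eq_zero] at hyy
    rw [hc, hyy])
  have h' := h.translate q
  rw [sub_self] at h'
  by_cases hU : ∃ x, x ≠ q ∧ U x ≠ 0
  · obtain ⟨x, hx, hUx⟩ := hU
    have a := h'.reflection_le (x0 := x - q) (sub_ne_zero.2 hx) (by simpa using hUx) hyy
      (by simpa using hne)
    have b := h'.reflection_le (x0 := x - q) (sub_ne_zero.2 hx) (by simpa using hUx) hyy.symm
      (by simpa using Ne.symm hne)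
    simp only [sub_add_cancel] at a b
    exact le_antisymm b a
  · push Not at hU
    rw [hU y hy, hU y' hy']

end

section


theorem gam_ratio {n : ℕ} {ε : ℝ} (hε : 0 < ε) : ∃ τ : ℝ, 0 < τ ∧ ∀ v w : Eu n,
    w ≠ 0 → ‖v - w‖ ≤ τ * ‖w‖ → |gam n v - gam n w| ≤ ε * gam n w := by
  have hc : ContinuousAt (fun t : ℝ => t ^ (4 - n : ℝ)) 1 :=
    Real.continuousAt_rpow_const _ _ (Or.inl one_ne_zero)
  obtain ⟨δ, hδ, H⟩ := Metric.continuousAt_iff.1 hc ε hε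
  refine ⟨δ / 2, by positivity, fun v w hw hvw => ?_⟩
  have hw0 : 0 < ‖w‖ := norm_pos_iff.2 hw
  have h1 : |‖v‖ / ‖w‖ - 1| < δ := by
    have : ‖v‖ / ‖w‖ - 1 = (‖v‖ - ‖w‖) / ‖w‖ := by field_simp
    rw [this, abs_div, abs_of_pos hw0, div_lt_iff₀ hw0]
    calc _ ≤ ‖v - w‖ := abs_norm_sub_norm_le v w
      _ ≤ δ / 2 * ‖w‖ := hvw
      _ < δ * ‖w‖ := by gcongr; linarith
  have h2 := H (x := ‖v‖ / ‖w‖) (by rwa [Real.dist_eq])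
  simp only [Real.dist_eq, Real.one_rpow] at h2
  have e : gam n v = (‖v‖ / ‖w‖) ^ (4 - n : ℝ) * gam n w := by
    unfold gam
    rw [← Real.mul_rpow (by positivity) hw0.le, div_mul_cancel₀ _ hw0.ne']
  rw [e, show (‖v‖ / ‖w‖) ^ (4 - n : ℝ) * gam n w - gam n w =
    ((‖v‖ / ‖w‖) ^ (4 - n : ℝ) - 1) * gam n w by ring, abs_mul, abs_of_nonneg (gam_nonneg w)]
  exact mul_le_mul_of_nonneg_right h2.le (gam_nonneg w)

theorem exists_small_ball {n : ℕ} (hn : 1 ≤ n) (x : Eu n) {r η : ℝ} (hr : 0 < r) (hη : 0 < η) :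
    ∃ ρ : ℝ, 0 < ρ ∧ ρ ≤ r ∧ volume (ball x ρ) ≤ ENNReal.ofReal η := by
  have : Nonempty (Fin n) := ⟨⟨0, by omega⟩⟩
  set v := (volume (ball (0 : Eu n) 1)).toReal with hv
  have hv0 : 0 ≤ v := ENNReal.toReal_nonneg
  refine ⟨min r (min 1 (η / (v + 1))), by positivity, min_le_left _ _, ?_⟩
  set ρ := min r (min 1 (η / (v + 1))) with hρ
  have h0 : 0 < ρ := by positivity
  have h1 : ρ ≤ 1 := (min_le_right _ _).trans (min_le_left _ _)
  have h2 : ρ ≤ η / (v + 1) := (min_le_right _ _).trans (min_le_right _ _)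
  rw [Measure.addHaar_ball _ _ h0.le, ← ENNReal.ofReal_toReal (measure_ball_lt_top (μ := volume)
    (x := (0 : Eu n)) (r := 1)).ne, ← ENNReal.ofReal_mul (by positivity)]
  refine ENNReal.ofReal_le_ofReal ?_
  rw [finrank_euclideanSpace_fin]
  calc ρ ^ n * v ≤ ρ ^ 1 * (v + 1) := by
        gcongr ?_ * ?_
        · exact pow_le_pow_of_le_one h0.le h1 hn
        · linarith
    _ ≤ η / (v + 1) * (v + 1) := by rw [pow_one]; gcongr
    _ = η := by field_simp

/-- A sequence of approximate solutions of the integral equation off a closed null set. -/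
structure Blow (n : ℕ) (p κ : ℝ) (S : Set (Eu n)) (w f : ℕ → Eu n → ℝ) : Prop where
  hn : 5 ≤ n
  hp : 1 < p
  hκ : 0 < κ
  closed : IsClosed S
  null : volume S = 0
  nonneg : ∀ R : ℝ, ∀ᶠ i in atTop, ∀ x ∈ ball (0 : Eu n) R \ S, 0 ≤ w i x
  fnonneg : ∀ i z, 0 ≤ f i z
  meas : ∀ i, AEStronglyMeasurable (f i) volume
  loc : ∀ x ∉ S, ∃ r C : ℝ, 0 < r ∧ ∀ᶠ i in atTop, ∀ y ∈ ball x r, w i y ≤ C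
  dom : ∀ x ∉ S, ∀ R : ℝ, ∃ D : Eu n → ℝ, IntegrableOn (fun z => gam n (x - z) * D z) (ball 0 R) ∧
    ∀ᶠ i in atTop, ∀ z ∈ ball (0 : Eu n) R \ S, f i z ≤ D z
  eq : ∀ R ε : ℝ, 0 < ε → ∀ᶠ i in atTop, ∀ x ∈ ball (0 : Eu n) R \ S,
    Integrable (fun z => gam n (x - z) * f i z) ∧ |w i x - κ * ∫ z, gam n (x - z) * f i z| ≤ ε
  pow : ∀ R : ℝ, ∀ᶠ i in atTop, ∀ z ∈ ball (0 : Eu n) R \ S, f i z = w i z ^ p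

variable {n : ℕ} {p κ : ℝ} {S : Set (Eu n)} {w f : ℕ → Eu n → ℝ}

theorem Blow.comp (h : Blow n p κ S w f) {φ : ℕ → ℕ} (hφ : StrictMono φ) :
    Blow n p κ S (fun i => w (φ i)) (fun i => f (φ i)) where
  hn := h.hn
  hp := h.hp
  hκ := h.hκ
  closed := h.closed
  null := h.null
  nonneg R := hφ.tendsto_atTop.eventually (h.nonneg R)
  fnonneg i := h.fnonneg _
  meas i := h.meas _
  loc x hx := by
    obtain ⟨r, C, hr, H⟩ := h.loc x hx
    exact ⟨r, C, hr, hφ.tendsto_atTop.eventually H⟩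
  dom x hx R := by
    obtain ⟨D, hD, H⟩ := h.dom x hx R
    exact ⟨D, hD, hφ.tendsto_atTop.eventually H⟩
  eq R ε hε := hφ.tendsto_atTop.eventually (h.eq R ε hε)
  pow R := hφ.tendsto_atTop.eventually (h.pow R)

theorem Blow.equicont (h : Blow n p κ S w f) {x0 : Eu n} (hx0 : x0 ∉ S) {ε : ℝ} (hε : 0 < ε) :
    ∃ δ : ℝ, 0 < δ ∧ ∀ᶠ i in atTop, ∀ x ∈ ball x0 δ, |w i x - w i x0| ≤ ε := by
  obtain ⟨r, C0, hr, hC0⟩ := h.loc x0 hx0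
  obtain ⟨r2, hr2, hS⟩ := Metric.isOpen_iff.1 h.closed.isOpen_compl x0 hx0
  set C := max C0 0 with hCdef
  have hC : 0 ≤ C := le_max_right _ _
  have hκ := h.hκ
  set ε1 := ε / (8 * (κ * C ^ p + 1)) with hε1
  have hCp : 0 ≤ C ^ p := Real.rpow_nonneg hC _
  obtain ⟨η, hη, hsmall⟩ := exists_small_volume h.hn (ε := ε1) (by positivity)
  obtain ⟨ρ, hρ, hρr, hvol⟩ := exists_small_ball (by linarith [h.hn]) x0 (lt_min hr hr2) hη
  set ε2 := ε / (4 * (C + 1)) with hε2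
  obtain ⟨τ, hτ, hrat⟩ := gam_ratio (n := n) (ε := ε2) (by positivity)
  refine ⟨min ρ (τ * ρ), by positivity, ?_⟩
  set R := ‖x0‖ + ρ + 1
  filter_upwards [hC0, h.nonneg R, h.pow R, h.eq R (min 1 (ε / 4)) (by positivity)]
    with i h1 h2 h3 h4 x hx
  have hB : ∀ y ∈ ball x0 ρ, y ∈ ball (0 : Eu n) R \ S := fun y hy => by
    refine ⟨?_, hS (ball_subset_ball (hρr.trans (min_le_right _ _)) hy)⟩
    rw [mem_ball_zero_iff]
    rw [mem_ball_iff_norm] at hy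
    have := norm_le_norm_add_norm_sub' y x0
    simp only [R]
    linarith
  have hfB : ∀ y ∈ ball x0 ρ, f i y ≤ C ^ p := fun y hy => by
    rw [h3 y (hB y hy)]
    exact Real.rpow_le_rpow (h2 y (hB y hy))
      ((h1 y (ball_subset_ball (hρr.trans (min_le_left _ _)) hy)).trans (le_max_left _ _))
      (by linarith [h.hp])
  have hxB : x ∈ ball x0 ρ := ball_subset_ball (min_le_left _ _) hx
  have hx0B : x0 ∈ ball x0 ρ := mem_ball_self hρ
  obtain ⟨i1, e1⟩ := h4 x (hB x hxB)
  obtain ⟨i2, e2⟩ := h4 x0 (hB x0 hx0B)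
  obtain ⟨s1, t1⟩ := hsmall _ measurableSet_ball hvol x
  obtain ⟨s2, t2⟩ := hsmall _ measurableSet_ball hvol x0
  have hpt : ∀ z, |gam n (x - z) * f i z - gam n (x0 - z) * f i z| ≤
      C ^ p * ((ball x0 ρ).indicator (fun z => gam n (x - z)) z +
        (ball x0 ρ).indicator (fun z => gam n (x0 - z)) z) + ε2 * (gam n (x0 - z) * f i z) := by
    intro z
    have hf0 := h.fnonneg i z
    have g1 := gam_nonneg (x - z)
    have g2 := gam_nonneg (x0 - z)
    rw [← sub_mul, abs_mul, abs_of_nonneg hf0]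
    by_cases hz : z ∈ ball x0 ρ
    · rw [Set.indicator_of_mem hz, Set.indicator_of_mem hz]
      have : |gam n (x - z) - gam n (x0 - z)| ≤ gam n (x - z) + gam n (x0 - z) := by
        rw [abs_le]; constructor <;> linarith
      calc _ ≤ (gam n (x - z) + gam n (x0 - z)) * C ^ p := by
            gcongr; exact hfB z hz
        _ ≤ _ := by
          have : 0 ≤ ε2 * (gam n (x0 - z) * f i z) := by positivity
          linarith
    · rw [Set.indicator_of_notMem hz, Set.indicator_of_notMem hz]
      have hz' : ρ ≤ ‖x0 - z‖ := by
        rw [mem_ball_iff_norm, not_lt, norm_sub_rev] at hz; exact hz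
      have := hrat (x - z) (x0 - z) (norm_pos_iff.1 (hρ.trans_le hz')) (by
        rw [sub_sub_sub_cancel_right]
        have : ‖x - x0‖ < min ρ (τ * ρ) := mem_ball_iff_norm.1 hx
        calc _ ≤ τ * ρ := this.le.trans (min_le_right _ _)
          _ ≤ _ := by gcongr)
      calc _ ≤ ε2 * gam n (x0 - z) * f i z := by gcongr
        _ = _ := by ring
  have j1 : Integrable fun z => (ball x0 ρ).indicator (fun z => gam n (x - z)) z +
        (ball x0 ρ).indicator (fun z => gam n (x0 - z)) z :=
    ((integrable_indicator_iff measurableSet_ball).2 s1).add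
      ((integrable_indicator_iff measurableSet_ball).2 s2)
  have k1 : |(∫ z, gam n (x - z) * f i z) - ∫ z, gam n (x0 - z) * f i z| ≤
      C ^ p * (ε1 + ε1) + ε2 * ∫ z, gam n (x0 - z) * f i z := by
    rw [← integral_sub i1 i2]
    refine abs_integral_le_integral_abs.trans
      ((integral_mono (i1.sub i2).abs ((j1.const_mul _).add (i2.const_mul _)) hpt).trans ?_)
    simp only [Pi.add_apply]
    rw [integral_add (j1.const_mul _) (i2.const_mul _), integral_const_mul, integral_const_mul,
      integral_add ((integrable_indicator_iff measurableSet_ball).2 s1)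
      ((integrable_indicator_iff measurableSet_ball).2 s2), integral_indicator measurableSet_ball,
      integral_indicator measurableSet_ball]
    gcongr
  set I := ∫ z, gam n (x - z) * f i z
  set J := ∫ z, gam n (x0 - z) * f i z
  have hwC : w i x0 ≤ C := (h1 x0 (mem_ball_self hr)).trans (le_max_left _ _)
  have m1 : min 1 (ε / 4) ≤ 1 := min_le_left _ _
  have m2 : min 1 (ε / 4) ≤ ε / 4 := min_le_right _ _
  rw [abs_le] at e1 e2
  have hJ : κ * J ≤ C + 1 := by linarith [e2.1]
  have a1 : κ * (C ^ p * (ε1 + ε1)) ≤ ε / 4 := by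
    have : (κ * C ^ p + 1) * ε1 = ε / 8 := by rw [hε1]; field_simp
    have : 0 < ε1 := by positivity
    linarith
  have a2 : ε2 * (κ * J) ≤ ε / 4 := by
    have : ε2 * (C + 1) = ε / 4 := by rw [hε2]; field_simp
    rw [← this]; gcongr
  have a3 : κ * |I - J| ≤ ε / 2 := by
    calc _ ≤ κ * (C ^ p * (ε1 + ε1) + ε2 * J) := by gcongr
      _ = κ * (C ^ p * (ε1 + ε1)) + ε2 * (κ * J) := by ring
      _ ≤ _ := by linarith
  have a4 : |κ * (I - J)| ≤ ε / 2 := by rwa [abs_mul, abs_of_pos hκ]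
  rw [abs_le] at a4 ⊢
  constructor <;> linarith [a4.1, a4.2, e1.1, e1.2, e2.1, e2.2]

/-- Pointwise convergence off the singular set is continuous. -/
theorem Blow.continuous_conv (h : Blow n p κ S w f) {U : Eu n → ℝ}
    (hU : ∀ x ∉ S, Tendsto (fun i => w i x) atTop (nhds (U x))) {x0 : Eu n} (hx0 : x0 ∉ S) {ε : ℝ}
    (hε : 0 < ε) : ∃ δ : ℝ, 0 < δ ∧ ∀ᶠ i in atTop, ∀ x ∈ ball x0 δ, |w i x - U x0| ≤ ε := by
  obtain ⟨δ, hδ, H⟩ := h.equicont hx0 (half_pos hε)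
  refine ⟨δ, hδ, ?_⟩
  filter_upwards [H, (Metric.tendsto_nhds.1 (hU x0 hx0)) (ε / 2) (half_pos hε)] with i h1 h2 x hx
  have := h1 x hx
  rw [Real.dist_eq] at h2
  calc _ ≤ |w i x - w i x0| + |w i x0 - U x0| := abs_sub_le _ _ _
    _ ≤ ε := by linarith

theorem Blow.continuousOn (h : Blow n p κ S w f) {U : Eu n → ℝ}
    (hU : ∀ x ∉ S, Tendsto (fun i => w i x) atTop (nhds (U x))) : ContinuousOn U Sᶜ := by
  intro x0 hx0
  rw [Metric.continuousWithinAt_iff]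
  intro ε hε
  obtain ⟨δ, hδ, H⟩ := h.continuous_conv hU hx0 (half_pos hε)
  refine ⟨δ, hδ, fun {x} hx hxd => ?_⟩
  rw [Real.dist_eq]
  refine lt_of_le_of_lt ?_ (half_lt_self hε)
  exact le_of_tendsto ((hU x hx).sub_const _).abs (H.mono fun i hi => hi x hxd)

theorem Blow.limit_nonneg (h : Blow n p κ S w f) {U : Eu n → ℝ}
    (hU : ∀ x ∉ S, Tendsto (fun i => w i x) atTop (nhds (U x))) {x : Eu n} (hx : x ∉ S) :
    0 ≤ U x :=
  ge_of_tendsto (hU x hx) ((h.nonneg (‖x‖ + 1)).mono fun i hi => hi x ⟨by simp, hx⟩)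

theorem Blow.tendsto_pow (h : Blow n p κ S w f) {U : Eu n → ℝ}
    (hU : ∀ x ∉ S, Tendsto (fun i => w i x) atTop (nhds (U x))) {x : Eu n} (hx : x ∉ S) :
    Tendsto (fun i => f i x) atTop (nhds (U x ^ p)) :=
  ((hU x hx).rpow_const (Or.inr (by linarith [h.hp]))).congr'
    ((h.pow (‖x‖ + 1)).mono fun i hi => (hi x ⟨by simp, hx⟩).symm)

theorem Blow.ae_notMem (h : Blow n p κ S w f) : ∀ᵐ x : Eu n, x ∉ S :=
  measure_eq_zero_iff_ae_notMem.1 h.null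

theorem Blow.tendsto_ball (h : Blow n p κ S w f) {U : Eu n → ℝ}
    (hU : ∀ x ∉ S, Tendsto (fun i => w i x) atTop (nhds (U x))) {x : Eu n} (hx : x ∉ S) (R : ℝ) :
    IntegrableOn (fun z => gam n (x - z) * U z ^ p) (ball 0 R) ∧
      Tendsto (fun i => ∫ z in ball 0 R, gam n (x - z) * f i z) atTop
        (nhds (∫ z in ball 0 R, gam n (x - z) * U z ^ p)) := by
  obtain ⟨D, hD, H⟩ := h.dom x hx R
  have hgm : Measurable fun z => gam n (x - z) := (measurable_gam n).comp (measurable_const_sub x)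
  have hm : ∀ i, AEStronglyMeasurable (fun z => gam n (x - z) * f i z) volume := fun i =>
    hgm.aestronglyMeasurable.mul (h.meas i)
  have hae : ∀ᵐ z ∂(volume.restrict (ball (0 : Eu n) R)), z ∈ ball (0 : Eu n) R \ S := by
    filter_upwards [ae_restrict_mem measurableSet_ball, ae_restrict_of_ae h.ae_notMem] with z h1 h2
    exact ⟨h1, h2⟩
  have hb : ∀ᶠ i in atTop, ∀ᵐ z ∂(volume.restrict (ball (0 : Eu n) R)),
      ‖gam n (x - z) * f i z‖ ≤ gam n (x - z) * D z := by
    filter_upwards [H] with i hi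
    filter_upwards [hae] with z hz
    rw [Real.norm_of_nonneg (mul_nonneg (gam_nonneg _) (h.fnonneg _ _))]
    exact mul_le_mul_of_nonneg_left (hi z hz) (gam_nonneg _)
  have hl : ∀ᵐ z ∂(volume.restrict (ball (0 : Eu n) R)),
      Tendsto (fun i => gam n (x - z) * f i z) atTop (nhds (gam n (x - z) * U z ^ p)) := by
    filter_upwards [hae] with z hz using (h.tendsto_pow hU hz.2).const_mul _
  refine ⟨hD.mono' (aestronglyMeasurable_of_tendsto_ae atTop (fun i => (hm i).restrict) hl) ?_,
    tendsto_integral_filter_of_dominated_convergence _ (.of_forall fun i => (hm i).restrict) hb hD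
      hl⟩
  filter_upwards [hae, hl] with z hz hlz
  refine le_of_tendsto hlz.norm ?_
  filter_upwards [H] with i hi
  rw [Real.norm_of_nonneg (mul_nonneg (gam_nonneg _) (h.fnonneg _ _))]
  exact mul_le_mul_of_nonneg_left (hi z hz) (gam_nonneg _)

theorem Blow.tendsto_far (h : Blow n p κ S w f) {U : Eu n → ℝ}
    (hU : ∀ x ∉ S, Tendsto (fun i => w i x) atTop (nhds (U x))) {x : Eu n} (hx : x ∉ S) (R : ℝ) :
    Tendsto (fun i => κ * ∫ z in (ball 0 R)ᶜ, gam n (x - z) * f i z) atTop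
      (nhds (U x - κ * ∫ z in ball 0 R, gam n (x - z) * U z ^ p)) := by
  have h0 : Tendsto (fun i => w i x - κ * ∫ z, gam n (x - z) * f i z) atTop (nhds 0) := by
    rw [Metric.tendsto_nhds]
    intro ε hε
    filter_upwards [h.eq (‖x‖ + 1) (ε / 2) (half_pos hε)] with i hi
    rw [Real.dist_eq, sub_zero]
    linarith [(hi x ⟨by simp, hx⟩).2]
  have h1 := (((hU x hx).sub h0).sub (((h.tendsto_ball hU hx R).2).const_mul κ))
  rw [sub_zero] at h1
  refine h1.congr' ?_
  filter_upwards [h.eq (‖x‖ + 1) 1 one_pos] with i hi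
  have := integral_add_compl (measurableSet_ball (x := (0 : Eu n)) (ε := R))
    (hi x ⟨by simp, hx⟩).1
  linear_combination -κ * this

theorem Blow.integral_ball_le (h : Blow n p κ S w f) {U : Eu n → ℝ}
    (hU : ∀ x ∉ S, Tendsto (fun i => w i x) atTop (nhds (U x))) {x : Eu n} (hx : x ∉ S) (R : ℝ) :
    κ * ∫ z in ball 0 R, gam n (x - z) * U z ^ p ≤ U x := by
  rw [← sub_nonneg]
  exact ge_of_tendsto (h.tendsto_far hU hx R) (.of_forall fun i => mul_nonneg h.hκ.le
    (integral_nonneg fun z => mul_nonneg (gam_nonneg _) (h.fnonneg _ _)))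

theorem Blow.integrable_limit (h : Blow n p κ S w f) {U : Eu n → ℝ}
    (hU : ∀ x ∉ S, Tendsto (fun i => w i x) atTop (nhds (U x))) {x : Eu n} (hx : x ∉ S) :
    Integrable fun z => gam n (x - z) * U z ^ p := by
  refine (aecover_ball (μ := volume) (x := (0 : Eu n)) (r := fun k : ℕ => (k : ℝ))
    tendsto_natCast_atTop_atTop).integrable_of_integral_bounded_of_nonneg_ae (U x / κ)
    (fun k => (h.tendsto_ball hU hx k).1) ?_ (.of_forall fun k => ?_)
  · filter_upwards [h.ae_notMem] with z hz
    exact mul_nonneg (gam_nonneg _) (Real.rpow_nonneg (h.limit_nonneg hU hz) _)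
  · rw [le_div_iff₀ h.hκ, mul_comm]
    exact h.integral_ball_le hU hx k

theorem Blow.tendsto_const (h : Blow n p κ S w f) {U : Eu n → ℝ}
    (hU : ∀ x ∉ S, Tendsto (fun i => w i x) atTop (nhds (U x))) {x : Eu n} (hx : x ∉ S) :
    Tendsto (fun k : ℕ => U x - κ * ∫ z in ball 0 k, gam n (x - z) * U z ^ p) atTop
      (nhds (U x - κ * ∫ z, gam n (x - z) * U z ^ p)) :=
  (((aecover_ball (μ := volume) (x := (0 : Eu n)) (r := fun k : ℕ => (k : ℝ))
    tendsto_natCast_atTop_atTop).integral_tendsto_of_countably_generated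
      (h.integrable_limit hU hx)).const_mul κ).const_sub _

theorem Blow.const_eq (h : Blow n p κ S w f) {U : Eu n → ℝ}
    (hU : ∀ x ∉ S, Tendsto (fun i => w i x) atTop (nhds (U x))) {x x' : Eu n} (hx : x ∉ S)
    (hx' : x' ∉ S) : U x - κ * (∫ z, gam n (x - z) * U z ^ p) =
      U x' - κ * ∫ z, gam n (x' - z) * U z ^ p := by
  have key : ∀ ε : ℝ, 0 < ε → |(U x - κ * (∫ z, gam n (x - z) * U z ^ p)) -
      (U x' - κ * ∫ z, gam n (x' - z) * U z ^ p)| ≤ ε * U x' := by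
    intro ε hε
    obtain ⟨τ, hτ, hrat⟩ := gam_ratio (n := n) hε
    refine le_of_tendsto ((h.tendsto_const hU hx).sub (h.tendsto_const hU hx')).abs ?_
    obtain ⟨N, hN⟩ := exists_nat_gt (‖x - x'‖ / τ + ‖x'‖)
    filter_upwards [eventually_ge_atTop N] with k hk
    have hkN : ‖x - x'‖ / τ + ‖x'‖ < k := hN.trans_le (by exact_mod_cast hk)
    have hfar : ∀ z ∈ (ball (0 : Eu n) k)ᶜ,
        |gam n (x - z) - gam n (x' - z)| ≤ ε * gam n (x' - z) := fun z hz => by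
      rw [Set.mem_compl_iff, mem_ball_zero_iff, not_lt] at hz
      have h1 : ‖x - x'‖ / τ < ‖x' - z‖ := by
        have := norm_le_norm_add_norm_sub x' z
        linarith
      refine hrat _ _ (norm_pos_iff.1 (lt_of_le_of_lt (by positivity) h1)) ?_
      rw [sub_sub_sub_cancel_right, mul_comm]
      exact ((div_lt_iff₀ hτ).1 h1).le
    have hk' := (h.tendsto_far hU hx k).sub (h.tendsto_far hU hx' k)
    refine (le_of_tendsto_of_tendsto hk'.abs ((h.tendsto_far hU hx' k).const_mul ε) ?_).trans ?_
    · filter_upwards [h.eq (max ‖x‖ ‖x'‖ + 1) 1 one_pos] with i hi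
      have i1 := (hi x ⟨by simpa using lt_add_of_le_of_pos (le_max_left _ _) one_pos, hx⟩).1
      have i2 := (hi x' ⟨by simpa using lt_add_of_le_of_pos (le_max_right _ _) one_pos, hx'⟩).1
      rw [← mul_sub, abs_mul, abs_of_pos h.hκ, ← integral_sub i1.integrableOn i2.integrableOn,
        mul_left_comm]
      refine mul_le_mul_of_nonneg_left ?_ h.hκ.le
      rw [← integral_const_mul]
      refine abs_integral_le_integral_abs.trans (setIntegral_mono_on
        (i1.sub i2).abs.integrableOn (i2.const_mul ε).integrableOn measurableSet_ball.compl
        fun z hz => ?_)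
      rw [← sub_mul, abs_mul, abs_of_nonneg (h.fnonneg i z), ← mul_assoc]
      exact mul_le_mul_of_nonneg_right (hfar z hz) (h.fnonneg i z)
    · refine mul_le_mul_of_nonneg_left ?_ hε.le
      rw [sub_le_self_iff]
      refine mul_nonneg h.hκ.le (integral_nonneg_of_ae ?_)
      filter_upwards [ae_restrict_of_ae h.ae_notMem] with z hz
      exact mul_nonneg (gam_nonneg _) (Real.rpow_nonneg (h.limit_nonneg hU hz) _)
  rw [← sub_eq_zero, ← abs_eq_zero]
  refine le_antisymm ?_ (abs_nonneg _)
  have hl : Tendsto (fun ε : ℝ => ε * U x') (nhdsWithin 0 (Set.Ioi 0)) (nhds (0 * U x')) :=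
    ((continuous_id.mul continuous_const).tendsto 0).mono_left nhdsWithin_le_nhds
  rw [zero_mul] at hl
  refine ge_of_tendsto hl ?_
  filter_upwards [self_mem_nhdsWithin] with ε hε using key ε hε

theorem Blow.isEq (h : Blow n p κ S w f) {U : Eu n → ℝ} (hp2 : p * ((n : ℝ) - 4) < n + 4)
    (hU : ∀ x ∉ S, Tendsto (fun i => w i x) atTop (nhds (U x))) (hU0 : ∀ x ∈ S, U x = 0)
    {q : Eu n} (hS : S ⊆ {q}) : ∃ c0, IEq n p κ c0 q U := by
  have hpos : ∀ x, 0 ≤ U x := fun x => by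
    by_cases hx : x ∈ S
    · exact (hU0 x hx).ge
    · exact h.limit_nonneg hU hx
  have hsub : ({q} : Set (Eu n))ᶜ ⊆ Sᶜ := Set.compl_subset_compl.2 hS
  have : Nonempty (Fin n) := ⟨⟨0, by linarith [h.hn]⟩⟩
  obtain ⟨x1, hx1⟩ := exists_ne q
  refine ⟨U x1 - κ * ∫ z, gam n (x1 - z) * U z ^ p, h.hn, h.hp, hp2, h.hκ, ?_, hpos,
    (h.continuousOn hU).mono hsub, fun x hx => h.integrable_limit hU (hsub hx), fun x hx => ?_⟩
  · exact ge_of_tendsto (h.tendsto_const hU (hsub hx1))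
      (.of_forall fun k => sub_nonneg.2 (h.integral_ball_le hU (hsub hx1) k))
  · have := h.const_eq hU (hsub hx) (hsub hx1)
    linarith

theorem Blow.exists_subseq (h : Blow n p κ S w f) : ∃ φ : ℕ → ℕ, StrictMono φ ∧
    ∃ U : Eu n → ℝ, (∀ x ∈ S, U x = 0) ∧
      ∀ x ∉ S, Tendsto (fun i => w (φ i) x) atTop (nhds (U x)) := by
  have hb : ∀ x, ∃ C : ℝ, x ∉ S → ∀ᶠ i in atTop, 0 ≤ w i x ∧ w i x ≤ C := fun x => by
    by_cases hx : x ∈ S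
    · exact ⟨0, fun h => absurd hx h⟩
    · obtain ⟨r, C, hr, H⟩ := h.loc x hx
      refine ⟨C, fun _ => ?_⟩
      filter_upwards [H, h.nonneg (‖x‖ + 1)] with i h1 h2
      exact ⟨h2 x ⟨by simp, hx⟩, h1 x (mem_ball_self hr)⟩
  choose C hC using hb
  set d := TopologicalSpace.denseSeq (Eu n) with hd
  set F : ℕ → ℕ → ℝ := fun i k => max 0 (min (w i (d k)) |C (d k)|) with hF
  have hK : IsCompact (Set.pi Set.univ fun k => Set.Icc (0 : ℝ) |C (d k)|) :=
    isCompact_univ_pi fun k => isCompact_Icc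
  obtain ⟨l, -, φ, hφ, hl⟩ := hK.tendsto_subseq (x := F) (fun i k _ =>
    ⟨le_max_left _ _, max_le (abs_nonneg _) (min_le_right _ _)⟩)
  have hk : ∀ k, d k ∉ S → Tendsto (fun i => w (φ i) (d k)) atTop (nhds (l k)) := fun k hk => by
    refine ((tendsto_pi_nhds.1 hl) k).congr' ?_
    filter_upwards [hφ.tendsto_atTop.eventually (hC (d k) hk)] with i hi
    simp only [hF, Function.comp]
    rw [min_eq_left (hi.2.trans (le_abs_self _)), max_eq_right hi.1]
  have hlim : ∀ x, ∃ L : ℝ, (x ∈ S → L = 0) ∧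
      (x ∉ S → Tendsto (fun i => w (φ i) x) atTop (nhds L)) := fun x => by
    by_cases hx : x ∈ S
    · exact ⟨0, fun _ => rfl, fun h => absurd hx h⟩
    · have hcs : CauchySeq (fun i => w (φ i) x) := by
        rw [Metric.cauchySeq_iff]
        intro ε hε
        obtain ⟨δ, hδ, H⟩ := (h.comp hφ).equicont hx (ε := ε / 8) (by positivity)
        obtain ⟨k, hy⟩ := (TopologicalSpace.denseRange_denseSeq (Eu n)).exists_mem_open
          (isOpen_ball.inter h.closed.isOpen_compl) ⟨x, mem_ball_self hδ, hx⟩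
        obtain ⟨N1, hN1⟩ := eventually_atTop.1 H
        obtain ⟨N2, hN2⟩ := Metric.cauchySeq_iff.1 (hk k hy.2).cauchySeq (ε / 8) (by positivity)
        refine ⟨max N1 N2, fun i hi j hj => ?_⟩
        have a1 := hN1 i (le_of_max_le_left hi) _ hy.1
        have a2 := hN1 j (le_of_max_le_left hj) _ hy.1
        have a3 := hN2 i (le_of_max_le_right hi) j (le_of_max_le_right hj)
        rw [Real.dist_eq] at a3 ⊢
        rw [abs_le] at a1 a2
        rw [abs_lt] at a3 ⊢
        constructor <;> linarith [a1.1, a1.2, a2.1, a2.2, a3.1, a3.2]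
      obtain ⟨L, hL⟩ := cauchySeq_tendsto_of_complete hcs
      exact ⟨L, fun h => absurd h hx, fun _ => hL⟩
  choose U hU using hlim
  exact ⟨φ, hφ, U, fun x hx => (hU x).1 hx, fun x hx => (hU x).2 hx⟩

end


theorem integral_affine {n : ℕ} {c : ℝ} (hc : 0 < c) (x : Eu n) (F : Eu n → ℝ) :
    ∫ y, F y = c ^ n * ∫ z, F (x + c • z) := by
  have e := Measure.integral_comp_smul (volume : Measure (Eu n)) (fun y => F (x + y)) c
  rw [finrank_euclideanSpace_fin, abs_of_pos (by positivity), integral_add_left_eq_self,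
    smul_eq_mul] at e
  rw [e]
  field_simp

theorem integrable_affine {n : ℕ} {c : ℝ} (hc : 0 < c) (x : Eu n) {F : Eu n → ℝ}
    (hF : Integrable F) : Integrable fun z => F (x + c • z) :=
  (hF.comp_add_left x).comp_smul hc.ne'

theorem gam_smul {n : ℕ} {c : ℝ} (hc : 0 < c) (x : Eu n) :
    gam n (c • x) = c ^ (4 - n : ℝ) * gam n x := by
  unfold gam
  rw [norm_smul, Real.norm_of_nonneg hc.le, Real.mul_rpow hc.le (norm_nonneg _)]

theorem Sol.a_pos {n : ℕ} {p a : ℝ} {u : Eu n → ℝ} (h : Sol n p a u) : 0 < a := by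
  have hp0 : 0 < p - 1 := by linarith [h.hp]
  by_contra hneg
  have := mul_nonpos_of_nonpos_of_nonneg (not_lt.1 hneg) hp0.le
  linarith [h.hap]

theorem Sol.blow {n : ℕ} {p a : ℝ} {u : Eu n → ℝ} (h : Sol n p a u) {S : Set (Eu n)}
    (hS : IsClosed S) (hS0 : volume S = 0) {x : ℕ → Eu n} {c : ℕ → ℝ} (hc : ∀ k, 0 < c k)
    (hc0 : Tendsto c atTop (nhds 0)) (hx0 : Tendsto x atTop (nhds 0))
    (hne : ∀ R : ℝ, ∀ᶠ k in atTop, ∀ z ∈ ball (0 : Eu n) R \ S, x k + c k • z ≠ 0)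
    (hloc : ∀ y ∉ S, ∃ r C : ℝ, 0 < r ∧ ∀ᶠ k in atTop, ∀ z ∈ ball y r,
      c k ^ a * u (x k + c k • z) ≤ C)
    (hdom : ∀ y ∉ S, ∀ R : ℝ, ∃ D : Eu n → ℝ,
      IntegrableOn (fun z => gam n (y - z) * D z) (ball 0 R) ∧
      ∀ᶠ k in atTop, ∀ z ∈ ball (0 : Eu n) R \ S, (c k ^ a * u (x k + c k • z)) ^ p ≤ D z) :
    Blow n p (cN n)⁻¹ S (fun k z => c k ^ a * u (x k + c k • z))
      (fun k z => c k ^ (a + 4) * src p u (x k + c k • z)) := by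
  have hκ := inv_pos.2 (cN_pos h.hn)
  have hp0 : 0 < p - 1 := by linarith [h.hp]
  have ha := h.a_pos
  have hap : a * p = a + 4 := by linarith [h.hap]
  have hsm : ∀ R ε : ℝ, 0 < ε → ∀ᶠ k in atTop, ∀ z ∈ ball (0 : Eu n) R,
      ‖x k + c k • z‖ < ε := by
    intro R ε hε
    have hl : Tendsto (fun k => ‖x k‖ + c k * |R|) atTop (nhds (‖(0 : Eu n)‖ + 0 * |R|)) :=
      hx0.norm.add (hc0.mul_const _)
    rw [norm_zero, zero_mul, add_zero] at hl
    filter_upwards [hl.eventually (gt_mem_nhds hε)] with k hk z hz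
    refine lt_of_le_of_lt ((norm_add_le _ _).trans ?_) hk
    rw [norm_smul, Real.norm_of_nonneg (hc k).le]
    have := (mem_ball_zero_iff.1 hz).le.trans (le_abs_self R)
    have := (hc k).le
    gcongr
  have hpow : ∀ R : ℝ, ∀ᶠ i in atTop, ∀ z ∈ ball (0 : Eu n) R \ S,
      0 ≤ c i ^ a * u (x i + c i • z) ∧ c i ^ (a + 4) * src p u (x i + c i • z) =
        (c i ^ a * u (x i + c i • z)) ^ p := by
    intro R
    filter_upwards [hsm R (2 / 25) (by norm_num), hne R] with i h1 h2 z hz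
    have hu := h.pos _ ⟨mem_ball_zero_iff.2 ((h1 z hz.1).trans (by norm_num)), h2 z hz⟩
    have hci := (hc i).le
    refine ⟨mul_nonneg (Real.rpow_nonneg hci _) hu, ?_⟩
    rw [src_eq (h2 z hz) (h1 z hz.1).le, Real.mul_rpow (Real.rpow_nonneg hci _) hu,
      ← Real.rpow_mul hci, hap]
  obtain ⟨M, hM⟩ := h.rep'
  refine ⟨h.hn, h.hp, hκ, hS, hS0, fun R => (hpow R).mono fun i hi z hz => (hi z hz).1,
    fun i z => mul_nonneg (Real.rpow_nonneg (hc i).le _) (h.src_nonneg _), fun i => ?_, hloc,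
    fun y hy R => ?_, fun R ε hε => ?_, fun R => (hpow R).mono fun i hi z hz => (hi z hz).2⟩
  · exact ((integrable_affine (hc i) (x i) h.integrable_src).const_mul _).aestronglyMeasurable
  · obtain ⟨D, hD, H⟩ := hdom y hy R
    refine ⟨D, hD, ?_⟩
    filter_upwards [H, hpow R] with i h1 h2 z hz
    rw [(h2 z hz).2]; exact h1 z hz
  · have hl : Tendsto (fun k => c k ^ a * ((cN n)⁻¹ * M)) atTop
        (nhds (0 ^ a * ((cN n)⁻¹ * M))) := (hc0.rpow_const (Or.inr ha.le)).mul_const _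
    rw [Real.zero_rpow ha.ne', zero_mul] at hl
    filter_upwards [hsm R (1 / 25) (by norm_num), hne R, hl.eventually (gt_mem_nhds hε)]
      with i h1 h2 h3 z hz
    obtain ⟨k1, k2⟩ := hM _ (h2 z hz) (h1 z hz.1)
    have hcn : (0 : ℝ) < c i ^ (4 - n : ℝ) := Real.rpow_pos_of_pos (hc i) _
    have hsub : ∀ y, gam n (x i + c i • z - (x i + c i • y)) = c i ^ (4 - n : ℝ) * gam n (z - y) :=
      fun y => by rw [add_sub_add_left_eq_sub, ← smul_sub, gam_smul (hc i)]
    have e1 : c i ^ (4 - n : ℝ) * c i ^ n = c i ^ (4 : ℝ) := by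
      rw [← Real.rpow_natCast, ← Real.rpow_add (hc i)]; congr 1; ring
    constructor
    · have := (integrable_affine (hc i) (x i) k1).const_mul
        (c i ^ (a + 4) * (c i ^ (4 - n : ℝ))⁻¹)
      refine this.congr (.of_forall fun y => ?_)
      simp only [hsub]
      field_simp
    · rw [integral_affine (hc i) (x i)] at k2
      simp only [hsub, mul_assoc, integral_const_mul] at k2
      have e2 : (∫ y, gam n (z - y) * (c i ^ (a + 4) * src p u (x i + c i • y))) =
          c i ^ a * (c i ^ (4 : ℝ) * ∫ y, gam n (z - y) * src p u (x i + c i • y)) := by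
        rw [← mul_assoc, ← Real.rpow_add (hc i), ← integral_const_mul]
        congr 1; funext y; ring
      rw [mul_left_comm, ← mul_assoc, e1] at k2
      have hcN := cN_pos h.hn
      rw [e2]
      set J := c i ^ (4 : ℝ) * ∫ y, gam n (z - y) * src p u (x i + c i • y)
      have e3 : c i ^ a * u (x i + c i • z) - (cN n)⁻¹ * (c i ^ a * J) =
          c i ^ a * ((cN n)⁻¹ * (cN n * u (x i + c i • z) - J)) := by
        field_simp
      rw [e3, abs_mul, abs_mul, abs_of_pos (Real.rpow_pos_of_pos (hc i) _), abs_of_pos hκ]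
      refine le_trans ?_ h3.le
      gcongr
      exact (Real.rpow_pos_of_pos (hc i) _).le

theorem integral_gam_const {n : ℕ} (hn : 5 ≤ n) : ¬ Integrable (gam n) := by
  intro hi
  have : Nonempty (Fin n) := ⟨⟨0, by omega⟩⟩
  have e := integral_affine (n := n) two_pos 0 (gam n)
  simp only [zero_add, gam_smul two_pos, integral_const_mul] at e
  rw [← mul_assoc, ← Real.rpow_natCast, ← Real.rpow_add two_pos] at e
  have e4 : (2 : ℝ) ^ ((n : ℝ) + (4 - n)) = 16 := by
    rw [add_sub_cancel]; norm_num
  rw [e4] at e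
  have hpos : 0 < ∫ x, gam n x := by
    rw [integral_pos_iff_support_of_nonneg gam_nonneg hi]
    refine (measure_ball_pos volume (0 : Eu n) one_pos).trans_le ?_
    rw [← measure_sdiff_null (measure_singleton (0 : Eu n))]
    refine measure_mono fun x hx => ?_
    have : x ≠ 0 := hx.2
    exact (Real.rpow_pos_of_pos (norm_pos_iff.2 this) _).ne'
  linarith

theorem Sol.p_lt {n : ℕ} {p a : ℝ} {u : Eu n → ℝ} (h : Sol n p a u) :
    p * ((n : ℝ) - 4) < n + 4 := by
  have hp0 : 0 < p - 1 := by linarith [h.hp]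
  have := mul_lt_mul_of_pos_right h.ha1 hp0
  linarith [h.hap]

/-- Selection of a good point for the blow-up. -/
theorem Sol.exists_scale {n : ℕ} {p a : ℝ} {u : Eu n → ℝ} (h : Sol n p a u) {y : Eu n}
    (hy0 : y ≠ 0) (hy : ‖y‖ < 1 / 2) {N : ℝ} (hN : 0 < N) (hu : (2 * N) ^ a < ‖y‖ ^ a * u y) :
    ∃ (x : Eu n) (c : ℝ), 0 < c ∧ c * N ≤ ‖y‖ ∧ ‖x‖ ≤ 2 * ‖y‖ ∧ c ^ a * u x = 1 ∧
      ∀ z : Eu n, ‖z‖ ≤ N / 2 → x + c • z ≠ 0 ∧ c ^ a * u (x + c • z) ≤ 2 ^ a := by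
  have ha := h.a_pos
  have hyn : 0 < ‖y‖ := norm_pos_iff.2 hy0
  have hsub : closedBall y (‖y‖ / 2) ⊆ ball (0 : Eu n) 1 \ {0} := fun z hz => by
    rw [mem_closedBall_iff_norm] at hz
    refine ⟨mem_ball_zero_iff.2 ?_, ?_⟩
    · have := norm_le_norm_add_norm_sub' z y
      linarith
    · rintro rfl
      rw [zero_sub, norm_neg] at hz
      linarith
  have hcont : ContinuousOn (fun x => (‖y‖ / 2 - ‖x - y‖) ^ a * u x)
      (closedBall y (‖y‖ / 2)) :=
    (ContinuousOn.rpow_const (by fun_prop) fun _ _ => Or.inr ha.le).mul (h.contOn.mono hsub)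
  obtain ⟨x, hx, hmax⟩ := (isCompact_closedBall y (‖y‖ / 2)).exists_isMaxOn
    ⟨y, mem_closedBall_self (by positivity)⟩ hcont
  have hM : N ^ a < (‖y‖ / 2 - ‖x - y‖) ^ a * u x := by
    refine lt_of_lt_of_le ?_ (hmax (mem_closedBall_self (by positivity)))
    simp only [sub_self, norm_zero, sub_zero]
    rw [Real.div_rpow hyn.le two_pos.le, div_mul_eq_mul_div, lt_div_iff₀ (by positivity),
      mul_comm (N ^ a), ← Real.mul_rpow two_pos.le hN.le]
    exact hu
  have hux : 0 ≤ u x := h.pos x (hsub hx)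
  have hs0 : 0 ≤ ‖y‖ / 2 - ‖x - y‖ := sub_nonneg.2 (mem_closedBall_iff_norm.1 hx)
  have hNa : 0 < N ^ a := Real.rpow_pos_of_pos hN _
  set s := ‖y‖ / 2 - ‖x - y‖ with hs
  have hux' : 0 < u x := by
    refine lt_of_le_of_ne hux fun h0 => ?_
    rw [← h0, mul_zero] at hM
    linarith
  set c := u x ^ (-a⁻¹) with hc
  have hc0 : 0 < c := Real.rpow_pos_of_pos hux' _
  have hca : c ^ a * u x = 1 := by
    rw [hc, ← Real.rpow_mul hux, neg_mul, inv_mul_cancel₀ ha.ne', Real.rpow_neg_one,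
      inv_mul_cancel₀ hux'.ne']
  have hcN : c * N ≤ s := by
    rw [← Real.rpow_le_rpow_iff (by positivity) hs0 ha, Real.mul_rpow hc0.le hN.le]
    have : 0 < c ^ a := Real.rpow_pos_of_pos hc0 _
    calc c ^ a * N ^ a ≤ c ^ a * (s ^ a * u x) := by gcongr
      _ = s ^ a * (c ^ a * u x) := by ring
      _ = s ^ a := by rw [hca, mul_one]
  have hs1 : 0 < s := lt_of_lt_of_le (by positivity) hcN
  have hsy : s ≤ ‖y‖ / 2 := by rw [hs]; linarith [norm_nonneg (x - y)]
  refine ⟨x, c, hc0, by linarith, ?_, hca, fun z hz => ?_⟩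
  · have := norm_le_norm_add_norm_sub' x y
    linarith [mem_closedBall_iff_norm.1 hx]
  · have hcz : ‖c • z‖ ≤ s / 2 := by
      rw [norm_smul, Real.norm_of_nonneg hc0.le]
      calc c * ‖z‖ ≤ c * (N / 2) := by gcongr
        _ ≤ s / 2 := by linarith
    have hd : s / 2 ≤ ‖y‖ / 2 - ‖x + c • z - y‖ := by
      have : ‖x + c • z - y‖ ≤ ‖x - y‖ + ‖c • z‖ := by
        rw [add_sub_right_comm]; exact norm_add_le _ _
      linarith
    have hmem : x + c • z ∈ closedBall y (‖y‖ / 2) := by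
      rw [mem_closedBall_iff_norm]; linarith
    refine ⟨(hsub hmem).2, ?_⟩
    have hm : (‖y‖ / 2 - ‖x + c • z - y‖) ^ a * u (x + c • z) ≤ s ^ a * u x := hmax hmem
    have hu0 := h.pos _ (hsub hmem)
    have h1 : (s / 2) ^ a * u (x + c • z) ≤ s ^ a * u x :=
      le_trans (mul_le_mul_of_nonneg_right (Real.rpow_le_rpow (by positivity) hd ha.le) hu0) hm
    rw [Real.div_rpow hs1.le two_pos.le] at h1
    have hsa : 0 < s ^ a := Real.rpow_pos_of_pos hs1 _
    have h2a : (0 : ℝ) < 2 ^ a := by positivity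
    have h2 : u (x + c • z) ≤ 2 ^ a * u x := by
      have : s ^ a / 2 ^ a * u (x + c • z) = s ^ a * (u (x + c • z) / 2 ^ a) := by ring
      rw [this] at h1
      have h3 := le_of_mul_le_mul_left h1 hsa
      rwa [div_le_iff₀ h2a, mul_comm] at h3
    calc _ ≤ c ^ a * (2 ^ a * u x) := by gcongr
      _ = 2 ^ a * (c ^ a * u x) := by ring
      _ = 2 ^ a := by rw [hca, mul_one]

theorem IEq.false_of_forall {n : ℕ} {p κ : ℝ} {U : Eu n → ℝ}
    (h : ∀ q : Eu n, ∃ c0, IEq n p κ c0 q U) (h1 : U 0 = 1) : False := by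
  obtain ⟨c0, h0⟩ := h 0
  have : Nonempty (Fin n) := ⟨⟨0, by linarith [h0.hn]⟩⟩
  have hU : ∀ x, U x = 1 := fun x => by
    obtain ⟨c, hc⟩ := h ((2 : ℝ)⁻¹ • x)
    rw [← h1]
    refine hc.radial ?_
    rw [zero_sub, norm_neg]
    congr 1
    nth_rw 1 [← one_smul ℝ x]
    rw [← sub_smul]
    norm_num
  obtain ⟨q, hq⟩ := exists_ne (0 : Eu n)
  obtain ⟨c, hc⟩ := h q
  have := hc.int 0 hq.symm
  simp only [hU, Real.one_rpow, mul_one, zero_sub, gam_neg] at this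
  exact integral_gam_const h0.hn this

theorem Sol.upper {n : ℕ} {p a : ℝ} {u : Eu n → ℝ} (h : Sol n p a u) :
    ∃ C r : ℝ, 0 < r ∧ r < 1 ∧ ∀ x : Eu n, x ≠ 0 → ‖x‖ < r → ‖x‖ ^ a * u x ≤ C := by
  by_contra hcon
  push Not at hcon
  have ha := h.a_pos
  have : ∀ k : ℕ, ∃ y : Eu n, y ≠ 0 ∧ ‖y‖ < 1 / (k + 2 : ℝ) ∧
      (2 * (k + 1 : ℝ)) ^ a < ‖y‖ ^ a * u y := fun k => by
    refine hcon _ _ (by positivity) ?_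
    rw [div_lt_one (by positivity)]
    have : (0 : ℝ) ≤ k := k.cast_nonneg
    linarith
  choose y hy0 hy hyu using this
  have hy2 : ∀ k : ℕ, ‖y k‖ < 1 / 2 := fun k => (hy k).trans_le (by
    have : (0 : ℝ) ≤ k := k.cast_nonneg
    gcongr; linarith)
  choose x c hc hcN hx hcu hz using fun k : ℕ =>
    h.exists_scale (hy0 k) (hy2 k) (N := (k : ℝ) + 1) (by positivity) (hyu k)
  have hylim : Tendsto (fun k => ‖y k‖) atTop (nhds 0) := by
    refine squeeze_zero (fun k => norm_nonneg _) (fun k => (hy k).le) ?_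
    refine (tendsto_one_div_add_atTop_nhds_zero_nat (𝕜 := ℝ)).comp (tendsto_add_atTop_nat 1)
      |>.congr fun k => ?_
    simp only [Function.comp]; push_cast; ring
  have hclim : Tendsto c atTop (nhds 0) := by
    refine squeeze_zero (fun k => (hc k).le) (fun k => ?_) hylim
    have : (0 : ℝ) ≤ k := k.cast_nonneg
    nlinarith [hc k, hcN k]
  have hxlim : Tendsto x atTop (nhds 0) := by
    rw [tendsto_zero_iff_norm_tendsto_zero]
    refine squeeze_zero (fun k => norm_nonneg _) hx ?_
    simpa using hylim.const_mul 2
  have hbd : ∀ R : ℝ, ∀ᶠ k in atTop, ∀ z ∈ ball (0 : Eu n) R,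
      x k + c k • z ≠ 0 ∧ c k ^ a * u (x k + c k • z) ≤ 2 ^ a := fun R => by
    obtain ⟨N, hN⟩ := exists_nat_gt (2 * R)
    filter_upwards [eventually_ge_atTop N] with k hk z hzR
    refine hz k z ?_
    have : (N : ℝ) ≤ k := by exact_mod_cast hk
    linarith [mem_ball_zero_iff.1 hzR]
  have hcp : ∀ k, 0 < c k ^ a := fun k => Real.rpow_pos_of_pos (hc k) _
  have B := h.blow isClosed_empty (by simp) hc hclim hxlim
    (fun R => (hbd R).mono fun k hk z hz => (hk z hz.1).1)
    (fun y _ => ⟨1, 2 ^ a, one_pos, (hbd (‖y‖ + 1)).mono fun k hk z hz => (hk z (by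
      rw [mem_ball_iff_norm] at hz
      rw [mem_ball_zero_iff]
      linarith [norm_le_norm_add_norm_sub' z y])).2⟩)
    (fun y _ R => ⟨fun _ => (2 ^ a) ^ p,
      ((integrableOn_gam h.hn y 0 R).mono_set ball_subset_closedBall).mul_const _, by
      filter_upwards [hbd R, hbd R, hxlim.norm.eventually (gt_mem_nhds (by norm_num : ‖(0 : Eu n)‖
        < (1 : ℝ) / 2)), (hclim.mul_const |R|).eventually (gt_mem_nhds (by norm_num : 0 * |R| <
        (1 : ℝ) / 2))] with k hk _ h1 h2 z hz
      refine Real.rpow_le_rpow (mul_nonneg (hcp k).le (h.pos _ ⟨?_, (hk z hz.1).1⟩))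
        (hk z hz.1).2 (by linarith [h.hp])
      rw [mem_ball_zero_iff]
      refine (norm_add_le _ _).trans_lt ?_
      rw [norm_smul, Real.norm_of_nonneg (hc k).le]
      have := (mem_ball_zero_iff.1 hz.1).le.trans (le_abs_self R)
      have := mul_le_mul_of_nonneg_left this (hc k).le
      linarith⟩)
  obtain ⟨φ, hφ, U, -, hU⟩ := B.exists_subseq
  refine IEq.false_of_forall (U := U) (fun q => (B.comp hφ).isEq h.p_lt hU (fun x hx => hx.elim)
    (Set.empty_subset _)) ?_
  refine tendsto_nhds_unique (hU 0 (Set.notMem_empty _)) ?_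
  simp only [smul_zero, add_zero, hcu]
  exact tendsto_const_nhds

section


theorem tendsto_deriv_zero {l : Filter ℝ} (hl : ∀ h : ℝ, Tendsto (fun t => t + h) l l)
    {y z q : ℝ → ℝ} {M L : ℝ} (hy : ∀ t, HasDerivAt y (z t) t) (hz : ∀ t, HasDerivAt z (q t) t)
    (hq : ∀ t, |q t| ≤ M) (hL : Tendsto y l (nhds L)) : Tendsto z l (nhds 0) := by
  have hM : 0 ≤ M := (abs_nonneg _).trans (hq 0)
  have hlip : ∀ s t, |z s - z t| ≤ M * |s - t| := fun s t =>
    Convex.norm_image_sub_le_of_norm_hasDerivWithin_le (s := Set.univ)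
      (fun x _ => (hz x).hasDerivWithinAt) (fun x _ => hq x) convex_univ trivial trivial
  rw [Metric.tendsto_nhds]
  intro ε hε
  set h := ε / (2 * (M + 1)) with hh
  have hh0 : 0 < h := by positivity
  have hd : Tendsto (fun t => (y (t + h) - y t) / h) l (nhds ((L - L) / h)) :=
    ((hL.comp (hl h)).sub hL).div_const h
  rw [sub_self, zero_div] at hd
  filter_upwards [(Metric.tendsto_nhds.1 hd) (ε / 2) (half_pos hε)] with t ht
  obtain ⟨ξ, hξ, e⟩ := exists_hasDerivAt_eq_slope y z (lt_add_of_pos_right t hh0)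
    (fun x _ => (hy x).continuousAt.continuousWithinAt) (fun x _ => hy x)
  rw [add_sub_cancel_left] at e
  rw [← e] at ht
  rw [Real.dist_eq, sub_zero] at ht ⊢
  have h1 := hlip ξ t
  have h2 : |ξ - t| ≤ h := by
    rw [abs_of_pos (sub_pos.2 hξ.1)]; linarith [hξ.2]
  have h3 : M * |ξ - t| ≤ ε / 2 := by
    calc _ ≤ (M + 1) * h := by gcongr; linarith
      _ = ε / 2 := by rw [hh]; field_simp
  have h4 : |z t| ≤ |z ξ| + |z ξ - z t| := by
    have := abs_sub_abs_le_abs_sub (z t) (z ξ)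
    rw [abs_sub_comm] at this
    linarith
  linarith

/-- Bounded nonnegative entire orbits of the fourth-order equation in logarithmic variables. -/
structure Orbit (p A B G K M : ℝ) (v0 v1 v2 v3 : ℝ → ℝ) : Prop where
  hp : 1 < p
  hA : A < 0
  hG : G < 0
  hK : 0 < K
  nonneg : ∀ t, 0 ≤ v0 t
  d0 : ∀ t, HasDerivAt v0 (v1 t) t
  d1 : ∀ t, HasDerivAt v1 (v2 t) t
  d2 : ∀ t, HasDerivAt v2 (v3 t) t
  d3 : ∀ t, HasDerivAt v3 (v0 t ^ p - A * v3 t - B * v2 t + G * v1 t - K * v0 t) t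
  b0 : ∀ t, |v0 t| ≤ M
  b1 : ∀ t, |v1 t| ≤ M
  b2 : ∀ t, |v2 t| ≤ M
  b3 : ∀ t, |v3 t| ≤ M

/-- The energy. -/
noncomputable def energy (p A B K : ℝ) (v0 v1 v2 v3 : ℝ → ℝ) (t : ℝ) : ℝ :=
  v3 t * v1 t - v2 t ^ 2 / 2 + A * v2 t * v1 t + B * v1 t ^ 2 / 2 + K * v0 t ^ 2 / 2 -
    v0 t ^ (p + 1) / (p + 1)

theorem abs_mul_le_of_le {x y M N : ℝ} (hx : |x| ≤ M) (hy : |y| ≤ N) : |x * y| ≤ M * N := by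
  rw [abs_mul]
  exact mul_le_mul hx hy (abs_nonneg _) ((abs_nonneg _).trans hx)

theorem abs_add_le_of_le {x y M N : ℝ} (hx : |x| ≤ M) (hy : |y| ≤ N) : |x + y| ≤ M + N :=
  (abs_add_le x y).trans (add_le_add hx hy)

theorem abs_sub_le_of_le {x y M N : ℝ} (hx : |x| ≤ M) (hy : |y| ≤ N) : |x - y| ≤ M + N :=
  (abs_sub x y).trans (add_le_add hx hy)

variable {p A B G K M : ℝ} {v0 v1 v2 v3 : ℝ → ℝ}

theorem Orbit.hasDerivAt_energy (h : Orbit p A B G K M v0 v1 v2 v3) (t : ℝ) :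
    HasDerivAt (energy p A B K v0 v1 v2 v3) (G * v1 t ^ 2 + A * v2 t ^ 2) t := by
  have hp := h.hp
  have h0 := h.d0 t
  have h1 := h.d1 t
  have h2 := h.d2 t
  have h3 := h.d3 t
  have hr : HasDerivAt (fun s => v0 s ^ (p + 1)) (v1 t * (p + 1) * v0 t ^ p) t := by
    have := h0.rpow_const (p := p + 1) (Or.inr (by linarith))
    rwa [add_sub_cancel_right] at this
  have := ((((((h3.mul h1).sub ((h2.pow 2).div_const 2)).add ((h2.const_mul A).mul h1)).add
    (((h1.pow 2).const_mul B).div_const 2)).add (((h0.pow 2).const_mul K).div_const 2)).sub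
    (hr.div_const (p + 1)))
  refine this.congr_deriv ?_
  have : p + 1 ≠ 0 := by linarith
  field_simp
  ring

theorem Orbit.rpow_le (h : Orbit p A B G K M v0 v1 v2 v3) {r : ℝ} (hr : 0 < r) (t : ℝ) :
    |v0 t ^ r| ≤ M ^ r := by
  rw [abs_of_nonneg (Real.rpow_nonneg (h.nonneg t) _)]
  exact Real.rpow_le_rpow (h.nonneg t) ((le_abs_self _).trans (h.b0 t)) hr.le

theorem Orbit.antitone_energy (h : Orbit p A B G K M v0 v1 v2 v3) :
    Antitone (energy p A B K v0 v1 v2 v3) :=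
  antitone_of_hasDerivAt_nonpos h.hasDerivAt_energy fun t => by
    have := mul_nonneg (neg_nonneg.2 h.hG.le) (sq_nonneg (v1 t))
    have := mul_nonneg (neg_nonneg.2 h.hA.le) (sq_nonneg (v2 t))
    simp only [Pi.zero_apply]
    linarith

theorem Orbit.exists_energy_bound (h : Orbit p A B G K M v0 v1 v2 v3) :
    ∃ C, ∀ t, |energy p A B K v0 v1 v2 v3 t| ≤ C := by
  refine ⟨M * M + M ^ 2 / 2 + |A| * M * M + |B| * M ^ 2 / 2 + |K| * M ^ 2 / 2 +
    M ^ (p + 1) / (p + 1), fun t => ?_⟩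
  have hp := h.hp
  have e : ∀ x : ℝ, |x| ≤ M → |x ^ 2| ≤ M ^ 2 := fun x hx => by
    rw [abs_pow]; gcongr
  unfold energy
  refine abs_sub_le_of_le (abs_add_le_of_le (abs_add_le_of_le (abs_add_le_of_le
    (abs_sub_le_of_le (abs_mul_le_of_le (h.b3 t) (h.b1 t)) ?_) ?_) ?_) ?_) ?_
  · rw [abs_div, abs_two]; gcongr; exact e _ (h.b2 t)
  · exact abs_mul_le_of_le (abs_mul_le_of_le le_rfl (h.b2 t)) (h.b1 t)
  · rw [abs_div, abs_two]; gcongr; exact abs_mul_le_of_le le_rfl (e _ (h.b1 t))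
  · rw [abs_div, abs_two]; gcongr; exact abs_mul_le_of_le le_rfl (e _ (h.b0 t))
  · rw [abs_div, abs_of_pos (by linarith : 0 < p + 1)]; gcongr; exact h.rpow_le (by linarith) t

/-- If the energy converges along a translation-invariant filter, the nonlinearity tends to zero. -/
theorem Orbit.tendsto_aux (h : Orbit p A B G K M v0 v1 v2 v3) {l : Filter ℝ}
    (hl : ∀ c : ℝ, Tendsto (fun t => t + c) l l) {L : ℝ}
    (hE : Tendsto (energy p A B K v0 v1 v2 v3) l (nhds L)) :
    Tendsto (fun t => v0 t ^ p - K * v0 t) l (nhds 0) ∧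
      Tendsto (fun t => K * v0 t ^ 2 / 2 - v0 t ^ (p + 1) / (p + 1)) l (nhds L) := by
  have hp := h.hp
  have hd : ∀ t, HasDerivAt (fun t => G * v1 t ^ 2 + A * v2 t ^ 2)
      (2 * G * (v1 t * v2 t) + 2 * A * (v2 t * v3 t)) t := fun t => by
    refine ((((h.d1 t).pow 2).const_mul G).add (((h.d2 t).pow 2).const_mul A)).congr_deriv ?_
    ring
  have hz := tendsto_deriv_zero hl h.hasDerivAt_energy hd
    (M := |2 * G| * (M * M) + |2 * A| * (M * M)) (fun t => abs_add_le_of_le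
      (abs_mul_le_of_le le_rfl (abs_mul_le_of_le (h.b1 t) (h.b2 t)))
      (abs_mul_le_of_le le_rfl (abs_mul_le_of_le (h.b2 t) (h.b3 t)))) hE
  have sq : ∀ {x : ℝ → ℝ} {c : ℝ}, c < 0 → (∀ t, -c * x t ^ 2 ≤ -(G * v1 t ^ 2 + A * v2 t ^ 2)) →
      Tendsto x l (nhds 0) := fun {x c} hc hx => by
    have h1 : Tendsto (fun t => x t ^ 2) l (nhds 0) := by
      refine squeeze_zero (g := fun t => -(G * v1 t ^ 2 + A * v2 t ^ 2) / (-c))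
        (fun t => sq_nonneg _) (fun t => ?_) (by simpa using (hz.neg).div_const (-c))
      rw [le_div_iff₀ (neg_pos.2 hc), mul_comm]
      exact hx t
    have h2 := h1.sqrt
    simp only [Real.sqrt_sq_eq_abs, Real.sqrt_zero] at h2
    exact (tendsto_zero_iff_abs_tendsto_zero _).2 h2
  have t1 : Tendsto v1 l (nhds 0) := sq h.hG fun t => by
    have := mul_nonneg (neg_nonneg.2 h.hA.le) (sq_nonneg (v2 t))
    linarith
  have t2 : Tendsto v2 l (nhds 0) := sq h.hA fun t => by
    have := mul_nonneg (neg_nonneg.2 h.hG.le) (sq_nonneg (v1 t))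
    linarith
  set v4 : ℝ → ℝ := fun t => v0 t ^ p - A * v3 t - B * v2 t + G * v1 t - K * v0 t with hv4
  have bd4 : ∀ t, |v4 t| ≤ M ^ p + |A| * M + |B| * M + |G| * M + |K| * M := fun t =>
    abs_sub_le_of_le (abs_add_le_of_le (abs_sub_le_of_le (abs_sub_le_of_le
      (h.rpow_le (by linarith) t) (abs_mul_le_of_le le_rfl (h.b3 t)))
      (abs_mul_le_of_le le_rfl (h.b2 t))) (abs_mul_le_of_le le_rfl (h.b1 t)))
      (abs_mul_le_of_le le_rfl (h.b0 t))
  have t3 : Tendsto v3 l (nhds 0) := tendsto_deriv_zero hl h.d2 h.d3 bd4 t2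
  have d4 : ∀ t, HasDerivAt v4 (p * (v1 t * v0 t ^ (p - 1)) - A * v4 t - B * v3 t + G * v2 t
      - K * v1 t) t := fun t => by
    refine ((((((h.d0 t).rpow_const (p := p) (Or.inr hp.le)).sub ((h.d3 t).const_mul A)).sub
      ((h.d2 t).const_mul B)).add ((h.d1 t).const_mul G)).sub ((h.d0 t).const_mul K)).congr_deriv ?_
    simp only [hv4]
    ring
  have t4 : Tendsto v4 l (nhds 0) := tendsto_deriv_zero hl h.d3 d4
    (M := |p| * (M * M ^ (p - 1)) + |A| * (M ^ p + |A| * M + |B| * M + |G| * M + |K| * M)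
      + |B| * M + |G| * M + |K| * M) (fun t =>
    abs_sub_le_of_le (abs_add_le_of_le (abs_sub_le_of_le (abs_sub_le_of_le
      (abs_mul_le_of_le le_rfl (abs_mul_le_of_le (h.b1 t) (h.rpow_le (by linarith) t)))
      (abs_mul_le_of_le le_rfl (bd4 t)))
      (abs_mul_le_of_le le_rfl (h.b3 t))) (abs_mul_le_of_le le_rfl (h.b2 t)))
      (abs_mul_le_of_le le_rfl (h.b1 t))) t3
  constructor
  · have := ((t4.add (t3.const_mul A)).add (t2.const_mul B)).sub (t1.const_mul G)
    simp only [mul_zero, add_zero, sub_zero] at this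
    refine this.congr fun t => ?_
    simp only [hv4]; ring
  · have := (((hE.sub (t3.mul t1)).add ((t2.pow 2).div_const 2)).sub
      ((t2.const_mul A).mul t1)).sub (((t1.pow 2).const_mul B).div_const 2)
    norm_num at this
    refine this.congr fun t => ?_
    simp only [energy]; ring

theorem Orbit.limit_dichotomy (h : Orbit p A B G K M v0 v1 v2 v3) {l : Filter ℝ} [l.NeBot]
    (hl : ∀ P : ℝ → Prop, (∀ᶠ t in l, P t) → ∃ I : Set ℝ, I.OrdConnected ∧ I ∈ l ∧ ∀ t ∈ I, P t)
    (hQ : Tendsto (fun t => v0 t ^ p - K * v0 t) l (nhds 0)) :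
    Tendsto v0 l (nhds 0) ∨ Tendsto v0 l (nhds (K ^ (1 / (p - 1)))) := by
  have hp := h.hp
  have hp1 : 0 < p - 1 := by linarith
  have hK := h.hK
  set m := K ^ (1 / (p - 1)) / 2 with hm
  have hm0 : 0 < m := by positivity
  have hmp : m ^ (p - 1) < K := by
    rw [hm, Real.div_rpow (by positivity) two_pos.le, ← Real.rpow_mul hK.le,
      one_div_mul_cancel hp1.ne', Real.rpow_one]
    exact div_lt_self hK (Real.one_lt_rpow one_lt_two hp1)
  have hfac : ∀ t, v0 t ^ p - K * v0 t = v0 t * (v0 t ^ (p - 1) - K) := fun t => by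
    rcases (h.nonneg t).eq_or_lt with h0 | h0
    · rw [← h0, Real.zero_rpow (by linarith)]; ring
    · rw [Real.rpow_sub_one h0.ne']; field_simp
  have hne : ∀ᶠ t in l, v0 t ≠ m := by
    have hpos : 0 < m * (K - m ^ (p - 1)) := mul_pos hm0 (sub_pos.2 hmp)
    filter_upwards [hQ.eventually (lt_mem_nhds (neg_lt_zero.2 hpos))] with t ht e
    rw [hfac, e] at ht
    linarith
  obtain ⟨I, hI, hIl, hIP⟩ := hl _ hne
  have hc : Continuous v0 := continuous_iff_continuousAt.2 fun t => (h.d0 t).continuousAt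
  obtain ⟨t0, ht0⟩ := l.nonempty_of_mem hIl
  have hpre : IsPreconnected (v0 '' I) := hI.isPreconnected.image _ hc.continuousOn
  rcases lt_or_gt_of_ne (hIP t0 ht0) with hlt | hgt
  · left
    have hall : ∀ t ∈ I, v0 t < m := fun t ht => by
      by_contra hge
      obtain ⟨s, hs, e⟩ := hpre.Icc_subset ⟨t0, ht0, rfl⟩ ⟨t, ht, rfl⟩ ⟨hlt.le, not_lt.1 hge⟩
      exact hIP s hs e
    have hpos : 0 < K - m ^ (p - 1) := sub_pos.2 hmp
    have hz : Tendsto (fun t => -(v0 t ^ p - K * v0 t) / (K - m ^ (p - 1))) l (nhds 0) := by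
      simpa using hQ.neg.div_const (K - m ^ (p - 1))
    refine squeeze_zero' (.of_forall h.nonneg) ?_ hz
    filter_upwards [hIl] with t ht
    rw [le_div_iff₀ hpos, hfac, ← mul_neg]
    have : v0 t ^ (p - 1) ≤ m ^ (p - 1) := Real.rpow_le_rpow (h.nonneg t) (hall t ht).le hp1.le
    exact mul_le_mul_of_nonneg_left (by linarith) (h.nonneg t)
  · right
    have hall : ∀ t ∈ I, m < v0 t := fun t ht => by
      by_contra hge
      obtain ⟨s, hs, e⟩ := hpre.Icc_subset ⟨t, ht, rfl⟩ ⟨t0, ht0, rfl⟩ ⟨not_lt.1 hge, hgt.le⟩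
      exact hIP s hs e
    have h1 : Tendsto (fun t => v0 t ^ (p - 1) - K) l (nhds 0) := by
      refine squeeze_zero_norm' (a := fun t => |v0 t ^ p - K * v0 t| / m) ?_
        (by simpa using hQ.abs.div_const m)
      filter_upwards [hIl] with t ht
      rw [le_div_iff₀ hm0, hfac, abs_mul, mul_comm, Real.norm_eq_abs]
      gcongr
      exact (hall t ht).le.trans (le_abs_self _)
    have h2 : Tendsto (fun t => v0 t ^ (p - 1)) l (nhds K) := by
      simpa using h1.add_const K
    refine (h2.rpow_const (p := 1 / (p - 1)) (Or.inl hK.ne')).congr fun t => ?_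
    rw [← Real.rpow_mul (h.nonneg t), mul_one_div_cancel hp1.ne', Real.rpow_one]

theorem Orbit.limit (h : Orbit p A B G K M v0 v1 v2 v3) {l : Filter ℝ} [l.NeBot]
    (hs : ∀ c : ℝ, Tendsto (fun t => t + c) l l)
    (hl : ∀ P : ℝ → Prop, (∀ᶠ t in l, P t) → ∃ I : Set ℝ, I.OrdConnected ∧ I ∈ l ∧ ∀ t ∈ I, P t)
    {L : ℝ} (hE : Tendsto (energy p A B K v0 v1 v2 v3) l (nhds L)) :
    (Tendsto v0 l (nhds 0) ∧ L = 0) ∨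
      (Tendsto v0 l (nhds (K ^ (1 / (p - 1)))) ∧
        L = K * (K ^ (1 / (p - 1))) ^ 2 * (1 / 2 - 1 / (p + 1))) := by
  have hp := h.hp
  have hK := h.hK
  obtain ⟨hQ, hP⟩ := h.tendsto_aux hs hE
  have hlim : ∀ {c : ℝ}, Tendsto v0 l (nhds c) → L = K * c ^ 2 / 2 - c ^ (p + 1) / (p + 1) :=
    fun {c} hc => tendsto_nhds_unique hP ((((hc.pow 2).const_mul K).div_const 2).sub
      ((hc.rpow_const (Or.inr (by linarith))).div_const (p + 1)))
  rcases h.limit_dichotomy hl hQ with h0 | h0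
  · refine Or.inl ⟨h0, ?_⟩
    rw [hlim h0, Real.zero_rpow (by linarith)]
    simp
  · refine Or.inr ⟨h0, ?_⟩
    rw [hlim h0]
    have e : (K ^ (1 / (p - 1))) ^ (p + 1) = K * (K ^ (1 / (p - 1))) ^ 2 := by
      have hC : 0 < K ^ (1 / (p - 1)) := by positivity
      have hp1 : p - 1 ≠ 0 := by linarith
      rw [show p + 1 = (p - 1) + 2 by ring, Real.rpow_add hC, ← Real.rpow_mul hK.le,
        one_div_mul_cancel hp1, Real.rpow_one]
      norm_cast
    rw [e]
    ring

theorem Orbit.eq_const (h : Orbit p A B G K M v0 v1 v2 v3) {L : ℝ}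
    (h1 : Tendsto (energy p A B K v0 v1 v2 v3) atBot (nhds L))
    (h2 : Tendsto (energy p A B K v0 v1 v2 v3) atTop (nhds L)) (s t : ℝ) : v0 s = v0 t := by
  have hE : ∀ t, energy p A B K v0 v1 v2 v3 t = L := fun t =>
    le_antisymm (h.antitone_energy.ge_of_tendsto h1 t) (h.antitone_energy.le_of_tendsto h2 t)
  have hz : ∀ t, v1 t = 0 := fun t => by
    have e : energy p A B K v0 v1 v2 v3 = fun _ => L := funext hE
    have hd := h.hasDerivAt_energy t
    rw [e] at hd
    have h0 := hd.unique (hasDerivAt_const t L)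
    have := mul_nonneg (neg_nonneg.2 h.hA.le) (sq_nonneg (v2 t))
    have h3 : -G * v1 t ^ 2 ≤ 0 := by linarith
    have h4 : v1 t ^ 2 ≤ 0 := by
      by_contra hpos
      have := mul_pos (neg_pos.2 h.hG) (not_le.1 hpos)
      linarith
    exact pow_eq_zero_iff two_ne_zero |>.1 (le_antisymm h4 (sq_nonneg _))
  exact is_const_of_deriv_eq_zero (fun t => (h.d0 t).differentiableAt)
    (fun t => by rw [(h.d0 t).deriv, hz]) s t

theorem Orbit.exists_energy_limits (h : Orbit p A B G K M v0 v1 v2 v3) :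
    ∃ L1 L2 : ℝ, L2 ≤ L1 ∧ Tendsto (energy p A B K v0 v1 v2 v3) atBot (nhds L1) ∧
      Tendsto (energy p A B K v0 v1 v2 v3) atTop (nhds L2) := by
  obtain ⟨C, hC⟩ := h.exists_energy_bound
  have h1 := tendsto_atBot_ciSup h.antitone_energy
    ⟨C, by rintro _ ⟨t, rfl⟩; exact (abs_le.1 (hC t)).2⟩
  have h2 := tendsto_atTop_ciInf h.antitone_energy
    ⟨-C, by rintro _ ⟨t, rfl⟩; exact (abs_le.1 (hC t)).1⟩
  exact ⟨_, _, (h.antitone_energy.le_of_tendsto h2 0).trans (h.antitone_energy.ge_of_tendsto h1 0),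
    h1, h2⟩

theorem Orbit.dichotomy (h : Orbit p A B G K M v0 v1 v2 v3) :
    (∀ t, v0 t = 0) ∨ (∀ t, v0 t = K ^ (1 / (p - 1))) ∨
      (Tendsto v0 atBot (nhds (K ^ (1 / (p - 1)))) ∧ Tendsto v0 atTop (nhds 0)) := by
  have hp := h.hp
  have hK := h.hK
  obtain ⟨L1, L2, hL, t1, t2⟩ := h.exists_energy_limits
  have hpos : 0 < K * (K ^ (1 / (p - 1))) ^ 2 * (1 / 2 - 1 / (p + 1)) := by
    have : 0 < 1 / 2 - 1 / (p + 1) := by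
      rw [sub_pos, one_div_lt_one_div (by linarith) two_pos]; linarith
    positivity
  have r1 := h.limit (l := atBot) (fun c => tendsto_atBot_add_const_right _ c tendsto_id)
    (fun P hP => by
      obtain ⟨N, hN⟩ := eventually_atBot.1 hP
      exact ⟨Set.Iic N, Set.ordConnected_Iic, Iic_mem_atBot N, hN⟩) t1
  have r2 := h.limit (l := atTop) (fun c => tendsto_atTop_add_const_right _ c tendsto_id)
    (fun P hP => by
      obtain ⟨N, hN⟩ := eventually_atTop.1 hP
      exact ⟨Set.Ici N, Set.ordConnected_Ici, Ici_mem_atTop N, hN⟩) t2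
  rcases r1 with ⟨a1, e1⟩ | ⟨a1, e1⟩ <;> rcases r2 with ⟨a2, e2⟩ | ⟨a2, e2⟩
  · left
    rw [e1] at t1; rw [e2] at t2
    intro t
    exact tendsto_nhds_unique (tendsto_const_nhds.congr fun s => h.eq_const t1 t2 t s) a1
  · linarith
  · exact Or.inr (Or.inr ⟨a1, a2⟩)
  · right; left
    rw [e1] at t1; rw [e2] at t2
    intro t
    exact tendsto_nhds_unique (tendsto_const_nhds.congr fun s => h.eq_const t1 t2 t s) a1

end


theorem exists_bounded_solution_neg {μ : ℝ} (hμ : μ < 0) {f : ℝ → ℝ} (hf : Continuous f) {M : ℝ}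
    (hM : ∀ t, |f t| ≤ M) :
    ∃ (y : ℝ → ℝ) (C : ℝ), (∀ t, HasDerivAt y (μ * y t + f t) t) ∧ ∀ t, |y t| ≤ C := by
  have hνpos : 0 < -μ := neg_pos.2 hμ
  have hc : Continuous fun s => Real.exp (-μ * s) * f s := by fun_prop
  have hi : ∀ t, IntegrableOn (fun s => Real.exp (-μ * s) * f s) (Set.Iic t) := fun t =>
    (integrableOn_exp_mul_Iic hνpos t).mul_bdd (c := M) hf.aestronglyMeasurable
      (.of_forall fun s => hM s)
  have he : ∀ t, ∫ s in Set.Iic t, Real.exp (-μ * s) * f s =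
      (∫ s in Set.Iic 0, Real.exp (-μ * s) * f s) + ∫ s in (0 : ℝ)..t, Real.exp (-μ * s) * f s :=
    fun t => by rw [← intervalIntegral.integral_Iic_sub_Iic (hi 0) (hi t)]; ring
  refine ⟨fun t => Real.exp (μ * t) * ∫ s in Set.Iic t, Real.exp (-μ * s) * f s, M / (-μ),
    fun t => ?_, fun t => ?_⟩
  · have h1 : HasDerivAt (fun t => Real.exp (μ * t)) (Real.exp (μ * t) * μ) t := by
      simpa using ((hasDerivAt_id t).const_mul μ).exp
    have h2 : HasDerivAt (fun t => ∫ s in Set.Iic t, Real.exp (-μ * s) * f s)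
        (Real.exp (-μ * t) * f t) t := by
      exact ((hc.integral_hasStrictDerivAt 0 t).hasDerivAt.const_add _).congr_of_eventuallyEq
        (.of_forall he)
    refine (h1.mul h2).congr_deriv ?_
    have : Real.exp (μ * t) * Real.exp (-μ * t) = 1 := by
      rw [← Real.exp_add]; simp
    linear_combination f t * this
  · rw [abs_mul, abs_of_pos (Real.exp_pos _)]
    have h1 : |∫ s in Set.Iic t, Real.exp (-μ * s) * f s| ≤
        ∫ s in Set.Iic t, Real.exp (-μ * s) * M := by
      refine abs_integral_le_integral_abs.trans (integral_mono (hi t).abs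
        ((integrableOn_exp_mul_Iic hνpos t).mul_const M) fun s => ?_)
      simp only
      rw [abs_mul, abs_of_pos (Real.exp_pos _)]
      exact mul_le_mul_of_nonneg_left (hM s) (Real.exp_pos _).le
    rw [integral_mul_const, integral_exp_mul_Iic hνpos] at h1
    have : Real.exp (μ * t) * Real.exp (-μ * t) = 1 := by
      rw [← Real.exp_add]; simp
    calc _ ≤ Real.exp (μ * t) * (Real.exp (-μ * t) / -μ * M) := by gcongr
      _ = (Real.exp (μ * t) * Real.exp (-μ * t)) * (M / -μ) := by ring
      _ = _ := by rw [this, one_mul]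

theorem exists_bounded_solution {μ : ℝ} (hμ : μ ≠ 0) {f : ℝ → ℝ} (hf : Continuous f) {M : ℝ}
    (hM : ∀ t, |f t| ≤ M) :
    ∃ (y : ℝ → ℝ) (C : ℝ), (∀ t, HasDerivAt y (μ * y t + f t) t) ∧ ∀ t, |y t| ≤ C := by
  rcases lt_or_gt_of_ne hμ with h | h
  · exact exists_bounded_solution_neg h hf hM
  · obtain ⟨y, C, hy, hC⟩ := exists_bounded_solution_neg (neg_lt_zero.2 h)
      (f := fun t => -f (-t)) (by fun_prop) (fun t => by rw [abs_neg]; exact hM _)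
    refine ⟨fun t => y (-t), C, fun t => ?_, fun t => hC _⟩
    refine ((hy (-t)).comp t (hasDerivAt_neg t)).congr_deriv ?_
    rw [neg_neg]; ring

theorem eq_zero_of_bounded {μ : ℝ} (hμ : μ ≠ 0) {F : ℝ → ℝ} {M : ℝ}
    (hF : ∀ t, HasDerivAt F (μ * F t) t) (hM : ∀ t, |F t| ≤ M) (t : ℝ) : F t = 0 := by
  have hd : ∀ s, HasDerivAt (fun s => Real.exp (-μ * s) * F s) 0 s := fun s => by
    have h1 : HasDerivAt (fun t => Real.exp (-μ * t)) (Real.exp (-μ * s) * (-μ)) s := by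
      simpa using ((hasDerivAt_id s).const_mul (-μ)).exp
    refine (h1.mul (hF s)).congr_deriv ?_
    ring
  have hc : ∀ s, Real.exp (-μ * s) * F s = Real.exp (-μ * t) * F t := fun s =>
    is_const_of_deriv_eq_zero (fun s => (hd s).differentiableAt) (fun s => (hd s).deriv) s t
  by_contra hne
  have hK : 0 < |Real.exp (-μ * t) * F t| := by positivity
  have hlim : Tendsto (fun r : ℝ => Real.exp (-μ * (μ * r)) * M) atTop (nhds (0 * M)) := by
    refine Tendsto.mul_const _ (Real.tendsto_exp_atBot.comp ?_)
    have : (fun r : ℝ => -μ * (μ * r)) = fun r => -(μ ^ 2) * r := by funext r; ring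
    rw [this]
    exact tendsto_id.const_mul_atTop_of_neg (neg_lt_zero.2 (by positivity))
  rw [zero_mul] at hlim
  obtain ⟨r, hr⟩ := (hlim.eventually (gt_mem_nhds hK)).exists
  rw [← hc (μ * r), abs_mul, abs_of_pos (Real.exp_pos _)] at hr
  exact absurd hr (not_lt.2 (mul_le_mul_of_nonneg_left (hM _) (Real.exp_pos _).le))

/-- The first-order operator `D + μ`. -/
noncomputable def dop (μ : ℝ) (χ : ℝ → ℝ) (t : ℝ) : ℝ := deriv χ t + μ * χ t

theorem contDiff_dop {μ : ℝ} {χ : ℝ → ℝ} (h : ContDiff ℝ ((⊤ : ℕ∞) : WithTop ℕ∞) χ) :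
    ContDiff ℝ ((⊤ : ℕ∞) : WithTop ℕ∞) (dop μ χ) :=
  ((contDiff_infty_iff_deriv.1 h).2).add (contDiff_const.mul h)

theorem hasCompactSupport_dop {μ : ℝ} {χ : ℝ → ℝ} (h : HasCompactSupport χ) :
    HasCompactSupport (dop μ χ) := h.deriv.add h.mul_left

theorem dop_comp_add (μ : ℝ) (χ : ℝ → ℝ) (x : ℝ) :
    dop μ (fun s => χ (s + x)) = fun s => dop μ χ (s + x) := by
  funext s
  simp only [dop, deriv_comp_add_const]

theorem integral_mul_dop {μ : ℝ} {y g χ : ℝ → ℝ} (hy : ∀ t, HasDerivAt y (μ * y t + g t) t)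
    (hg : Continuous g) (hχ : ContDiff ℝ ((⊤ : ℕ∞) : WithTop ℕ∞) χ) (hc : HasCompactSupport χ) :
    ∫ t, y t * dop μ χ t = -∫ t, g t * χ t := by
  have hyc : Continuous y := continuous_iff_continuousAt.2 fun t => (hy t).continuousAt
  have hdc : Continuous (deriv χ) := hχ.continuous_deriv (by simp)
  have i1 : Integrable fun t => y t * dop μ χ t :=
    (hyc.mul (contDiff_dop hχ).continuous).integrable_of_hasCompactSupport
      (hasCompactSupport_dop hc).mul_left
  have i2 : Integrable fun t => g t * χ t :=
    (hg.mul hχ.continuous).integrable_of_hasCompactSupport hc.mul_left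
  have hd : ∀ t, HasDerivAt (fun t => y t * χ t) (y t * dop μ χ t + g t * χ t) t := fun t => by
    refine ((hy t).mul (hχ.differentiable (by simp) t).hasDerivAt).congr_deriv ?_
    simp only [dop]; ring
  have hz := integral_eq_zero_of_hasDerivAt_of_integrable hd (i1.add i2)
    ((hyc.mul hχ.continuous).integrable_of_hasCompactSupport hc.mul_left)
  rw [integral_add i1 i2] at hz
  linarith

theorem integral_shift_eq_zero {μ M : ℝ} (hμ : μ ≠ 0) {h χ : ℝ → ℝ} (hh : Continuous h)
    (hM : ∀ t, |h t| ≤ M) (hχ : ContDiff ℝ ((⊤ : ℕ∞) : WithTop ℕ∞) χ) (hc : HasCompactSupport χ)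
    (H : ∀ x, ∫ s, h s * dop μ χ (s + x) = 0) (x : ℝ) : ∫ s, h s * χ (s + x) = 0 := by
  have hdc : Continuous (deriv χ) := hχ.continuous_deriv (by simp)
  have conv : ∀ g : ℝ → ℝ, ∀ x, convolution (fun s => h (-s)) g (ContinuousLinearMap.mul ℝ ℝ)
      volume x = ∫ s, h s * g (s + x) := fun g x => by
    rw [convolution, ← integral_neg_eq_self]
    simp only [ContinuousLinearMap.mul_apply', neg_neg, sub_neg_eq_add, add_comm x]
  have hd : ∀ x, HasDerivAt (fun x => ∫ s, h s * χ (s + x)) (∫ s, h s * deriv χ (s + x)) x :=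
    fun x => by
      have := hc.hasDerivAt_convolution_right (ContinuousLinearMap.mul ℝ ℝ) (μ := volume)
        ((hh.comp continuous_neg).locallyIntegrable :
          LocallyIntegrable (fun s => h (-s)) volume) (hχ.of_le (by simp)) x
      rw [show h ∘ (fun a => -a) = fun s => h (-s) from rfl, conv] at this
      exact this.congr_of_eventuallyEq (.of_forall fun x => (conv χ x).symm)
  have i : ∀ {g : ℝ → ℝ}, Continuous g → HasCompactSupport g → ∀ x,
      Integrable fun s => h s * g (s + x) := fun hg hgc x =>
    (hh.mul (hg.comp (continuous_add_const x))).integrable_of_hasCompactSupport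
      (HasCompactSupport.mul_left (hgc.comp_homeomorph (Homeomorph.addRight x)))
  refine eq_zero_of_bounded (μ := -μ) (neg_ne_zero.2 hμ) (M := M * ∫ s, |χ s|)
    (F := fun x => ∫ s, h s * χ (s + x)) (fun x => ?_) (fun x => ?_) x
  · refine (hd x).congr_deriv ?_
    have := H x
    simp only [dop, mul_add] at this
    rw [integral_add (i hdc hc.deriv x)] at this
    · have e : ∫ s, h s * (μ * χ (s + x)) = μ * ∫ s, h s * χ (s + x) := by
        rw [← integral_const_mul]; congr 1; funext s; ring
      rw [e] at this
      linarith
    · exact ((i hχ.continuous hc x).const_mul μ).congr (.of_forall fun s => by ring)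
  · rw [← integral_add_right_eq_self (fun s => |χ s|) x, ← integral_const_mul]
    refine abs_integral_le_integral_abs.trans (integral_mono (i hχ.continuous hc x).abs
      ((((hχ.continuous.comp (continuous_add_const x)).integrable_of_hasCompactSupport
        (hc.comp_homeomorph (Homeomorph.addRight x))).abs).const_mul M) fun s => ?_)
    simp only [abs_mul]
    exact mul_le_mul_of_nonneg_right (hM s) (abs_nonneg _)

theorem exists_system {μ1 μ2 μ3 μ4 M N : ℝ} (h1 : μ1 ≠ 0) (h2 : μ2 ≠ 0) (h3 : μ3 ≠ 0)
    (h4 : μ4 ≠ 0) {V f : ℝ → ℝ} (hV : Continuous V) (hf : Continuous f) (hM : ∀ t, |V t| ≤ M)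
    (hN : ∀ t, |f t| ≤ N)
    (H : ∀ ψ : ℝ → ℝ, ContDiff ℝ ((⊤ : ℕ∞) : WithTop ℕ∞) ψ → HasCompactSupport ψ →
      ∫ t, V t * dop μ1 (dop μ2 (dop μ3 (dop μ4 ψ))) t = ∫ t, f t * ψ t) :
    ∃ (y2 y3 y4 : ℝ → ℝ) (C : ℝ), (∀ t, |y2 t| ≤ C ∧ |y3 t| ≤ C ∧ |y4 t| ≤ C) ∧
      ∀ t, HasDerivAt V (μ1 * V t + y2 t) t ∧ HasDerivAt y2 (μ2 * y2 t + y3 t) t ∧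
        HasDerivAt y3 (μ3 * y3 t + y4 t) t ∧ HasDerivAt y4 (μ4 * y4 t + f t) t := by
  have cont : ∀ {y g : ℝ → ℝ} {μ : ℝ}, (∀ t, HasDerivAt y (μ * y t + g t) t) → Continuous y :=
    fun hy => continuous_iff_continuousAt.2 fun t => (hy t).continuousAt
  obtain ⟨y4, C4, hy4, hC4⟩ := exists_bounded_solution h4 hf hN
  obtain ⟨y3, C3, hy3, hC3⟩ := exists_bounded_solution h3 (cont hy4) hC4
  obtain ⟨y2, C2, hy2, hC2⟩ := exists_bounded_solution h2 (cont hy3) hC3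
  obtain ⟨y1, C1, hy1, hC1⟩ := exists_bounded_solution h1 (cont hy2) hC2
  set h : ℝ → ℝ := fun t => V t - y1 t with hh
  have hhc : Continuous h := hV.sub (cont hy1)
  have hhb : ∀ t, |h t| ≤ M + C1 := fun t => abs_sub_le_of_le (hM t) (hC1 t)
  have hz : ∀ ψ : ℝ → ℝ, ContDiff ℝ ((⊤ : ℕ∞) : WithTop ℕ∞) ψ → HasCompactSupport ψ →
      ∫ t, h t * dop μ1 (dop μ2 (dop μ3 (dop μ4 ψ))) t = 0 := fun ψ hψ hc => by
    have c4 := contDiff_dop (μ := μ4) hψ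
    have c3 := contDiff_dop (μ := μ3) c4
    have c2 := contDiff_dop (μ := μ2) c3
    have c1 := contDiff_dop (μ := μ1) c2
    have s4 := hasCompactSupport_dop (μ := μ4) hc
    have s3 := hasCompactSupport_dop (μ := μ3) s4
    have s2 := hasCompactSupport_dop (μ := μ2) s3
    have s1 := hasCompactSupport_dop (μ := μ1) s2
    have i1 : Integrable fun t => V t * dop μ1 (dop μ2 (dop μ3 (dop μ4 ψ))) t :=
      (hV.mul c1.continuous).integrable_of_hasCompactSupport s1.mul_left
    have i2 : Integrable fun t => y1 t * dop μ1 (dop μ2 (dop μ3 (dop μ4 ψ))) t :=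
      ((cont hy1).mul c1.continuous).integrable_of_hasCompactSupport s1.mul_left
    simp only [hh, sub_mul]
    rw [integral_sub i1 i2, H ψ hψ hc,
      integral_mul_dop hy1 (cont hy2) c2 s2, integral_mul_dop hy2 (cont hy3) c3 s3,
      integral_mul_dop hy3 (cont hy4) c4 s4, integral_mul_dop hy4 hf hψ hc]
    ring
  have hz0 : ∀ ψ : ℝ → ℝ, ContDiff ℝ ((⊤ : ℕ∞) : WithTop ℕ∞) ψ → HasCompactSupport ψ →
      ∫ t, h t * ψ t = 0 := fun ψ hψ hc => by
    have c4 := contDiff_dop (μ := μ4) hψ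
    have c3 := contDiff_dop (μ := μ3) c4
    have c2 := contDiff_dop (μ := μ2) c3
    have s4 := hasCompactSupport_dop (μ := μ4) hc
    have s3 := hasCompactSupport_dop (μ := μ3) s4
    have s2 := hasCompactSupport_dop (μ := μ2) s3
    have k := integral_shift_eq_zero h4 hhc hhb hψ hc (integral_shift_eq_zero h3 hhc hhb c4 s4
      (integral_shift_eq_zero h2 hhc hhb c3 s3 (integral_shift_eq_zero h1 hhc hhb c2 s2
        fun x => ?_))) 0
    · simpa using k
    · have := hz (fun s => ψ (s + x)) (hψ.comp (contDiff_id.add contDiff_const))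
        (hc.comp_homeomorph (Homeomorph.addRight x))
      simpa only [dop_comp_add] using this
  have h0 : h = fun _ => 0 := by
    refine (hhc.ae_eq_iff_eq volume continuous_const).1 ?_
    refine ae_eq_zero_of_integral_contDiff_smul_eq_zero hhc.locallyIntegrable fun ψ hψ hc => ?_
    simp only [smul_eq_mul, mul_comm (ψ _)]
    exact hz0 ψ hψ hc
  have hVy : V = y1 := funext fun t => by
    have := congrFun h0 t
    simp only [hh] at this
    linarith
  refine ⟨y2, y3, y4, max C2 (max C3 C4), fun t => ⟨(hC2 t).trans (le_max_left _ _),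
    (hC3 t).trans ((le_max_left _ _).trans (le_max_right _ _)),
    (hC4 t).trans ((le_max_right _ _).trans (le_max_right _ _))⟩, fun t =>
    ⟨hVy ▸ hy1 t, hy2 t, hy3 t, hy4 t⟩⟩

theorem lapLog_eq_dop (n : ℕ) (β : ℝ) {g : ℝ → ℝ}
    (hg : ContDiff ℝ ((⊤ : ℕ∞) : WithTop ℕ∞) g) :
    lapLog n β g = dop β (dop (β + n - 2) g) := by
  funext t
  have hd : HasDerivAt (dop (β + n - 2) g) (deriv (deriv g) t + (β + n - 2) * deriv g t) t :=
    (((contDiff_infty_iff_deriv.1 hg).2.differentiable (by simp) t).hasDerivAt).add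
      ((hg.differentiable (by simp) t).hasDerivAt.const_mul _)
  simp only [lapLog, dop] at hd ⊢
  rw [hd.deriv]
  ring


/-- The zeroth-order coefficient of the operator in logarithmic coordinates. -/
noncomputable def coefK (n : ℕ) (a : ℝ) : ℝ := a * (a + 2) * ((n : ℝ) - 2 - a) * ((n : ℝ) - 4 - a)

theorem coefK_pos {n : ℕ} {a : ℝ} (ha : 0 < a) (ha2 : a < (n : ℝ) - 4) : 0 < coefK n a := by
  have h1 : 0 < (n : ℝ) - 2 - a := by linarith
  have h2 : 0 < (n : ℝ) - 4 - a := by linarith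
  unfold coefK
  positivity

/-- Bounded nonnegative weak solutions of the equation in logarithmic coordinates. -/
structure LogSol (n : ℕ) (p a C : ℝ) (V : ℝ → ℝ) : Prop where
  cont : Continuous V
  nonneg : ∀ t, 0 ≤ V t
  le : ∀ t, V t ≤ C
  weak : ∀ ψ : ℝ → ℝ, ContDiff ℝ ((⊤ : ℕ∞) : WithTop ℕ∞) ψ → HasCompactSupport ψ →
    ∫ t, V t * lapLog n (a + 2 - n) (lapLog n (a + 4 - n) ψ) t = ∫ t, V t ^ p * ψ t

theorem LogSol.exists_orbit {n : ℕ} {p a C : ℝ} {V : ℝ → ℝ} (h : LogSol n p a C V) (hp : 1 < p)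
    (ha : 0 < a) (ha1 : ((n : ℝ) - 4) / 2 < a) (ha2 : a < (n : ℝ) - 4) :
    ∃ (A B G M : ℝ) (v1 v2 v3 : ℝ → ℝ), Orbit p A B G (coefK n a) M V v1 v2 v3 := by
  have habs : ∀ t, |V t| ≤ C := fun t => by rw [abs_of_nonneg (h.nonneg t)]; exact h.le t
  have hf : Continuous fun t => V t ^ p := h.cont.rpow_const fun _ => .inr (by linarith)
  obtain ⟨y2, y3, y4, C', hC, hy⟩ := exists_system (μ1 := a + 2 - n) (μ2 := a) (μ3 := a + 4 - n)
    (μ4 := a + 2) (M := C) (N := C ^ p) (f := fun t => V t ^ p) (by linarith) ha.ne'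
    (by linarith) (by linarith) h.cont hf habs
    (fun t => by
      rw [abs_of_nonneg (Real.rpow_nonneg (h.nonneg t) p)]
      exact Real.rpow_le_rpow (h.nonneg t) (h.le t) (by linarith))
    (fun ψ hψ hc => by
      rw [← h.weak ψ hψ hc, lapLog_eq_dop n _ hψ, lapLog_eq_dop n _ (contDiff_dop (contDiff_dop hψ)),
        show a + 2 - (n : ℝ) + n - 2 = a by ring, show a + 4 - (n : ℝ) + n - 2 = a + 2 by ring])
  set μ1 : ℝ := a + 2 - n with h1
  set μ3 : ℝ := a + 4 - n with h3
  have k1 : ∀ t, |μ1 * V t + y2 t| ≤ |μ1| * C + C' := fun t =>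
    abs_add_le_of_le (abs_mul_le_of_le le_rfl (habs t)) (hC t).1
  have k2 : ∀ t, |μ1 * (μ1 * V t + y2 t) + (a * y2 t + y3 t)| ≤
      |μ1| * (|μ1| * C + C') + (|a| * C' + C') := fun t =>
    abs_add_le_of_le (abs_mul_le_of_le le_rfl (k1 t))
      (abs_add_le_of_le (abs_mul_le_of_le le_rfl (hC t).1) (hC t).2.1)
  have k3 : ∀ t, |μ1 * (μ1 * (μ1 * V t + y2 t) + (a * y2 t + y3 t)) +
      (a * (a * y2 t + y3 t) + (μ3 * y3 t + y4 t))| ≤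
      |μ1| * (|μ1| * (|μ1| * C + C') + (|a| * C' + C')) +
        (|a| * (|a| * C' + C') + (|μ3| * C' + C')) := fun t =>
    abs_add_le_of_le (abs_mul_le_of_le le_rfl (k2 t)) (abs_add_le_of_le (abs_mul_le_of_le le_rfl
      (abs_add_le_of_le (abs_mul_le_of_le le_rfl (hC t).1) (hC t).2.1))
      (abs_add_le_of_le (abs_mul_le_of_le le_rfl (hC t).2.1) (hC t).2.2))
  obtain ⟨M, hM0, hM1, hM2, hM3⟩ : ∃ M, C ≤ M ∧ |μ1| * C + C' ≤ M ∧
      |μ1| * (|μ1| * C + C') + (|a| * C' + C') ≤ M ∧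
      |μ1| * (|μ1| * (|μ1| * C + C') + (|a| * C' + C')) +
        (|a| * (|a| * C' + C') + (|μ3| * C' + C')) ≤ M :=
    ⟨max (max _ _) (max _ _), (le_max_left _ _).trans (le_max_left _ _),
      (le_max_right _ _).trans (le_max_left _ _), (le_max_left _ _).trans (le_max_right _ _),
      (le_max_right _ _).trans (le_max_right _ _)⟩
  have d1 : ∀ t, HasDerivAt (fun t => μ1 * V t + y2 t)
      (μ1 * (μ1 * V t + y2 t) + (a * y2 t + y3 t)) t := fun t =>
    ((hy t).1.const_mul μ1).add (hy t).2.1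
  have e1 : ∀ t, HasDerivAt (fun t => a * y2 t + y3 t)
      (a * (a * y2 t + y3 t) + (μ3 * y3 t + y4 t)) t := fun t =>
    ((hy t).2.1.const_mul a).add (hy t).2.2.1
  refine ⟨2 * ((n : ℝ) - 4 - 2 * a), ((n : ℝ) - 2 - 2 * a) * ((n : ℝ) - 6 - 2 * a) -
    a * ((n : ℝ) - 2 - a) - (a + 2) * ((n : ℝ) - 4 - a),
    ((n : ℝ) - 4 - 2 * a) * (a * ((n : ℝ) - 2 - a) + (a + 2) * ((n : ℝ) - 4 - a) + 4), M, _, _, _,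
    hp, by linarith, ?_, coefK_pos ha ha2, h.nonneg, fun t => (hy t).1, d1,
    fun t => ((d1 t).const_mul μ1).add (e1 t), fun t => ?_, fun t => (habs t).trans hM0,
    fun t => (k1 t).trans hM1, fun t => (k2 t).trans hM2, fun t => (k3 t).trans hM3⟩
  · refine mul_neg_of_neg_of_pos (by linarith) ?_
    have := mul_pos ha (show 0 < (n : ℝ) - 2 - a by linarith)
    have := mul_pos (show 0 < a + 2 by linarith) (show 0 < (n : ℝ) - 4 - a by linarith)
    linarith
  · refine ((((d1 t).const_mul μ1).add (e1 t)).const_mul μ1 |>.add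
      (((e1 t).const_mul a).add (((hy t).2.2.1.const_mul μ3).add (hy t).2.2.2))).congr_deriv ?_
    simp only [coefK, h1, h3]
    ring

/-- A bounded solution that does not vanish at one point converges to the positive constant. -/
theorem LogSol.tendsto_atBot {n : ℕ} {p a C : ℝ} {V : ℝ → ℝ} (h : LogSol n p a C V) (hp : 1 < p)
    (ha : 0 < a) (ha1 : ((n : ℝ) - 4) / 2 < a) (ha2 : a < (n : ℝ) - 4) (h0 : V 0 ≠ 0) :
    Tendsto V atBot (nhds (coefK n a ^ (1 / (p - 1)))) := by
  obtain ⟨A, B, G, M, v1, v2, v3, ho⟩ := h.exists_orbit hp ha ha1 ha2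
  rcases ho.dichotomy with hd | hd | hd
  · exact absurd (hd 0) h0
  · rw [funext hd]; exact tendsto_const_nhds
  · exact hd.1

theorem LogSol.eq_of_close {n : ℕ} {p a C : ℝ} {V : ℝ → ℝ} (h : LogSol n p a C V) (hp : 1 < p)
    (ha : 0 < a) (ha1 : ((n : ℝ) - 4) / 2 < a) (ha2 : a < (n : ℝ) - 4)
    {δ : ℝ} (hδ : δ < coefK n a ^ (1 / (p - 1)))
    (hc : ∀ t, 0 ≤ t → |V t - coefK n a ^ (1 / (p - 1))| ≤ δ) :
    V 0 = coefK n a ^ (1 / (p - 1)) := by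
  obtain ⟨A, B, G, M, v1, v2, v3, ho⟩ := h.exists_orbit hp ha ha1 ha2
  rcases ho.dichotomy with hd | hd | hd
  · have := hc 0 le_rfl
    rw [hd 0, zero_sub, abs_neg] at this
    exact absurd ((le_abs_self _).trans this) (not_le.2 hδ)
  · exact hd 0
  · have := le_of_tendsto (hd.2.sub_const (coefK n a ^ (1 / (p - 1)))).abs
      ((eventually_ge_atTop 0).mono hc)
    rw [zero_sub, abs_neg] at this
    exact absurd ((le_abs_self _).trans this) (not_le.2 hδ)


theorem radLog_smul {n : ℕ} (β : ℝ) (g : ℝ → ℝ) {c : ℝ} (hc : 0 < c) (z : Eu n) :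
    radLog β (fun t => g (t - Real.log c)) (c • z) = c ^ β * radLog β g z := by
  by_cases hz : z = 0
  · simp [hz]
  have hz0 := norm_pos_iff.2 hz
  rw [radLog_of_ne _ _ (smul_ne_zero hc.ne' hz), radLog_of_ne _ _ hz, norm_smul,
    Real.norm_of_nonneg hc.le, Real.mul_rpow hc.le hz0.le, Real.log_mul hc.ne' hz0.ne',
    add_sub_cancel_left, mul_assoc]

theorem Sol.ap {n : ℕ} {p a : ℝ} {u : Eu n → ℝ} (h : Sol n p a u) : a * p = a + 4 := by
  linear_combination h.hap

theorem Sol.weak_scaled {n : ℕ} {p a : ℝ} {u : Eu n → ℝ} (h : Sol n p a u) {c : ℝ} (hc : 0 < c)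
    {ψ : ℝ → ℝ} (hψ : ContDiff ℝ ((⊤ : ℕ∞) : WithTop ℕ∞) ψ) {T : ℝ} (h1 : ∀ t < -T, ψ t = 0)
    (h2 : ∀ t, T < t → ψ t = 0) (hcT : c * Real.exp T < 1) :
    ∫ z, (c ^ a * u (c • z)) * bilap (radLog (a + 4 - n) ψ) z =
      ∫ z, (c ^ a * u (c • z)) ^ p * radLog (a + 4 - n) ψ z := by
  set β : ℝ := a + 4 - n with hβ
  have hψc : ContDiff ℝ ((⊤ : ℕ∞) : WithTop ℕ∞) fun t => ψ (t - Real.log c) :=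
    hψ.comp (contDiff_id.sub contDiff_const)
  have k1 : ∀ t < -T + Real.log c, ψ (t - Real.log c) = 0 := fun t ht => h1 _ (by linarith)
  have k2 : ∀ t, T + Real.log c < t → ψ (t - Real.log c) = 0 := fun t ht => h2 _ (by linarith)
  have E := weak_test h ((contDiff_radLog β hψc k1).of_le four_le_top)
    (hasCompactSupport_radLog β k1 k2) (fun x hx => by
      have := tsupport_radLog_subset β k1 k2 hx
      refine ⟨?_, fun hx0 => ?_⟩
      · rw [mem_ball_zero_iff]
        refine this.2.trans_lt ?_
        rwa [Real.exp_add, Real.exp_log hc, mul_comm]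
      · rw [Set.mem_singleton_iff] at hx0
        rw [hx0] at this
        exact absurd this.1 (by simpa using Real.exp_pos _))
  rw [integral_affine hc 0 fun x => u x * bilap (radLog β fun t => ψ (t - Real.log c)) x,
    integral_affine hc 0 fun x => u x ^ p * radLog β (fun t => ψ (t - Real.log c)) x] at E
  have E' := mul_left_cancel₀ (pow_pos hc n).ne' E
  simp only [zero_add, radLog_smul β ψ hc] at E'
  have hb : ∀ z : Eu n, bilap (radLog β fun t => ψ (t - Real.log c)) (c • z) =
      c ^ (β - 4) * bilap (radLog β ψ) z := fun z => by
    rw [bilap_radLog' β (hψc.of_le four_le_top) k1, bilap_radLog' β (hψ.of_le four_le_top) h1,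
      lapLog_comp_sub, lapLog_comp_sub, radLog_smul _ _ hc]
  simp only [hb] at E'
  have hca : 0 < c ^ a := Real.rpow_pos_of_pos hc a
  have e1 : ∫ z, (c ^ a * u (c • z)) * bilap (radLog β ψ) z =
      c ^ (a + 4 - β) * ∫ z : Eu n, u (c • z) * (c ^ (β - 4) * bilap (radLog β ψ) z) := by
    rw [← integral_const_mul]
    congr 1; funext z
    have : c ^ a = c ^ (a + 4 - β) * c ^ (β - 4) := by rw [← Real.rpow_add hc]; congr 1; ring
    rw [this]; ring
  have e2 : ∫ z, (c ^ a * u (c • z)) ^ p * radLog β ψ z =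
      c ^ (a + 4 - β) * ∫ z : Eu n, u (c • z) ^ p * (c ^ β * radLog β ψ z) := by
    rw [← integral_const_mul]
    congr 1; funext z
    by_cases hz : z ∈ tsupport (radLog β ψ : Eu n → ℝ)
    · have hs := tsupport_radLog_subset β h1 h2 hz
      have hz0 : 0 < ‖z‖ := (Real.exp_pos _).trans_le hs.1
      have hu : 0 ≤ u (c • z) := h.pos _ ⟨by
        rw [mem_ball_zero_iff, norm_smul, Real.norm_of_nonneg hc.le]
        exact (mul_le_mul_of_nonneg_left hs.2 hc.le).trans_lt hcT,
        smul_ne_zero hc.ne' (norm_pos_iff.1 hz0)⟩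
      rw [Real.mul_rpow hca.le hu, ← Real.rpow_mul hc.le, h.ap]
      have : c ^ (a + 4) = c ^ (a + 4 - β) * c ^ β := by rw [← Real.rpow_add hc]; congr 1; ring
      rw [this]; ring
    · rw [image_eq_zero_of_notMem_tsupport hz]; ring
  rw [e1, e2, E']

theorem tendsto_integral_mul_of_compact {n : ℕ} {χ : Eu n → ℝ} (hχ : Continuous χ)
    (hc : HasCompactSupport χ) {G : ℕ → Eu n → ℝ} {G0 : Eu n → ℝ} {M : ℝ}
    (hG : ∀ᶠ k in atTop, AEStronglyMeasurable (fun x => G k x * χ x) volume)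
    (hM : ∀ᶠ k in atTop, ∀ x ∈ tsupport χ, |G k x| ≤ M)
    (hl : ∀ x ∈ tsupport χ, Tendsto (fun k => G k x) atTop (nhds (G0 x))) :
    Tendsto (fun k => ∫ x, G k x * χ x) atTop (nhds (∫ x, G0 x * χ x)) := by
  refine tendsto_integral_filter_of_dominated_convergence (fun x => M * |χ x|) hG ?_
    ((hχ.integrable_of_hasCompactSupport hc).abs.const_mul M) (.of_forall fun x => ?_)
  · filter_upwards [hM] with k hk
    refine .of_forall fun x => ?_
    rw [Real.norm_eq_abs, abs_mul]
    by_cases hx : x ∈ tsupport χ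
    · exact mul_le_mul_of_nonneg_right (hk x hx) (abs_nonneg _)
    · simp [image_eq_zero_of_notMem_tsupport hx]
  · by_cases hx : x ∈ tsupport χ
    · exact (hl x hx).mul_const _
    · simp [image_eq_zero_of_notMem_tsupport hx]

section

variable {n : ℕ} {p a C r : ℝ} {u : Eu n → ℝ}

theorem scaled_le (hub : ∀ x : Eu n, x ≠ 0 → ‖x‖ < r → ‖x‖ ^ a * u x ≤ C) {c : ℝ}
    (hc : 0 < c) {z : Eu n} (hz : z ≠ 0) (hr : c * ‖z‖ < r) :
    c ^ a * u (c • z) ≤ C * ‖z‖ ^ (-a) := by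
  have hz0 := norm_pos_iff.2 hz
  have := hub (c • z) (smul_ne_zero hc.ne' hz) (by rwa [norm_smul, Real.norm_of_nonneg hc.le])
  rw [norm_smul, Real.norm_of_nonneg hc.le, Real.mul_rpow hc.le hz0.le] at this
  rw [Real.rpow_neg hz0.le, ← div_eq_mul_inv, le_div_iff₀ (Real.rpow_pos_of_pos hz0 _)]
  linarith

theorem Sol.blow_zero (h : Sol n p a u) (hr : 0 < r) (hr1 : r < 1) (hC : 0 ≤ C)
    (hub : ∀ x : Eu n, x ≠ 0 → ‖x‖ < r → ‖x‖ ^ a * u x ≤ C) {c : ℕ → ℝ} (hc : ∀ k, 0 < c k)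
    (hc0 : Tendsto c atTop (nhds 0)) :
    ∃ f, Blow n p (cN n)⁻¹ {0} (fun k z => c k ^ a * u (c k • z)) f := by
  have : Nonempty (Fin n) := ⟨⟨0, by linarith [h.hn]⟩⟩
  have ha := h.a_pos
  have hsm : ∀ R : ℝ, ∀ᶠ k in atTop, ∀ z ∈ ball (0 : Eu n) R, c k * ‖z‖ < r := fun R => by
    filter_upwards [(hc0.mul_const |R|).eventually (gt_mem_nhds (by simpa using hr))] with k hk z hz
    exact (mul_le_mul_of_nonneg_left ((mem_ball_zero_iff.1 hz).le.trans (le_abs_self R))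
      (hc k).le).trans_lt hk
  suffices hB : Blow n p (cN n)⁻¹ {0} (fun k z => c k ^ a * u (0 + c k • z))
      (fun k z => c k ^ (a + 4) * src p u (0 + c k • z)) from
    ⟨_, by simpa only [zero_add] using hB⟩
  refine h.blow (x := fun _ => 0) isClosed_singleton (by simp) hc hc0
    tendsto_const_nhds (fun R => .of_forall fun k z hz => ?_) (fun y hy => ?_) fun y hy R => ?_
  · rw [zero_add]; exact smul_ne_zero (hc k).ne' hz.2
  · have hy0 : 0 < ‖y‖ := norm_pos_iff.2 hy
    refine ⟨‖y‖ / 2, C * (‖y‖ / 2) ^ (-a), by positivity, ?_⟩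
    filter_upwards [hsm (‖y‖ + ‖y‖ / 2)] with k hk z hz
    have h1 : ‖y‖ / 2 ≤ ‖z‖ := by
      have := norm_le_norm_add_norm_sub' y z
      rw [mem_ball_iff_norm, norm_sub_rev] at hz
      linarith
    have h2 : ‖z‖ < ‖y‖ + ‖y‖ / 2 := by
      have := norm_le_norm_add_norm_sub' z y
      rw [mem_ball_iff_norm] at hz
      linarith
    have hz0 : z ≠ 0 := norm_pos_iff.1 (by linarith)
    rw [zero_add]
    refine (scaled_le hub (hc k) hz0 (hk z (by rwa [mem_ball_zero_iff]))).trans ?_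
    refine mul_le_mul_of_nonneg_left ?_ hC
    exact Real.rpow_le_rpow_of_nonpos (by positivity) h1 (by linarith)
  · have hy0 : 0 < ‖y‖ := norm_pos_iff.2 hy
    refine ⟨(closedBall (0 : Eu n) R).indicator fun z => C ^ p * ‖z‖ ^ (-(a + 4)),
      (integrable_gam_mul h.hn (δ := ‖y‖ / 2) (C := C ^ p * (‖y‖ / 2) ^ (-(a + 4)))
        ?_ y (by positivity) fun z hz => ?_).integrableOn, ?_⟩
    · rw [integrable_indicator_iff measurableSet_closedBall]
      exact ((locallyIntegrable_norm_rpow (by linarith [h.hn]) (by linarith [h.ha2])).integrableOn_isCompact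
        (isCompact_closedBall _ _)).const_mul _
    · by_cases hzR : z ∈ closedBall (0 : Eu n) R
      · rw [Set.indicator_of_mem hzR, abs_of_nonneg (by positivity)]
        refine mul_le_mul_of_nonneg_left ?_ (by positivity)
        refine Real.rpow_le_rpow_of_nonpos (by positivity) ?_ (by linarith)
        have := norm_le_norm_add_norm_sub' y z
        rw [mem_closedBall_iff_norm, norm_sub_rev] at hz
        linarith
      · rw [Set.indicator_of_notMem hzR, abs_zero]; positivity
    · filter_upwards [hsm R] with k hk z hz
      rw [zero_add, Set.indicator_of_mem (ball_subset_closedBall hz.1)]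
      have hz0 : 0 < ‖z‖ := norm_pos_iff.2 hz.2
      have hlt := hk z hz.1
      have hu : 0 ≤ u (c k • z) := h.pos _ ⟨by
        rw [mem_ball_zero_iff, norm_smul, Real.norm_of_nonneg (hc k).le]
        exact hlt.trans hr1, smul_ne_zero (hc k).ne' hz.2⟩
      refine (Real.rpow_le_rpow (mul_nonneg (Real.rpow_nonneg (hc k).le _) hu)
        (scaled_le hub (hc k) hz.2 hlt) (by linarith [h.hp])).trans_eq ?_
      rw [Real.mul_rpow hC (by positivity), ← Real.rpow_mul hz0.le, neg_mul, h.ap]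

theorem Sol.weak_limit (h : Sol n p a u) (hr : 0 < r) (hr1 : r < 1) (hC : 0 ≤ C)
    (hub : ∀ x : Eu n, x ≠ 0 → ‖x‖ < r → ‖x‖ ^ a * u x ≤ C) {c : ℕ → ℝ} (hc : ∀ k, 0 < c k)
    (hc0 : Tendsto c atTop (nhds 0)) {U : Eu n → ℝ}
    (hU : ∀ x ≠ 0, Tendsto (fun k => c k ^ a * u (c k • x)) atTop (nhds (U x)))
    {ψ : ℝ → ℝ} (hψ : ContDiff ℝ ((⊤ : ℕ∞) : WithTop ℕ∞) ψ) {T : ℝ} (h1 : ∀ t < -T, ψ t = 0)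
    (h2 : ∀ t, T < t → ψ t = 0) :
    ∫ z, U z * bilap (radLog (a + 4 - n) ψ) z = ∫ z, U z ^ p * radLog (a + 4 - n) ψ z := by
  have ha := h.a_pos
  set φ : Eu n → ℝ := radLog (a + 4 - n) ψ with hφ
  have hφs : ContDiff ℝ 4 φ := (contDiff_radLog _ hψ h1).of_le four_le_top
  have hφc : HasCompactSupport φ := hasCompactSupport_radLog _ h1 h2
  have hsub : tsupport φ ⊆ {x | Real.exp (-T) ≤ ‖x‖ ∧ ‖x‖ ≤ Real.exp T} :=
    tsupport_radLog_subset _ h1 h2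
  have hsm : ∀ᶠ k in atTop, c k * Real.exp T < r :=
    (hc0.mul_const _).eventually (gt_mem_nhds (by simpa using hr))
  have key : ∀ {k}, c k * Real.exp T < r → ∀ x : Eu n, Real.exp (-T) ≤ ‖x‖ → ‖x‖ ≤ Real.exp T →
      c k • x ∈ ball (0 : Eu n) 1 \ {0} ∧ 0 ≤ c k ^ a * u (c k • x) ∧
        c k ^ a * u (c k • x) ≤ C * Real.exp (-T) ^ (-a) := fun {k} hk x hx1 hx2 => by
    have hx0 : x ≠ 0 := norm_pos_iff.1 ((Real.exp_pos _).trans_le hx1)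
    have hlt : c k * ‖x‖ < r := (mul_le_mul_of_nonneg_left hx2 (hc k).le).trans_lt hk
    have hm : c k • x ∈ ball (0 : Eu n) 1 \ {0} := ⟨by
      rw [mem_ball_zero_iff, norm_smul, Real.norm_of_nonneg (hc k).le]
      exact hlt.trans hr1, smul_ne_zero (hc k).ne' hx0⟩
    refine ⟨hm, mul_nonneg (Real.rpow_nonneg (hc k).le _) (h.pos _ hm),
      (scaled_le hub (hc k) hx0 hlt).trans (mul_le_mul_of_nonneg_left ?_ hC)⟩
    exact Real.rpow_le_rpow_of_nonpos (Real.exp_pos _) hx1 (by linarith)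
  have hcont : ∀ k, ContinuousOn (fun x => c k ^ a * u (c k • x))
      ((fun x : Eu n => c k • x) ⁻¹' (ball 0 1 \ {0})) := fun k =>
    continuousOn_const.mul (h.contOn.comp (continuous_const_smul (c k)).continuousOn fun x hx => hx)
  have hop : ∀ k, IsOpen ((fun x : Eu n => c k • x) ⁻¹' (ball 0 1 \ {0})) := fun k =>
    (isOpen_punctured n).preimage (continuous_const_smul (c k))
  have hne : ∀ x ∈ tsupport φ, x ≠ 0 := fun x hx =>
    norm_pos_iff.1 ((Real.exp_pos _).trans_le (hsub hx).1)
  have L1 := tendsto_integral_mul_of_compact (continuous_bilap hφs)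
    (hφc.of_isClosed_subset (isClosed_tsupport _) (tsupport_bilap_subset φ))
    (G := fun k x => c k ^ a * u (c k • x)) (G0 := U) (M := C * Real.exp (-T) ^ (-a))
    (hsm.mono fun k hk => (continuous_mul_of_tsupport (hop k) (hcont k) (continuous_bilap hφs)
      fun x hx => (key hk x (hsub (tsupport_bilap_subset φ hx)).1
        (hsub (tsupport_bilap_subset φ hx)).2).1).aestronglyMeasurable)
    (hsm.mono fun k hk x hx => by
      have := key hk x (hsub (tsupport_bilap_subset φ hx)).1 (hsub (tsupport_bilap_subset φ hx)).2
      rw [abs_of_nonneg this.2.1]; exact this.2.2)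
    (fun x hx => hU x (hne x (tsupport_bilap_subset φ hx)))
  have L2 := tendsto_integral_mul_of_compact hφs.continuous hφc
    (G := fun k x => (c k ^ a * u (c k • x)) ^ p) (G0 := fun x => U x ^ p)
    (M := (C * Real.exp (-T) ^ (-a)) ^ p)
    (hsm.mono fun k hk => (continuous_mul_of_tsupport (hop k)
      ((hcont k).rpow_const fun _ _ => .inr (by linarith [h.hp])) hφs.continuous
      fun x hx => (key hk x (hsub hx).1 (hsub hx).2).1).aestronglyMeasurable)
    (hsm.mono fun k hk x hx => by
      have := key hk x (hsub hx).1 (hsub hx).2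
      rw [abs_of_nonneg (Real.rpow_nonneg this.2.1 _)]
      exact Real.rpow_le_rpow this.2.1 this.2.2 (by linarith [h.hp]))
    (fun x hx => (hU x (hne x hx)).rpow_const (.inr (by linarith [h.hp])))
  refine tendsto_nhds_unique L1 (L2.congr' ?_)
  filter_upwards [hsm] with k hk
  exact (h.weak_scaled (hc k) hψ h1 h2 (hk.trans hr1)).symm

theorem Sol.exists_limit (h : Sol n p a u) (hr : 0 < r) (hr1 : r < 1) (hC : 0 ≤ C)
    (hub : ∀ x : Eu n, x ≠ 0 → ‖x‖ < r → ‖x‖ ^ a * u x ≤ C) {s : ℕ → ℝ}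
    (hs : Tendsto s atTop atBot) : ∃ φ : ℕ → ℕ, StrictMono φ ∧ ∃ V : ℝ → ℝ, LogSol n p a C V ∧
      ∀ x0 : Eu n, x0 ≠ 0 → Tendsto (fun q : ℕ × Eu n => ‖Real.exp (s (φ q.1)) • q.2‖ ^ a *
        u (Real.exp (s (φ q.1)) • q.2)) (atTop ×ˢ nhds x0) (nhds (V (Real.log ‖x0‖))) := by
  have hn0 : 0 < n := by linarith [h.hn]
  have ha := h.a_pos
  have hc0 : Tendsto (fun k => Real.exp (s k)) atTop (nhds 0) := Real.tendsto_exp_atBot.comp hs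
  obtain ⟨f, B⟩ := h.blow_zero hr hr1 hC hub (fun k => Real.exp_pos (s k)) hc0
  obtain ⟨φ, hφ, U, hU0, hU⟩ := B.exists_subseq
  have B' := B.comp hφ
  obtain ⟨c0, I⟩ := B'.isEq h.p_lt hU hU0 (Set.Subset.refl _)
  set e : Eu n := EuclideanSpace.single ⟨0, hn0⟩ 1 with he
  have hen : ‖e‖ = 1 := by simp [he]
  have hexp : ∀ t, ‖Real.exp t • e‖ = Real.exp t := fun t => by
    rw [norm_smul, hen, mul_one, Real.norm_of_nonneg (Real.exp_pos t).le]
  have hUe : ∀ x : Eu n, x ≠ 0 → U x = U (Real.exp (Real.log ‖x‖) • e) := fun x hx =>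
    I.radial (by rw [sub_zero, sub_zero, hexp, Real.exp_log (norm_pos_iff.2 hx)])
  set V : ℝ → ℝ := fun t => Real.exp t ^ a * U (Real.exp t • e) with hV
  have hUV : ∀ x : Eu n, x ≠ 0 → ‖x‖ ^ a * U x = V (Real.log ‖x‖) := fun x hx => by
    simp only [hV]
    rw [← hUe x hx, Real.exp_log (norm_pos_iff.2 hx)]
  have hUV' : ∀ x : Eu n, x ≠ 0 → U x = ‖x‖ ^ (-a) * V (Real.log ‖x‖) := fun x hx => by
    have hx0 := norm_pos_iff.2 hx
    rw [← hUV x hx, ← mul_assoc, ← Real.rpow_add hx0, neg_add_cancel, Real.rpow_zero, one_mul]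
  have hpt : ∀ t, Real.exp t • e ≠ 0 := fun t => norm_pos_iff.1 (by rw [hexp]; exact Real.exp_pos t)
  have hVnn : ∀ t, 0 ≤ V t := fun t => mul_nonneg (by positivity) (I.pos _)
  refine ⟨φ, hφ, V, ⟨?_, hVnn, fun t => ?_, fun ψ hψ hψc => ?_⟩, fun x0 hx0 => ?_⟩
  · refine (Real.continuous_exp.rpow_const fun _ => .inr ha.le).mul ?_
    exact I.cont.comp_continuous (Real.continuous_exp.smul continuous_const) fun t => hpt t
  · have hl := (hU (Real.exp t • e) (hpt t)).const_mul (Real.exp t ^ a)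
    refine le_of_tendsto hl ?_
    have hsm : ∀ᶠ k in atTop, Real.exp (s (φ k)) * Real.exp t < r :=
      ((hc0.comp hφ.tendsto_atTop).mul_const _).eventually (gt_mem_nhds (by simpa using hr))
    filter_upwards [hsm] with k hk
    have := scaled_le hub (Real.exp_pos (s (φ k))) (hpt t) (by rwa [hexp])
    rw [hexp, Real.rpow_neg (Real.exp_pos t).le, ← div_eq_mul_inv,
      le_div_iff₀ (Real.rpow_pos_of_pos (Real.exp_pos t) _)] at this
    linarith
  · obtain ⟨T, hT⟩ := hψc.isCompact.isBounded.subset_closedBall 0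
    have hz : ∀ t, T < |t| → ψ t = 0 := fun t ht => image_eq_zero_of_notMem_tsupport fun hc => by
      have := hT hc
      rw [mem_closedBall_zero_iff, Real.norm_eq_abs] at this
      linarith
    have h1 : ∀ t < -T, ψ t = 0 := fun t ht => hz t (by linarith [neg_le_abs t])
    have h2 : ∀ t, T < t → ψ t = 0 := fun t ht => hz t (ht.trans_le (le_abs_self t))
    have W := h.weak_limit hr hr1 hC hub (fun k => Real.exp_pos (s (φ k)))
      (hc0.comp hφ.tendsto_atTop) hU hψ h1 h2
    rw [bilap_radLog' _ (hψ.of_le four_le_top) h1] at W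
    have e1 : ∀ z : Eu n, U z * radLog (a + 4 - n - 4) (lapLog n (a + 4 - n - 2)
        (lapLog n (a + 4 - n) ψ)) z =
        radLog (-(n : ℝ)) (fun t => V t * lapLog n (a + 2 - n) (lapLog n (a + 4 - n) ψ) t) z :=
      fun z => by
        by_cases hz : z = 0
        · simp [hz]
        rw [radLog_of_ne _ _ hz, radLog_of_ne _ _ hz, hUV' z hz,
          show -(n : ℝ) = -a + (a + 4 - n - 4) by ring, Real.rpow_add (norm_pos_iff.2 hz),
          show a + 4 - (n : ℝ) - 2 = a + 2 - n by ring]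
        ring
    have e2 : ∀ z : Eu n, U z ^ p * radLog (a + 4 - n) ψ z =
        radLog (-(n : ℝ)) (fun t => V t ^ p * ψ t) z := fun z => by
      by_cases hz : z = 0
      · simp [hz]
      have hz0 := norm_pos_iff.2 hz
      rw [radLog_of_ne _ _ hz, radLog_of_ne _ _ hz, hUV' z hz,
        Real.mul_rpow (by positivity) (hVnn _), ← Real.rpow_mul hz0.le, neg_mul, h.ap,
        show -(n : ℝ) = -(a + 4) + (a + 4 - n) by ring, Real.rpow_add hz0]
      ring
    simp only [e1, e2, integral_radLog_neg n hn0.ne'] at W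
    refine mul_left_cancel₀ ?_ W
    have : 0 < (volume : Measure (Eu n)).real (ball 0 1) :=
      ENNReal.toReal_pos (measure_ball_pos volume _ one_pos).ne' measure_ball_lt_top.ne
    positivity
  · have hw : Tendsto (fun q : ℕ × Eu n => Real.exp (s (φ q.1)) ^ a *
        u (Real.exp (s (φ q.1)) • q.2)) (atTop ×ˢ nhds x0) (nhds (U x0)) := by
      rw [Metric.tendsto_nhds]
      intro ε hε
      obtain ⟨δ, hδ, H⟩ := B'.continuous_conv hU (x0 := x0) hx0 (half_pos hε)
      have := H.prod_mk (ball_mem_nhds x0 hδ)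
      filter_upwards [this] with q hq
      rw [Real.dist_eq]
      exact (hq.1 q.2 hq.2).trans_lt (half_lt_self hε)
    rw [← hUV x0 hx0]
    refine (((continuous_norm.tendsto x0).rpow_const (.inr ha.le)).comp tendsto_snd |>.mul
      hw).congr fun q => ?_
    simp only [Function.comp]
    rw [norm_smul, Real.norm_of_nonneg (Real.exp_pos _).le, Real.mul_rpow (Real.exp_pos _).le
      (norm_nonneg _)]
    ring

end


theorem exists_last_exit {P : ℝ → Prop} {b σ η : ℝ} (hb : ¬P b) (hbσ : b ≤ σ) (hη : 0 < η) :
    ∃ b', ¬P b' ∧ b' ≤ σ ∧ ∀ t, b' + η ≤ t → t ≤ σ → P t := by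
  have hbdd : BddAbove {t | ¬P t ∧ t ≤ σ} := ⟨σ, fun t ht => ht.2⟩
  obtain ⟨b', hb', hlt⟩ := exists_lt_of_lt_csSup (s := {t | ¬P t ∧ t ≤ σ}) ⟨b, hb, hbσ⟩
    (sub_lt_self (sSup {t | ¬P t ∧ t ≤ σ}) hη)
  refine ⟨b', hb'.1, hb'.2, fun t h1 h2 => ?_⟩
  by_contra hP
  have := le_csSup hbdd (a := t) ⟨hP, h2⟩
  linarith

/-- If all translation limits of `g` at `-∞` belong to a class of functions which either vanish at
the origin or converge to `c` at `-∞`, and which stay close to `c` on a half-line only if they take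
the value `c`, then `g` converges to `0` or to `c`. -/
theorem tendsto_zero_or_const {g : ℝ → ℝ} {c : ℝ} (hc : 0 < c) {S : (ℝ → ℝ) → Prop}
    (hcpt : ∀ s : ℕ → ℝ, Tendsto s atTop atBot → ∃ φ : ℕ → ℕ, StrictMono φ ∧ ∃ V, S V ∧
      ∀ t, Tendsto (fun q : ℕ × ℝ => g (s (φ q.1) + q.2)) (atTop ×ˢ nhds t) (nhds (V t)))
    (h1 : ∀ V, S V → V 0 ≠ 0 → Tendsto V atBot (nhds c))
    (h2 : ∀ V, S V → (∀ t, 0 ≤ t → |V t - c| ≤ c / 2) → V 0 = c) :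
    Tendsto g atBot (nhds 0) ∨ Tendsto g atBot (nhds c) := by
  by_contra hcon
  rw [not_or] at hcon
  obtain ⟨hz, hnc⟩ := hcon
  have seq : ∀ {ℓ : ℝ}, ¬Tendsto g atBot (nhds ℓ) → ∃ ε, 0 < ε ∧ ∀ N : ℝ, ∃ s ≤ N, ε ≤ |g s - ℓ| :=
    fun {ℓ} hℓ => by
      rw [Metric.tendsto_nhds] at hℓ
      push Not at hℓ
      obtain ⟨ε, hε, H⟩ := hℓ
      refine ⟨ε, hε, fun N => ?_⟩
      obtain ⟨s, hs, hs'⟩ := (frequently_atBot.1 H) N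
      exact ⟨s, hs, by rwa [Real.dist_eq] at hs'⟩
  obtain ⟨ε0, hε0, H0⟩ := seq hz
  obtain ⟨ε1, hε1, H1⟩ := seq hnc
  set δ := min (ε1 / 2) (c / 2) with hδ
  have hδ0 : 0 < δ := lt_min (half_pos hε1) (half_pos hc)
  have lim : ∀ {s : ℕ → ℝ}, (∀ k : ℕ, s k ≤ -k) → Tendsto s atTop atBot := fun hs =>
    tendsto_atBot_mono hs (tendsto_neg_atTop_atBot.comp tendsto_natCast_atTop_atTop)
  -- arbitrarily long windows on which `g` is close to `c`
  have win : ∀ k : ℕ, ∃ σ ≤ -(k : ℝ), ∀ t, σ - k ≤ t → t ≤ σ → |g t - c| ≤ δ := by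
    choose s hs hgs using fun k : ℕ => H0 (-k)
    obtain ⟨φ, hφ, V, hV, hl⟩ := hcpt s (lim hs)
    have hV0 : V 0 ≠ 0 := fun h0 => by
      have hl0 := (hl 0).comp (tendsto_id.prodMk (tendsto_const_nhds (x := (0 : ℝ)) (f := atTop)))
      simp only [Function.comp_def, id, add_zero, h0] at hl0
      have := ge_of_tendsto hl0.abs (.of_forall fun k => by simpa using hgs (φ k))
      rw [abs_zero] at this
      linarith
    obtain ⟨T, hT⟩ := (((h1 V hV hV0).eventually (ball_mem_nhds c (half_pos hδ0)))).exists_forall_of_atBot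
    intro k
    have hK : IsCompact (Set.Icc (T - k) T) := isCompact_Icc
    have hev : ∀ᶠ j in atTop, ∀ t ∈ Set.Icc (T - k) T, |g (s (φ j) + t) - c| ≤ δ := by
      have hP : ∀ t ∈ Set.Icc (T - k) T, ∀ᶠ q : ℕ × ℝ in atTop ×ˢ nhds t,
          |g (s (φ q.1) + q.2) - c| ≤ δ := fun t ht => by
        filter_upwards [(hl t) (ball_mem_nhds (V t) (half_pos hδ0))] with q hq
        have ha := hT t ht.2
        rw [Set.mem_preimage, mem_ball, Real.dist_eq] at hq
        rw [Real.dist_eq] at ha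
        calc _ ≤ |g (s (φ q.1) + q.2) - V t| + |V t - c| := abs_sub_le _ _ _
          _ ≤ δ := by linarith
      simp only [← eventually_iSup, ← hK.prod_nhdsSet_eq_biSup] at hP
      exact hP.curry.mono fun _ h => h.self_of_nhdsSet
    have hs' : ∀ᶠ j in atTop, s (φ j) ≤ -k - T :=
      ((lim hs).comp hφ.tendsto_atTop).eventually (eventually_le_atBot _)
    obtain ⟨j, hj, hj'⟩ := (hev.and hs').exists
    refine ⟨s (φ j) + T, by linarith, fun t ht1 ht2 => ?_⟩
    have := hj (t - s (φ j)) ⟨by linarith, by linarith⟩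
    rwa [add_sub_cancel] at this
  have ex : ∀ k : ℕ, ∃ b ≤ -(k : ℝ), δ < |g b - c| ∧
      ∀ t, b + 1 / ((k : ℝ) + 1) ≤ t → t ≤ b + k → |g t - c| ≤ δ := fun k => by
    obtain ⟨σ, hσ, hw⟩ := win k
    obtain ⟨b0, hb0, hb0'⟩ := H1 σ
    have hlt : δ < ε1 := (min_le_left _ _).trans_lt (half_lt_self hε1)
    obtain ⟨b, hb, hbσ, hbw⟩ := exists_last_exit (P := fun t => |g t - c| ≤ δ)
      (not_le.2 (hlt.trans_le hb0')) hb0 (η := 1 / ((k : ℝ) + 1)) (by positivity)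
    have : b < σ - k := by
      by_contra hcon
      exact hb (hw b (not_lt.1 hcon) hbσ)
    exact ⟨b, hbσ.trans hσ, not_le.1 hb, fun t ht1 ht2 => hbw t ht1 (by linarith)⟩
  choose b hb hbad hgood using ex
  obtain ⟨φ, hφ, V, hV, hl⟩ := hcpt b (lim hb)
  have hpt : ∀ {θ : ℕ → ℝ} {t}, Tendsto θ atTop (nhds t) →
      Tendsto (fun k => |g (b (φ k) + θ k) - c|) atTop (nhds |V t - c|) := fun hθ =>
    (((hl _).comp (tendsto_id.prodMk hθ)).sub_const c).abs
  have hpos : ∀ t, 0 ≤ t → |V t - c| ≤ δ := fun t ht => by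
    have hθ : Tendsto (fun k => t + 1 / ((φ k : ℝ) + 1)) atTop (nhds t) := by
      simpa using (tendsto_const_nhds (x := t)).add
        ((tendsto_one_div_add_atTop_nhds_zero_nat (𝕜 := ℝ)).comp hφ.tendsto_atTop)
    refine le_of_tendsto (hpt hθ) ?_
    filter_upwards [(tendsto_natCast_atTop_atTop.comp hφ.tendsto_atTop).eventually
      (eventually_ge_atTop (t + 1))] with k hk
    simp only [Function.comp] at hk
    have : 1 / ((φ k : ℝ) + 1) ≤ 1 := by
      rw [div_le_one (by positivity)]
      linarith [(φ k).cast_nonneg (α := ℝ)]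
    exact hgood (φ k) _ (by linarith) (by linarith)
  have hV0 := h2 V hV fun t ht => (hpos t ht).trans (min_le_right _ _)
  have h0 := ge_of_tendsto (hpt (tendsto_const_nhds (x := (0 : ℝ))))
    (.of_forall fun k => by simpa using (hbad (φ k)).le)
  rw [hV0, sub_self, abs_zero] at h0
  linarith

section

variable {n : ℕ} {p a : ℝ} {u : Eu n → ℝ}

theorem Sol.alternative (h : Sol n p a u) :
    Tendsto (fun x : Eu n => ‖x‖ ^ a * u x) (nhdsWithin 0 {0}ᶜ) (nhds 0) ∨
    Tendsto (fun x : Eu n => ‖x‖ ^ a * u x) (nhdsWithin 0 {0}ᶜ)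
      (nhds (coefK n a ^ (1 / (p - 1)))) := by
  have hn0 : 0 < n := by linarith [h.hn]
  have ha := h.a_pos
  obtain ⟨C', r, hr, hr1, hub'⟩ := h.upper
  set C := max C' 0
  have hC : 0 ≤ C := le_max_right _ _
  have hub : ∀ x : Eu n, x ≠ 0 → ‖x‖ < r → ‖x‖ ^ a * u x ≤ C := fun x h1 h2 =>
    (hub' x h1 h2).trans (le_max_left _ _)
  set L := coefK n a ^ (1 / (p - 1)) with hL
  have hL0 : 0 < L := Real.rpow_pos_of_pos (coefK_pos ha h.ha2) _
  set e : Eu n := EuclideanSpace.single ⟨0, hn0⟩ 1 with he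
  have hen : ‖e‖ = 1 := by simp [he]
  have hexp : ∀ t, ‖Real.exp t • e‖ = Real.exp t := fun t => by
    rw [norm_smul, hen, mul_one, Real.norm_of_nonneg (Real.exp_pos t).le]
  have hpt : ∀ t, Real.exp t • e ≠ 0 := fun t => norm_pos_iff.1 (by rw [hexp]; exact Real.exp_pos t)
  set F : Eu n → ℝ := fun x => ‖x‖ ^ a * u x with hF
  set g : ℝ → ℝ := fun t => F (Real.exp t • e) with hg
  have hgt : ∃ ℓ, (ℓ = 0 ∨ ℓ = L) ∧ Tendsto g atBot (nhds ℓ) := by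
    have := tendsto_zero_or_const (g := g) hL0 (S := LogSol n p a C) (fun s hs => ?_)
      (fun V hV h0 => hV.tendsto_atBot h.hp ha h.ha1 h.ha2 h0)
      (fun V hV hc => hV.eq_of_close h.hp ha h.ha1 h.ha2 (half_lt_self hL0) hc)
    · rcases this with h0 | h0
      · exact ⟨0, .inl rfl, h0⟩
      · exact ⟨L, .inr rfl, h0⟩
    · obtain ⟨φ, hφ, V, hV, hl⟩ := h.exists_limit hr hr1 hC hub hs
      refine ⟨φ, hφ, V, hV, fun t => ?_⟩
      have hm : Tendsto (fun q : ℕ × ℝ => (q.1, Real.exp q.2 • e)) (atTop ×ˢ nhds t)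
          (atTop ×ˢ nhds (Real.exp t • e)) :=
        tendsto_id.prodMap ((Real.continuous_exp.smul continuous_const).tendsto t)
      have := (hl _ (hpt t)).comp hm
      rw [hexp, Real.log_exp] at this
      refine this.congr fun q => ?_
      simp only [Function.comp, hg, hF, smul_smul, ← Real.exp_add]
  obtain ⟨ℓ, hℓ, hgl⟩ := hgt
  suffices hmain : Tendsto F (nhdsWithin 0 {0}ᶜ) (nhds ℓ) by
    rcases hℓ with rfl | rfl
    · exact .inl hmain
    · exact .inr hmain
  refine tendsto_of_subseq_tendsto fun x hx => ?_
  have hx0 : Tendsto x atTop (nhds 0) := tendsto_nhds_of_tendsto_nhdsWithin hx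
  have hne : ∀ᶠ k in atTop, x k ≠ 0 := eventually_mem_of_tendsto_nhdsWithin hx
  have hs : Tendsto (fun k => Real.log ‖x k‖) atTop atBot :=
    Real.tendsto_log_nhdsGT_zero.comp (tendsto_nhdsWithin_iff.2
      ⟨by simpa using hx0.norm, hne.mono fun k hk => norm_pos_iff.2 hk⟩)
  obtain ⟨φ, hφ, V, hV, hl⟩ := h.exists_limit hr hr1 hC hub hs
  set z : ℕ → Eu n := fun k => (‖x (φ k)‖)⁻¹ • x (φ k) with hz
  have hzb : ∀ k, z k ∈ closedBall (0 : Eu n) 1 := fun k => by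
    rw [mem_closedBall_zero_iff, hz, norm_smul, Real.norm_of_nonneg (inv_nonneg.2 (norm_nonneg _))]
    exact inv_mul_le_one
  obtain ⟨z0, -, ψ, hψ, hz0⟩ := (isCompact_closedBall (0 : Eu n) 1).tendsto_subseq hzb
  have hne' : ∀ᶠ k in atTop, x (φ (ψ k)) ≠ 0 :=
    (hφ.tendsto_atTop.comp hψ.tendsto_atTop).eventually hne
  have hz1 : ‖z0‖ = 1 := by
    refine tendsto_nhds_unique hz0.norm (tendsto_const_nhds.congr' ?_)
    filter_upwards [hne'] with k hk
    simp only [Function.comp, hz, norm_smul, Real.norm_of_nonneg (inv_nonneg.2 (norm_nonneg _))]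
    rw [inv_mul_cancel₀ (norm_ne_zero_iff.2 hk)]
  have hz00 : z0 ≠ 0 := norm_ne_zero_iff.1 (by rw [hz1]; exact one_ne_zero)
  have he0 : e ≠ 0 := norm_ne_zero_iff.1 (by rw [hen]; exact one_ne_zero)
  have l1 := (hl z0 hz00).comp (hψ.tendsto_atTop.prodMk hz0)
  have l2 := (hl e he0).comp (hψ.tendsto_atTop.prodMk (tendsto_const_nhds (x := e)))
  have l3 : Tendsto (fun k => g (Real.log ‖x (φ (ψ k))‖)) atTop (nhds ℓ) :=
    hgl.comp (hs.comp (hφ.tendsto_atTop.comp hψ.tendsto_atTop))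
  rw [hen, ← hz1] at l2
  have := tendsto_nhds_unique l2 l3
  rw [this] at l1
  refine ⟨φ ∘ ψ, l1.congr' ?_⟩
  filter_upwards [hne'] with k hk
  have hk0 := norm_pos_iff.2 hk
  simp only [Function.comp, hz, hF]
  rw [Real.exp_log hk0, smul_smul, mul_inv_cancel₀ hk0.ne', one_smul]

end


theorem integral_gam_rpow_le {n : ℕ} (hn : 5 ≤ n) {b : ℝ} (hb0 : 0 < b) (hb : b < n - 4) :
    ∃ C, 0 ≤ C ∧ ∀ x : Eu n, x ≠ 0 → (Integrable fun z => gam n (x - z) * ‖z‖ ^ (-4 - b)) ∧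
      ∫ z, gam n (x - z) * ‖z‖ ^ (-4 - b) ≤ C * ‖x‖ ^ (-b) := by
  have h5 : (5 : ℝ) ≤ n := by exact_mod_cast hn
  set D : ℝ := (1 / 2) ^ (4 - n : ℝ) + (1 / 2) ^ (-4 - b) + (1 / 3) ^ (-(n + b)) with hD
  have d1 : (0 : ℝ) < (1 / 2) ^ (4 - n : ℝ) := by positivity
  have d2 : (0 : ℝ) < (1 / 2) ^ (-4 - b) := by positivity
  have d3 : (0 : ℝ) < (1 / 3) ^ (-(n + b)) := by positivity
  set K : Eu n → ℝ := fun z => (closedBall (0 : Eu n) 1).indicator (fun z => ‖z‖ ^ (-4 - b)) z +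
    (1 + ‖z‖) ^ (-(n + b)) with hK
  set G : Eu n → ℝ := (closedBall (0 : Eu n) 3).indicator (gam n) with hG
  have hKi : Integrable K := by
    refine ((integrable_indicator_iff measurableSet_closedBall).2
      ((locallyIntegrable_norm_rpow (by omega) (by linarith)).integrableOn_isCompact
        (isCompact_closedBall 0 1))).add (integrable_one_add_norm ?_)
    rw [finrank_euclideanSpace_fin]
    linarith
  have hGi : Integrable G := (integrable_indicator_iff measurableSet_closedBall).2
      ((locallyIntegrable_norm_rpow (by omega) (by linarith)).integrableOn_isCompact
        (isCompact_closedBall 0 3))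
  have k1 : ∀ z, 0 ≤ (closedBall (0 : Eu n) 1).indicator (fun z => ‖z‖ ^ (-4 - b)) z := fun z =>
    Set.indicator_nonneg (fun _ _ => by positivity) _
  have k2 : ∀ z : Eu n, 0 ≤ (1 + ‖z‖) ^ (-(n + b)) := fun z => by positivity
  have hG0 : ∀ z, 0 ≤ G z := fun z => Set.indicator_nonneg (fun _ _ => gam_nonneg _) _
  have hle : ∀ e z : Eu n, ‖e‖ = 1 → gam n (e - z) * ‖z‖ ^ (-4 - b) ≤ D * (K z + G (e - z)) := by
    intro e z he
    have hDK : ∀ {s t : ℝ}, 0 ≤ t → s ≤ D → t ≤ K z + G (e - z) →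
        s * t ≤ D * (K z + G (e - z)) := fun h0 h1 h2 =>
      mul_le_mul h1 h2 h0 (by positivity)
    rcases le_or_gt ‖z‖ (1 / 2) with h1 | h1
    · have : gam n (e - z) ≤ (1 / 2) ^ (4 - n : ℝ) := gam_anti hn (by norm_num) (by
        have := norm_sub_norm_le e z
        linarith)
      refine (mul_le_mul_of_nonneg_right this (by positivity)).trans
        (hDK (by positivity) (by linarith) ?_)
      simp only [hK]
      rw [Set.indicator_of_mem (by rw [mem_closedBall_zero_iff]; linarith)]
      linarith [k2 z, hG0 (e - z)]
    rcases le_or_gt ‖z‖ 2 with h2 | h2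
    · have : ‖z‖ ^ (-4 - b) ≤ (1 / 2) ^ (-4 - b) :=
        Real.rpow_le_rpow_of_nonpos (by norm_num) h1.le (by linarith)
      rw [mul_comm]
      refine (mul_le_mul_of_nonneg_right this (gam_nonneg _)).trans
        (hDK (gam_nonneg _) (by linarith) ?_)
      have : G (e - z) = gam n (e - z) := Set.indicator_of_mem (by
        rw [mem_closedBall_zero_iff]
        linarith [norm_sub_le e z]) _
      rw [this]
      simp only [hK]
      linarith [k1 z, k2 z]
    · have hz3 : 0 < (1 + ‖z‖) * (1 / 3) := by positivity
      have e1 : gam n (e - z) ≤ ((1 + ‖z‖) * (1 / 3)) ^ (4 - n : ℝ) := gam_anti hn hz3 (by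
        have := norm_sub_norm_le z e
        rw [norm_sub_rev] at this
        linarith)
      have e2 : ‖z‖ ^ (-4 - b) ≤ ((1 + ‖z‖) * (1 / 3)) ^ (-4 - b) :=
        Real.rpow_le_rpow_of_nonpos hz3 (by linarith) (by linarith)
      refine (mul_le_mul e1 e2 (by positivity) (by positivity)).trans ?_
      rw [← Real.rpow_add hz3, show (4 - n : ℝ) + (-4 - b) = -(n + b) by ring,
        Real.mul_rpow (by positivity) (by norm_num), mul_comm]
      refine hDK (k2 z) (by linarith) ?_
      simp only [hK]
      linarith [k1 z, hG0 (e - z)]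
  have hHi : ∀ e : Eu n, Integrable fun z => D * (K z + G (e - z)) := fun e =>
    (hKi.add (hGi.comp_sub_left e)).const_mul D
  have hm : ∀ e : Eu n, AEStronglyMeasurable fun z => gam n (e - z) * ‖z‖ ^ (-4 - b) := fun e =>
    (((measurable_gam n).comp (measurable_const_sub e)).mul
      (measurable_norm.pow_const _)).aestronglyMeasurable
  have hn0 : ∀ e z : Eu n, 0 ≤ gam n (e - z) * ‖z‖ ^ (-4 - b) := fun e z =>
    mul_nonneg (gam_nonneg _) (by positivity)
  have hKn : 0 ≤ ∫ z, K z := integral_nonneg fun z => add_nonneg (k1 z) (k2 z)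
  have hGn : 0 ≤ ∫ z, G z := integral_nonneg hG0
  refine ⟨D * ((∫ z, K z) + ∫ z, G z), by positivity, fun x hx => ?_⟩
  set c := ‖x‖ with hc
  have hc0 : 0 < c := norm_pos_iff.2 hx
  set e : Eu n := c⁻¹ • x with he
  have hxe : x = c • e := by rw [he, smul_smul, mul_inv_cancel₀ hc0.ne', one_smul]
  have hen : ‖e‖ = 1 := by
    rw [he, norm_smul, Real.norm_of_nonneg (inv_nonneg.2 hc0.le), ← hc, inv_mul_cancel₀ hc0.ne']
  have hsc : (fun z => gam n (x - c • z) * ‖c • z‖ ^ (-4 - b)) = fun z =>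
      (c ^ (4 - n : ℝ) * c ^ (-4 - b)) * (gam n (e - z) * ‖z‖ ^ (-4 - b)) := by
    funext z
    rw [hxe, ← smul_sub, gam_smul hc0, norm_smul, Real.norm_of_nonneg hc0.le,
      Real.mul_rpow hc0.le (norm_nonneg _)]
    ring
  have hIe : Integrable fun z => gam n (e - z) * ‖z‖ ^ (-4 - b) :=
    (hHi e).mono' (hm e) (.of_forall fun z => by
      rw [Real.norm_of_nonneg (hn0 e z)]; exact hle e z hen)
  refine ⟨(integrable_comp_smul_iff volume _ hc0.ne').1 (by
    rw [hsc]; exact hIe.const_mul _), ?_⟩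
  rw [integral_affine hc0 0]
  simp only [zero_add]
  rw [hsc, integral_const_mul, ← mul_assoc, ← Real.rpow_natCast, ← Real.rpow_add hc0,
    ← Real.rpow_add hc0, show (n : ℝ) + (4 - n + (-4 - b)) = -b by ring, mul_comm]
  refine mul_le_mul_of_nonneg_right ?_ (by positivity)
  calc _ ≤ ∫ z, D * (K z + G (e - z)) := integral_mono hIe (hHi e) fun z => hle e z hen
    _ = _ := by
      rw [integral_const_mul, integral_add hKi (hGi.comp_sub_left e),
        integral_sub_left_eq_self G volume e]

theorem integral_gam_rpow_le_const {n : ℕ} (hn : 5 ≤ n) {s : ℝ} (hs0 : 0 ≤ s) (hs : s < 4) {r : ℝ}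
    (hr : r ≤ 1) : ∃ C, ∀ x : Eu n, ‖x‖ ≤ 1 →
      (IntegrableOn (fun z => gam n (x - z) * ‖z‖ ^ (-s)) (closedBall 0 r)) ∧
      ∫ z in closedBall 0 r, gam n (x - z) * ‖z‖ ^ (-s) ≤ C := by
  have h5 : (5 : ℝ) ≤ n := by exact_mod_cast hn
  have hN : Nonempty (Fin n) := ⟨⟨0, by omega⟩⟩
  set b : ℝ := 4 - n - s with hb
  have hb' : -(n : ℝ) < b := by linarith
  set G : Eu n → ℝ := (closedBall (0 : Eu n) 2).indicator fun z => ‖z‖ ^ b with hG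
  have hGi : Integrable G := (integrable_indicator_iff measurableSet_closedBall).2
    ((locallyIntegrable_norm_rpow (by omega) hb').integrableOn_isCompact (isCompact_closedBall 0 2))
  have hG0 : ∀ z, 0 ≤ G z := fun z => Set.indicator_nonneg (fun _ _ => by positivity) _
  refine ⟨2 * ∫ z, G z, fun x hx => ?_⟩
  have hHi : Integrable fun z => G (x - z) + G z := (hGi.comp_sub_left x).add hGi
  have hle : ∀ z : Eu n, z ≠ x → z ≠ 0 → z ∈ closedBall (0 : Eu n) r →
      gam n (x - z) * ‖z‖ ^ (-s) ≤ G (x - z) + G z := fun z hzx hz0 hz => by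
    rw [mem_closedBall_zero_iff] at hz
    have p1 := norm_pos_iff.2 hz0
    have p2 := norm_pos_iff.2 (sub_ne_zero.2 hzx.symm)
    have g1 : G z = ‖z‖ ^ b := Set.indicator_of_mem (by rw [mem_closedBall_zero_iff]; linarith) _
    have g2 : G (x - z) = ‖x - z‖ ^ b := Set.indicator_of_mem (by
      rw [mem_closedBall_zero_iff]; linarith [norm_sub_le x z]) _
    rw [g1, g2]
    unfold gam
    rcases le_total ‖z‖ ‖x - z‖ with h | h
    · have := Real.rpow_le_rpow_of_nonpos p1 h (z := (4 - n : ℝ)) (by linarith)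
      refine (mul_le_mul_of_nonneg_right this (by positivity)).trans ?_
      rw [← Real.rpow_add p1, ← sub_eq_add_neg]
      exact le_add_of_nonneg_left (by positivity)
    · have := Real.rpow_le_rpow_of_nonpos p2 h (z := -s) (by linarith)
      refine (mul_le_mul_of_nonneg_left this (by positivity)).trans ?_
      rw [← Real.rpow_add p2, ← sub_eq_add_neg]
      exact le_add_of_nonneg_right (by positivity)
  have hle' : ∀ᵐ z ∂(volume.restrict (closedBall (0 : Eu n) r)),
      gam n (x - z) * ‖z‖ ^ (-s) ≤ G (x - z) + G z := by
    filter_upwards [ae_restrict_mem measurableSet_closedBall,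
      ae_restrict_of_ae (Measure.ae_ne volume (0 : Eu n)),
      ae_restrict_of_ae (Measure.ae_ne volume x)] with z h1 h2 h3 using hle z h3 h2 h1
  have hI : IntegrableOn (fun z => gam n (x - z) * ‖z‖ ^ (-s)) (closedBall 0 r) := by
    refine hHi.integrableOn.mono' (((measurable_gam n).comp (measurable_const_sub x)).mul
      (measurable_norm.pow_const _)).aestronglyMeasurable ?_
    filter_upwards [hle'] with z hz
    rwa [Real.norm_of_nonneg (mul_nonneg (gam_nonneg _) (by positivity))]
  refine ⟨hI, ?_⟩
  calc _ ≤ ∫ z in closedBall 0 r, (G (x - z) + G z) := integral_mono_ae hI hHi.integrableOn hle'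
    _ ≤ ∫ z, (G (x - z) + G z) := setIntegral_le_integral hHi
      (.of_forall fun z => add_nonneg (hG0 _) (hG0 _))
    _ = _ := by
      rw [integral_add (hGi.comp_sub_left x) hGi, integral_sub_left_eq_self G volume x, two_mul]


section

variable {n : ℕ} {p a : ℝ} {u : Eu n → ℝ}

theorem Sol.exists_src_le (h : Sol n p a u) {ρ : ℝ} (hρ : 0 < ρ) : ∃ B, 0 ≤ B ∧ ∀ y : Eu n,
    ρ ≤ ‖y‖ → src p u y ≤ (closedBall (0 : Eu n) (2 / 25)).indicator (fun _ => B) y := by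
  obtain ⟨B, hB⟩ := ((isCompact_closedBall (0 : Eu n) (2 / 25)).diff
    (isOpen_ball (x := (0 : Eu n)) (ε := ρ))).exists_bound_of_continuousOn
    (h.contOn_rpow.mono fun y hy => ⟨closedBall_subset_ball (by norm_num) hy.1, fun h0 =>
      hy.2 (by rw [Set.mem_singleton_iff.1 h0]; exact mem_ball_self hρ)⟩)
  refine ⟨max B 0, le_max_right _ _, fun y hy => ?_⟩
  by_cases hy2 : y ∈ closedBall (0 : Eu n) (2 / 25)
  · rw [Set.indicator_of_mem hy2, src_eq (norm_pos_iff.1 (hρ.trans_le hy)) (by simpa using hy2)]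
    exact ((Real.le_norm_self _).trans (hB y ⟨hy2, by simpa using hy⟩)).trans (le_max_left _ _)
  · rw [Set.indicator_of_notMem hy2, src, Set.indicator_of_notMem fun hc => hy2 hc.1]

theorem Sol.bounded (h : Sol n p a u)
    (h0 : Tendsto (fun x : Eu n => ‖x‖ ^ a * u x) (nhdsWithin 0 {0}ᶜ) (nhds 0)) :
    ∃ A ρ, 0 < ρ ∧ ρ < 1 ∧ ∀ x : Eu n, x ≠ 0 → ‖x‖ ≤ ρ → u x ≤ A := by
  have hn := h.hn
  have ha := h.a_pos
  have hp := h.hp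
  have hp0 : 0 < p := by linarith
  have hcN := cN_pos hn
  have hap := h.ap
  have ha2 := h.ha2
  set b : ℝ := 2 / p with hb
  have hb0 : 0 < b := by positivity
  have hbp : b * p = 2 := by rw [hb]; field_simp
  have hba : b < a := by nlinarith
  obtain ⟨Ca, hCa0, hCa⟩ := integral_gam_rpow_le hn ha ha2
  obtain ⟨Cb, hCb0, hCb⟩ := integral_gam_rpow_le hn hb0 (hba.trans ha2)
  obtain ⟨C0, hC0⟩ := integral_gam_rpow_le_const hn (s := 0) le_rfl (by norm_num)
    (r := 2 / 25) (by norm_num)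
  obtain ⟨C2, hC2⟩ := integral_gam_rpow_le_const hn (s := 2) (by norm_num) (by norm_num)
    (r := 2 / 25) (by norm_num)
  simp only [neg_zero, Real.rpow_zero, mul_one] at hC0
  obtain ⟨M, hM⟩ := h.rep'
  set ε : ℝ := cN n / (2 * (Ca + Cb + 1)) with hε
  have hε0 : 0 < ε := by positivity
  have hεa : ε * Ca ≤ cN n / 2 := by
    rw [hε, div_mul_eq_mul_div, div_le_div_iff₀ (by positivity) (by norm_num)]
    nlinarith [mul_nonneg hcN.le hCb0]
  have hεb : ε * Cb ≤ cN n / 2 := by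
    rw [hε, div_mul_eq_mul_div, div_le_div_iff₀ (by positivity) (by norm_num)]
    nlinarith [mul_nonneg hcN.le hCa0]
  -- smallness near the origin
  obtain ⟨ρ0, hρ0, hsm⟩ := Metric.mem_nhdsWithin_iff.1
    (h0.eventually (gt_mem_nhds (Real.rpow_pos_of_pos hε0 (1 / (p - 1)))))
  set ρ := min (ρ0 / 2) (1 / 26) with hρ
  have hρpos : 0 < ρ := by positivity
  have hρ1 : ρ ≤ 1 / 26 := min_le_right _ _
  have hu0 : ∀ x : Eu n, x ≠ 0 → ‖x‖ ≤ ρ → 0 ≤ u x := fun x hx0 hx =>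
    h.pos x ⟨by rw [mem_ball_zero_iff]; linarith, hx0⟩
  have hsrc : ∀ y : Eu n, y ≠ 0 → ‖y‖ ≤ ρ → src p u y ≤ ε * ‖y‖ ^ (-4 : ℝ) * u y := by
    intro y hy0 hy
    have hyp := norm_pos_iff.2 hy0
    have hs : ‖y‖ ^ a * u y < ε ^ (1 / (p - 1)) := hsm ⟨by
      rw [mem_ball_zero_iff]
      linarith [min_le_left (ρ0 / 2) (1 / 26)], hy0⟩
    have := Real.rpow_le_rpow (mul_nonneg (by positivity) (hu0 y hy0 hy)) hs.le
      (z := p - 1) (by linarith)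
    rw [← Real.rpow_mul hε0.le, one_div_mul_cancel (by linarith), Real.rpow_one,
      Real.mul_rpow (by positivity) (hu0 y hy0 hy), ← Real.rpow_mul hyp.le, h.hap] at this
    rw [src_eq hy0 (by linarith), show p = p - 1 + 1 by ring,
      Real.rpow_add_one' (hu0 y hy0 hy) (by linarith)]
    refine mul_le_mul_of_nonneg_right ?_ (hu0 y hy0 hy)
    rw [Real.rpow_neg hyp.le, ← div_eq_mul_inv, le_div_iff₀ (by positivity), mul_comm]
    exact this
  obtain ⟨B, hB0, hB⟩ := h.exists_src_le hρpos
  have hone : ∀ x : Eu n, x ≠ 0 → ‖x‖ ≤ ρ → 1 ≤ ‖x‖ ^ (-b) := fun x hx0 hx =>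
    Real.one_le_rpow_of_pos_of_le_one_of_nonpos (norm_pos_iff.2 hx0) (by linarith) (by linarith)
  have hrep : ∀ x : Eu n, x ≠ 0 → ‖x‖ ≤ ρ → ∀ g : Eu n → ℝ,
      (Integrable fun y => gam n (x - y) * g y) → (∀ y, y ≠ 0 → ‖y‖ ≤ ρ → src p u y ≤ g y) →
      (∀ y, 0 ≤ g y) → cN n * u x ≤ (∫ y, gam n (x - y) * g y) + (|M| + B * |C0|) := by
    intro x hx0 hx g hg hle hg0
    obtain ⟨hI, hR⟩ := hM x hx0 (by linarith)
    obtain ⟨hJ, hJ'⟩ := hC0 x (by linarith)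
    set I := (closedBall (0 : Eu n) (2 / 25)).indicator (fun y => B * gam n (x - y)) with hIdef
    have hIi : Integrable I := (integrable_indicator_iff measurableSet_closedBall).2
      (hJ.const_mul B)
    have hI0 : ∀ y, 0 ≤ I y := fun y =>
      Set.indicator_nonneg (fun _ _ => mul_nonneg hB0 (gam_nonneg _)) _
    have key : ∫ y, gam n (x - y) * src p u y ≤ ∫ y, (gam n (x - y) * g y + I y) := by
      refine integral_mono hI (hg.add hIi) fun y => ?_
      by_cases hy : ρ ≤ ‖y‖
      · have h1 := mul_le_mul_of_nonneg_left (hB y hy) (gam_nonneg (x - y))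
        have : gam n (x - y) * (closedBall (0 : Eu n) (2 / 25)).indicator (fun _ => B) y = I y := by
          rw [hIdef]
          by_cases hm : y ∈ closedBall (0 : Eu n) (2 / 25)
          · rw [Set.indicator_of_mem hm, Set.indicator_of_mem hm, mul_comm]
          · rw [Set.indicator_of_notMem hm, Set.indicator_of_notMem hm, mul_zero]
        rw [this] at h1
        exact h1.trans (le_add_of_nonneg_left (mul_nonneg (gam_nonneg _) (hg0 y)))
      · rcases eq_or_ne y 0 with rfl | hy0
        · rw [src, Set.indicator_of_notMem (by simp), mul_zero]
          exact add_nonneg (mul_nonneg (gam_nonneg _) (hg0 _)) (hI0 _)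
        · exact (mul_le_mul_of_nonneg_left (hle y hy0 (by linarith)) (gam_nonneg _)).trans
            (le_add_of_nonneg_right (hI0 y))
    rw [integral_add hg hIi, hIdef, integral_indicator measurableSet_closedBall,
      integral_const_mul] at key
    have h1 := (abs_le.1 hR).2
    have h2 := mul_le_mul_of_nonneg_left (hJ'.trans (le_abs_self _)) hB0
    linarith [le_abs_self M]
  set Q := (|M| + B * |C0|) / cN n with hQ
  have hQ0 : 0 ≤ Q := by positivity
  have hcQ : cN n * Q = |M| + B * |C0| := by rw [hQ]; field_simp
  have step : ∀ δ, 0 < δ → ∀ N, 0 ≤ N →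
      (∀ x : Eu n, x ≠ 0 → ‖x‖ ≤ ρ → u x ≤ N * (‖x‖ ^ (-b) + δ * ‖x‖ ^ (-a))) →
      ∀ x : Eu n, x ≠ 0 → ‖x‖ ≤ ρ → u x ≤ (N / 2 + Q) * (‖x‖ ^ (-b) + δ * ‖x‖ ^ (-a)) := by
    intro δ hδ N hN hP x hx0 hx
    obtain ⟨ia, ja⟩ := hCa x hx0
    obtain ⟨ib, jb⟩ := hCb x hx0
    have hform : (fun y => gam n (x - y) *
        (ε * N * (‖y‖ ^ (-4 - b) + δ * ‖y‖ ^ (-4 - a)))) = fun y =>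
        ε * N * (gam n (x - y) * ‖y‖ ^ (-4 - b)) +
          ε * N * δ * (gam n (x - y) * ‖y‖ ^ (-4 - a)) := by
      funext y; ring
    have := hrep x hx0 hx (fun y => ε * N * (‖y‖ ^ (-4 - b) + δ * ‖y‖ ^ (-4 - a)))
      (by rw [hform]; exact (ib.const_mul _).add (ia.const_mul _)) (fun y hy0 hy => by
        refine (hsrc y hy0 hy).trans ((mul_le_mul_of_nonneg_left (hP y hy0 hy)
          (by positivity)).trans_eq ?_)
        have hy' := norm_pos_iff.2 hy0
        rw [sub_eq_add_neg, sub_eq_add_neg, Real.rpow_add hy', Real.rpow_add hy']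
        ring) (fun y => by positivity)
    rw [hform, integral_add (ib.const_mul _) (ia.const_mul _), integral_const_mul,
      integral_const_mul] at this
    have xb : 0 ≤ ‖x‖ ^ (-b) := by positivity
    have xa : 0 ≤ ‖x‖ ^ (-a) := by positivity
    have t1 : ε * N * ∫ y, gam n (x - y) * ‖y‖ ^ (-4 - b) ≤ N * (cN n / 2) * ‖x‖ ^ (-b) :=
      calc _ ≤ ε * N * (Cb * ‖x‖ ^ (-b)) := mul_le_mul_of_nonneg_left jb (by positivity)
        _ = N * (ε * Cb) * ‖x‖ ^ (-b) := by ring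
        _ ≤ _ := by gcongr
    have t2 : ε * N * δ * ∫ y, gam n (x - y) * ‖y‖ ^ (-4 - a) ≤
        N * (cN n / 2) * (δ * ‖x‖ ^ (-a)) :=
      calc _ ≤ ε * N * δ * (Ca * ‖x‖ ^ (-a)) := mul_le_mul_of_nonneg_left ja (by positivity)
        _ = N * (ε * Ca) * (δ * ‖x‖ ^ (-a)) := by ring
        _ ≤ _ := by gcongr
    have t3 : cN n * Q ≤ cN n * (Q * (‖x‖ ^ (-b) + δ * ‖x‖ ^ (-a))) := by
      refine mul_le_mul_of_nonneg_left (le_mul_of_one_le_right hQ0 ?_) hcN.le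
      linarith [hone x hx0 hx, mul_nonneg hδ.le xa]
    refine le_of_mul_le_mul_left ?_ hcN
    rw [hcQ] at t3
    linarith
  have hlim : ∀ δ, 0 < δ → ∀ x : Eu n, x ≠ 0 → ‖x‖ ≤ ρ →
      u x ≤ 2 * Q * (‖x‖ ^ (-b) + δ * ‖x‖ ^ (-a)) := by
    intro δ hδ x hx0 hx
    set N0 := ε ^ (1 / (p - 1)) / δ with hN0
    have hN00 : 0 ≤ N0 := by positivity
    have hk : ∀ k : ℕ, ∀ x : Eu n, x ≠ 0 → ‖x‖ ≤ ρ →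
        u x ≤ (N0 * (1 / 2) ^ k + 2 * Q) * (‖x‖ ^ (-b) + δ * ‖x‖ ^ (-a)) := by
      intro k
      induction k with
      | zero =>
        intro x hx0 hx
        have hxp := norm_pos_iff.2 hx0
        have hs : ‖x‖ ^ a * u x < ε ^ (1 / (p - 1)) := hsm ⟨by
          rw [mem_ball_zero_iff]
          linarith [min_le_left (ρ0 / 2) (1 / 26)], hx0⟩
        have hux : u x ≤ N0 * (δ * ‖x‖ ^ (-a)) := by
          rw [hN0, Real.rpow_neg hxp.le, ← mul_assoc, div_mul_cancel₀ _ hδ.ne',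
            ← div_eq_mul_inv, le_div_iff₀ (by positivity), mul_comm]
          exact hs.le
        refine hux.trans (mul_le_mul (by simpa using hQ0) ?_ (by positivity) (by positivity))
        exact le_add_of_nonneg_left (by positivity)
      | succ k ih =>
        intro x hx0 hx
        refine (step δ hδ _ (by positivity) ih x hx0 hx).trans_eq ?_
        rw [pow_succ]
        ring
    have ht : Tendsto (fun k : ℕ => (N0 * (1 / 2) ^ k + 2 * Q) *
        (‖x‖ ^ (-b) + δ * ‖x‖ ^ (-a))) atTop
        (nhds ((N0 * 0 + 2 * Q) * (‖x‖ ^ (-b) + δ * ‖x‖ ^ (-a)))) :=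
      (((tendsto_pow_atTop_nhds_zero_of_lt_one (by norm_num) (by norm_num)).const_mul
        N0).add_const _).mul_const _
    rw [mul_zero, zero_add] at ht
    exact ge_of_tendsto ht (.of_forall fun k => hk k x hx0 hx)
  have hub : ∀ x : Eu n, x ≠ 0 → ‖x‖ ≤ ρ → u x ≤ 2 * Q * ‖x‖ ^ (-b) := by
    intro x hx0 hx
    have ht : Tendsto (fun k : ℕ => 2 * Q * (‖x‖ ^ (-b) + 1 / ((k : ℝ) + 1) * ‖x‖ ^ (-a))) atTop
        (nhds (2 * Q * (‖x‖ ^ (-b) + 0 * ‖x‖ ^ (-a)))) :=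
      ((tendsto_one_div_add_atTop_nhds_zero_nat.mul_const _).const_add _).const_mul _
    rw [zero_mul, add_zero] at ht
    exact ge_of_tendsto ht (.of_forall fun k => hlim _ (by positivity) x hx0 hx)
  set A := (2 * Q) ^ p with hA
  refine ⟨(A * |C2| + (|M| + B * |C0|)) / cN n, ρ, hρpos, by linarith, fun x hx0 hx => ?_⟩
  obtain ⟨i2, j2⟩ := hC2 x (by linarith)
  set g : Eu n → ℝ := (closedBall (0 : Eu n) (2 / 25)).indicator fun y => A * ‖y‖ ^ (-2 : ℝ) with hg
  have hform : (fun y => gam n (x - y) * g y) = (closedBall (0 : Eu n) (2 / 25)).indicator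
      fun y => A * (gam n (x - y) * ‖y‖ ^ (-2 : ℝ)) := by
    funext y
    rw [hg]
    by_cases hm : y ∈ closedBall (0 : Eu n) (2 / 25)
    · rw [Set.indicator_of_mem hm, Set.indicator_of_mem hm]; ring
    · rw [Set.indicator_of_notMem hm, Set.indicator_of_notMem hm, mul_zero]
  have := hrep x hx0 hx g (by
      rw [hform]
      exact (integrable_indicator_iff measurableSet_closedBall).2 (i2.const_mul A))
    (fun y hy0 hy => by
      have hyp := norm_pos_iff.2 hy0
      rw [src_eq hy0 (by linarith), hg, Set.indicator_of_mem (by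
        rw [mem_closedBall_zero_iff]; linarith), hA, show (-2 : ℝ) = -b * p by rw [← hbp]; ring,
        Real.rpow_mul hyp.le, ← Real.mul_rpow (by positivity) (by positivity)]
      exact Real.rpow_le_rpow (hu0 y hy0 hy) (hub y hy0 hy) hp0.le)
    fun y => Set.indicator_nonneg (fun _ _ => by positivity) _
  rw [hform, integral_indicator measurableSet_closedBall, integral_const_mul] at this
  rw [le_div_iff₀ hcN, mul_comm]
  have hA0 : 0 ≤ A := by positivity
  have := mul_le_mul_of_nonneg_left (j2.trans (le_abs_self _)) hA0
  linarith

end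


section

variable {n : ℕ} {F : Type} [NormedAddCommGroup F] [NormedSpace ℝ F]

theorem hasFDerivAt_integral_smul_comp_sub {g : Eu n → ℝ} (hg : LocallyIntegrable g)
    {Ψ : Eu n → F} (hΨ : ContDiff ℝ 1 Ψ) (hc : HasCompactSupport Ψ) (x : Eu n) :
    HasFDerivAt (fun x => ∫ y, g y • Ψ (x - y)) (∫ y, g y • fderiv ℝ Ψ (x - y)) x := by
  have h := hc.hasFDerivAt_convolution_right (μ := volume) (ContinuousLinearMap.lsmul ℝ ℝ) hg hΨ x
  have e : ∀ y, (ContinuousLinearMap.precompR (Eu n) (ContinuousLinearMap.lsmul ℝ ℝ) (g y))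
      (fderiv ℝ Ψ (x - y)) = g y • fderiv ℝ Ψ (x - y) := fun y => by
    ext v
    simp
  have h2 : (convolution g (fderiv ℝ Ψ) (ContinuousLinearMap.precompR (Eu n)
      (ContinuousLinearMap.lsmul ℝ ℝ)) volume) x = ∫ y, g y • fderiv ℝ Ψ (x - y) := by
    unfold convolution
    exact integral_congr_ae (.of_forall e)
  rw [h2] at h
  exact h

theorem contDiff_integral_smul_comp_sub {g : Eu n → ℝ} (hg : LocallyIntegrable g) {m : ℕ∞}
    {Ψ : Eu n → F} (hΨ : ContDiff ℝ m Ψ) (hc : HasCompactSupport Ψ) :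
    ContDiff ℝ m (fun x => ∫ y, g y • Ψ (x - y)) :=
  hc.contDiff_convolution_right (μ := volume) (ContinuousLinearMap.lsmul ℝ ℝ) hg hΨ

theorem norm_iteratedFDeriv_integral_le {g : Eu n → ℝ} (hg : LocallyIntegrable g) {B : ℝ}
    (hB : ∀ y, |g y| ≤ B) (k : ℕ) {F : Type} [NormedAddCommGroup F] [NormedSpace ℝ F]
    {Ψ : Eu n → F} (hΨ : ContDiff ℝ (⊤ : ℕ∞) Ψ) (hc : HasCompactSupport Ψ) (x : Eu n) :
    ‖iteratedFDeriv ℝ k (fun x => ∫ y, g y • Ψ (x - y)) x‖ ≤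
      B * ∫ y, ‖iteratedFDeriv ℝ k Ψ y‖ := by
  induction k generalizing F with
  | zero =>
    simp only [norm_iteratedFDeriv_zero]
    rw [← integral_sub_left_eq_self (fun y => ‖Ψ y‖) volume x, ← integral_const_mul]
    have hi : Integrable Ψ := hΨ.continuous.integrable_of_hasCompactSupport hc
    refine norm_integral_le_of_norm_le ((hi.norm.comp_sub_left x).const_mul B)
      (.of_forall fun y => ?_)
    rw [norm_smul]
    exact mul_le_mul_of_nonneg_right (hB y) (norm_nonneg _)
  | succ k ih =>
    rw [← norm_iteratedFDeriv_fderiv]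
    have e : (fderiv ℝ fun x => ∫ y, g y • Ψ (x - y)) = fun x => ∫ y, g y • fderiv ℝ Ψ (x - y) :=
      funext fun x => (hasFDerivAt_integral_smul_comp_sub hg (hΨ.of_le (by simp)) hc x).fderiv
    rw [e]
    refine (ih (hΨ.fderiv_right (m := (⊤ : ℕ∞)) (by simp)) (hc.fderiv ℝ)).trans_eq ?_
    simp only [norm_iteratedFDeriv_fderiv]

end

section

variable {n : ℕ}

theorem kern_dyadic (n N : ℕ) (x : Eu n) : kern n (N + 2) x =
    ∑ j ∈ Finset.range N, Real.exp j ^ ((n : ℝ) - 4) * kern n 3 (Real.exp j • x) := by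
  induction N with
  | zero =>
    simp only [Nat.cast_zero, zero_add, Finset.range_zero, Finset.sum_empty, kern, sub_self]
    by_cases hx : x = 0
    · simp [hx]
    · rw [radLog_of_ne _ _ hx, mul_zero]
  | succ N ih =>
    rw [Finset.sum_range_succ, ← ih]
    have h := radLog_smul (n := n) (4 - n)
      (fun t => Real.smoothTransition (t + 3) - Real.smoothTransition (t + 2))
      (Real.exp_pos (-(N : ℝ))) (Real.exp N • x)
    rw [smul_smul, ← Real.exp_add, neg_add_cancel, Real.exp_zero, one_smul, Real.log_exp] at h
    have h' : kern n 3 (Real.exp N • x) = radLog (4 - n)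
      (fun t => Real.smoothTransition (t + 3) - Real.smoothTransition (t + 2))
      (Real.exp N • x) := rfl
    have h2 : Real.exp N ^ ((n : ℝ) - 4) * kern n 3 (Real.exp N • x) = radLog (4 - n)
        (fun t => Real.smoothTransition (t - -(N : ℝ) + 3) -
          Real.smoothTransition (t - -(N : ℝ) + 2)) x := by
      rw [h, h', ← Real.exp_mul, ← Real.exp_mul]
      congr 2
      ring
    rw [h2]
    unfold kern
    by_cases hx : x = 0
    · simp [hx]
    · rw [radLog_of_ne _ _ hx, radLog_of_ne _ _ hx, radLog_of_ne _ _ hx, ← mul_add]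
      push_cast
      rw [show Real.log ‖x‖ - -(N : ℝ) + 3 = Real.log ‖x‖ + (N + 1 + 2) by ring,
        show Real.log ‖x‖ - -(N : ℝ) + 2 = Real.log ‖x‖ + (N + 2) by ring]
      ring

theorem norm_iteratedFDeriv_comp_smul_le' {Θ : Eu n → ℝ} (hΘ : ContDiff ℝ (⊤ : ℕ∞) Θ) (k : ℕ)
    {c : ℝ} (hc : 0 < c) (x : Eu n) : ‖iteratedFDeriv ℝ k (fun y => Θ (c • y)) x‖ ≤
      c ^ k * ‖iteratedFDeriv ℝ k Θ (c • x)‖ := by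
  let L : Eu n →L[ℝ] Eu n := c • ContinuousLinearMap.id ℝ (Eu n)
  have hL : ‖L‖ ≤ c := ContinuousLinearMap.opNorm_le_bound _ hc.le fun y => by
    simp [L, norm_smul, abs_of_pos hc]
  have e : (fun y => Θ (c • y)) = Θ ∘ L := by ext y; simp [L]
  rw [e, L.iteratedFDeriv_comp_right hΘ x (by exact_mod_cast le_top), mul_comm]
  have h1 := (iteratedFDeriv ℝ k Θ (L x)).norm_compContinuousLinearMap_le fun _ => L
  have h2 : ∏ _j : Fin k, ‖L‖ ≤ c ^ k := by
    simpa using pow_le_pow_left₀ (norm_nonneg L) hL k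
  exact h1.trans (mul_le_mul_of_nonneg_left h2 (norm_nonneg _))

/-- The potential `kerInf ∗ f`. -/
noncomputable def pot (n : ℕ) (f : Eu n → ℝ) (x : Eu n) : ℝ := ∫ y, kerInf n (x - y) * f y

theorem integrable_kerInf_mul (hn : 5 ≤ n) {f : Eu n → ℝ} (hf : Integrable f) {B : ℝ}
    (hB : ∀ y, |f y| ≤ B) (x : Eu n) : Integrable fun y => kerInf n (x - y) * f y := by
  refine (integrable_gam_mul hn hf x one_pos fun y _ => hB y).mono
    (((measurable_kerInf n).comp (measurable_const_sub x)).aestronglyMeasurable.mul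
      hf.aestronglyMeasurable) (.of_forall fun y => ?_)
  rw [norm_mul, norm_mul, Real.norm_of_nonneg (kerInf_nonneg n _),
    Real.norm_of_nonneg (gam_nonneg _)]
  exact mul_le_mul_of_nonneg_right (kerInf_le_gam n _) (norm_nonneg _)

theorem tendsto_integral_kern (hn : 5 ≤ n) {f : Eu n → ℝ} (hf : Integrable f) {B : ℝ}
    (hB : ∀ y, |f y| ≤ B) (x : Eu n) :
    Tendsto (fun k : ℕ => ∫ y, f y * kern n k (x - y)) atTop (nhds (pot n f x)) := by
  refine tendsto_integral_filter_of_dominated_convergence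
    (fun y => ‖kerInf n (x - y) * f y‖) ?_ ?_ (integrable_kerInf_mul hn hf hB x).norm ?_
  · filter_upwards [eventually_ge_atTop 2] with k hk
    exact hf.aestronglyMeasurable.mul ((contDiff_ker n (s := k)
      (by exact_mod_cast hk)).continuous.comp (continuous_sub_left x)).aestronglyMeasurable
  · filter_upwards [eventually_ge_atTop 2] with k hk
    refine .of_forall fun y => ?_
    rw [norm_mul, norm_mul, mul_comm, Real.norm_of_nonneg (kerInf_nonneg n _),
      Real.norm_of_nonneg (kern_nonneg n (by exact_mod_cast hk) _)]
    exact mul_le_mul_of_nonneg_right (kern_le_kerInf n k _) (norm_nonneg _)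
  · refine .of_forall fun y => tendsto_const_nhds.congr' ?_
    filter_upwards [kern_eventually_eq n (x - y)] with k hk
    rw [hk, mul_comm]

theorem contDiff_pot_three (hn : 5 ≤ n) {f : Eu n → ℝ} (hf : Integrable f) {B : ℝ}
    (hB : ∀ y, |f y| ≤ B) : ContDiff ℝ 3 (pot n f) := by
  have hB0 : 0 ≤ B := (abs_nonneg _).trans (hB 0)
  set Ψ : ℕ → Eu n → ℝ := fun j x => Real.exp j ^ ((n : ℝ) - 4) * kern n 3 (Real.exp j • x) with hΨ
  have hk3 := contDiff_ker n (s := 3) (by norm_num)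
  have hsm : ∀ j : ℕ, ContDiff ℝ (⊤ : ℕ∞) fun x : Eu n => kern n 3 (Real.exp j • x) := fun j =>
    hk3.comp (contDiff_const_smul _)
  have hΨs : ∀ j, ContDiff ℝ (⊤ : ℕ∞) (Ψ j) := fun j => contDiff_const.mul (hsm j)
  have hcs : HasCompactSupport (kern n 3) := hasCompactSupport_ker n (by norm_num)
  have hΨc : ∀ j, HasCompactSupport (Ψ j) := fun j =>
    (hcs.comp_smul (Real.exp_pos j).ne').mul_left
  set I : ℕ → ℝ := fun k => ∫ y, ‖iteratedFDeriv ℝ k (kern n 3) y‖ with hI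
  have hI0 : ∀ k, 0 ≤ I k := fun k => integral_nonneg fun _ => norm_nonneg _
  have hIi : ∀ k, Integrable fun y => ‖iteratedFDeriv ℝ k (kern n 3) y‖ := fun k =>
    ((hk3.continuous_iteratedFDeriv (by exact_mod_cast le_top)).integrable_of_hasCompactSupport
      (hcs.iteratedFDeriv k)).norm
  have hbd : ∀ k j : ℕ, k ≤ 3 → ∫ y, ‖iteratedFDeriv ℝ k (Ψ j) y‖ ≤ I k * Real.exp (-1) ^ j := by
    intro k j hk
    have hle : ∀ y, ‖iteratedFDeriv ℝ k (Ψ j) y‖ ≤ Real.exp j ^ ((n : ℝ) - 4) * Real.exp j ^ k *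
        ‖iteratedFDeriv ℝ k (kern n 3) (Real.exp j • y)‖ := fun y => by
      have e : Ψ j = Real.exp j ^ ((n : ℝ) - 4) • fun x : Eu n => kern n 3 (Real.exp j • x) := rfl
      rw [e, iteratedFDeriv_const_smul_apply ((hsm j).contDiffAt.of_le (by exact_mod_cast le_top)),
        norm_smul, Real.norm_of_nonneg (by positivity), mul_assoc]
      exact mul_le_mul_of_nonneg_left (norm_iteratedFDeriv_comp_smul_le' hk3 k (Real.exp_pos j) y)
        (by positivity)
    have hs := Measure.integral_comp_smul (volume : Measure (Eu n))
      (fun y => ‖iteratedFDeriv ℝ k (kern n 3) y‖) (Real.exp j)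
    rw [finrank_euclideanSpace_fin, abs_of_pos (by positivity), smul_eq_mul] at hs
    calc _ ≤ ∫ y, Real.exp j ^ ((n : ℝ) - 4) * Real.exp j ^ k *
        ‖iteratedFDeriv ℝ k (kern n 3) (Real.exp j • y)‖ := by
          refine integral_mono_of_nonneg (.of_forall fun y => norm_nonneg _)
            (((hIi k).comp_smul (Real.exp_pos j).ne').const_mul _) (.of_forall hle)
      _ = (Real.exp j ^ ((n : ℝ) - 4) * Real.exp j ^ k * (Real.exp j ^ n)⁻¹) * I k := by
          rw [integral_const_mul, hs, ← mul_assoc]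
      _ ≤ Real.exp (-1) ^ j * I k := by
          refine mul_le_mul_of_nonneg_right ?_ (hI0 k)
          rw [← Real.rpow_natCast, ← Real.rpow_natCast, ← Real.rpow_natCast, ← Real.exp_mul,
            ← Real.exp_mul, ← Real.exp_mul, ← Real.exp_mul, ← Real.exp_neg, ← Real.exp_add,
            ← Real.exp_add]
          refine Real.exp_le_exp.2 ?_
          have : (k : ℝ) ≤ 3 := by exact_mod_cast hk
          nlinarith [(j : ℕ).cast_nonneg (α := ℝ)]
      _ = _ := mul_comm _ _
  set w : ℕ → Eu n → ℝ := fun j x => ∫ y, f y • Ψ j (x - y) with hw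
  set v : ℕ → ℕ → ℝ := fun k j => B * (I k * Real.exp (-1) ^ j) with hv
  have hvs : ∀ k, Summable (v k) := fun k =>
    ((summable_geometric_of_lt_one (Real.exp_pos _).le
      (Real.exp_neg_one_lt_d9.trans (by norm_num))).mul_left _).mul_left _
  have hwv : ∀ (k j : ℕ) (x : Eu n), k ≤ 3 → ‖iteratedFDeriv ℝ k (w j) x‖ ≤ v k j :=
    fun k j x hk => (norm_iteratedFDeriv_integral_le hf.locallyIntegrable hB k (hΨs j) (hΨc j)
      x).trans (mul_le_mul_of_nonneg_left (hbd k j hk) hB0)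
  have hws : ∀ j, ContDiff ℝ ((3 : ℕ∞) : WithTop ℕ∞) (w j) := fun j =>
    contDiff_integral_smul_comp_sub hf.locallyIntegrable
      ((hΨs j).of_le (by exact_mod_cast le_top)) (hΨc j)
  have hmain := contDiff_tsum (N := 3) hws (fun k _ => hvs k) fun k j x hk =>
    hwv k j x (by exact_mod_cast hk)
  have hsum : (fun x => ∑' j, w j x) = pot n f := by
    funext x
    have h1 : Summable fun j => w j x := Summable.of_norm_bounded (hvs 0) fun j => by
      have := hwv 0 j x (by norm_num)
      rwa [norm_iteratedFDeriv_zero] at this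
    refine tendsto_nhds_unique h1.hasSum.tendsto_sum_nat
      (((tendsto_integral_kern hn hf hB x).comp (tendsto_add_atTop_nat 2)).congr fun N => ?_)
    simp only [Function.comp, hw]
    rw [← integral_finsetSum]
    · refine integral_congr_ae (.of_forall fun y => ?_)
      simp only [smul_eq_mul]
      push_cast
      rw [kern_dyadic, Finset.mul_sum]
    · intro j _
      obtain ⟨D, hD⟩ := (hΨs j).continuous.bounded_above_of_compact_support (hΨc j)
      exact hf.smul_bdd D ((hΨs j).continuous.comp
        (continuous_sub_left x)).aestronglyMeasurable (.of_forall fun y => hD _)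
  rwa [hsum] at hmain

end


section

variable {n : ℕ}

theorem locallyIntegrable_kerInf (hn : 5 ≤ n) : LocallyIntegrable (kerInf n) := by
  have h5 : (5 : ℝ) ≤ n := by exact_mod_cast hn
  refine (locallyIntegrable_norm_rpow (n := n) (by omega) (b := (4 - n : ℝ)) (by linarith)).mono
    (measurable_kerInf n).aestronglyMeasurable (.of_forall fun y => ?_)
  rw [Real.norm_of_nonneg (kerInf_nonneg n _)]
  exact (kerInf_le_gam n y).trans (Real.le_norm_self _)

theorem contDiff_pot_four (hn : 5 ≤ n) {f : Eu n → ℝ} (hf : ContDiff ℝ 1 f)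
    (hc : HasCompactSupport f) : ContDiff ℝ 4 (pot n f) := by
  have hK := locallyIntegrable_kerInf hn
  have hcv : ∀ g : Eu n → ℝ, pot n g = fun x => ∫ y, kerInf n y • g (x - y) := fun g => by
    funext x
    rw [pot, ← integral_sub_left_eq_self (fun y => kerInf n y • g (x - y)) volume x]
    simp only [sub_sub_cancel, smul_eq_mul]
  have hd : ∀ x, HasFDerivAt (pot n f) (∫ y, kerInf n y • fderiv ℝ f (x - y)) x := fun x => by
    rw [hcv]
    exact hasFDerivAt_integral_smul_comp_sub hK hf hc x
  have hf1 : Continuous (fderiv ℝ f) := hf.continuous_fderiv one_ne_zero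
  have h4 : (4 : WithTop ℕ∞) = 3 + 1 := by norm_num
  rw [h4, contDiff_succ_iff_fderiv_apply]
  refine ⟨fun x => (hd x).differentiableAt, by simp, fun v => ?_⟩
  have e : (fun x => fderiv ℝ (pot n f) x v) = pot n fun y => fderiv ℝ f y v := by
    funext x
    rw [(hd x).fderiv, ContinuousLinearMap.integral_apply, hcv]
    · rfl
    · exact hK.integrable_smul_right_of_hasCompactSupport (hf1.comp (continuous_sub_left x))
        ((hc.fderiv ℝ).comp_homeomorph (Homeomorph.subLeft x))
  rw [e]
  have hcv' : Continuous fun y => fderiv ℝ f y v := hf1.clm_apply continuous_const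
  have hcc : HasCompactSupport fun y => fderiv ℝ f y v := hc.fderiv_apply ℝ v
  obtain ⟨B, hB⟩ := hcv'.bounded_above_of_compact_support hcc
  exact contDiff_pot_three hn (hcv'.integrable_of_hasCompactSupport hcc) hB

end


section

variable {n : ℕ} {p a : ℝ} {u : Eu n → ℝ}

theorem kern_four_eq (n : ℕ) {x : Eu n} (hx : 1 / 8 ≤ ‖x‖) : kern n 4 x = kerInf n x := by
  have h0 : x ≠ 0 := norm_pos_iff.1 (by linarith)
  have h3 : Real.exp (-3) ≤ 1 / 8 := by
    have h1 := Real.exp_neg_one_lt_d9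
    rw [show (-3 : ℝ) = -1 + -1 + -1 by norm_num, Real.exp_add, Real.exp_add]
    have h2 := Real.exp_pos (-1)
    have : Real.exp (-1) * Real.exp (-1) ≤ 1 / 4 := by nlinarith
    nlinarith
  have := (Real.le_log_iff_exp_le (norm_pos_iff.2 h0)).2 (h3.trans hx)
  unfold kern kerInf
  rw [radLog_of_ne _ _ h0, radLog_of_ne _ _ h0,
    Real.smoothTransition.one_of_one_le (x := Real.log ‖x‖ + 4) (by linarith)]

theorem Sol.exists_extension (h : Sol n p a u) {A ρ : ℝ} (hρ : 0 < ρ)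
    (hA : ∀ x : Eu n, x ≠ 0 → ‖x‖ ≤ ρ → u x ≤ A) :
    ∃ v : Eu n → ℝ, ContDiff ℝ 4 v ∧ ∀ x : Eu n, x ≠ 0 → ‖x‖ < 1 / 8 → v x = u x := by
  have hn := h.hn
  have hp := h.hp
  have hN : Nonempty (Fin n) := ⟨⟨0, by omega⟩⟩
  have hcN := cN_pos hn
  have e1 : Real.exp (-1) < 3 / 8 := Real.exp_neg_one_lt_d9.trans (by norm_num)
  have hne : ∀ᵐ y : Eu n, y ≠ 0 := Measure.ae_ne volume 0
  set f : Eu n → ℝ := (closedBall (0 : Eu n) (7 / 8) \ {0}).indicator fun y => u y ^ p with hf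
  have hfi : Integrable f :=
    (integrable_indicator_iff (measurableSet_closedBall.diff (measurableSet_singleton _))).2
      ((h.integrableOn_rpow (r := 7 / 8) (by norm_num)).mono_set Set.sdiff_subset)
  obtain ⟨B, hB⟩ : ∃ B, ∀ y, |f y| ≤ B := by
    obtain ⟨B, hB⟩ := ((isCompact_closedBall (0 : Eu n) (7 / 8)).diff
      (isOpen_ball (x := (0 : Eu n)) (ε := ρ))).exists_bound_of_continuousOn
      (h.contOn_rpow.mono fun y hy => ⟨closedBall_subset_ball (by norm_num) hy.1, fun h0 =>
        hy.2 (by rw [Set.mem_singleton_iff.1 h0]; exact mem_ball_self hρ)⟩)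
    refine ⟨max (max B 0) (max A 0 ^ p), fun y => ?_⟩
    by_cases hy : y ∈ closedBall (0 : Eu n) (7 / 8) \ {0}
    · rw [hf, Set.indicator_of_mem hy]
      have hu0 := h.pos y ⟨closedBall_subset_ball (by norm_num) hy.1, hy.2⟩
      rcases le_or_gt ρ ‖y‖ with hr | hr
      · exact ((hB y ⟨hy.1, by simpa using hr⟩).trans (le_max_left _ _)).trans (le_max_left _ _)
      · rw [abs_of_nonneg (by positivity)]
        exact (Real.rpow_le_rpow hu0 ((hA y hy.2 hr.le).trans (le_max_left _ _))
          (by linarith)).trans (le_max_right _ _)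
    · rw [hf, Set.indicator_of_notMem hy, abs_zero]
      exact (le_max_right _ _).trans (le_max_left _ _)
  set g : Eu n → ℝ := (closedBall (0 : Eu n) (7 / 8)).indicator u with hg
  have hgi : Integrable g := (integrable_indicator_iff measurableSet_closedBall).2
    (h.integrableOn_u (by norm_num))
  set H : Eu n → ℝ := fun x => ∫ y, g y • bump n 2 (x - y) with hH
  have hHs : ContDiff ℝ (4 : ℕ∞) H := contDiff_integral_smul_comp_sub hgi.locallyIntegrable
    ((contDiff_bump n 2).of_le (by exact_mod_cast le_top)) (hasCompactSupport_bump n 2)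
  have hfar : ∀ x y : Eu n, ‖x‖ < 1 / 2 → y ∉ closedBall (0 : Eu n) (7 / 8) →
      Real.exp (-1) < ‖x - y‖ := fun x y hx hy => by
    rw [mem_closedBall_zero_iff, not_le] at hy
    have := norm_sub_norm_le y x
    rw [norm_sub_rev] at this
    linarith
  set v0 : Eu n → ℝ := fun x => (pot n f x + H x) / cN n with hv0
  have hv0u : ∀ x : Eu n, x ≠ 0 → ‖x‖ < 1 / 2 → v0 x = u x := fun x hx0 hx => by
    have hr := (h.rep hx0 hx).2
    have t1 : pot n f x = ∫ y, kerInf n (x - y) * u y ^ p := by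
      refine integral_congr_ae ?_
      filter_upwards [hne] with y hy0
      by_cases hy : y ∈ closedBall (0 : Eu n) (7 / 8)
      · simp only [hf]
        rw [Set.indicator_of_mem (s := closedBall (0 : Eu n) (7 / 8) \ {0}) ⟨hy, hy0⟩]
      · rw [kerInf_eq_zero n (hfar x y hx hy), zero_mul, zero_mul]
    have t2 : H x = ∫ y, u y * bump n 2 (x - y) := by
      refine integral_congr_ae (.of_forall fun y => ?_)
      by_cases hy : y ∈ closedBall (0 : Eu n) (7 / 8)
      · simp only [hg]
        rw [Set.indicator_of_mem hy, smul_eq_mul]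
      · have : bump n 2 (x - y) = 0 := by
          by_contra hc
          have h1 := tsupport_bump_subset n 2 (subset_tsupport _ hc)
          rw [mem_closedBall_zero_iff] at h1
          have h2 := hfar x y hx hy
          norm_num at h1
          linarith
        simp only [this, smul_zero, mul_zero]
    rw [hv0]
    simp only
    rw [t1, t2, ← hr]
    field_simp
  have hv0s : ContDiff ℝ 3 v0 :=
    ((contDiff_pot_three hn hfi hB).add (hHs.of_le (by exact_mod_cast (by norm_num)))).div_const _
  have hv0n : ∀ x : Eu n, ‖x‖ < 1 / 2 → 0 ≤ v0 x := fun x hx => by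
    rcases eq_or_ne x 0 with rfl | hx0
    · have ht : Tendsto v0 (nhdsWithin (0 : Eu n) {0}ᶜ) (nhds (v0 0)) :=
        hv0s.continuous.continuousAt.tendsto.mono_left nhdsWithin_le_nhds
      refine ge_of_tendsto ht ?_
      filter_upwards [self_mem_nhdsWithin, mem_nhdsWithin_of_mem_nhds
        (ball_mem_nhds (0 : Eu n) (show (0 : ℝ) < 1 / 2 by norm_num))] with y hy0 hy
      rw [mem_ball_zero_iff] at hy
      rw [hv0u y hy0 hy]
      exact h.pos y ⟨by rw [mem_ball_zero_iff]; linarith, hy0⟩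
    · rw [hv0u x hx0 hx]
      exact h.pos x ⟨by rw [mem_ball_zero_iff]; linarith, hx0⟩
  let χ : ContDiffBump (0 : Eu n) := ⟨1 / 4, 3 / 8, by norm_num, by norm_num⟩
  have hχs : ContDiff ℝ 1 χ := χ.contDiff
  set f1 : Eu n → ℝ := fun x => χ x * v0 x ^ p with hf1
  have hf1s : ContDiff ℝ 1 f1 := hχs.mul
    ((hv0s.of_le (by norm_num)).rpow_const_of_le (m := 1) (by simpa using hp.le))
  have hf1c : HasCompactSupport f1 := χ.hasCompactSupport.mul_right
  obtain ⟨B1, hB1⟩ := hf1s.continuous.bounded_above_of_compact_support hf1c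
  have hf1i : Integrable f1 := hf1s.continuous.integrable_of_hasCompactSupport hf1c
  set f2 : Eu n → ℝ := fun x => (1 - χ x) * f x with hf2
  have hχ2 : ∀ y, |1 - χ y| ≤ 1 := fun y => by
    rw [abs_of_nonneg (by linarith [χ.le_one (x := y)])]
    linarith [χ.nonneg (x := y)]
  have hf2B : ∀ y, |f2 y| ≤ B := fun y => by
    rw [hf2]
    simp only
    rw [abs_mul]
    exact (mul_le_of_le_one_left (abs_nonneg _) (hχ2 y)).trans (hB y)
  have hf2i : Integrable f2 := hfi.mono
    ((continuous_const.sub hχs.continuous).aestronglyMeasurable.mul hfi.aestronglyMeasurable)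
    (.of_forall fun y => by
      rw [hf2]
      simp only
      rw [norm_mul]
      exact mul_le_of_le_one_left (norm_nonneg _) (hχ2 y))
  set w : Eu n → ℝ := fun x => ∫ y, f2 y • kern n 4 (x - y) with hw
  have hws : ContDiff ℝ (4 : ℕ∞) w := contDiff_integral_smul_comp_sub hf2i.locallyIntegrable
    ((contDiff_ker n (by norm_num)).of_le (by exact_mod_cast le_top))
    (hasCompactSupport_ker n (by norm_num))
  have hsplit : ∀ x, pot n f x = pot n f1 x + pot n f2 x := fun x => by
    unfold pot
    rw [← integral_add (integrable_kerInf_mul hn hf1i hB1 x) (integrable_kerInf_mul hn hf2i hf2B x)]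
    refine integral_congr_ae ?_
    filter_upwards [hne] with y hy0
    rw [← mul_add]
    congr 1
    simp only [hf1, hf2]
    rcases lt_or_ge ‖y‖ (1 / 2) with hy | hy
    · have : f y = v0 y ^ p := by
        rw [hv0u y hy0 hy]
        exact Set.indicator_of_mem (s := closedBall (0 : Eu n) (7 / 8) \ {0})
          ⟨by rw [mem_closedBall_zero_iff]; linarith, hy0⟩ _
      rw [this]
      ring
    · rw [χ.zero_of_le_dist (by rw [dist_zero_right]; exact le_trans (by norm_num [χ]) hy)]
      ring
  have hpf2 : ∀ x : Eu n, ‖x‖ < 1 / 8 → pot n f2 x = w x := fun x hx => by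
    refine integral_congr_ae (.of_forall fun y => ?_)
    simp only [smul_eq_mul]
    rcases lt_or_ge ‖y‖ (1 / 4) with hy | hy
    · have : f2 y = 0 := by
        simp only [hf2]
        rw [χ.one_of_mem_closedBall (by rw [mem_closedBall_zero_iff]; exact hy.le), sub_self,
          zero_mul]
      rw [this, mul_zero, zero_mul]
    · rw [kern_four_eq n, mul_comm]
      have := norm_sub_norm_le y x
      rw [norm_sub_rev] at this
      linarith
  refine ⟨fun x => (pot n f1 x + w x + H x) / cN n,
    (((contDiff_pot_four hn hf1s hf1c).add hws).add hHs).div_const _, fun x hx0 hx => ?_⟩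
  rw [← hv0u x hx0 (by linarith), hv0]
  simp only
  rw [hsplit, hpf2 x hx]

theorem Sol.removable (h : Sol n p a u) {v0 : Eu n → ℝ} (hv : ContDiff ℝ 4 v0)
    (hvu : ∀ x : Eu n, x ≠ 0 → ‖x‖ < 1 / 8 → v0 x = u x) :
    ∃ v : Eu n → ℝ, ContDiffOn ℝ 4 v (ball 0 1) ∧
        (∀ x ∈ ball (0 : Eu n) 1, bilap v x = v x ^ p) ∧
        ∀ x ∈ ball (0 : Eu n) 1 \ {0}, v x = u x := by
  have hN : Nonempty (Fin n) := ⟨⟨0, by have := h.hn; omega⟩⟩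
  set v : Eu n → ℝ := Function.update u 0 (v0 0) with hvdef
  have hvne : ∀ x, x ≠ 0 → v x = u x := fun x hx => Function.update_of_ne hx _ _
  have hv00 : v 0 = v0 0 := Function.update_self _ _ _
  have e0 : v =ᶠ[nhds 0] v0 := by
    filter_upwards [ball_mem_nhds (0 : Eu n) (show (0 : ℝ) < 1 / 8 by norm_num)] with x hx
    rcases eq_or_ne x 0 with rfl | hx0
    · exact hv00
    · rw [hvne x hx0, hvu x hx0 (by simpa using hx)]
  have e1 : ∀ x, x ≠ 0 → v =ᶠ[nhds x] u := fun x hx => by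
    filter_upwards [isOpen_ne.mem_nhds hx] with y hy using hvne y hy
  have hb : ∀ x ∈ ball (0 : Eu n) 1, x ≠ 0 → bilap v x = v x ^ p := fun x hx hx0 => by
    rw [bilap_congr (e1 x hx0), hvne x hx0, h.eq x ⟨hx, hx0⟩]
  refine ⟨v, fun x hx => ?_, fun x hx => ?_, fun x hx => hvne x hx.2⟩
  · rcases eq_or_ne x 0 with rfl | hx0
    · exact (hv.contDiffAt.congr_of_eventuallyEq e0).contDiffWithinAt
    · exact ((h.reg.contDiffAt ((isOpen_punctured n).mem_nhds
        ⟨hx, hx0⟩)).congr_of_eventuallyEq (e1 x hx0)).contDiffWithinAt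
  · rcases eq_or_ne x 0 with rfl | hx0
    · rw [bilap_congr e0, hv00]
      have hp0 : 0 ≤ p := by linarith [h.hp]
      refine tendsto_nhds_unique (f := bilap v0) (l := nhdsWithin (0 : Eu n) {0}ᶜ)
        ((continuous_bilap hv).continuousAt.tendsto.mono_left nhdsWithin_le_nhds)
        (((hv.continuous.rpow_const fun _ => Or.inr hp0).continuousAt
          (x := 0)).tendsto.mono_left nhdsWithin_le_nhds |>.congr' ?_)
      filter_upwards [self_mem_nhdsWithin, mem_nhdsWithin_of_mem_nhds
        (eventually_eventually_nhds.2 e0), mem_nhdsWithin_of_mem_nhds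
        (ball_mem_nhds (0 : Eu n) one_pos)] with y hy0 hy hy1
      rw [← bilap_congr hy, hb y hy1 hy0, hy.self_of_nhds]
    · exact hb x hx hx0

end


theorem K0_eq_coefK {n : ℕ} {p : ℝ} (hp : 1 < p) : K0 n p = coefK n (4 / (p - 1)) := by
  have : p - 1 ≠ 0 := by linarith
  unfold K0 coefK
  field_simp
  ring

/-- Classification of isolated singularities for `Δ²u = u^p` in the punctured
unit ball: either the singularity is removable, or `u` is a distribution solution in the whole
ball and `|x|^{4/(p-1)} u(x) → C_{p,n} = K₀(p,n)^{1/(p-1)} > 0` as `x → 0`. -/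
theorem stmt_0 (n : ℕ) (hn : 5 ≤ n) (p : ℝ)
    (hp1 : (n : ℝ) / ((n : ℝ) - 4) < p) (hp2 : p < ((n : ℝ) + 4) / ((n : ℝ) - 4))
    (u : EuclideanSpace ℝ (Fin n) → ℝ)
    (hreg : ContDiffOn ℝ 4 u (ball 0 1 \ {0}))
    (hpos : ∀ x ∈ ball (0 : EuclideanSpace ℝ (Fin n)) 1 \ {0}, 0 ≤ u x)
    (heq : ∀ x ∈ ball (0 : EuclideanSpace ℝ (Fin n)) 1 \ {0}, bilap u x = u x ^ p) :
    (∃ v : EuclideanSpace ℝ (Fin n) → ℝ,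
        ContDiffOn ℝ 4 v (ball 0 1) ∧
        (∀ x ∈ ball (0 : EuclideanSpace ℝ (Fin n)) 1, bilap v x = v x ^ p) ∧
        (∀ x ∈ ball (0 : EuclideanSpace ℝ (Fin n)) 1 \ {0}, v x = u x)) ∨
    (LocallyIntegrableOn (fun x => u x ^ p) (ball 0 1) volume ∧
      (∀ φ : EuclideanSpace ℝ (Fin n) → ℝ, ContDiff ℝ (⊤ : ℕ∞) φ → HasCompactSupport φ →
        tsupport φ ⊆ ball 0 1 →
        ∫ x in ball (0 : EuclideanSpace ℝ (Fin n)) 1, u x * bilap φ x =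
          ∫ x in ball (0 : EuclideanSpace ℝ (Fin n)) 1, u x ^ p * φ x) ∧
      0 < K0 n p ^ ((1 : ℝ) / (p - 1)) ∧
      Tendsto (fun x : EuclideanSpace ℝ (Fin n) => ‖x‖ ^ ((4 : ℝ) / (p - 1)) * u x)
        (nhdsWithin 0 {0}ᶜ) (nhds (K0 n p ^ ((1 : ℝ) / (p - 1))))) := by
  have hn4 : (0 : ℝ) < (n : ℝ) - 4 := by
    have : (5 : ℝ) ≤ n := by exact_mod_cast hn
    linarith
  rw [div_lt_iff₀ hn4] at hp1
  rw [lt_div_iff₀ hn4] at hp2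
  have hp : 1 < p := by nlinarith
  have hpp : 0 < p - 1 := by linarith
  have hs : Sol n p (4 / (p - 1)) u := by
    refine ⟨hn, hp, by field_simp, ?_, ?_, hreg, hpos, heq⟩
    · rw [lt_div_iff₀ hpp]
      nlinarith
    · rw [div_lt_iff₀ hpp]
      nlinarith
  rcases hs.alternative with h0 | h1
  · obtain ⟨A, ρ, hρ, -, hA⟩ := hs.bounded h0
    obtain ⟨v, hv, hvu⟩ := hs.exists_extension hρ hA
    exact Or.inl (hs.removable hv hvu)
  · rw [K0_eq_coefK hp]
    refine Or.inr ⟨?_, fun φ hφ hc hsub => ?_,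
      Real.rpow_pos_of_pos (coefK_pos hs.a_pos hs.ha2) _, h1⟩
    · intro x hx
      obtain ⟨r, hxr, hr⟩ := exists_between (mem_ball_zero_iff.1 hx)
      exact ⟨closedBall 0 r, mem_nhdsWithin_of_mem_nhds
        (closedBall_mem_nhds_of_mem (mem_ball_zero_iff.2 hxr)), hs.integrableOn_rpow hr⟩
    · rw [setIntegral_eq_integral_of_forall_compl_eq_zero fun x hx => ?_,
        setIntegral_eq_integral_of_forall_compl_eq_zero fun x hx => ?_]
      · exact hs.weak (hφ.of_le four_le_top) hc hsub
      · rw [image_eq_zero_of_notMem_tsupport fun h => hx (hsub h), mul_zero]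
      · rw [image_eq_zero_of_notMem_tsupport fun h => hx (hsub (tsupport_bilap_subset φ h)),
          mul_zero]
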